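/- Let d be a natural number and p, q real numbers with 1 < p < d and p−1 < q < q_c, where q_c = pd/(d−p) − 1. Write ℝ^d_+ = {x ∈ ℝ^d : x_d > 0}. Then there is no function u : ℝ^d → ℝ which is continuous on {x : x_d ≥ 0}, continuously differentiable with u(x) > 0 on ℝ^d_+, vanishes on {x : x_d = 0}, and is a weak solution of −Δ_p u = u^q on ℝ^d_+, i.e. for every infinitely differentiable φ : ℝ^d → ℝ with compact support contained in the open half-space ℝ^d_+ one has ∫ ‖∇u(x)‖^{p−2} ⟨∇u(x), ∇φ(x)⟩ dx = ∫ u(x)^q φ(x) dx (integrals with respect to Lebesgue measure, ∇ the Euclidean gradient and ⟨·,·⟩ the Euclidean inner product). -/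

import Mathlib

open scoped RealInnerProductSpace ContDiff
open MeasureTheory Set Filter Topology Metric

open EuclideanSpace (single)
open ENNReal (ofReal ofReal_mul ofReal_le_ofReal ofReal_ne_top ofReal_add)
open Real (exp log exp_pos exp_add exp_neg exp_log exp_mul exp_le_exp norm_of_nonneg norm_eq_abs rpow_le_rpow rpow_mul mul_rpow
  zero_rpow rpow_add rpow_nonneg rpow_add_one rpow_natCast rpow_neg rpow_pos_of_pos one_rpow div_rpow rpow_le_rpow_of_nonpos)

namespace PLap

local notation:max "∇" f:max => gradient f

/-- Euclidean space of dimension `d`. -/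
abbrev Eu (d : ℕ) := EuclideanSpace ℝ (Fin d)

/-- The space of triples `(x, f x, ∇f x)`. -/
abbrev Jet (d : ℕ) := Eu d × ℝ × Eu d

theorem mul_le_left {a b c : ℝ} (h : b ≤ c) (ha : 0 ≤ a) : a * b ≤ a * c := mul_le_mul_of_nonneg_left h ha

theorem mul_le_right {a b c : ℝ} (h : b ≤ c) (ha : 0 ≤ a) : b * a ≤ c * a := mul_le_mul_of_nonneg_right h ha

theorem eq_zero_of_notMem {X E : Type*} [TopologicalSpace X] [Zero E] {f : X → E} {x : X}
    (hx : x ∉ tsupport f) : f x = 0 := image_eq_zero_of_notMem_tsupport hx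

/-- The vector field `z ↦ |z|^(p-2) z` of the `p`-Laplacian. -/
noncomputable def A {d : ℕ} (p : ℝ) (z : Eu d) : Eu d := ‖z‖ ^ (p - 2) • z

/-- The derivative of `A p` away from the origin. -/
noncomputable def DA {d : ℕ} (p : ℝ) (z : Eu d) : Eu d →L[ℝ] Eu d :=
  ‖z‖ ^ (p - 2) • (ContinuousLinearMap.id ℝ (Eu d) + ((p - 2) * (‖z‖ ^ 2)⁻¹) • (innerSL ℝ z).smulRight z)

section field
variable {d : ℕ} {p : ℝ}

theorem A_zero : A p (0 : Eu d) = 0 := by simp [A]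

theorem norm_A (hp : 1 < p) (z : Eu d) : ‖A p z‖ = ‖z‖ ^ (p - 1) := by
  rcases eq_or_ne z 0 with rfl | hz
  · simp [A, zero_rpow (by linarith : p - 1 ≠ 0)]
  · have : 0 < ‖z‖ := norm_pos_iff.2 hz
    rw [A, norm_smul, norm_of_nonneg (by positivity),
      show p - 1 = (p - 2) + 1 by ring, rpow_add_one this.ne']

theorem inner_A (z y : Eu d) : ⟪A p z, y⟫ = ‖z‖ ^ (p - 2) * ⟪z, y⟫ := by
  rw [A, real_inner_smul_left]

theorem inner_A_self (hp : 1 < p) (z : Eu d) : ⟪A p z, z⟫ = ‖z‖ ^ p := by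
  rcases eq_or_ne z 0 with rfl | hz
  · simp [A, zero_rpow (by linarith : p ≠ 0)]
  · have : 0 < ‖z‖ := norm_pos_iff.2 hz
    rw [inner_A, real_inner_self_eq_norm_sq, ← rpow_natCast, ← rpow_add this]
    congr 1; push_cast; ring

theorem contDiffAt_A {z : Eu d} (hz : z ≠ 0) {n : WithTop ℕ∞} : ContDiffAt ℝ n (A (d := d) p) z := by
  unfold A
  have h1 : ContDiffAt ℝ n (fun z : Eu d => ‖z‖) z := contDiffAt_norm ℝ hz
  exact (h1.rpow_const_of_ne (norm_ne_zero_iff.2 hz)).smul contDiffAt_id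

theorem continuous_A (hp : 1 < p) : Continuous (A (d := d) p) := by
  rw [continuous_iff_continuousAt]
  intro z
  rcases eq_or_ne z 0 with rfl | hz
  · rw [ContinuousAt, A_zero, tendsto_zero_iff_norm_tendsto_zero]
    simp_rw [norm_A hp]
    have : Continuous fun z : Eu d => ‖z‖ ^ (p - 1) :=
      continuous_norm.rpow_const fun _ => Or.inr (by linarith)
    have h := this.tendsto 0
    simpa [zero_rpow (by linarith : p - 1 ≠ 0)] using h
  · exact (contDiffAt_A (n := 1) hz).continuousAt

theorem hasFDerivAt_norm {z : Eu d} (hz : z ≠ 0) :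
    HasFDerivAt (fun z : Eu d => ‖z‖) (‖z‖⁻¹ • innerSL ℝ z) z := by
  have h := (hasStrictFDerivAt_norm_sq z).hasFDerivAt.sqrt (by simpa using hz)
  have h0 : (0:ℝ) < ‖z‖ := norm_pos_iff.2 hz
  simp only [Real.sqrt_sq (norm_nonneg _)] at h
  refine h.congr_fderiv ?_
  ext1 y
  simp only [_root_.smul_apply, nsmul_eq_mul, smul_eq_mul]
  push_cast
  field_simp

theorem hasFDerivAt_A {z : Eu d} (hz : z ≠ 0) : HasFDerivAt (A p) (DA p z) z := by
  have h0 : (0:ℝ) < ‖z‖ := norm_pos_iff.2 hz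
  have h := ((hasFDerivAt_norm hz).rpow_const (p := p - 2) (Or.inl h0.ne')).smul (hasFDerivAt_id z)
  refine h.congr_fderiv ?_
  ext1 y
  simp only [DA, _root_.smul_apply, _root_.add_apply,
    ContinuousLinearMap.smulRight_apply, ContinuousLinearMap.id_apply, id, innerSL_apply_apply,
    smul_add, smul_smul, smul_eq_mul]
  congr 2
  rw [show p - 2 = (p - 2 - 1) + 1 by ring, rpow_add_one h0.ne']
  simp only [add_sub_cancel_right]
  field_simp

theorem hasStrictFDerivAt_A {z : Eu d} (hz : z ≠ 0) : HasStrictFDerivAt (A p) (DA p z) z := by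
  have h := (contDiffAt_A (p := p) (n := 1) hz).hasStrictFDerivAt one_ne_zero
  rwa [(hasFDerivAt_A hz).fderiv] at h

theorem DA_apply (z y : Eu d) :
    DA p z y = ‖z‖ ^ (p - 2) • (y + ((p - 2) * (‖z‖ ^ 2)⁻¹ * ⟪z, y⟫) • z) := by
  simp only [DA, _root_.smul_apply, _root_.add_apply, ContinuousLinearMap.smulRight_apply,
    ContinuousLinearMap.id_apply, innerSL_apply_apply, smul_smul]

theorem inner_DA (z y : Eu d) :
    ⟪DA p z y, y⟫ = ‖z‖ ^ (p - 2) * (‖y‖ ^ 2 + (p - 2) * (‖z‖ ^ 2)⁻¹ * ⟪z, y⟫ ^ 2) := by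
  rw [DA_apply, real_inner_smul_left, inner_add_left, real_inner_smul_left, real_inner_self_eq_norm_sq]
  ring

theorem inner_DA_ge {z : Eu d} (hz : z ≠ 0) (y : Eu d) :
    ‖z‖ ^ (p - 2) * min 1 (p - 1) * ‖y‖ ^ 2 ≤ ⟪DA p z y, y⟫ := by
  have h0 : (0:ℝ) < ‖z‖ := norm_pos_iff.2 hz
  rw [inner_DA, mul_assoc]
  refine mul_le_left ?_ (by positivity)
  have hcs : ⟪z, y⟫ ^ 2 ≤ ‖z‖ ^ 2 * ‖y‖ ^ 2 := by
    rw [← mul_pow]; exact sq_le_sq' (by linarith [neg_le_of_abs_le (abs_real_inner_le_norm z y)])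
      (real_inner_le_norm z y)
  have hq : (‖z‖ ^ 2)⁻¹ * ⟪z, y⟫ ^ 2 ≤ ‖y‖ ^ 2 := by
    rw [inv_mul_le_iff₀ (by positivity)]; exact hcs
  have hq0 : 0 ≤ (‖z‖ ^ 2)⁻¹ * ⟪z, y⟫ ^ 2 := by positivity
  rw [mul_assoc]
  rcases le_total 2 p with h | h
  · calc min 1 (p - 1) * ‖y‖ ^ 2 ≤ 1 * ‖y‖ ^ 2 := by gcongr; exact min_le_left _ _
      _ ≤ _ := by nlinarith
  · calc min 1 (p - 1) * ‖y‖ ^ 2 ≤ (p - 1) * ‖y‖ ^ 2 := by gcongr; exact min_le_right _ _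
      _ ≤ _ := by nlinarith

theorem inner_A_le_young (hp : 1 < p) (z y : Eu d) :
    ⟪A p z, y⟫ ≤ (1 - 1 / p) * ‖z‖ ^ p + ‖y‖ ^ p / p := by
  have hc : Real.HolderConjugate (p / (p - 1)) p := by
    refine (Real.HolderConjugate.conjExponent hp).symm
  have h := Real.young_inequality_of_nonneg (a := ‖z‖ ^ (p - 1)) (b := ‖y‖) (by positivity) (by positivity) hc
  have hne : p - 1 ≠ 0 := by linarith
  rw [← rpow_mul (norm_nonneg _), mul_div_cancel₀ _ hne] at h
  calc ⟪A p z, y⟫ ≤ ‖A p z‖ * ‖y‖ := real_inner_le_norm _ _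
    _ = ‖z‖ ^ (p - 1) * ‖y‖ := by rw [norm_A hp]
    _ ≤ _ := h
    _ = _ := by congr 1; field_simp

theorem A_convex (hp : 1 < p) (z y : Eu d) :
    (‖z‖ ^ p - ‖y‖ ^ p) / p ≤ ⟪A p z, z - y⟫ := by
  rw [inner_sub_right, inner_A_self hp]
  have := inner_A_le_young hp z y
  have h2 : (‖z‖ ^ p - ‖y‖ ^ p) / p = 1 / p * ‖z‖ ^ p - ‖y‖ ^ p / p := by ring
  rw [h2]; linarith

theorem A_strict_mono (hp : 1 < p) {z y : Eu d} (h : z ≠ y) : 0 < ⟪A p z - A p y, z - y⟫ := by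
  have key : ⟪A p z - A p y, z - y⟫ = (‖z‖ ^ (p - 1) - ‖y‖ ^ (p - 1)) * (‖z‖ - ‖y‖) +
      (‖z‖ ^ (p - 2) + ‖y‖ ^ (p - 2)) * (‖z‖ * ‖y‖ - ⟪z, y⟫) := by
    rw [inner_sub_left, inner_sub_right, inner_sub_right, inner_A_self hp, inner_A_self hp,
      inner_A, inner_A, real_inner_comm z y]
    have e : ∀ x : Eu d, ‖x‖ ^ p = ‖x‖ ^ (p - 1) * ‖x‖ ∧ ‖x‖ ^ (p - 1) = ‖x‖ ^ (p - 2) * ‖x‖ := by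
      intro x
      rcases eq_or_ne x 0 with rfl | hx
      · simp [zero_rpow (by linarith : p ≠ 0), zero_rpow (by linarith : p - 1 ≠ 0)]
      · have h0 : ‖x‖ ≠ 0 := norm_ne_zero_iff.2 hx
        rw [← rpow_add_one h0, ← rpow_add_one h0]
        constructor <;> congr 1 <;> ring
    rw [(e z).1, (e y).1, (e z).2, (e y).2]; ring
  have hcs := real_inner_le_norm z y
  have h1 : 0 ≤ (‖z‖ ^ (p - 1) - ‖y‖ ^ (p - 1)) * (‖z‖ - ‖y‖) := by
    rcases le_total ‖z‖ ‖y‖ with hh | hh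
    · have := rpow_le_rpow (norm_nonneg z) hh (by linarith : 0 ≤ p - 1); nlinarith
    · have := rpow_le_rpow (norm_nonneg y) hh (by linarith : 0 ≤ p - 1); nlinarith
  have h2 : 0 ≤ (‖z‖ ^ (p - 2) + ‖y‖ ^ (p - 2)) * (‖z‖ * ‖y‖ - ⟪z, y⟫) :=
    mul_nonneg (by positivity) (by linarith)
  rw [key]
  by_contra hcon
  have e1 : (‖z‖ ^ (p - 1) - ‖y‖ ^ (p - 1)) * (‖z‖ - ‖y‖) = 0 := by linarith
  have e2 : (‖z‖ ^ (p - 2) + ‖y‖ ^ (p - 2)) * (‖z‖ * ‖y‖ - ⟪z, y⟫) = 0 := by linarith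
  have hn : ‖z‖ = ‖y‖ := by
    rcases mul_eq_zero.1 e1 with h3 | h3
    · exact (Real.rpow_left_inj (norm_nonneg _) (norm_nonneg _) (by linarith : p - 1 ≠ 0)).1 (by linarith)
    · linarith
  rcases eq_or_ne z 0 with rfl | hz
  · exact h (by simpa using hn.symm : y = 0).symm
  have hz0 : 0 < ‖z‖ := norm_pos_iff.2 hz
  rcases mul_eq_zero.1 e2 with h3 | h3
  · have : 0 < ‖z‖ ^ (p - 2) := by positivity
    have : 0 ≤ ‖y‖ ^ (p - 2) := by positivity
    linarith
  · apply h
    rw [← sub_eq_zero, ← norm_eq_zero, ← sq_eq_zero_iff, norm_sub_sq_real]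
    rw [← hn] at h3 ⊢
    nlinarith

end field

section gradient
variable {d : ℕ} {f g : Eu d → ℝ} {f' g' x : Eu d}

theorem HasGradientAt.add' (hf : HasGradientAt f f' x) (hg : HasGradientAt g g' x) :
    HasGradientAt (fun y => f y + g y) (f' + g') x := by
  rw [hasGradientAt_iff_hasFDerivAt] at *
  rw [map_add]; exact hf.add hg

theorem HasGradientAt.sub' (hf : HasGradientAt f f' x) (hg : HasGradientAt g g' x) :
    HasGradientAt (fun y => f y - g y) (f' - g') x := by
  rw [hasGradientAt_iff_hasFDerivAt] at *
  rw [map_sub]; exact hf.sub hg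

theorem HasGradientAt.mul' (hf : HasGradientAt f f' x) (hg : HasGradientAt g g' x) :
    HasGradientAt (fun y => f y * g y) (f x • g' + g x • f') x := by
  rw [hasGradientAt_iff_hasFDerivAt] at *
  have := hf.mul hg
  refine this.congr_fderiv ?_
  ext y; simp

theorem HasGradientAt.comp_real {k : ℝ → ℝ} {k' : ℝ} (hk : HasDerivAt k k' (f x))
    (hf : HasGradientAt f f' x) : HasGradientAt (fun y => k (f y)) (k' • f') x := by
  rw [hasGradientAt_iff_hasFDerivAt] at *
  have := hk.comp_hasFDerivAt x hf
  refine this.congr_fderiv ?_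
  ext y; simp

theorem hasGradientAt_of_contDiffAt (hf : ContDiffAt ℝ 1 f x) :
    HasGradientAt f (∇f x) x :=
  (hf.differentiableAt one_ne_zero).hasGradientAt

theorem gradient_eq_toDual_fderiv :
    ∇f = fun x => (InnerProductSpace.toDual ℝ (Eu d)).symm (fderiv ℝ f x) := rfl

theorem contDiffAt_gradient {n : WithTop ℕ∞} (hf : ContDiffAt ℝ (n + 1) f x) :
    ContDiffAt ℝ n (∇f) x := by
  rw [gradient_eq_toDual_fderiv]
  exact (InnerProductSpace.toDual ℝ (Eu d)).symm.toContinuousLinearEquiv.contDiff.contDiffAt.comp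
    x (hf.fderiv_right le_rfl)

theorem continuousAt_gradient (hf : ContDiffAt ℝ 1 f x) : ContinuousAt (∇f) x :=
  (contDiffAt_gradient (n := 0) (by simpa using hf)).continuousAt

theorem continuous_gradient (hf : ContDiff ℝ 1 f) : Continuous (∇f) :=
  continuous_iff_continuousAt.2 fun _ => continuousAt_gradient hf.contDiffAt

theorem gradient_of_notMem (hx : x ∉ tsupport f) : ∇f x = 0 := by
  have h : f =ᶠ[𝓝 x] fun _ => 0 := notMem_tsupport_iff_eventuallyEq.1 hx
  rw [h.gradient_eq]; simp [gradient]

theorem norm_gradient_eq : ‖∇f x‖ = ‖fderiv ℝ f x‖ := by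
  rw [gradient, LinearIsometryEquiv.norm_map]

end gradient

section ibp
variable {d : ℕ}

/-- Divergence of a vector field. -/
noncomputable def dv (X : Eu d → Eu d) (x : Eu d) : ℝ :=
  ∑ i, (fderiv ℝ X x (single i 1)) i

theorem continuous_mul_of_tsupport {φ ψ g : Eu d → ℝ} (hψ : Continuous ψ)
    (hs : ∀ x ∉ tsupport φ, ψ x = 0) (hg : ∀ x ∈ tsupport φ, ContinuousAt g x) :
    Continuous fun x => g x * ψ x := by
  rw [continuous_iff_continuousAt]
  intro x
  by_cases hx : x ∈ tsupport φ
  · exact (hg x hx).mul hψ.continuousAt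
  · have : (fun x => g x * ψ x) =ᶠ[𝓝 x] fun _ => 0 := by
      filter_upwards [(isClosed_tsupport φ).isOpen_compl.mem_nhds hx] with y hy
      simp [hs y hy]
    exact continuousAt_const.congr this.symm

theorem integrable_mul_of_tsupport {φ ψ g : Eu d → ℝ} (hc : HasCompactSupport φ)
    (hψ : Continuous ψ) (hs : ∀ x ∉ tsupport φ, ψ x = 0)
    (hg : ∀ x ∈ tsupport φ, ContinuousAt g x) : Integrable fun x => g x * ψ x := by
  refine (continuous_mul_of_tsupport hψ hs hg).integrable_of_hasCompactSupport ?_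
  refine HasCompactSupport.intro (K := tsupport φ) hc fun x hx => by simp [hs x hx]

theorem inner_eq_sum (x y : Eu d) : ⟪x, y⟫ = ∑ i, x i * y i := by
  simp [PiLp.inner_apply, mul_comm]

theorem gradient_apply_coord (φ : Eu d → ℝ) (x : Eu d) (i : Fin d) :
    ∇φ x i = fderiv ℝ φ x (single i 1) := by
  rw [← inner_gradient_left, inner_eq_sum]; simp

theorem integrable_inner_gradient {φ : Eu d → ℝ} {X : Eu d → Eu d} (hφ : ContDiff ℝ 1 φ)
    (hc : HasCompactSupport φ) (hX : ∀ x ∈ tsupport φ, ContinuousAt X x) :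
    Integrable fun x => ⟪X x, ∇φ x⟫ := by
  simp_rw [inner_eq_sum]
  refine integrable_finsetSum _ fun i _ => ?_
  refine integrable_mul_of_tsupport (φ := φ) hc ?_ ?_ ?_
  · exact (EuclideanSpace.proj i).continuous.comp (continuous_gradient hφ)
  · intro x hx; simp [gradient_of_notMem hx]
  · exact fun x hx => (EuclideanSpace.proj (𝕜 := ℝ) i).continuous.continuousAt.comp (hX x hx)

theorem continuousAt_dv {X : Eu d → Eu d} {x : Eu d} (hX : ContDiffAt ℝ 1 X x) :
    ContinuousAt (dv X) x := by
  unfold dv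
  refine tendsto_finsetSum _ fun i _ => ?_
  have h1 : ContinuousAt (fderiv ℝ X) x :=
    (hX.fderiv_right (m := 0) (by norm_num)).continuousAt
  exact ((EuclideanSpace.proj (𝕜 := ℝ) i).continuous.continuousAt).tendsto.comp
    (h1.clm_apply continuousAt_const).tendsto

/-- Integration by parts for a compactly supported function and a vector field that is regular on
its support. -/
theorem integral_inner_gradient {φ : Eu d → ℝ} {X : Eu d → Eu d} (hφ : ContDiff ℝ 1 φ)
    (hc : HasCompactSupport φ) (hX : ∀ x ∈ tsupport φ, ContDiffAt ℝ 1 X x) :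
    ∫ x, ⟪X x, ∇φ x⟫ = - ∫ x, dv X x * φ x := by
  have hd : ∀ i, ∀ x ∈ tsupport φ, fderiv ℝ (fun y => X y i) x (single i 1)
      = (fderiv ℝ X x (single i 1)) i := by
    intro i x hx
    have h := ((EuclideanSpace.proj (𝕜 := ℝ) i).hasFDerivAt.comp x
      ((hX x hx).differentiableAt one_ne_zero).hasFDerivAt)
    have h2 : HasFDerivAt (fun y => X y i) _ x := h
    rw [h2.fderiv]; simp
  have hci : ∀ i, ∀ x ∈ tsupport φ, ContDiffAt ℝ 1 (fun y => X y i) x := fun i x hx =>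
    (EuclideanSpace.proj (𝕜 := ℝ) i).contDiff.contDiffAt.comp x (hX x hx)
  have hgr : ∀ i, Continuous fun x => fderiv ℝ φ x (single i 1) := fun i =>
    (hφ.continuous_fderiv one_ne_zero).clm_apply continuous_const
  have hz : ∀ i, ∀ x ∉ tsupport φ, fderiv ℝ φ x (single i 1) = 0 := by
    intro i x hx
    rw [← gradient_apply_coord, gradient_of_notMem hx]; simp
  have hI1 : ∀ i, Integrable fun x => X x i * fderiv ℝ φ x (single i 1) := fun i =>
    integrable_mul_of_tsupport hc (hgr i) (hz i) fun x hx => (hci i x hx).continuousAt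
  have hI2 : ∀ i, Integrable fun x =>
      fderiv ℝ (fun y => X y i) x (single i 1) * φ x := fun i =>
    integrable_mul_of_tsupport hc hφ.continuous (fun x hx => eq_zero_of_notMem hx)
      fun x hx => (((hci i x hx).fderiv_right (m := 0) (by norm_num)).continuousAt).clm_apply
        continuousAt_const
  have key : ∀ i, ∫ x, X x i * fderiv ℝ φ x (single i 1)
      = - ∫ x, fderiv ℝ (fun y => X y i) x (single i 1) * φ x := fun i =>
    integral_mul_fderiv_eq_neg_fderiv_mul_of_integrable (hI2 i) (hI1 i)
      (integrable_mul_of_tsupport hc hφ.continuous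
        (fun x hx => eq_zero_of_notMem hx) fun x hx => (hci i x hx).continuousAt)
      (fun x hx => (hci i x hx).differentiableAt one_ne_zero)
      (fun x _ => hφ.differentiable one_ne_zero x)
  calc ∫ x, ⟪X x, ∇φ x⟫
      = ∫ x, ∑ i, X x i * fderiv ℝ φ x (single i 1) := by
        simp_rw [inner_eq_sum, gradient_apply_coord]
    _ = ∑ i, ∫ x, X x i * fderiv ℝ φ x (single i 1) :=
        integral_finsetSum _ fun i _ => hI1 i
    _ = - ∑ i, ∫ x, fderiv ℝ (fun y => X y i) x (single i 1) * φ x := by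
        rw [← Finset.sum_neg_distrib]; exact Finset.sum_congr rfl fun i _ => key i
    _ = - ∫ x, ∑ i, fderiv ℝ (fun y => X y i) x (single i 1) * φ x := by
        rw [integral_finsetSum _ fun i _ => hI2 i]
    _ = _ := by
        congr 1
        refine integral_congr_ae (.of_forall fun x => ?_)
        simp only [dv]
        rw [← Finset.sum_mul]
        by_cases hx : x ∈ tsupport φ
        · rw [Finset.sum_congr rfl fun i _ => hd i x hx]
        · simp [eq_zero_of_notMem hx]

end ibp

section mollify
variable {d : ℕ} {F : Type*} [NormedAddCommGroup F] [NormedSpace ℝ F]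

/-- A bump function of outer radius `1 / (n + 1)`. -/
noncomputable def bmp (d n : ℕ) : ContDiffBump (0 : Eu d) where
  rIn := 1 / (2 * ((n : ℝ) + 1))
  rOut := 1 / ((n : ℝ) + 1)
  rIn_pos := by positivity
  rIn_lt_rOut := by
    apply one_div_lt_one_div_of_lt <;> [positivity; linarith [(Nat.cast_nonneg n : (0:ℝ) ≤ n)]]

/-- The standard mollifier. -/
noncomputable def rho (d n : ℕ) : Eu d → ℝ := (bmp d n).normed volume

/-- Mollification at scale `1 / (n + 1)`. -/
noncomputable def moll (n : ℕ) (g : Eu d → F) : Eu d → F :=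
  convolution (rho d n) g (ContinuousLinearMap.lsmul ℝ ℝ) volume

theorem moll_apply (n : ℕ) (g : Eu d → F) (x : Eu d) :
    moll n g x = ∫ y, rho d n y • g (x - y) := rfl

theorem rho_nonneg (n : ℕ) (x : Eu d) : 0 ≤ rho d n x := (bmp d n).nonneg_normed x

theorem rho_contDiff (n : ℕ) : ContDiff ℝ ∞ (rho d n) := (bmp d n).contDiff_normed

theorem rho_hasCompactSupport (n : ℕ) : HasCompactSupport (rho d n) :=
  (bmp d n).hasCompactSupport_normed

theorem rho_integral (n : ℕ) : ∫ x, rho d n x = 1 := (bmp d n).integral_normed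

theorem rho_integrable (n : ℕ) : Integrable (rho d n) := (bmp d n).integrable_normed

theorem tsupport_rho (n : ℕ) : tsupport (rho d n) = closedBall 0 (1 / ((n : ℝ) + 1)) :=
  (bmp d n).tsupport_normed_eq

theorem rho_eq_zero {n : ℕ} {x : Eu d} (hx : 1 / ((n : ℝ) + 1) < ‖x‖) : rho d n x = 0 := by
  apply eq_zero_of_notMem
  rw [tsupport_rho]; simpa using hx

theorem moll_contDiff [CompleteSpace F] (n : ℕ) {g : Eu d → F} (hg : LocallyIntegrable g) :
    ContDiff ℝ ∞ (moll n g) :=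
  (rho_hasCompactSupport n).contDiff_convolution_left _ (rho_contDiff n) hg

theorem moll_dist_le (n : ℕ) {g : Eu d → F} [CompleteSpace F] (hg : Continuous g) {x : Eu d} {ε : ℝ}
    (h : ∀ y ∈ ball x (1 / ((n : ℝ) + 1)), dist (g y) (g x) ≤ ε) : dist (moll n g x) (g x) ≤ ε :=
  (bmp d n).dist_normed_convolution_le hg.aestronglyMeasurable h

theorem moll_unif [CompleteSpace F] {g : Eu d → F} (hg : Continuous g) (hc : HasCompactSupport g)
    {ε : ℝ} (hε : 0 < ε) : ∀ᶠ n : ℕ in atTop, ∀ x, dist (moll n g x) (g x) ≤ ε := by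
  have hu := hc.uniformContinuous_of_continuous hg
  obtain ⟨δ, hδ, h⟩ := Metric.uniformContinuous_iff.1 hu ε hε
  have ht : Tendsto (fun n : ℕ => 1 / ((n : ℝ) + 1)) atTop (𝓝 0) :=
    tendsto_one_div_add_atTop_nhds_zero_nat
  filter_upwards [ht.eventually (gt_mem_nhds hδ)] with n hn x
  exact moll_dist_le n hg fun y hy => (h (lt_trans (mem_ball.1 hy) hn)).le

theorem moll_congr (n : ℕ) {g g' : Eu d → F} {x : Eu d}
    (h : ∀ y ∈ closedBall x (1 / ((n : ℝ) + 1)), g y = g' y) : moll n g x = moll n g' x := by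
  rw [moll_apply, moll_apply]
  refine integral_congr_ae (.of_forall fun y => ?_)
  simp only
  by_cases hy : 1 / ((n : ℝ) + 1) < ‖y‖
  · simp [rho_eq_zero hy]
  · rw [h]; simpa [dist_eq_norm] using not_lt.1 hy

theorem moll_eq_zero (n : ℕ) {g : Eu d → F} {x : Eu d}
    (hx : x ∉ cthickening (1 / ((n : ℝ) + 1)) (tsupport g)) : moll n g x = 0 := by
  have : moll n g x = moll n (fun _ => (0 : F)) x := by
    refine moll_congr n fun y hy => ?_
    apply eq_zero_of_notMem
    intro hy'
    exact hx (mem_cthickening_of_dist_le x y _ _ hy' (by rw [dist_comm]; exact hy))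
  rw [this, moll_apply]; simp

theorem moll_gradient (n : ℕ) {g : Eu d → ℝ} (hg : ContDiff ℝ 1 g) (hc : HasCompactSupport g)
    (x : Eu d) : ∇(moll n g) x = moll n (∇g) x := by
  have h := hc.hasFDerivAt_convolution_right (ContinuousLinearMap.lsmul ℝ ℝ)
    (rho_integrable (d := d) n).locallyIntegrable hg x
  have h1 : fderiv ℝ (moll n g) x = _ := h.fderiv
  rw [gradient, h1, moll_apply, convolution]
  rw [← (InnerProductSpace.toDual ℝ (Eu d)).symm.coe_toContinuousLinearEquiv,
    ← ContinuousLinearEquiv.integral_comp_comm]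
  refine integral_congr_ae (.of_forall fun y => ?_)
  have e : ((ContinuousLinearMap.precompR (Eu d) (ContinuousLinearMap.lsmul ℝ ℝ)) (rho d n y))
      (fderiv ℝ g (x - y)) = rho d n y • fderiv ℝ g (x - y) := by
    ext z; simp [ContinuousLinearMap.precompR]
  simp only
  rw [e, LinearIsometryEquiv.coe_toContinuousLinearEquiv, map_smulₛₗ]
  simp [gradient]

theorem moll_hasCompactSupport (n : ℕ) {g : Eu d → F} (hc : HasCompactSupport g) :
    HasCompactSupport (moll n g) :=
  HasCompactSupport.intro (K := cthickening (1 / ((n : ℝ) + 1)) (tsupport g))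
    (hc.isCompact.cthickening) fun _ hx => moll_eq_zero n hx

theorem norm_inner_integral_le {K : Set (Eu d)} (hK : IsCompact K) {V ψ : Eu d → Eu d} {ε C : ℝ}
    (hV : ∀ x ∈ K, ‖V x‖ ≤ C) (hψ : ∀ x ∈ K, ‖ψ x‖ ≤ ε) (hz : ∀ x ∉ K, ψ x = 0) :
    ‖∫ x, ⟪V x, ψ x⟫‖ ≤ C * ε * volume.real K := by
  have h : ∫ x, ⟪V x, ψ x⟫ = ∫ x in K, ⟪V x, ψ x⟫ := by
    rw [setIntegral_eq_integral_of_forall_compl_eq_zero]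
    intro x hx; simp [hz x hx]
  rw [h]
  refine norm_setIntegral_le_of_norm_le_const hK.measure_lt_top fun x hx => ?_
  refine (norm_inner_le_norm _ _).trans ?_
  exact mul_le_mul (hV x hx) (hψ x hx) (norm_nonneg _) ((norm_nonneg _).trans (hV x hx))

/-- A weak equation tested with smooth functions may be tested with `C¹` functions. -/
theorem weak_test_C1 {Ω : Set (Eu d)} (hΩ : IsOpen Ω) {V : Eu d → Eu d} {g : Eu d → ℝ}
    (hV : ContinuousOn V Ω) (hg : ContinuousOn g Ω)
    (hw : ∀ φ : Eu d → ℝ, ContDiff ℝ ∞ φ → HasCompactSupport φ → tsupport φ ⊆ Ω →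
      ∫ x, ⟪V x, ∇φ x⟫ = ∫ x, g x * φ x)
    {φ : Eu d → ℝ} (hφ : ContDiff ℝ 1 φ) (hc : HasCompactSupport φ) (hs : tsupport φ ⊆ Ω) :
    ∫ x, ⟪V x, ∇φ x⟫ = ∫ x, g x * φ x := by
  obtain ⟨δ, hδ, hsub⟩ := hc.isCompact.exists_cthickening_subset_open hΩ hs
  set K := cthickening δ (tsupport φ) with hKdef
  have hK : IsCompact K := hc.isCompact.cthickening
  obtain ⟨CV, hCV⟩ := hK.exists_bound_of_continuousOn (hV.mono hsub)
  obtain ⟨Cg, hCg⟩ := hK.exists_bound_of_continuousOn (hg.mono hsub)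
  have hVa : ∀ ψ : Eu d → ℝ, tsupport ψ ⊆ Ω → ∀ x ∈ tsupport ψ, ContinuousAt V x :=
    fun ψ h x hx => hV.continuousAt (hΩ.mem_nhds (h hx))
  have hga : ∀ ψ : Eu d → ℝ, tsupport ψ ⊆ Ω → ∀ x ∈ tsupport ψ, ContinuousAt g x :=
    fun ψ h x hx => hg.continuousAt (hΩ.mem_nhds (h hx))
  have hIntg : ∀ ψ : Eu d → ℝ, Continuous ψ → HasCompactSupport ψ → tsupport ψ ⊆ Ω →
      Integrable fun x => g x * ψ x := fun ψ h1 h2 h3 =>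
    integrable_mul_of_tsupport h2 h1 (fun x hx => eq_zero_of_notMem hx) (hga ψ h3)
  set m := volume.real K
  have hgradc : HasCompactSupport (∇φ) :=
    HasCompactSupport.intro hc fun x hx => gradient_of_notMem hx
  have key : ∀ ε > 0, ‖(∫ x, ⟪V x, ∇φ x⟫) - ∫ x, g x * φ x‖ ≤ ε * ((|CV| + |Cg|) * m) := by
    intro ε hε
    have ht : Tendsto (fun n : ℕ => 1 / ((n : ℝ) + 1)) atTop (𝓝 0) :=
      tendsto_one_div_add_atTop_nhds_zero_nat
    obtain ⟨n, h1, h2, h3⟩ := ((moll_unif hφ.continuous hc hε).and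
      ((moll_unif (continuous_gradient hφ) hgradc hε).and (ht.eventually (gt_mem_nhds hδ)))).exists
    have hsm : ContDiff ℝ ∞ (moll n φ) := moll_contDiff n hφ.continuous.locallyIntegrable
    have hz : ∀ x ∉ K, moll n φ x = 0 := fun x hx => moll_eq_zero n fun hx' =>
      hx (cthickening_mono h3.le _ hx')
    have hsupp : tsupport (moll n φ) ⊆ K :=
      closure_minimal (fun x hx => by_contra fun h => hx (hz x h)) isClosed_cthickening
    have hsuppφ : tsupport φ ⊆ K := self_subset_cthickening _
    have hcn := moll_hasCompactSupport n hc
    have e := hw _ hsm hcn (hsupp.trans hsub)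
    have hI1 := integrable_inner_gradient hφ hc (hVa φ hs)
    have hI2 := integrable_inner_gradient (hsm.of_le (by simp)) hcn (hVa _ (hsupp.trans hsub))
    have hI3 := hIntg φ hφ.continuous hc hs
    have hI4 := hIntg _ hsm.continuous hcn (hsupp.trans hsub)
    have e1 : (∫ x, ⟪V x, ∇φ x⟫) - ∫ x, g x * φ x = (∫ x, ⟪V x, ∇φ x - ∇(moll n φ) x⟫)
          + ∫ x, g x * (moll n φ x - φ x) := by
      simp_rw [inner_sub_right, mul_sub]
      rw [integral_sub hI1 hI2, integral_sub hI4 hI3, e]; ring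
    have b1 : ‖∫ x, ⟪V x, ∇φ x - ∇(moll n φ) x⟫‖ ≤ CV * ε * m := by
      refine norm_inner_integral_le hK hCV (fun x _ => ?_) fun x hx => ?_
      · rw [moll_gradient n hφ hc, ← dist_eq_norm, dist_comm]; exact h2 x
      · rw [gradient_of_notMem fun h => hx (hsuppφ h),
          gradient_of_notMem fun h => hx (hsupp h), sub_zero]
    have b2 : ‖∫ x, g x * (moll n φ x - φ x)‖ ≤ Cg * ε * m := by
      have h : ∫ x, g x * (moll n φ x - φ x) = ∫ x in K, g x * (moll n φ x - φ x) := by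
        rw [setIntegral_eq_integral_of_forall_compl_eq_zero]
        intro x hx
        rw [hz x hx, eq_zero_of_notMem fun h => hx (hsuppφ h)]; simp
      rw [h]
      refine norm_setIntegral_le_of_norm_le_const hK.measure_lt_top fun x hx => ?_
      rw [norm_mul]
      refine mul_le_mul (hCg x hx) ?_ (norm_nonneg _) ((norm_nonneg _).trans (hCg x hx))
      rw [← dist_eq_norm]; exact h1 x
    have hm : 0 ≤ m := measureReal_nonneg
    rw [e1]
    refine (norm_add_le _ _).trans ((add_le_add b1 b2).trans ?_)
    have := mul_le_right (le_abs_self CV) (mul_nonneg hε.le hm)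
    have := mul_le_right (le_abs_self Cg) (mul_nonneg hε.le hm)
    nlinarith
  rw [← sub_eq_zero, ← norm_le_zero_iff]
  refine le_of_forall_pos_le_add fun ε hε => ?_
  have hC : 0 ≤ (|CV| + |Cg|) * m := mul_nonneg (by positivity) measureReal_nonneg
  refine (key (ε / ((|CV| + |Cg|) * m + 1)) (by positivity)).trans ?_
  rw [zero_add, div_mul_eq_mul_div, div_le_iff₀ (by positivity)]
  nlinarith

end mollify

section weak
variable {d : ℕ}

/-- `f` is a `C¹` weak solution of `-div (|∇f|^(p-2) ∇f) = g` in the open set `Ω`. -/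
structure WeakEq (p : ℝ) (Ω : Set (Eu d)) (f g : Eu d → ℝ) : Prop where
  isOpen : IsOpen Ω
  c1 : ContDiffOn ℝ 1 f Ω
  cont : ContinuousOn g Ω
  weak : ∀ φ : Eu d → ℝ, ContDiff ℝ 1 φ → HasCompactSupport φ → tsupport φ ⊆ Ω →
    ∫ x, ⟪A p (∇f x), ∇φ x⟫ = ∫ x, g x * φ x

theorem contDiff_mul_of_tsupport {n : WithTop ℕ∞} {η g : Eu d → ℝ} (hη : ContDiff ℝ n η)
    (hg : ∀ x ∈ tsupport η, ContDiffAt ℝ n g x) : ContDiff ℝ n fun x => η x * g x := by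
  rw [contDiff_iff_contDiffAt]
  intro x
  by_cases hx : x ∈ tsupport η
  · exact hη.contDiffAt.mul (hg x hx)
  · have : (fun x => η x * g x) =ᶠ[𝓝 x] fun _ => 0 := by
      filter_upwards [(isClosed_tsupport η).isOpen_compl.mem_nhds hx] with y hy
      simp [eq_zero_of_notMem hy]
    exact contDiffAt_const.congr_of_eventuallyEq this

theorem tsupport_mul_subset {η g : Eu d → ℝ} : tsupport (fun x => η x * g x) ⊆ tsupport η :=
  closure_mono fun x hx h => hx (by simp [h])

theorem gradient_comp_add (f : Eu d → ℝ) (z x : Eu d) :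
    ∇(fun y => f (y + z)) x = ∇f (x + z) := by
  simp only [gradient, fderiv_comp_add_right]

variable {p : ℝ} {Ω : Set (Eu d)} {f g : Eu d → ℝ}

theorem WeakEq.contDiffAt (h : WeakEq p Ω f g) {x : Eu d} (hx : x ∈ Ω) : ContDiffAt ℝ 1 f x :=
  h.c1.contDiffAt (h.isOpen.mem_nhds hx)

theorem WeakEq.continuousOn_gradient (h : WeakEq p Ω f g) : ContinuousOn (∇f) Ω :=
  fun _ hx => (continuousAt_gradient (h.contDiffAt hx)).continuousWithinAt

set_option maxHeartbeats 1000000 in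
theorem WeakEq.diff_quot_near (hp : 1 < p) (h : WeakEq p Ω f g) {x₁ : Eu d} (hx₁ : x₁ ∈ Ω) (hne : ∇f x₁ ≠ 0)
    (hg : ∃ C, ∃ r > 0, ∀ x ∈ ball x₁ r, ∀ y ∈ ball x₁ r,
      |g x - g y| ≤ C * (‖∇f x - ∇f y‖ + ‖x - y‖)) :
    ∃ r > 0, ∃ C, ∀ z : Eu d, ‖z‖ < r → ∫⁻ x in ball x₁ r, ofReal (‖∇f (x + z) - ∇f x‖ ^ 2)
        ≤ ofReal (C * ‖z‖ ^ 2) := by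
  obtain ⟨Cg, r₀, hr₀, hg⟩ := hg
  set ξ := ∇f x₁
  set L := DA p ξ
  have hξ : 0 < ‖ξ‖ := norm_pos_iff.2 hne
  set c := ‖ξ‖ ^ (p - 2) * min 1 (p - 1) with hcdef
  have hc : 0 < c := mul_pos (by positivity) (lt_min one_pos (by linarith))
  obtain ⟨s, hs, hL⟩ := (hasStrictFDerivAt_A (p := p) hne).approximates_deriv_on_nhds
    (c := Real.toNNReal (c / 2)) (Or.inr (Real.toNNReal_pos.2 (by positivity)))
  have hcont : ContinuousAt (∇f) x₁ := continuousAt_gradient (h.contDiffAt hx₁)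
  obtain ⟨R, hR, hball⟩ := Metric.mem_nhds_iff.1 (Filter.inter_mem
    (Filter.inter_mem (h.isOpen.mem_nhds hx₁) (hcont.preimage_mem_nhds hs))
    (Filter.inter_mem (ball_mem_nhds x₁ hr₀) (hcont.preimage_mem_nhds (ball_mem_nhds ξ one_pos))))
  set r := R / 4 with hr
  have hrp : 0 < r := by positivity
  have hΩ : ∀ x ∈ ball x₁ R, x ∈ Ω := fun x hx => (hball hx).1.1
  set M := ‖ξ‖ + 1 with hM
  have hMb : ∀ x ∈ ball x₁ R, ‖∇f x‖ ≤ M := by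
    intro x hx
    have h1 : ∇f x ∈ ball ξ 1 := (hball hx).2.2
    rw [mem_ball, dist_eq_norm] at h1
    have := norm_le_norm_add_norm_sub' (∇f x) ξ
    linarith
  have hLip : ∀ x ∈ ball x₁ R, ∀ y ∈ ball x₁ R, |f y - f x| ≤ M * ‖y - x‖ := by
    intro x hx y hy
    refine (convex_ball x₁ R).norm_image_sub_le_of_norm_fderiv_le (𝕜 := ℝ)
      (fun w hw => (h.contDiffAt (hΩ w hw)).differentiableAt one_ne_zero) (fun w hw => ?_) hx hy
    rw [← norm_gradient_eq]; exact hMb w hw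
  let η : ContDiffBump x₁ := ⟨r, 2 * r, hrp, by linarith⟩
  have hη : ContDiff ℝ ∞ (η : Eu d → ℝ) := η.contDiff
  have hη1 : ContDiff ℝ 1 (η : Eu d → ℝ) := hη.of_le (by simp)
  have hηs : tsupport (η : Eu d → ℝ) = closedBall x₁ (2 * r) := η.tsupport_eq
  have hηc : HasCompactSupport (η : Eu d → ℝ) := η.hasCompactSupport
  obtain ⟨Cη, hCη⟩ := (isCompact_closedBall x₁ (2 * r)).exists_bound_of_continuousOn
    (continuous_gradient hη1).continuousOn
  set C₁ := ‖L‖ + c / 2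
  set B := (8 / c) * (M * C₁ * Cη) ^ 2 + ((2 / c) * (Cg * M) ^ 2 + |Cg * M|) with hB
  refine ⟨r, hrp, 4 / c * (B * volume.real (closedBall x₁ (2 * r))), fun z hz => ?_⟩
  have hsh : ∀ x ∈ closedBall x₁ (2 * r), x + z ∈ ball x₁ R := by
    intro x hx
    rw [mem_closedBall] at hx
    have : dist (x + z) x = ‖z‖ := by rw [dist_eq_norm]; simp
    rw [mem_ball]
    linarith [dist_triangle (x + z) x x₁]
  have hin : ∀ x ∈ closedBall x₁ (2 * r), x ∈ ball x₁ R := fun x hx => by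
    rw [mem_closedBall] at hx; rw [mem_ball]; linarith
  set δ : Eu d → ℝ := fun x => f (x + z) - f x with hδ
  have hδc : ∀ x ∈ closedBall x₁ (2 * r), ContDiffAt ℝ 1 δ x := by
    intro x hx
    have h1 : ContDiffAt ℝ 1 (fun x => f (x + z)) x :=
      (h.contDiffAt (hΩ _ (hsh x hx))).comp x (contDiffAt_id.add contDiffAt_const)
    exact h1.sub (h.contDiffAt (hΩ _ (hin x hx)))
  have hη2 : ContDiff ℝ 1 fun x => η x * η x := hη1.mul hη1
  have hη2s : tsupport (fun x => η x * η x) ⊆ closedBall x₁ (2 * r) :=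
    tsupport_mul_subset.trans hηs.subset
  set ψ : Eu d → ℝ := fun x => (η x * η x) * δ x with hψ
  have hψ1 : ContDiff ℝ 1 ψ := contDiff_mul_of_tsupport hη2 fun x hx => hδc x (hη2s hx)
  have hψs : tsupport ψ ⊆ closedBall x₁ (2 * r) := tsupport_mul_subset.trans hη2s
  have hψc : HasCompactSupport ψ := HasCompactSupport.of_support_subset_isCompact
    (isCompact_closedBall x₁ (2 * r)) (subset_closure.trans hψs)
  set Dg : Eu d → Eu d := fun x => ∇f (x + z) - ∇f x with hDg
  have hgrad : ∀ x ∈ closedBall x₁ (2 * r), ∇ψ x = (η x * η x) • Dg x + δ x • (η x • ∇η x + η x • ∇η x) := by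
    intro x hx
    have e1 : HasGradientAt (η : Eu d → ℝ) (∇η x) x :=
      hasGradientAt_of_contDiffAt hη1.contDiffAt
    have e2 : HasGradientAt δ (Dg x) x := by
      have a1 : HasGradientAt (fun x => f (x + z)) (∇f (x + z)) x := by
        rw [← gradient_comp_add]
        exact hasGradientAt_of_contDiffAt
          ((h.contDiffAt (hΩ _ (hsh x hx))).comp x (contDiffAt_id.add contDiffAt_const))
      exact HasGradientAt.sub' a1 (hasGradientAt_of_contDiffAt (h.contDiffAt (hΩ _ (hin x hx))))
    exact (HasGradientAt.mul' (HasGradientAt.mul' e1 e1) e2).gradient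
  -- the equation for the difference
  set V : Eu d → Eu d := fun x => A p (∇f x) with hV
  have hVc : ∀ x ∈ ball x₁ R, ContinuousAt V x := fun x hx =>
    (continuous_A hp).continuousAt.comp (continuousAt_gradient (h.contDiffAt (hΩ x hx)))
  have hgc : ∀ x ∈ ball x₁ R, ContinuousAt g x := fun x hx =>
    h.cont.continuousAt (h.isOpen.mem_nhds (hΩ x hx))
  have htr : ∀ x ∈ ball x₁ R, Tendsto (fun y : Eu d => y + z) (𝓝 x) (𝓝 (x + z)) := fun x _ =>
    (continuous_id.add continuous_const).tendsto x
  have eq1 := h.weak ψ hψ1 hψc (hψs.trans fun x hx => hΩ x (hin x hx))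
  have eq2 : ∫ x, ⟪V (x + z), ∇ψ x⟫ = ∫ x, g (x + z) * ψ x := by
    have hs2 : tsupport (fun x => ψ (x + -z)) ⊆ Ω := by
      intro x hx
      have hx' : x + -z ∈ closedBall x₁ (2 * r) := by
        have hcl : tsupport (fun x => ψ (x + -z)) ⊆ (fun x => x + -z) ⁻¹' closedBall x₁ (2 * r) :=
          closure_minimal (fun y hy => hψs (subset_closure hy)) (isClosed_closedBall.preimage (by fun_prop))
        exact hcl hx
      have := hΩ _ (hsh _ hx')
      simpa using this
    have hc2 : HasCompactSupport fun x => ψ (x + -z) :=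
      hψc.comp_homeomorph (Homeomorph.addRight (-z))
    have e := h.weak (fun x => ψ (x + -z)) (hψ1.comp (contDiff_id.add contDiff_const)) hc2 hs2
    simp_rw [gradient_comp_add ψ (-z)] at e
    rw [← integral_add_right_eq_self _ z, ← integral_add_right_eq_self (fun x => g x * ψ (x + -z)) z] at e
    simpa using e
  have hI1 := integrable_inner_gradient (X := V) hψ1 hψc fun x hx => hVc x (hin x (hψs hx))
  have hI2 := integrable_inner_gradient (X := fun x => V (x + z)) hψ1 hψc fun x hx =>
    (hVc _ (hsh x (hψs hx))).tendsto.comp (htr x (hin x (hψs hx)))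
  have hz0 : ∀ x ∉ tsupport ψ, ψ x = 0 := fun x hx => eq_zero_of_notMem hx
  have hI3 := integrable_mul_of_tsupport (g := g) hψc hψ1.continuous hz0 fun x hx => hgc x (hin x (hψs hx))
  have hI4 := integrable_mul_of_tsupport (g := fun x => g (x + z)) hψc hψ1.continuous hz0
    fun x hx => (hgc _ (hsh x (hψs hx))).tendsto.comp (htr x (hin x (hψs hx)))
  have htot : ∫ x, ((⟪V (x + z), ∇ψ x⟫ - ⟪V x, ∇ψ x⟫) - (g (x + z) * ψ x - g x * ψ x)) = 0 := by
    have e1 := integral_sub (hI2.sub hI1) (hI4.sub hI3)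
    simp only [Pi.sub_apply] at e1
    rw [e1, integral_sub hI2 hI1, integral_sub hI4 hI3, eq2, hV, eq1]; ring
  set S := closedBall x₁ (2 * r)
  have hpt : ∀ x ∈ S, c / 4 * ((η x) ^ 2 * ‖Dg x‖ ^ 2) - B * ‖z‖ ^ 2 ≤
      (⟪V (x + z), ∇ψ x⟫ - ⟪V x, ∇ψ x⟫) - (g (x + z) * ψ x - g x * ψ x) := by
    intro x hx
    have k1 := hin x hx
    have k2 := hsh x hx
    have hLx : ‖V (x + z) - V x - L (Dg x)‖ ≤ c / 2 * ‖Dg x‖ := by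
      have := hL _ (hball k2).1.2 _ (hball k1).1.2
      rwa [Real.coe_toNNReal _ (by positivity)] at this
    have hmono : c / 2 * ‖Dg x‖ ^ 2 ≤ ⟪V (x + z) - V x, Dg x⟫ := by
      have h1 := inner_DA_ge (p := p) hne (Dg x)
      have h2 : |⟪V (x + z) - V x - L (Dg x), Dg x⟫| ≤ c / 2 * ‖Dg x‖ * ‖Dg x‖ :=
        (abs_real_inner_le_norm _ _).trans (mul_le_right hLx (norm_nonneg _))
      rw [inner_sub_left] at h2
      have h3 := (abs_le.1 h2).1
      have h4 : c * ‖Dg x‖ ^ 2 ≤ ⟪L (Dg x), Dg x⟫ := h1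
      nlinarith
    have hVb : ‖V (x + z) - V x‖ ≤ C₁ * ‖Dg x‖ := by
      have h1 := norm_le_norm_add_norm_sub' (V (x + z) - V x) (L (Dg x))
      have h2 : ‖V (x + z) - V x - L (Dg x)‖ ≤ c / 2 * ‖Dg x‖ := hLx
      have h3 := L.le_opNorm (Dg x)
      have : C₁ * ‖Dg x‖ = ‖L‖ * ‖Dg x‖ + c / 2 * ‖Dg x‖ := by ring
      linarith
    have hδb : |δ x| ≤ M * ‖z‖ := by
      have := hLip x k1 (x + z) k2
      simpa using this
    have hgb : |g (x + z) - g x| ≤ Cg * (‖Dg x‖ + ‖z‖) := by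
      have := hg (x + z) (hball k2).2.1 x (hball k1).2.1
      simpa using this
    have hη0 : 0 ≤ η x := η.nonneg
    have hη1' : η x ≤ 1 := η.le_one
    rw [← inner_sub_left, hgrad x hx, inner_add_right, real_inner_smul_right,
      real_inner_smul_right, ← two_smul ℝ, real_inner_smul_right, real_inner_smul_right]
    set D := ‖Dg x‖
    set Z := ‖z‖
    have hD : 0 ≤ D := norm_nonneg _
    have hZ : 0 ≤ Z := norm_nonneg _
    have t1 : |δ x * (2 * (η x * ⟪V (x + z) - V x, ∇η x⟫))| ≤ 2 * (η x * D) * (M * C₁ * Cη * Z) := by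
      have i1 : |⟪V (x + z) - V x, ∇η x⟫| ≤ C₁ * D * Cη :=
        (abs_real_inner_le_norm _ _).trans (mul_le_mul hVb (hCη x hx) (norm_nonneg _)
          ((norm_nonneg _).trans hVb))
      rw [abs_mul, abs_mul, abs_mul, abs_of_nonneg hη0, abs_two]
      calc |δ x| * (2 * (η x * |⟪V (x + z) - V x, ∇η x⟫|)) ≤ (M * Z) * (2 * (η x * (C₁ * D * Cη))) := by
            apply mul_le_mul hδb _ (by positivity) (by positivity)
            gcongr
        _ = _ := by ring
    have t2 : |g (x + z) * ψ x - g x * ψ x| ≤ |Cg * M| * Z * (D + Z) * (η x) ^ 2 := by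
      rw [← sub_mul, abs_mul, hψ]
      simp only
      rw [abs_mul, abs_of_nonneg (mul_nonneg hη0 hη0)]
      calc |g (x + z) - g x| * (η x * η x * |δ x|) ≤ (|Cg| * (D + Z)) * (η x * η x * (M * Z)) := by
            apply mul_le_mul (hgb.trans _) _ (by positivity) (by positivity)
            · exact mul_le_right (le_abs_self _) (by positivity)
            · gcongr
        _ = _ := by rw [abs_mul, abs_of_nonneg (by positivity : 0 ≤ M)]; ring
    have y1 : 2 * (η x * D) * (M * C₁ * Cη * Z) ≤
        c / 8 * (η x * D) ^ 2 + 8 / c * (M * C₁ * Cη) ^ 2 * Z ^ 2 := by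
      have : 0 ≤ (c / 8) * (η x * D - 8 / c * (M * C₁ * Cη * Z)) ^ 2 := by positivity
      have e : (c / 8) * (η x * D - 8 / c * (M * C₁ * Cη * Z)) ^ 2 = c / 8 * (η x * D) ^ 2 -
          2 * (η x * D) * (M * C₁ * Cη * Z) + 8 / c * (M * C₁ * Cη) ^ 2 * Z ^ 2 := by
        field_simp; ring
      linarith
    have y2 : |Cg * M| * Z * (D + Z) * (η x) ^ 2 ≤
        c / 8 * (η x * D) ^ 2 + ((2 / c) * (Cg * M) ^ 2 + |Cg * M|) * Z ^ 2 := by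
      have e0 : 0 ≤ (c / 8) * (η x * D - 4 / c * (|Cg * M| * Z * η x)) ^ 2 := by positivity
      have e : (c / 8) * (η x * D - 4 / c * (|Cg * M| * Z * η x)) ^ 2 = c / 8 * (η x * D) ^ 2 -
          |Cg * M| * Z * D * (η x) ^ 2 + 2 / c * |Cg * M| ^ 2 * Z ^ 2 * (η x) ^ 2 := by
        field_simp; ring
      rw [sq_abs] at e
      have h1 : (η x) ^ 2 ≤ 1 := pow_le_one₀ hη0 hη1'
      have h2 : 2 / c * (Cg * M) ^ 2 * Z ^ 2 * (η x) ^ 2 ≤ 2 / c * (Cg * M) ^ 2 * Z ^ 2 * 1 :=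
        mul_le_left h1 (by positivity)
      have h3 : |Cg * M| * Z ^ 2 * (η x) ^ 2 ≤ |Cg * M| * Z ^ 2 * 1 :=
        mul_le_left h1 (by positivity)
      nlinarith
    have hm2 : η x * η x * (c / 2 * D ^ 2) ≤ η x * η x * ⟪V (x + z) - V x, Dg x⟫ :=
      mul_le_left hmono (by positivity)
    have l1 := (abs_le.1 t1).1
    have l2 := (abs_le.1 t2).2
    have e3 : B * Z ^ 2 = 8 / c * (M * C₁ * Cη) ^ 2 * Z ^ 2 +
      ((2 / c) * (Cg * M) ^ 2 + |Cg * M|) * Z ^ 2 := by rw [hB]; ring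
    nlinarith
  have hSm : MeasurableSet S := measurableSet_closedBall
  have hStop : volume S ≠ ⊤ := (isCompact_closedBall x₁ (2 * r)).measure_lt_top.ne
  have hDc : ContinuousOn Dg S := by
    intro x hx
    have a1 : ContinuousAt (fun y => ∇f (y + z)) x :=
      (continuousAt_gradient (h.contDiffAt (hΩ _ (hsh x hx)))).tendsto.comp (htr x (hin x hx))
    exact (a1.sub (continuousAt_gradient (h.contDiffAt (hΩ _ (hin x hx))))).continuousWithinAt
  have hIη : IntegrableOn (fun x => (η x) ^ 2 * ‖Dg x‖ ^ 2) S :=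
    ((hη.continuous.continuousOn.pow 2).mul (hDc.norm.pow 2)).integrableOn_compact
      (isCompact_closedBall x₁ (2 * r))
  have hset : ∫ x in S, ((⟪V (x + z), ∇ψ x⟫ - ⟪V x, ∇ψ x⟫) - (g (x + z) * ψ x - g x * ψ x)) = 0 := by
    rw [setIntegral_eq_integral_of_forall_compl_eq_zero, htot]
    intro x hx
    rw [gradient_of_notMem fun h => hx (hψs h), hz0 x fun h => hx (hψs h)]
    simp
  have hle : ∫ x in S, (c / 4 * ((η x) ^ 2 * ‖Dg x‖ ^ 2) - B * ‖z‖ ^ 2) ≤ 0 := by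
    rw [← hset]
    refine setIntegral_mono_on ?_ ((hI2.sub hI1).sub (hI4.sub hI3)).integrableOn hSm hpt
    exact (hIη.const_mul _).sub (integrableOn_const hStop)
  rw [integral_sub (hIη.const_mul _) (integrableOn_const hStop), integral_const_mul,
    setIntegral_const, smul_eq_mul] at hle
  have hfin : ∫ x in S, (η x) ^ 2 * ‖Dg x‖ ^ 2 ≤ 4 / c * (B * volume.real S) * ‖z‖ ^ 2 := by
    rw [show 4 / c * (B * volume.real S) * ‖z‖ ^ 2 = (volume.real S * (B * ‖z‖ ^ 2)) / (c / 4) by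
      field_simp, le_div_iff₀ (by positivity)]
    linarith
  have hbs : ball x₁ r ⊆ S := fun x hx => by
    rw [mem_ball] at hx; rw [mem_closedBall]; linarith
  calc ∫⁻ x in ball x₁ r, ofReal (‖∇f (x + z) - ∇f x‖ ^ 2)
      = ∫⁻ x in ball x₁ r, ofReal ((η x) ^ 2 * ‖Dg x‖ ^ 2) := by
        refine setLIntegral_congr_fun measurableSet_ball fun x hx => ?_
        rw [η.one_of_mem_closedBall (ball_subset_closedBall hx)]; simp [hDg]
    _ ≤ ∫⁻ x in S, ofReal ((η x) ^ 2 * ‖Dg x‖ ^ 2) := lintegral_mono_set hbs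
    _ = ofReal (∫ x in S, (η x) ^ 2 * ‖Dg x‖ ^ 2) :=
        (ofReal_integral_eq_lintegral_ofReal hIη (.of_forall fun x => by positivity)).symm
    _ ≤ _ := ofReal_le_ofReal hfin

end weak

section approxA
variable {d : ℕ} {p : ℝ}

theorem continuousAt_DA {z : Eu d} (hz : z ≠ 0) : ContinuousAt (DA (d := d) p) z := by
  have h1 : ContinuousAt (fderiv ℝ (A (d := d) p)) z :=
    ((contDiffAt_A (p := p) (n := 1) hz).fderiv_right (m := 0) (by norm_num)).continuousAt
  refine h1.congr ?_
  filter_upwards [isOpen_ne.mem_nhds hz] with y hy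
  exact (hasFDerivAt_A hy).fderiv

/-- Uniform strict differentiability of the field `A p` on compact sets avoiding the origin. -/
theorem A_unif_strict {S : Set (Eu d)} (hS : IsCompact S) (h0 : (0 : Eu d) ∉ S) {ε : ℝ}
    (hε : 0 < ε) : ∃ r > 0, ∀ s ∈ S, ∀ a ∈ ball s r, ∀ b ∈ ball s r, ∀ c ∈ ball s r,
      ‖A p a - A p b - DA p c (a - b)‖ ≤ ε * ‖a - b‖ := by
  have hnear : ∀ s ∈ S, ∃ U : Set (Eu d), IsOpen U ∧ s ∈ U ∧ ∀ a ∈ U, ∀ b ∈ U, ∀ c ∈ U,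
      ‖A p a - A p b - DA p c (a - b)‖ ≤ ε * ‖a - b‖ := by
    intro s hs
    have hs0 : s ≠ 0 := fun h => h0 (h ▸ hs)
    obtain ⟨t, ht, hL⟩ := (hasStrictFDerivAt_A (p := p) hs0).approximates_deriv_on_nhds
      (c := Real.toNNReal (ε / 2)) (Or.inr (Real.toNNReal_pos.2 (by positivity)))
    have hc := (continuousAt_DA (p := p) hs0).preimage_mem_nhds (ball_mem_nhds (DA p s) (half_pos hε))
    obtain ⟨U, hUs, hU, hsU⟩ := _root_.mem_nhds_iff.1 (Filter.inter_mem ht hc)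
    refine ⟨U, hU, hsU, fun a ha b hb c hc => ?_⟩
    have h1 := hL a (hUs ha).1 b (hUs hb).1
    rw [Real.coe_toNNReal _ (by positivity)] at h1
    have h2 : ‖DA p c - DA p s‖ ≤ ε / 2 := by
      have := (hUs hc).2; simp only [mem_preimage, mem_ball, dist_eq_norm] at this; exact this.le
    have h3 := ((DA p c - DA p s).le_opNorm (a - b)).trans (mul_le_right h2 (norm_nonneg _))
    have e : A p a - A p b - DA p c (a - b) =
        (A p a - A p b - DA p s (a - b)) - (DA p c - DA p s) (a - b) := by simp
    rw [e]
    refine (norm_sub_le _ _).trans ?_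
    linarith
  choose! U hU hsU hUb using hnear
  obtain ⟨r, hr, h⟩ := lebesgue_number_lemma_of_metric (c := fun s : S => U s) hS
    (fun s => hU s s.2) fun s hs => mem_iUnion.2 ⟨⟨s, hs⟩, hsU s hs⟩
  refine ⟨r, hr, fun s hs a ha b hb c hc => ?_⟩
  obtain ⟨t, ht⟩ := h s hs
  exact hUb t t.2 a (ht ha) b (ht hb) c (ht hc)

end approxA

section moll2
variable {d : ℕ} {F : Type*} [NormedAddCommGroup F] [NormedSpace ℝ F]

theorem integrable_moll (n : ℕ) {g : Eu d → F} (hg : Continuous g) (x : Eu d) :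
    Integrable fun y => rho d n y • g (x - y) := by
  refine Continuous.integrable_of_hasCompactSupport ?_ ?_
  · exact (rho_contDiff n).continuous.smul (hg.comp (by fun_prop))
  · exact (rho_hasCompactSupport n).smul_right

theorem norm_moll_le (n : ℕ) (g : Eu d → F) (x : Eu d) :
    ‖moll n g x‖ ≤ moll n (fun y => ‖g y‖) x := by
  rw [moll_apply, moll_apply]
  refine (norm_integral_le_integral_norm _).trans (le_of_eq ?_)
  refine integral_congr_ae (.of_forall fun y => ?_)
  simp [norm_smul, abs_of_nonneg (rho_nonneg n y)]

theorem moll_sq_le (n : ℕ) {q : Eu d → ℝ} (hq : Continuous q) (x : Eu d) :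
    (moll n q x) ^ 2 ≤ moll n (fun y => q y ^ 2) x := by
  set m := moll n q x with hm
  have h1 : Integrable fun y => rho d n y • (q (x - y)) ^ 2 := integrable_moll n (hq.pow 2) x
  have h2 := integrable_moll n hq x
  have h3 : 0 ≤ ∫ y, rho d n y * (q (x - y) - m) ^ 2 :=
    integral_nonneg fun y => mul_nonneg (rho_nonneg n y) (sq_nonneg _)
  have e : (fun y => rho d n y * (q (x - y) - m) ^ 2) =
      fun y => (rho d n y • (q (x - y)) ^ 2 - (2 * m) * (rho d n y • q (x - y))) + m ^ 2 * rho d n y := by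
    funext y; simp only [smul_eq_mul]; ring
  have h12 : Integrable fun y => rho d n y • (q (x - y)) ^ 2 - (2 * m) * (rho d n y • q (x - y)) :=
    h1.sub (h2.const_mul _)
  rw [e, integral_add h12 ((rho_integrable n).const_mul _),
    integral_sub h1 (h2.const_mul _), integral_const_mul, integral_const_mul, rho_integral,
    ← moll_apply, ← hm] at h3
  have h4 : moll n (fun y => q y ^ 2) x = ∫ y, rho d n y • (q (x - y)) ^ 2 := rfl
  rw [h4]; nlinarith

theorem moll_mono (n : ℕ) {q q' : Eu d → ℝ} (hq : Continuous q) (hq' : Continuous q') {x : Eu d}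
    (h : ∀ y ∈ closedBall x (1 / ((n : ℝ) + 1)), q y ≤ q' y) : moll n q x ≤ moll n q' x := by
  rw [moll_apply, moll_apply]
  refine integral_mono (integrable_moll n hq x) (integrable_moll n hq' x) fun y => ?_
  simp only [smul_eq_mul]
  by_cases hy : 1 / ((n : ℝ) + 1) < ‖y‖
  · simp [rho_eq_zero hy]
  · exact mul_le_left (h _ (by simpa [dist_eq_norm] using not_lt.1 hy)) (rho_nonneg n y)

theorem lintegral_moll_le (n : ℕ) {q : Eu d → ℝ} (hq : Continuous q) (h0 : ∀ x, 0 ≤ q x)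
    {K : Set (Eu d)} (hK : MeasurableSet K) {r : ℝ} (hr : 1 / ((n : ℝ) + 1) ≤ r) :
    ∫⁻ x in K, ofReal (moll n q x) ≤ ∫⁻ x in cthickening r K, ofReal (q x) := by
  have e : ∀ x, ofReal (moll n q x) = ∫⁻ y, ofReal (rho d n y) * ofReal (q (x - y)) := by
    intro x
    rw [moll_apply, ofReal_integral_eq_lintegral_ofReal (integrable_moll n hq x)
      (.of_forall fun y => mul_nonneg (rho_nonneg n y) (h0 _))]
    refine lintegral_congr fun y => ?_
    rw [smul_eq_mul, ofReal_mul (rho_nonneg n y)]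
  simp_rw [e]
  have hρ : Measurable fun y => ofReal (rho d n y) :=
    (rho_contDiff n).continuous.measurable.ennreal_ofReal
  rw [lintegral_lintegral_swap]
  swap
  · refine Measurable.aemeasurable ?_
    exact (hρ.comp measurable_snd).mul
      ((hq.comp (continuous_fst.sub continuous_snd)).measurable.ennreal_ofReal)
  have h1 : ∀ y, ∫⁻ x in K, ofReal (rho d n y) * ofReal (q (x - y)) ≤
      ofReal (rho d n y) * ∫⁻ x in cthickening r K, ofReal (q x) := by
    intro y
    have hqm : Measurable fun x => ofReal (q (x - y)) :=
      (hq.comp (by fun_prop)).measurable.ennreal_ofReal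
    rw [lintegral_const_mul _ hqm]
    by_cases hy : 1 / ((n : ℝ) + 1) < ‖y‖
    · simp [rho_eq_zero hy]
    · refine mul_le_mul_right ?_ _
      have hyr : ‖y‖ ≤ r := (not_lt.1 hy).trans hr
      rw [← lintegral_indicator hK, ← lintegral_indicator isClosed_cthickening.measurableSet,
        ← lintegral_add_right_eq_self _ y]
      refine lintegral_mono fun x => ?_
      by_cases hx : x + y ∈ K
      · have hx' : x ∈ cthickening r K :=
          mem_cthickening_of_dist_le x (x + y) r K hx (by simpa [dist_eq_norm] using hyr)
        rw [indicator_of_mem hx, indicator_of_mem hx']; simp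
      · rw [indicator_of_notMem hx]; exact bot_le
  refine (lintegral_mono h1).trans ?_
  rw [lintegral_mul_const _ hρ, ← ofReal_integral_eq_lintegral_ofReal (rho_integrable n)
    (.of_forall (rho_nonneg n)), rho_integral]
  simp

theorem moll_shift (n : ℕ) {g : Eu d → F} (hg : Continuous g) (x z : Eu d) :
    moll n g (x + z) - moll n g x = moll n (fun y => g (y + z) - g y) x := by
  rw [moll_apply, moll_apply, moll_apply, ← integral_sub (integrable_moll n hg _) (integrable_moll n hg _)]
  refine integral_congr_ae (.of_forall fun y => ?_)
  simp only [smul_sub]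
  congr 3; abel

theorem moll_clm [CompleteSpace F] {F' : Type*} [NormedAddCommGroup F'] [NormedSpace ℝ F']
    [CompleteSpace F'] (n : ℕ) (L : F →L[ℝ] F') {g : Eu d → F}
    (hg : Continuous g) (x : Eu d) : moll n (fun y => L (g y)) x = L (moll n g x) := by
  rw [moll_apply, moll_apply, ← L.integral_comp_comm (integrable_moll n hg x)]
  refine integral_congr_ae (.of_forall fun y => ?_)
  simp

theorem dv_moll (n : ℕ) {V : Eu d → Eu d} (hV : Continuous V) (x : Eu d) :
    dv (moll n V) x = - ∫ y, ⟪V y, ∇(fun y => rho d n (x - y)) y⟫ := by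
  have h := (rho_hasCompactSupport (d := d) n).hasFDerivAt_convolution_left
    (ContinuousLinearMap.lsmul ℝ ℝ) ((rho_contDiff n).of_le (by simp)) hV.locallyIntegrable x
    (μ := volume)
  have h1 : fderiv ℝ (moll n V) x = _ := h.fderiv
  have hρc : Continuous (fderiv ℝ (rho d n)) := (rho_contDiff n).continuous_fderiv (by simp)
  have hρs : HasCompactSupport (fderiv ℝ (rho d n)) := (rho_hasCompactSupport n).fderiv (𝕜 := ℝ)
  have hI : Integrable fun t => (ContinuousLinearMap.precompL (Eu d)
      (ContinuousLinearMap.lsmul ℝ ℝ : ℝ →L[ℝ] Eu d →L[ℝ] Eu d)) (fderiv ℝ (rho d n) t) (V (x - t)) := by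
    refine Continuous.integrable_of_hasCompactSupport ?_ ?_
    · exact (((ContinuousLinearMap.precompL (Eu d)
        (ContinuousLinearMap.lsmul ℝ ℝ : ℝ →L[ℝ] Eu d →L[ℝ] Eu d)).continuous.comp
          hρc).clm_apply (hV.comp (by fun_prop)))
    · refine HasCompactSupport.intro hρs fun t ht => ?_
      rw [eq_zero_of_notMem ht]; simp
  have hgr : ∀ y, ∇(fun y => rho d n (x - y)) y = - ∇(rho d n) (x - y) := by
    intro y
    have hd : HasFDerivAt (fun y => rho d n (x - y))
        ((fderiv ℝ (rho d n) (x - y)).comp (-(ContinuousLinearMap.id ℝ (Eu d)))) y := by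
      refine HasFDerivAt.comp y ?_ ?_
      · exact (((rho_contDiff n).differentiable (by simp)) _).hasFDerivAt
      · exact (hasFDerivAt_id y).const_sub x
    rw [gradient, gradient, hd.fderiv]
    simp
  simp_rw [hgr]
  rw [← integral_neg, ← integral_sub_left_eq_self _ volume x]
  simp only [dv, h1, convolution]
  have hcomp : ∀ i, ((∫ t, (ContinuousLinearMap.precompL (Eu d)
      (ContinuousLinearMap.lsmul ℝ ℝ : ℝ →L[ℝ] Eu d →L[ℝ] Eu d)) (fderiv ℝ (rho d n) t)
        (V (x - t))) (single i 1)) i = ∫ t, ((ContinuousLinearMap.precompL (Eu d)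
      (ContinuousLinearMap.lsmul ℝ ℝ : ℝ →L[ℝ] Eu d →L[ℝ] Eu d)) (fderiv ℝ (rho d n) t)
        (V (x - t)) (single i 1)) i := by
    intro i
    rw [ContinuousLinearMap.integral_apply hI]
    exact ((EuclideanSpace.proj (𝕜 := ℝ) i).integral_comp_comm (hI.apply_continuousLinearMap _)).symm
  simp_rw [hcomp]
  rw [← integral_finsetSum]
  · refine integral_congr_ae (.of_forall fun y => ?_)
    simp only [inner_neg_right, neg_neg, inner_eq_sum, gradient_apply_coord, sub_sub_cancel]
    refine Finset.sum_congr rfl fun i _ => ?_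
    simp [ContinuousLinearMap.precompL, mul_comm]
  · intro i _
    exact (EuclideanSpace.proj (𝕜 := ℝ) i).integrable_comp (hI.apply_continuousLinearMap _)

end moll2

section approx
variable {d : ℕ} {p : ℝ} {Ω : Set (Eu d)} {f g : Eu d → ℝ}

/-- The right-hand side `g` is locally Lipschitz with respect to `(∇f, x)`. -/
def LipGrad (Ω : Set (Eu d)) (f g : Eu d → ℝ) : Prop :=
  ∀ x₁ ∈ Ω, ∃ C, ∃ r > 0, ∀ x ∈ ball x₁ r, ∀ y ∈ ball x₁ r,
    |g x - g y| ≤ C * (‖∇f x - ∇f y‖ + ‖x - y‖)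

theorem WeakEq.diff_quot_compact (hp : 1 < p) (h : WeakEq p Ω f g) (hg : LipGrad Ω f g)
    {K : Set (Eu d)} (hK : IsCompact K) (hKΩ : K ⊆ Ω) (hne : ∀ x ∈ K, ∇f x ≠ 0) :
    ∃ t₀ > 0, ∃ C, 0 ≤ C ∧ ∀ z : Eu d, ‖z‖ < t₀ → ∫⁻ x in K, ofReal (‖∇f (x + z) - ∇f x‖ ^ 2)
        ≤ ofReal (C * ‖z‖ ^ 2) := by
  refine hK.induction_on (p := fun S => ∃ t₀ > 0, ∃ C, 0 ≤ C ∧ ∀ z : Eu d, ‖z‖ < t₀ →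
      ∫⁻ x in S, ofReal (‖∇f (x + z) - ∇f x‖ ^ 2) ≤ ofReal (C * ‖z‖ ^ 2)) ?_ ?_ ?_ ?_
  · exact ⟨1, one_pos, 0, le_rfl, fun z _ => by simp⟩
  · rintro S T hST ⟨t₀, ht₀, C, hC, hb⟩
    exact ⟨t₀, ht₀, C, hC, fun z hz => (lintegral_mono_set hST).trans (hb z hz)⟩
  · rintro S T ⟨t, ht, C, hC, hb⟩ ⟨t', ht', C', hC', hb'⟩
    refine ⟨min t t', lt_min ht ht', C + C', by positivity, fun z hz => ?_⟩
    refine (lintegral_union_le _ _ _).trans ?_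
    rw [add_mul, ofReal_add (by positivity) (by positivity)]
    exact add_le_add (hb z (hz.trans_le (min_le_left _ _))) (hb' z (hz.trans_le (min_le_right _ _)))
  · intro x hx
    obtain ⟨r, hr, C, hb⟩ := h.diff_quot_near hp (hKΩ hx) (hne x hx) (hg x (hKΩ hx))
    refine ⟨ball x r, mem_nhdsWithin_of_mem_nhds (ball_mem_nhds x hr), r, hr, max C 0,
      le_max_right _ _, fun z hz => (hb z hz).trans (ofReal_le_ofReal ?_)⟩
    exact mul_le_right (le_max_left _ _) (by positivity)

theorem lintegral_fderiv_sq_le {G H : Eu d → Eu d} (hG : ContDiff ℝ 1 G) (hH : ContDiff ℝ 1 H)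
    {K : Set (Eu d)} (hK : MeasurableSet K) {L : Eu d → Eu d →L[ℝ] Eu d} (hL : ContinuousOn L K)
    {e : Eu d} {C t₀ : ℝ} (ht₀ : 0 < t₀)
    (hb : ∀ t : ℝ, 0 < t → t < t₀ → ∫⁻ x in K, ofReal
      (‖(G (x + t • e) - G x) - L x (H (x + t • e) - H x)‖ ^ 2) ≤ ofReal (C * t ^ 2)) :
    ∫⁻ x in K, ofReal (‖fderiv ℝ G x e - L x (fderiv ℝ H x e)‖ ^ 2) ≤ ofReal C := by
  set t : ℕ → ℝ := fun k => t₀ / ((k : ℝ) + 2) with ht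
  have htp : ∀ k, 0 < t k := fun k => by positivity
  have htl : ∀ k, t k < t₀ := fun k => by
    rw [ht, div_lt_iff₀ (by positivity)]; nlinarith [(Nat.cast_nonneg k : (0:ℝ) ≤ k)]
  have htt : Tendsto t atTop (𝓝[≠] 0) := by
    refine tendsto_nhdsWithin_iff.2 ⟨?_, .of_forall fun k => (htp k).ne'⟩
    exact tendsto_const_nhds.div_atTop (tendsto_atTop_add_const_right _ _ tendsto_natCast_atTop_atTop)
  set u : ℕ → Eu d → ℝ := fun k x =>
    ‖(t k)⁻¹ • (G (x + t k • e) - G x) - L x ((t k)⁻¹ • (H (x + t k • e) - H x))‖ ^ 2 with hu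
  have hlim : ∀ x, Tendsto (fun k => ofReal (u k x)) atTop
      (𝓝 (ofReal (‖fderiv ℝ G x e - L x (fderiv ℝ H x e)‖ ^ 2))) := by
    intro x
    have h1 : ∀ {W : Eu d → Eu d}, ContDiff ℝ 1 W → Tendsto
        (fun k => (t k)⁻¹ • (W (x + t k • e) - W x)) atTop (𝓝 (fderiv ℝ W x e)) := by
      intro W hW
      have := ((hW.differentiable one_ne_zero x).hasFDerivAt.hasLineDerivAt e).tendsto_slope_zero
      exact this.comp htt
    exact (ENNReal.continuous_ofReal.tendsto _).comp
      (((h1 hG).sub (((L x).continuous.tendsto _).comp (h1 hH))).norm.pow 2)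
  have hmeas : ∀ k, AEMeasurable (fun x => ofReal (u k x)) (volume.restrict K) := by
    intro k
    refine (ContinuousOn.aemeasurable ?_ hK).ennreal_ofReal
    have c1 : Continuous fun x => (t k)⁻¹ • (G (x + t k • e) - G x) := by
      have := hG.continuous; fun_prop
    have c2 : Continuous fun x => (t k)⁻¹ • (H (x + t k • e) - H x) := by
      have := hH.continuous; fun_prop
    exact ((c1.continuousOn.sub (hL.clm_apply c2.continuousOn)).norm.pow 2)
  have hle : ∀ k, ∫⁻ x in K, ofReal (u k x) ≤ ofReal C := by
    intro k
    have e1 : ∀ x, u k x = ((t k)⁻¹) ^ 2 * ‖(G (x + t k • e) - G x) - L x (H (x + t k • e) - H x)‖ ^ 2 := by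
      intro x
      rw [hu]; simp only
      rw [map_smul, ← smul_sub, norm_smul, mul_pow, norm_eq_abs, sq_abs]
    simp_rw [e1, ofReal_mul (sq_nonneg _)]
    rw [lintegral_const_mul' _ _ ofReal_ne_top]
    refine (mul_le_mul_right (hb _ (htp k) (htl k)) _).trans ?_
    rw [← ofReal_mul (sq_nonneg _)]
    refine ofReal_le_ofReal (le_of_eq ?_)
    have := (htp k).ne'
    field_simp
  calc ∫⁻ x in K, ofReal (‖fderiv ℝ G x e - L x (fderiv ℝ H x e)‖ ^ 2)
      = ∫⁻ x in K, liminf (fun k => ofReal (u k x)) atTop :=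
        lintegral_congr fun x => (hlim x).liminf_eq.symm
    _ ≤ liminf (fun k => ∫⁻ x in K, ofReal (u k x)) atTop := lintegral_liminf_le' hmeas
    _ ≤ ofReal C := by
        refine liminf_le_of_le (by isBoundedDefault) fun b hb' => ?_
        obtain ⟨k, hk⟩ := hb'.exists
        exact hk.trans (hle k)

theorem opNorm_sq_le_sum (L : Eu d →L[ℝ] Eu d) :
    ‖L‖ ^ 2 ≤ ∑ i, ‖L (single i 1)‖ ^ 2 := by
  rw [← Real.le_sqrt (by positivity) (by positivity)]
  refine L.opNorm_le_bound (Real.sqrt_nonneg _) fun x => ?_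
  have hx : x = ∑ i, x i • single i (1:ℝ) := by
    ext j; simp [Finset.sum_apply, Pi.single_apply]
  have h1 : ‖L x‖ ≤ ∑ i, |x i| * ‖L (single i 1)‖ := by
    conv_lhs => rw [hx, map_sum]
    refine (norm_sum_le _ _).trans (le_of_eq ?_)
    exact Finset.sum_congr rfl fun i _ => by rw [map_smul, norm_smul, norm_eq_abs]
  refine h1.trans ((Real.sum_mul_le_sqrt_mul_sqrt _ _ _).trans (le_of_eq ?_))
  rw [mul_comm, EuclideanSpace.norm_eq]
  simp

/-- Smooth cutoff functions for compact sets. -/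
theorem exists_cutoff {K U : Set (Eu d)} (hK : IsCompact K) (hU : IsOpen U) (hKU : K ⊆ U) :
    ∃ θ : Eu d → ℝ, ContDiff ℝ ∞ θ ∧ HasCompactSupport θ ∧ tsupport θ ⊆ U ∧
      (∀ x, θ x ∈ Icc (0:ℝ) 1) ∧ ∃ δ > 0, ∀ x ∈ cthickening δ K, θ x = 1 := by
  obtain ⟨δ, hδ, hsub⟩ := hK.exists_cthickening_subset_open hU hKU
  have hdisj : Disjoint ((thickening δ K)ᶜ) (cthickening (δ / 2) K) := by
    rw [disjoint_compl_left_iff_subset]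
    exact cthickening_subset_thickening' hδ (by linarith) K
  obtain ⟨θ, h0, h1, h2⟩ := exists_contMDiffMap_zero_one_of_isClosed
    (n := ⊤) (modelWithCornersSelf ℝ (Eu d)) isOpen_thickening.isClosed_compl
    isClosed_cthickening hdisj
  have hs : tsupport (θ : Eu d → ℝ) ⊆ cthickening δ K := by
    refine closure_minimal (fun x hx => ?_) isClosed_cthickening
    by_contra hc
    exact hx (h0 fun h => hc (thickening_subset_cthickening _ _ h))
  refine ⟨θ, θ.contMDiff.contDiff, ?_, hs.trans hsub, h2, δ / 2, by linarith, h1⟩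
  exact hK.cthickening.of_isClosed_subset (isClosed_tsupport _) hs

theorem moll_sub {F : Type*} [NormedAddCommGroup F] [NormedSpace ℝ F] (n : ℕ) {g g' : Eu d → F}
    (hg : Continuous g) (hg' : Continuous g') (x : Eu d) :
    moll n g x - moll n g' x = moll n (fun y => g y - g' y) x := by
  simp only [moll_apply, smul_sub]
  rw [integral_sub (integrable_moll n hg x) (integrable_moll n hg' x)]

theorem lintegral_moll_commutator (n : ℕ) {V W : Eu d → Eu d} (hV : Continuous V)
    (hW : Continuous W) {K : Set (Eu d)} (hK : MeasurableSet K) {r : ℝ}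
    (hr : 1 / ((n : ℝ) + 1) ≤ r) (L : Eu d → Eu d →L[ℝ] Eu d) {ε : ℝ} (z : Eu d)
    (hb : ∀ x ∈ K, ∀ y ∈ closedBall x (1 / ((n : ℝ) + 1)),
      ‖(V (y + z) - V y) - L x (W (y + z) - W y)‖ ≤ ε * ‖W (y + z) - W y‖) :
    ∫⁻ x in K, ofReal (‖(moll n V (x + z) - moll n V x) - L x (moll n W (x + z) - moll n W x)‖ ^ 2) ≤
      ofReal (ε ^ 2) * ∫⁻ x in cthickening r K, ofReal (‖W (x + z) - W x‖ ^ 2) := by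
  have cV : Continuous fun y => V (y + z) - V y := by fun_prop
  have cW : Continuous fun y => W (y + z) - W y := by fun_prop
  have key : ∀ x ∈ K, ‖(moll n V (x + z) - moll n V x) - L x (moll n W (x + z) - moll n W x)‖ ^ 2 ≤
      moll n (fun y => ε ^ 2 * ‖W (y + z) - W y‖ ^ 2) x := by
    intro x hx
    have cL : Continuous fun y => L x (W (y + z) - W y) := (L x).continuous.comp cW
    rw [moll_shift n hV, moll_shift n hW, ← moll_clm n (L x) cW, moll_sub n cV cL]
    have h1 := norm_moll_le n (fun y => (V (y + z) - V y) - L x (W (y + z) - W y)) x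
    have h2 := moll_mono n (cV.sub cL).norm (cW.norm.const_mul ε) (hb x hx)
    have h3 := moll_sq_le n (cW.norm.const_mul ε) x
    refine (pow_le_pow_left₀ (norm_nonneg _) (h1.trans h2) 2).trans (h3.trans (le_of_eq ?_))
    simp only [mul_pow]
  calc _ ≤ ∫⁻ x in K, ofReal (moll n (fun y => ε ^ 2 * ‖W (y + z) - W y‖ ^ 2) x) :=
        setLIntegral_mono' hK fun x hx => ofReal_le_ofReal (key x hx)
    _ ≤ ∫⁻ x in cthickening r K, ofReal (ε ^ 2 * ‖W (x + z) - W x‖ ^ 2) :=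
        lintegral_moll_le n ((cW.norm.pow 2).const_mul (ε ^ 2))
          (fun x => mul_nonneg (sq_nonneg _) (sq_nonneg _)) hK hr
    _ = _ := by
        simp_rw [ofReal_mul (sq_nonneg ε)]
        rw [lintegral_const_mul' _ _ ofReal_ne_top]

theorem dv_moll_weak (n : ℕ) (h : WeakEq p Ω f g) {V : Eu d → Eu d} {g' : Eu d → ℝ}
    (hV : Continuous V) {x : Eu d} (hx : closedBall x (1 / ((n : ℝ) + 1)) ⊆ Ω)
    (hVf : ∀ y ∈ closedBall x (1 / ((n : ℝ) + 1)), V y = A p (∇f y))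
    (hg : ∀ y ∈ closedBall x (1 / ((n : ℝ) + 1)), g' y = g y) :
    dv (moll n V) x = - moll n g' x := by
  rw [dv_moll n hV x]
  congr 1
  set φ : Eu d → ℝ := fun y => rho d n (x - y) with hφ
  have hts : tsupport φ ⊆ closedBall x (1 / ((n : ℝ) + 1)) := by
    refine closure_minimal (fun y hy => ?_) isClosed_closedBall
    by_contra hc
    refine hy (rho_eq_zero ?_)
    rw [mem_closedBall, not_le, dist_comm, dist_eq_norm] at hc
    exact hc
  have hcs : HasCompactSupport φ :=
    (isCompact_closedBall x (1 / ((n : ℝ) + 1))).of_isClosed_subset (isClosed_tsupport _) hts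
  have hφc : ContDiff ℝ 1 φ := by
    have := (rho_contDiff (d := d) n).of_le (m := 1) (by norm_cast)
    exact this.comp (contDiff_const.sub contDiff_id)
  have hw := h.weak φ hφc hcs (hts.trans hx)
  have e1 : ∫ y, ⟪V y, ∇φ y⟫ = ∫ y, ⟪A p (∇f y), ∇φ y⟫ := by
    refine integral_congr_ae (.of_forall fun y => ?_)
    by_cases hy : y ∈ tsupport φ
    · simp only [hVf y (hts hy)]
    · simp only [gradient_of_notMem hy, inner_zero_right]
  rw [e1, hw, moll_apply, ← integral_sub_left_eq_self _ _ x]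
  refine integral_congr_ae (.of_forall fun y => ?_)
  by_cases hy : x - y ∈ tsupport φ
  · simp only [smul_eq_mul, hφ, sub_sub_cancel, hg _ (hts hy)]; ring
  · have h0 : φ (x - y) = 0 := eq_zero_of_notMem hy
    have h0' : rho d n y = 0 := by simpa [hφ] using h0
    simp [h0, h0']

theorem sq_neg_add_le {D σ Q m ε : ℝ} (hD : 0 ≤ D) (hQ : 0 ≤ Q) (h1 : σ ^ 2 ≤ D * Q)
    (h2 : m ^ 2 ≤ ε ^ 2) : (-σ + m) ^ 2 ≤ (D + 1) * (Q + ε ^ 2) := by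
  have h3 : 2 * σ * m ≥ -(Q + D * m ^ 2) := by
    refine (abs_le_of_sq_le_sq' (?_ : (2 * σ * m) ^ 2 ≤ _) (by positivity)).1
    nlinarith [mul_le_right h1 (sq_nonneg m), sq_nonneg (Q - D * m ^ 2)]
  nlinarith [mul_le_left h2 hD]

/-- Smooth approximation of a weak solution, with convergence of the equation in `L²` away from the
critical points. -/
theorem WeakEq.approx (hp : 1 < p) (h : WeakEq p Ω f g) (hg : LipGrad Ω f g)
    {K₀ : Set (Eu d)} (hK₀ : IsCompact K₀) (hK₀Ω : K₀ ⊆ Ω) :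
    ∃ F : ℕ → Eu d → ℝ, (∀ n, ContDiff ℝ ∞ (F n)) ∧ (∀ ε > 0, ∀ᶠ n in atTop, ∀ x ∈ K₀, |F n x - f x| ≤ ε ∧
        ‖∇(F n) x - ∇f x‖ ≤ ε) ∧
      ∀ K ⊆ K₀, IsCompact K → (∀ x ∈ K, ∇f x ≠ 0) →
        (∃ C, ∀ᶠ n in atTop, ∫⁻ x in K, ofReal (‖fderiv ℝ (∇(F n)) x‖ ^ 2) ≤ ofReal C) ∧
        ∀ ε > 0, ∀ᶠ n in atTop, ∫⁻ x in K, ofReal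
          ((dv (fun y => A p (∇(F n) y)) x + g x) ^ 2) ≤ ofReal ε := by
  obtain ⟨θ, hθ, hθc, hθΩ, -, δ, hδ, hθ1⟩ := exists_cutoff hK₀ h.isOpen hK₀Ω
  set f' : Eu d → ℝ := fun x => θ x * f x with hf'
  have hf'1 : ContDiff ℝ 1 f' := contDiff_mul_of_tsupport
    (hθ.of_le (by norm_cast)) fun x hx => h.contDiffAt (hθΩ hx)
  have hf'c : HasCompactSupport f' :=
    hθc.of_isClosed_subset (isClosed_tsupport _) tsupport_mul_subset
  have hK₁ : ∀ x ∈ thickening δ K₀, f' x = f x := fun x hx => by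
    rw [hf']; simp only [hθ1 x (thickening_subset_cthickening _ _ hx), one_mul]
  have hΩ₁ : thickening δ K₀ ⊆ Ω := fun x hx => hθΩ <| subset_closure <| by
    rw [Function.mem_support, hθ1 x (thickening_subset_cthickening _ _ hx)]; exact one_ne_zero
  have hgr : ∀ x ∈ thickening δ K₀, ∇f' x = ∇f x := fun x hx => by
    have : f' =ᶠ[𝓝 x] f := by
      filter_upwards [isOpen_thickening.mem_nhds hx] with y hy using hK₁ y hy
    exact this.gradient_eq
  set W := ∇f' with hW
  have cW : Continuous W := continuous_gradient hf'1
  have hWc : HasCompactSupport W := hf'c.of_isClosed_subset (isClosed_tsupport _)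
    (closure_minimal (fun x hx => by_contra fun hc => hx (gradient_of_notMem hc))
      (isClosed_tsupport _))
  have hin : K₀ ⊆ thickening δ K₀ := self_subset_thickening hδ _
  have hgF : ∀ n, ∇(moll n f') = moll n W := fun n => funext fun x =>
    moll_gradient n hf'1 hf'c x
  refine ⟨fun n => moll n f', fun n => moll_contDiff n hf'1.continuous.locallyIntegrable, ?_, ?_⟩
  · intro ε hε
    filter_upwards [moll_unif hf'1.continuous hf'c hε, moll_unif cW hWc hε] with n h1 h2 x hx
    refine ⟨?_, ?_⟩
    · rw [← hK₁ x (hin hx)]; simpa [Real.dist_eq] using h1 x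
    · rw [← hgr x (hin hx), hgF]; simpa [dist_eq_norm] using h2 x
  intro K hKK₀ hK hne
  have hOp : IsOpen {x ∈ thickening δ K₀ | W x ≠ 0} :=
    isOpen_thickening.inter (isOpen_ne_fun cW continuous_const)
  obtain ⟨δ₁, hδ₁, hsub₁⟩ := hK.exists_cthickening_subset_open hOp fun x hx =>
    ⟨hin (hKK₀ hx), by rw [hgr x (hin (hKK₀ hx))]; exact hne x hx⟩
  have hK1c : IsCompact (cthickening δ₁ K) := hK.cthickening
  obtain ⟨δ₂, hδ₂, hsub₂⟩ := hK1c.exists_cthickening_subset_open isOpen_thickening fun x hx => (hsub₁ hx).1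
  obtain ⟨t₀, ht₀, C, hC, hq⟩ := h.diff_quot_compact hp hg hK1c (fun x hx => hΩ₁ (hsub₁ hx).1) fun x hx => by
      rw [← hgr x (hsub₁ hx).1]; exact (hsub₁ hx).2
  have hqW : ∀ z : Eu d, ‖z‖ < min t₀ δ₂ → ∫⁻ x in cthickening δ₁ K, ofReal (‖W (x + z) - W x‖ ^ 2) ≤
        ofReal (C * ‖z‖ ^ 2) := by
    intro z hz
    refine le_trans (le_of_eq ?_) (hq z (hz.trans_le (min_le_left _ _)))
    refine setLIntegral_congr_fun hK1c.measurableSet fun x hx => ?_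
    have hxz : x + z ∈ thickening δ K₀ := hsub₂ (mem_cthickening_of_dist_le _ x _ _ hx (by
      rw [dist_eq_norm, add_sub_cancel_left]; exact (hz.trans_le (min_le_right _ _)).le))
    simp only [hgr _ hxz, hgr x (hsub₁ hx).1]
  have hr1 : ∀ r > 0, ∀ᶠ n : ℕ in atTop, 1 / ((n : ℝ) + 1) < r := fun r hr =>
    (tendsto_one_div_add_atTop_nhds_zero_nat (𝕜 := ℝ)).eventually (gt_mem_nhds hr)
  have hunit : ∀ (t : ℝ) (i : Fin d), 0 < t → ‖t • single i (1:ℝ)‖ = t := by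
    intro t i ht; rw [norm_smul]; simp [abs_of_pos ht]
  have hsm : ∀ n, ContDiff ℝ 1 (moll n W) := fun n =>
    (moll_contDiff n cW.locallyIntegrable).of_le (by norm_cast)
  constructor
  · refine ⟨d * C, ?_⟩
    filter_upwards [hr1 δ₁ hδ₁] with n hn
    rw [hgF]
    have h1 : ∀ i : Fin d, ∫⁻ x in K, ofReal (‖fderiv ℝ (moll n W) x (single i 1)‖ ^ 2) ≤ ofReal C := by
      intro i
      have := lintegral_fderiv_sq_le (hsm n) (hsm n) hK.measurableSet (L := fun _ => 0)
        continuousOn_const (e := single i 1) (C := C) (t₀ := min t₀ δ₂)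
        (lt_min ht₀ hδ₂) (fun t ht ht' => by
          have h2 := lintegral_moll_commutator n cW cW hK.measurableSet hn.le (fun _ => 0)
            (ε := 1) (t • single i 1) (fun x _ y _ => by simp)
          refine h2.trans ?_
          have h3 := hqW (t • single i 1) (by rw [hunit t i ht]; exact ht')
          rw [hunit t i ht] at h3
          simpa using h3)
      simpa using this
    calc _ ≤ ∫⁻ x in K, ∑ i, ofReal (‖fderiv ℝ (moll n W) x (single i 1)‖ ^ 2) := by
          refine lintegral_mono fun x => ?_
          rw [← ENNReal.ofReal_sum_of_nonneg (fun i _ => by positivity)]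
          exact ofReal_le_ofReal (opNorm_sq_le_sum _)
      _ = ∑ i, ∫⁻ x in K, ofReal (‖fderiv ℝ (moll n W) x (single i 1)‖ ^ 2) := by
          refine lintegral_finsetSum' _ fun i _ => ?_
          have : Continuous fun x => fderiv ℝ (moll n W) x (single i 1) :=
            ((hsm n).continuous_fderiv one_ne_zero).clm_apply continuous_const
          exact (this.norm.pow 2).measurable.ennreal_ofReal.aemeasurable
      _ ≤ ∑ i : Fin d, ofReal C := Finset.sum_le_sum fun i _ => h1 i
      _ = ofReal (d * C) := by
          rw [Finset.sum_const, Finset.card_univ, Fintype.card_fin, nsmul_eq_mul,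
            ofReal_mul (by positivity), ENNReal.ofReal_natCast]
  intro ε' hε'
  obtain ⟨ε, hε, hεε⟩ : ∃ ε > 0, ((d:ℝ) + 1) * (d * (ε ^ 2 * C) + ε ^ 2 * volume.real K) ≤ ε' := by
    have : Tendsto (fun ε : ℝ => ((d:ℝ) + 1) * (d * (ε ^ 2 * C) + ε ^ 2 * volume.real K)) (𝓝[>] 0)
        (𝓝 (((d:ℝ) + 1) * (d * ((0:ℝ) ^ 2 * C) + (0:ℝ) ^ 2 * volume.real K))) := by
      refine (Continuous.tendsto ?_ _).mono_left nhdsWithin_le_nhds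
      fun_prop
    have h2 := (tendsto_order.1 this).2 ε' (by simpa using hε')
    obtain ⟨ε, h3, h4⟩ := (h2.and self_mem_nhdsWithin).exists
    exact ⟨ε, h4, h3.le⟩
  have hS0 : (0 : Eu d) ∉ W '' K := by
    rintro ⟨x, hx, hx0⟩
    exact (hsub₁ (self_subset_cthickening _ hx)).2 hx0
  obtain ⟨r, hr, hAr⟩ := A_unif_strict (p := p) (hK.image cW) hS0 hε
  obtain ⟨r', hr', hball⟩ : ∃ r' > 0, ∀ x ∈ K, ∀ c ∈ ball (W x) r', c ≠ 0 := by
    obtain ⟨r', hr', hh⟩ := (hK.image cW).exists_thickening_subset_open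
      (isOpen_ne (x := (0 : Eu d))) (fun y hy h0 => hS0 (h0 ▸ hy))
    exact ⟨r', hr', fun x hx c hc => hh (mem_thickening_iff.2 ⟨W x, mem_image_of_mem _ hx, hc⟩)⟩
  obtain ⟨δ₃, hδ₃, huc⟩ := Metric.uniformContinuous_iff.1 (hWc.uniformContinuous_of_continuous cW) r hr
  set g' : Eu d → ℝ := fun x => g x * θ x with hg'
  have cg' : Continuous g' := continuous_mul_of_tsupport (φ := θ) hθ.continuous
    (fun x hx => eq_zero_of_notMem hx)
    fun x hx => h.cont.continuousAt (h.isOpen.mem_nhds (hθΩ hx))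
  have hg'c : HasCompactSupport g' := hθc.of_isClosed_subset (isClosed_tsupport _)
    (closure_mono (Function.support_mul_subset_right _ _))
  have hgg' : ∀ x ∈ thickening δ K₀, g' x = g x := fun x hx => by
    rw [hg']; simp only [hθ1 x (thickening_subset_cthickening _ _ hx), mul_one]
  set V : Eu d → Eu d := fun x => A p (W x) with hV
  have cV : Continuous V := (continuous_A hp).comp cW
  have hsmV : ∀ n, ContDiff ℝ 1 (moll n V) := fun n =>
    (moll_contDiff n cV.locallyIntegrable).of_le (by norm_cast)
  filter_upwards [hr1 δ₁ hδ₁, hr1 (δ₃ / 2) (by linarith), moll_unif cg' hg'c hε,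
    moll_unif cW hWc (ε := min r r' / 2) (by positivity)] with n hn₁ hn₃ hng hnW
  rw [hgF]
  have hcl : ∀ x ∈ K, closedBall x (1 / ((n : ℝ) + 1)) ⊆ cthickening δ₁ K := fun x hx y hy =>
    mem_cthickening_of_dist_le y x _ _ hx ((mem_closedBall.1 hy).trans hn₁.le)
  have hmin : 0 < min r r' := lt_min hr hr'
  have hWr : ∀ x, moll n W x ∈ ball (W x) r := fun x => by
    rw [mem_ball]; have := hnW x; have := min_le_left r r'; linarith
  have hW0 : ∀ x ∈ K, moll n W x ≠ 0 := fun x hx => hball x hx _ <| by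
    rw [mem_ball]; have := hnW x; have := min_le_right r r'; linarith
  set L : Eu d → Eu d →L[ℝ] Eu d := fun x => DA p (moll n W x) with hL
  have hLc : ContinuousOn L K := fun x hx =>
    ((continuousAt_DA (hW0 x hx)).comp (f := moll n W) (hsm n).continuous.continuousAt).continuousWithinAt
  have hcomm : ∀ i : Fin d, ∫⁻ x in K, ofReal (‖fderiv ℝ (moll n V) x (single i 1)
        - L x (fderiv ℝ (moll n W) x (single i 1))‖ ^ 2) ≤
      ofReal (ε ^ 2 * C) := by
    intro i
    refine lintegral_fderiv_sq_le (hsmV n) (hsm n) hK.measurableSet hLc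
      (t₀ := min (min t₀ δ₂) (δ₃ / 2)) (by positivity) fun t ht ht' => ?_
    have h2 := lintegral_moll_commutator n cV cW hK.measurableSet hn₁.le L
      (ε := ε) (t • single i 1) (fun x hx y hy => by
        refine hAr (W x) (mem_image_of_mem _ hx) _ (huc ?_) _ (huc ?_) _ (hWr x)
        · have h5 : dist (y + t • single i 1) y = t := by
            rw [dist_eq_norm, add_sub_cancel_left, hunit t i ht]
          have h6 := dist_triangle (y + t • single i (1:ℝ)) y x
          have h7 := mem_closedBall.1 hy
          have h8 := ht'.trans_le (min_le_right _ _)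
          linarith
        · have h7 := mem_closedBall.1 hy
          linarith)
    refine h2.trans ?_
    have h3 := hqW (t • single i 1) (by
      rw [hunit t i ht]; exact ht'.trans_le (min_le_left _ _))
    rw [hunit t i ht] at h3
    refine (mul_le_mul_right h3 _).trans ?_
    rw [← ofReal_mul (sq_nonneg _), mul_assoc]
  have hpt : ∀ x ∈ K, (dv (fun y => A p (moll n W y)) x + g x) ^ 2 ≤
      ((d:ℝ) + 1) * (∑ i, ‖fderiv ℝ (moll n V) x (single i 1)
        - L x (fderiv ℝ (moll n W) x (single i 1))‖ ^ 2 + ε ^ 2) := by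
    intro x hx
    have hch : fderiv ℝ (fun y => A p (moll n W y)) x = (L x).comp (fderiv ℝ (moll n W) x) :=
      ((hasFDerivAt_A (hW0 x hx)).comp x ((hsm n).differentiable one_ne_zero x).hasFDerivAt).fderiv
    have hdm : dv (moll n V) x = - moll n g' x := by
      refine dv_moll_weak n h cV ?_ ?_ ?_
      · exact fun y hy => hΩ₁ (hsub₁ (hcl x hx hy)).1
      · exact fun y hy => by rw [hV]; simp only [hgr y (hsub₁ (hcl x hx hy)).1]
      · exact fun y hy => hgg' y (hsub₁ (hcl x hx hy)).1
    set a : Fin d → Eu d := fun i => fderiv ℝ (moll n V) x (single i 1)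
        - L x (fderiv ℝ (moll n W) x (single i 1)) with ha
    have hxg : g' x = g x := hgg' x (hin (hKK₀ hx))
    have heq : dv (fun y => A p (moll n W y)) x + g x = -(∑ i, a i i) + (g' x - moll n g' x) := by
      have : ∑ i, a i i = dv (moll n V) x - dv (fun y => A p (moll n W y)) x := by
        simp only [dv, ha, hch, ← Finset.sum_sub_distrib]; rfl
      rw [this, hdm, hxg]; ring
    have hs1 : (∑ i, a i i) ^ 2 ≤ d * ∑ i, ‖a i‖ ^ 2 := by
      have h1 := sq_sum_le_card_mul_sum_sq (s := Finset.univ) (f := fun i => a i i)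
      rw [Finset.card_univ, Fintype.card_fin] at h1
      refine h1.trans (mul_le_left (Finset.sum_le_sum fun i _ => ?_) (by positivity))
      rw [sq_le_sq, abs_norm]
      exact PiLp.norm_apply_le (a i) i
    have hs2 : (g' x - moll n g' x) ^ 2 ≤ ε ^ 2 := by
      rw [sq_le_sq, abs_of_pos hε, abs_sub_comm]; simpa [Real.dist_eq] using hng x
    rw [heq]
    set σ := ∑ i, a i i
    set Q := ∑ i, ‖a i‖ ^ 2
    exact sq_neg_add_le (Nat.cast_nonneg d) (Finset.sum_nonneg fun i _ => by positivity) hs1 hs2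
  calc _ ≤ ∫⁻ x in K, ofReal ((d:ℝ) + 1) * ((∑ i, ofReal (‖fderiv ℝ (moll n V) x (single i 1)
        - L x (fderiv ℝ (moll n W) x (single i 1))‖ ^ 2)) +
        ofReal (ε ^ 2)) := by
        refine setLIntegral_mono' hK.measurableSet fun x hx => ?_
        rw [← ENNReal.ofReal_sum_of_nonneg (fun i _ => by positivity),
          ← ofReal_add (by positivity) (by positivity),
          ← ofReal_mul (by positivity)]
        exact ofReal_le_ofReal (hpt x hx)
    _ = ofReal ((d:ℝ) + 1) * ((∑ i, ∫⁻ x in K, ofReal (‖fderiv ℝ (moll n V) x (single i 1)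
        - L x (fderiv ℝ (moll n W) x (single i 1))‖ ^ 2)) +
        ofReal (ε ^ 2) * volume K) := by
        rw [lintegral_const_mul' _ _ ofReal_ne_top, lintegral_add_right _ (by fun_prop),
          setLIntegral_const, lintegral_finsetSum']
        intro i _
        refine (ContinuousOn.aemeasurable ?_ hK.measurableSet).ennreal_ofReal
        have c1 : Continuous fun x => fderiv ℝ (moll n W) x (single i 1) :=
          ((hsm n).continuous_fderiv one_ne_zero).clm_apply continuous_const
        have c2 : Continuous fun x => fderiv ℝ (moll n V) x (single i 1) :=
          ((hsmV n).continuous_fderiv one_ne_zero).clm_apply continuous_const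
        exact (c2.continuousOn.sub (hLc.clm_apply c1.continuousOn)).norm.pow 2
    _ ≤ ofReal ((d:ℝ) + 1) * ((∑ _i : Fin d, ofReal (ε ^ 2 * C)) +
        ofReal (ε ^ 2) * ofReal (volume.real K)) := by
        rw [ofReal_measureReal hK.measure_lt_top.ne]
        gcongr with i _
        exact hcomm i
    _ = ofReal (((d:ℝ) + 1) * (d * (ε ^ 2 * C) + ε ^ 2 * volume.real K)) := by
        rw [Finset.sum_const, Finset.card_univ, Fintype.card_fin, nsmul_eq_mul,
          ofReal_mul (p := (d:ℝ) + 1) (by positivity),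
          ofReal_add (p := (d:ℝ) * _) (by positivity) (by positivity),
          ofReal_mul (p := (d:ℝ)) (by positivity), ENNReal.ofReal_natCast,
          ofReal_mul (p := ε ^ 2) (q := volume.real K) (by positivity)]
    _ ≤ ofReal ε' := ofReal_le_ofReal hεε

end approx

section bochner
variable {d : ℕ}

/-- The trace of an endomorphism, as a continuous linear functional. -/
noncomputable def trC (d : ℕ) : (Eu d →L[ℝ] Eu d) →L[ℝ] ℝ :=
  ∑ i, (EuclideanSpace.proj i : Eu d →L[ℝ] ℝ).comp (ContinuousLinearMap.apply ℝ (Eu d) (single i 1))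

theorem trC_apply (L : Eu d →L[ℝ] Eu d) : trC d L = ∑ i, (L (single i 1)) i := by
  simp [trC]

theorem dv_eq_trC (X : Eu d → Eu d) (x : Eu d) : dv X x = trC d (fderiv ℝ X x) := by
  rw [trC_apply, dv]

theorem eq_sum_single (x : Eu d) : x = ∑ i, x i • single i (1:ℝ) := by
  ext j; simp [Finset.sum_apply, Pi.single_apply]

theorem trC_smulRight (c : Eu d →L[ℝ] ℝ) (z : Eu d) : trC d (c.smulRight z) = c z := by
  rw [trC_apply]
  conv_rhs => rw [eq_sum_single z, map_sum]
  refine Finset.sum_congr rfl fun i _ => ?_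
  simp [mul_comm]

/-- Integrated Bochner identity for a vector field `Z`, with a multiplier `k` and an additional
field `Y`. -/
theorem bochner {Z Y : Eu d → Eu d} {φ k : Eu d → ℝ} (hφ : ContDiff ℝ 1 φ)
    (hc : HasCompactSupport φ) (hZ : ∀ x ∈ tsupport φ, ContDiffAt ℝ 2 Z x)
    (hk : ∀ x ∈ tsupport φ, ContDiffAt ℝ 1 k x) (hY : ∀ x ∈ tsupport φ, ContDiffAt ℝ 1 Y x) :
    (∫ x, ⟪fderiv ℝ Z x (Z x) - (dv Z x + k x) • Z x + Y x, ∇φ x⟫) =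
      - ∫ x, (trC d ((fderiv ℝ Z x).comp (fderiv ℝ Z x)) - dv Z x ^ 2 - k x * dv Z x
        - ⟪Z x, ∇k x⟫ + dv Y x) * φ x := by
  have hfd : ∀ x ∈ tsupport φ, ContDiffAt ℝ 1 (fderiv ℝ Z) x := fun x hx =>
    (hZ x hx).fderiv_right (m := 1) (by norm_num)
  have hdv : dv Z = fun x => trC d (fderiv ℝ Z x) := funext fun x => dv_eq_trC Z x
  rw [integral_inner_gradient hφ hc]
  · congr 1
    refine integral_congr_ae (.of_forall fun x => ?_)
    by_cases hx : x ∈ tsupport φ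
    swap
    · simp only [eq_zero_of_notMem hx, mul_zero]
    simp only
    congr 1
    have h1 : HasFDerivAt (fderiv ℝ Z) (fderiv ℝ (fderiv ℝ Z) x) x :=
      ((hfd x hx).differentiableAt one_ne_zero).hasFDerivAt
    have h2 : HasFDerivAt Z (fderiv ℝ Z x) x :=
      ((hZ x hx).differentiableAt two_ne_zero).hasFDerivAt
    have h3 : HasFDerivAt k (fderiv ℝ k x) x :=
      ((hk x hx).differentiableAt one_ne_zero).hasFDerivAt
    have h4 : HasFDerivAt Y (fderiv ℝ Y x) x :=
      ((hY x hx).differentiableAt one_ne_zero).hasFDerivAt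
    have hsym : ∀ y z, fderiv ℝ (fderiv ℝ Z) x y z = fderiv ℝ (fderiv ℝ Z) x z y :=
      fun y z => (hZ x hx).isSymmSndFDerivAt (by simp) y z
    have h5 := (((h1.clm_apply h2).sub ((((trC d).hasFDerivAt.comp x h1).add h3).smul h2)).add h4).fderiv
    rw [dv_eq_trC, hdv]
    have e0 : fderiv ℝ (fun x => fderiv ℝ Z x (Z x) - ((fun x => trC d (fderiv ℝ Z x)) x + k x) • Z x
        + Y x) x = _ := h5
    rw [e0, map_add, map_sub, map_add, map_add, map_smul, trC_smulRight]
    have e1 : trC d ((fderiv ℝ (fderiv ℝ Z) x).flip (Z x)) = trC d (fderiv ℝ (fderiv ℝ Z) x (Z x)) := by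
      congr 1; ext1 y; exact hsym y (Z x)
    have e2 : ⟪Z x, ∇k x⟫ = fderiv ℝ k x (Z x) := by
      rw [real_inner_comm]; simp [gradient]
    rw [e1, e2, dv_eq_trC]
    simp only [ContinuousLinearMap.add_apply, ContinuousLinearMap.comp_apply, smul_eq_mul,
      Function.comp_apply, Pi.add_apply]
    ring
  · intro x hx
    refine ((((hfd x hx).clm_apply ((hZ x hx).of_le (by norm_num)))).sub
      (ContDiffAt.smul (ContDiffAt.add ?_ (hk x hx)) ((hZ x hx).of_le (by norm_num)))).add (hY x hx)
    rw [hdv]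
    exact (trC d).contDiff.contDiffAt.comp x (hfd x hx)

theorem trC_eq_sum_inner (L : Eu d →L[ℝ] Eu d) (b : OrthonormalBasis (Fin d) ℝ (Eu d)) :
    trC d L = ∑ i, ⟪b i, L (b i)⟫ := by
  have h1 := LinearMap.trace_eq_sum_inner (L : Eu d →ₗ[ℝ] Eu d) b
  have h2 := LinearMap.trace_eq_sum_inner (L : Eu d →ₗ[ℝ] Eu d) (EuclideanSpace.basisFun (Fin d) ℝ)
  rw [trC_apply]
  rw [h2] at h1
  refine Eq.trans (Finset.sum_congr rfl fun i _ => ?_) h1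
  rw [EuclideanSpace.basisFun_apply, EuclideanSpace.inner_single_left]
  simp

theorem sum_eq_add_sum_erase (i₀ : Fin d) (f : Fin d → ℝ) :
    ∑ i, f i = f i₀ + ∑ i ∈ Finset.univ.erase i₀, f i :=
  (Finset.add_sum_erase _ _ (Finset.mem_univ i₀)).symm

theorem matrix_trace_sq_ge {P : ℝ} (hd : 2 ≤ d) (i₀ : Fin d) {s : Fin d → Fin d → ℝ}
    (hs : ∀ i j, s i j = s j i) {c : Fin d → ℝ} (h0 : c i₀ = P) (h1 : ∀ i, i ≠ i₀ → c i = 1) :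
    (P * s i₀ i₀) ^ 2 + 2 * P * (∑ j, s j i₀ ^ 2 - s i₀ i₀ ^ 2) +
      (∑ i, c i * s i i - P * s i₀ i₀) ^ 2 / (d - 1) ≤ ∑ i, ∑ j, c i * c j * s i j ^ 2 := by
  have hd1 : (0:ℝ) < (d:ℝ) - 1 := by
    have : (2:ℝ) ≤ d := by exact_mod_cast hd
    linarith
  have e1 : ∑ i, c i * s i i - P * s i₀ i₀ = ∑ i ∈ Finset.univ.erase i₀, s i i := by
    rw [sum_eq_add_sum_erase i₀, h0, add_sub_cancel_left]
    exact Finset.sum_congr rfl fun i hi => by rw [h1 i (Finset.ne_of_mem_erase hi), one_mul]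
  have e2 : ∑ j, s j i₀ ^ 2 - s i₀ i₀ ^ 2 = ∑ i ∈ Finset.univ.erase i₀, s i i₀ ^ 2 := by
    rw [sum_eq_add_sum_erase i₀, add_sub_cancel_left]
  have e3 : ∑ i, ∑ j, c i * c j * s i j ^ 2 = (P * s i₀ i₀) ^ 2 +
      2 * P * (∑ i ∈ Finset.univ.erase i₀, s i i₀ ^ 2) +
      ∑ i ∈ Finset.univ.erase i₀, ∑ j ∈ Finset.univ.erase i₀, s i j ^ 2 := by
    rw [sum_eq_add_sum_erase i₀, sum_eq_add_sum_erase i₀, h0]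
    have e4 : ∑ j ∈ Finset.univ.erase i₀, P * c j * s i₀ j ^ 2 =
        P * ∑ i ∈ Finset.univ.erase i₀, s i i₀ ^ 2 := by
      rw [Finset.mul_sum]
      exact Finset.sum_congr rfl fun i hi => by
        rw [h1 i (Finset.ne_of_mem_erase hi), hs i₀ i]; ring
    have e5 : ∑ i ∈ Finset.univ.erase i₀, ∑ j, c i * c j * s i j ^ 2 =
        P * ∑ i ∈ Finset.univ.erase i₀, s i i₀ ^ 2 +
        ∑ i ∈ Finset.univ.erase i₀, ∑ j ∈ Finset.univ.erase i₀, s i j ^ 2 := by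
      rw [Finset.mul_sum, ← Finset.sum_add_distrib]
      refine Finset.sum_congr rfl fun i hi => ?_
      rw [sum_eq_add_sum_erase i₀, h0, h1 i (Finset.ne_of_mem_erase hi), one_mul]
      congr 1
      exact Finset.sum_congr rfl fun j hj => by
        rw [h1 j (Finset.ne_of_mem_erase hj)]; ring
    rw [e4, e5]; ring
  rw [e1, e2, e3]
  refine add_le_add le_rfl ?_
  rw [div_le_iff₀ hd1]
  have h4 := sq_sum_le_card_mul_sum_sq (s := Finset.univ.erase i₀) (f := fun i => s i i)
  have h5 : ((Finset.univ.erase i₀).card : ℝ) = (d:ℝ) - 1 := by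
    rw [Finset.card_erase_of_mem (Finset.mem_univ _), Finset.card_univ, Fintype.card_fin,
      Nat.cast_sub (by omega)]; simp
  rw [h5] at h4
  refine h4.trans ?_
  rw [mul_comm]
  refine mul_le_right (Finset.sum_le_sum fun i hi => ?_) hd1.le
  exact Finset.single_le_sum (f := fun j => s i j ^ 2) (fun j _ => sq_nonneg _) hi

/-- Lower bounds for the trace of the square of the linearization of `A ∘ ∇F`. -/
theorem trC_sq_ge {p : ℝ} (hp : 1 < p) (hd : 2 ≤ d) {v : Eu d} (hv : v ≠ 0)
    {H L : Eu d →L[ℝ] Eu d} (hH : ∀ x y, ⟪H x, y⟫ = ⟪x, H y⟫) (hL : L = (DA p v).comp H)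
    {a σ : ℝ} (ha : a = (p - 1) * ‖v‖ ^ (p - 2) * ⟪H v, v⟫ / ‖v‖ ^ 2)
    (hσ : σ = (‖v‖ ^ (p - 2)) ^ 2 * (‖H v‖ ^ 2 / ‖v‖ ^ 2 - (⟪H v, v⟫ / ‖v‖ ^ 2) ^ 2)) :
    a ^ 2 + 2 * (p - 1) * σ + (trC d L - a) ^ 2 / (d - 1) ≤ trC d (L.comp L) ∧
      min 1 ((p - 1) ^ 2) * (‖v‖ ^ (p - 2) * ‖H‖) ^ 2 ≤ trC d (L.comp L) ∧
      trC d L ^ 2 ≤ d * (max 1 (p - 1)) ^ 2 * (d * (‖v‖ ^ (p - 2) * ‖H‖) ^ 2) := by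
  have hd0 : 0 < d := by omega
  have hP : 0 < p - 1 := by linarith
  set i₀ : Fin d := ⟨0, hd0⟩
  have hvn : ‖v‖ ≠ 0 := norm_ne_zero_iff.2 hv
  obtain ⟨b, hb⟩ : ∃ b : OrthonormalBasis (Fin d) ℝ (Eu d), b i₀ = ‖v‖⁻¹ • v := by
    have ho : Orthonormal ℝ (({i₀} : Set (Fin d)).restrict fun _ => ‖v‖⁻¹ • v) := by
      refine ⟨fun i => ?_, fun i j hij => ?_⟩
      · change ‖‖v‖⁻¹ • v‖ = 1
        rw [norm_smul, norm_inv, norm_norm, inv_mul_cancel₀ hvn]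
      · exact absurd (Subtype.ext (i.2.trans j.2.symm)) hij
    obtain ⟨b, hb⟩ := ho.exists_orthonormalBasis_extension_of_card_eq (by simp)
    exact ⟨b, hb i₀ rfl⟩
  set m := ‖v‖ ^ (p - 2) with hm
  set n := b i₀ with hn
  have hvn' : v = ‖v‖ • n := by rw [hb, smul_smul, mul_inv_cancel₀ hvn, one_smul]
  set s : Fin d → Fin d → ℝ := fun i j => m * ⟪b i, H (b j)⟫ with hs
  have hsym : ∀ i j, s i j = s j i := fun i j => by
    simp only [hs]; rw [← hH, real_inner_comm]
  have hLy : ∀ y, L y = m • (H y + ((p - 2) * ⟪n, H y⟫) • n) := by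
    intro y
    rw [hL, ContinuousLinearMap.comp_apply, DA_apply, ← hm]
    congr 2
    have : ⟪v, H y⟫ = ‖v‖ * ⟪n, H y⟫ := by
      conv_lhs => rw [hvn', real_inner_smul_left]
    rw [this]
    conv_lhs => rw [hvn', smul_smul]
    rw [← hvn']
    congr 1
    field_simp
  set c : Fin d → ℝ := fun i => if i = i₀ then p - 1 else 1 with hc
  have hLij : ∀ i j, ⟪b i, L (b j)⟫ = c i * s i j := by
    intro i j
    rw [hLy, real_inner_smul_right, inner_add_right, real_inner_smul_right]
    by_cases h : i = i₀
    · rw [h, ← hn, real_inner_self_eq_norm_sq, b.orthonormal.1 i₀]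
      simp only [hc, hs, ← hn, if_true]; ring
    · have : ⟪b i, n⟫ = 0 := b.orthonormal.2 h
      rw [this]; simp [hc, hs, h]
  have htr : trC d L = ∑ i, c i * s i i := by
    rw [trC_eq_sum_inner L b]; exact Finset.sum_congr rfl fun i _ => hLij i i
  have htr2 : trC d (L.comp L) = ∑ i, ∑ j, c i * c j * s i j ^ 2 := by
    rw [trC_eq_sum_inner _ b]
    refine Finset.sum_congr rfl fun i _ => ?_
    rw [ContinuousLinearMap.comp_apply]
    conv_lhs => rw [← b.sum_repr' (L (b i)), map_sum, inner_sum]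
    refine Finset.sum_congr rfl fun j _ => ?_
    rw [map_smul, real_inner_smul_right, hLij, hLij, hsym j i]; ring
  have hnm : ⟪H v, v⟫ / ‖v‖ ^ 2 = ⟪n, H n⟫ := by
    conv_lhs => rw [hvn', map_smul, real_inner_smul_left, real_inner_smul_right]
    rw [real_inner_comm, ← hvn']
    field_simp
  have hnH : ‖H v‖ ^ 2 / ‖v‖ ^ 2 = ∑ j, ⟪b j, H n⟫ ^ 2 := by
    have h1 : ‖H v‖ ^ 2 = ‖v‖ ^ 2 * ‖H n‖ ^ 2 := by
      conv_lhs => rw [hvn', map_smul, norm_smul, norm_norm, mul_pow]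
    rw [h1, mul_div_cancel_left₀ _ (pow_ne_zero 2 hvn), ← b.sum_sq_norm_inner_right (H n)]
    simp
  have hHS : (m * ‖H‖) ^ 2 ≤ ∑ i, ∑ j, s i j ^ 2 := by
    have h1 : ∑ i, ‖H (single i 1)‖ ^ 2 = trC d (H.comp H) := by
      rw [trC_apply]
      refine Finset.sum_congr rfl fun i _ => ?_
      have := EuclideanSpace.inner_single_left i (1:ℝ) (H (H (single i 1)))
      rw [← hH, real_inner_self_eq_norm_sq] at this
      simpa using this
    have h2 : trC d (H.comp H) = ∑ i, ∑ j, ⟪b i, H (b j)⟫ ^ 2 := by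
      rw [trC_eq_sum_inner _ b]
      refine Finset.sum_congr rfl fun i _ => ?_
      rw [ContinuousLinearMap.comp_apply, ← hH, real_inner_self_eq_norm_sq,
        ← b.sum_sq_norm_inner_right (H (b i))]
      refine Finset.sum_congr rfl fun j _ => ?_
      rw [← hH, real_inner_comm, norm_eq_abs, sq_abs]
    rw [mul_pow]
    have h3 := (opNorm_sq_le_sum H).trans (h1.trans h2).le
    refine (mul_le_left h3 (sq_nonneg m)).trans (le_of_eq ?_)
    simp only [hs, mul_pow, Finset.mul_sum]
  refine ⟨?_, ?_, ?_⟩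
  · have h1 := matrix_trace_sq_ge (P := p - 1) hd i₀ hsym (c := c) (by simp [hc])
      (fun i hi => by simp [hc, hi])
    rw [htr, htr2]
    have ea : a = (p - 1) * s i₀ i₀ := by
      rw [ha, mul_div_assoc, hnm]; simp only [hs, ← hn]; ring
    have eσ : σ = ∑ j, s j i₀ ^ 2 - s i₀ i₀ ^ 2 := by
      rw [hσ, hnH, hnm]
      simp only [hs, mul_pow, ← Finset.mul_sum, ← hn]
      ring
    rw [ea, eσ]
    exact h1
  · rw [htr2]
    refine (mul_le_left hHS (by positivity)).trans ?_
    simp only [Finset.mul_sum]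
    refine Finset.sum_le_sum fun i _ => Finset.sum_le_sum fun j _ => ?_
    refine mul_le_right ?_ (sq_nonneg _)
    have hP2 : min 1 ((p - 1) ^ 2) ≤ p - 1 := by
      rcases le_total 1 (p - 1) with h | h
      · exact (min_le_left _ _).trans h
      · exact (min_le_right _ _).trans (by nlinarith)
    simp only [hc]
    split_ifs
    · exact (min_le_right _ _).trans (by rw [sq])
    · rw [mul_one]; exact hP2
    · rw [one_mul]; exact hP2
    · rw [mul_one]; exact min_le_left _ _
  · rw [htr]
    have h1 := sq_sum_le_card_mul_sum_sq (s := Finset.univ) (f := fun i => c i * s i i)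
    rw [Finset.card_univ, Fintype.card_fin] at h1
    refine h1.trans ?_
    rw [mul_assoc]
    refine mul_le_left ?_ (by positivity)
    have h2 : ∀ i ∈ Finset.univ, (c i * s i i) ^ 2 ≤ max 1 (p - 1) ^ 2 * (m * ‖H‖) ^ 2 := by
      intro i _
      rw [mul_pow]
      have hm0 : 0 ≤ m := by positivity
      refine mul_le_mul ?_ ?_ (sq_nonneg _) (by positivity)
      · refine pow_le_pow_left₀ ?_ ?_ 2
        · simp only [hc]; split_ifs <;> linarith
        · simp only [hc]; split_ifs
          · exact le_max_right _ _
          · exact le_max_left _ _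
      · rw [sq_le_sq, abs_of_nonneg (a := m * ‖H‖) (by positivity)]
        simp only [hs]
        rw [abs_mul, abs_of_nonneg hm0]
        refine mul_le_left ?_ hm0
        refine (abs_real_inner_le_norm _ _).trans ?_
        rw [b.orthonormal.1 i, one_mul]
        refine (H.le_opNorm _).trans ?_
        rw [b.orthonormal.1 i, mul_one]
    refine (Finset.sum_le_sum h2).trans (le_of_eq ?_)
    rw [Finset.sum_const, Finset.card_univ, Fintype.card_fin, nsmul_eq_mul]
    ring

end bochner

section limit
variable {d : ℕ} {p s : ℝ} {Ω : Set (Eu d)} {f : Eu d → ℝ}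

/-- The right-hand side of the equation satisfied by the logarithm of a solution of
`-Δ_p u = u ^ q`, where `s = q + 1 - p`. -/
noncomputable def rhs (p s : ℝ) (f : Eu d → ℝ) (x : Eu d) : ℝ :=
  (p - 1) * ‖∇f x‖ ^ p + exp (s * f x)

theorem lipGrad_rhs (hp : 1 < p) (hΩ : IsOpen Ω) (hf : ContDiffOn ℝ 1 f Ω) :
    LipGrad Ω f (rhs p s f) := by
  intro x₁ hx₁
  have hfa : ContDiffAt ℝ 1 f x₁ := (hf x₁ hx₁).contDiffAt (hΩ.mem_nhds hx₁)
  obtain ⟨C₁, U, hU, hL₁⟩ := ((contDiff_norm_rpow (E := Eu d) hp).contDiffAt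
    (x := ∇f x₁)).exists_lipschitzOnWith
  obtain ⟨C₂, V, hV, hL₂⟩ := (((contDiff_const (c := s)).contDiffAt.mul hfa).exp
    (n := 1)).exists_lipschitzOnWith
  have hgU : ∇f ⁻¹' U ∈ 𝓝 x₁ := (continuousAt_gradient hfa) hU
  obtain ⟨r, hr, hrs⟩ := Metric.mem_nhds_iff.1 (inter_mem hgU hV)
  refine ⟨|p - 1| * C₁ + C₂, r, hr, fun x hx y hy => ?_⟩
  have h1 := hL₁.dist_le_mul _ (hrs hx).1 _ (hrs hy).1
  have h2 := hL₂.dist_le_mul _ (hrs hx).2 _ (hrs hy).2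
  rw [Real.dist_eq, dist_eq_norm] at h1 h2
  have e : rhs p s f x - rhs p s f y = (p - 1) * (‖∇f x‖ ^ p - ‖∇f y‖ ^ p) +
      (exp (s * f x) - exp (s * f y)) := by rw [rhs, rhs]; ring
  rw [e]
  refine (abs_add_le _ _).trans ?_
  rw [abs_mul]
  have h3 := mul_le_left h1 (abs_nonneg (p - 1))
  have h4 : 0 ≤ |p - 1| * C₁ * ‖x - y‖ := by positivity
  have h5 : 0 ≤ C₂ * ‖∇f x - ∇f y‖ := by positivity
  nlinarith

/-- Uniform continuity of `Γ` along the compact set `{(f x, ∇f x) : x ∈ K}`. -/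
theorem unif_comp {K : Set (Eu d)} (hK : IsCompact K) {f₁ : Eu d → ℝ} {f₂ : Eu d → Eu d}
    (h₁ : ContinuousOn f₁ K) (h₂ : ContinuousOn f₂ K) {Γ : ℝ × Eu d → ℝ} (hΓ : Continuous Γ)
    {ε : ℝ} (hε : 0 < ε) : ∃ δ > 0, ∀ x ∈ K, ∀ t v, |t - f₁ x| ≤ δ → ‖v - f₂ x‖ ≤ δ →
      |Γ (t, v) - Γ (f₁ x, f₂ x)| ≤ ε := by
  have hS : IsCompact ((fun x => (f₁ x, f₂ x)) '' K) := hK.image_of_continuousOn (h₁.prodMk h₂)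
  have h := hS.uniformContinuousAt_of_continuousAt Γ (fun a _ => hΓ.continuousAt)
    (Metric.dist_mem_uniformity hε)
  obtain ⟨δ, hδ, h⟩ := Metric.mem_uniformity_dist.1 h
  refine ⟨δ / 2, by linarith, fun x hx t v ht hv => ?_⟩
  have h3 : dist (f₁ x, f₂ x) (t, v) < δ := by
    rw [Prod.dist_eq, max_lt_iff]
    constructor
    · rw [dist_comm, Real.dist_eq]; linarith
    · rw [dist_comm, dist_eq_norm]; linarith
  have h4 := h h3 (mem_image_of_mem _ hx)
  have h5 : dist (Γ (f₁ x, f₂ x)) (Γ (t, v)) < ε := h4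
  rw [dist_comm, Real.dist_eq] at h5
  exact h5.le

theorem ofReal_integral_le_lintegral {q : Eu d → ℝ} (hq : Integrable q) :
    ofReal (∫ x, q x) ≤ ∫⁻ x, ofReal (q x) := by
  rw [integral_eq_lintegral_pos_part_sub_lintegral_neg_part hq]
  refine (ofReal_le_ofReal (sub_le_self _ ENNReal.toReal_nonneg)).trans ?_
  exact ENNReal.ofReal_toReal_le

/-- The residual of the equation for a smooth function. -/
noncomputable def resid (p s : ℝ) (F : Eu d → ℝ) (x : Eu d) : ℝ :=
  dv (fun y => A p (∇F y)) x + rhs p s F x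

theorem abs_add_mul_le {lam η b : ℝ} (hl : 0 < lam) (hb : |b| ≤ η) (a H : ℝ) :
    |a + b| * (1 + H) ≤ lam⁻¹ * a ^ 2 + (lam⁻¹ * η ^ 2 + lam) + lam * H ^ 2 := by
  have h1 : b ^ 2 ≤ η ^ 2 := sq_le_sq' (by linarith [neg_abs_le b]) ((le_abs_self b).trans hb)
  have h2 : |a + b| * (1 + H) ≤ lam⁻¹ * (a + b) ^ 2 / 2 + lam * (1 + H) ^ 2 / 2 := by
    have : 0 ≤ lam⁻¹ * (|a + b| - lam * (1 + H)) ^ 2 := by positivity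
    have e : lam⁻¹ * (|a + b| - lam * (1 + H)) ^ 2 =
        lam⁻¹ * |a + b| ^ 2 - 2 * (|a + b| * (1 + H)) + lam * (1 + H) ^ 2 := by
      field_simp; ring
    rw [e, sq_abs] at this
    linarith
  have h3 : (a + b) ^ 2 ≤ 2 * a ^ 2 + 2 * η ^ 2 := by nlinarith [sq_nonneg (a - b)]
  have h4 := mul_le_left h3 (inv_pos.2 hl).le
  nlinarith [mul_nonneg hl.le (sq_nonneg (1 - H))]

/-- An integral inequality valid for smooth functions up to a multiple of the residual holds for weak
solutions. -/
theorem WeakEq.integral_nonpos_of_approx (hp : 1 < p) (h : WeakEq p Ω f (rhs p s f))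
    {K₀ : Set (Eu d)} (hK₀ : IsCompact K₀) (hK₀Ω : K₀ ⊆ Ω) {c₀ δ₀ C : ℝ} (hc₀ : 0 < c₀)
    (hδ₀ : 0 < δ₀) {R : Jet d → ℝ} (hR : Continuous R)
    (hRs : ∀ x t v, x ∉ K₀ → R (x, t, v) = 0)
    (hI : ∀ F : Eu d → ℝ, ContDiff ℝ ∞ F → (∀ x ∈ K₀, |F x - f x| ≤ δ₀ ∧ ‖∇F x - ∇f x‖ ≤ δ₀) →
      ofReal (∫ x, R (x, F x, ∇F x)) ≤ ofReal C * ∫⁻ x in {x ∈ K₀ | c₀ ≤ ‖∇F x‖}, ofReal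
          (|resid p s F x| * (1 + ‖fderiv ℝ (∇F) x‖))) :
    ∫ x, R (x, f x, ∇f x) ≤ 0 := by
  obtain ⟨F, hF, hFu, hFK⟩ := h.approx hp (lipGrad_rhs hp h.isOpen h.c1) hK₀ hK₀Ω
  have cf : ContinuousOn f K₀ := h.c1.continuousOn.mono hK₀Ω
  have cg : ContinuousOn (∇f) K₀ := h.continuousOn_gradient.mono hK₀Ω
  set K : Set (Eu d) := {x ∈ K₀ | c₀ / 2 ≤ ‖∇f x‖} with hK
  have hKc : IsCompact K := by
    refine hK₀.of_isClosed_subset ?_ (sep_subset _ _)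
    have := cg.norm.preimage_isClosed_of_isClosed hK₀.isClosed (isClosed_Ici (a := c₀ / 2))
    exact this
  obtain ⟨⟨CH, hCH⟩, hres⟩ := hFK K (sep_subset _ _) hKc fun x hx h0 => by
    have := hx.2; rw [h0, norm_zero] at this; linarith
  have hFg : ∀ n, Continuous (∇(F n)) := fun n =>
    continuous_gradient ((hF n).of_le (by norm_cast))
  have hlim : Tendsto (fun n => ∫ x, R (x, F n x, ∇(F n) x)) atTop (𝓝 (∫ x, R (x, f x, ∇f x))) := by
    set S : Set (Jet d) := cthickening 1 ((fun x => (x, f x, ∇f x)) '' K₀)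
    have hS : IsCompact S :=
      (hK₀.image_of_continuousOn (continuousOn_id.prodMk (cf.prodMk cg))).cthickening
    obtain ⟨M, hM⟩ := hS.exists_bound_of_continuousOn hR.continuousOn
    have hbd : Integrable (K₀.indicator fun _ => M) :=
      (integrable_indicator_iff hK₀.measurableSet).2 (integrableOn_const (hs := hK₀.measure_lt_top.ne))
    refine tendsto_integral_filter_of_dominated_convergence _ ?_ ?_ hbd ?_
    · refine .of_forall fun n => Continuous.aestronglyMeasurable ?_
      exact hR.comp (continuous_id.prodMk ((hF n).continuous.prodMk (hFg n)))
    · filter_upwards [hFu 1 one_pos] with n hn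
      refine .of_forall fun x => ?_
      by_cases hx : x ∈ K₀
      · rw [indicator_of_mem hx]
        refine hM _ (mem_cthickening_of_dist_le _ _ _ _ (mem_image_of_mem _ hx) ?_)
        rw [Prod.dist_eq, Prod.dist_eq, dist_self, Real.dist_eq, dist_eq_norm]
        exact max_le zero_le_one (max_le (hn x hx).1 (hn x hx).2)
      · rw [indicator_of_notMem hx, hRs _ _ _ hx, norm_zero]
    · refine .of_forall fun x => ?_
      by_cases hx : x ∈ K₀
      · refine (hR.tendsto _).comp (tendsto_const_nhds.prodMk_nhds (Tendsto.prodMk_nhds ?_ ?_))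
        · refine Metric.tendsto_nhds.2 fun ε hε => ?_
          filter_upwards [hFu (ε / 2) (by linarith)] with n hn
          rw [Real.dist_eq]; linarith [(hn x hx).1]
        · refine Metric.tendsto_nhds.2 fun ε hε => ?_
          filter_upwards [hFu (ε / 2) (by linarith)] with n hn
          rw [dist_eq_norm]; linarith [(hn x hx).2]
      · simp only [hRs _ _ _ hx]; exact tendsto_const_nhds
  have herr : Tendsto (fun n => ∫⁻ x in {x ∈ K₀ | c₀ ≤ ‖∇(F n) x‖}, ofReal
          (|resid p s (F n) x| * (1 + ‖fderiv ℝ (∇(F n)) x‖))) atTop (𝓝 0) := by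
    refine ENNReal.tendsto_nhds_zero.2 fun ε₀ hε₀ => ?_
    obtain ⟨ε, hε, hεε⟩ := ENNReal.lt_iff_exists_nnreal_btwn.1 hε₀
    have hε' : (0:ℝ) < ε := by exact_mod_cast hε
    have hεε' : ofReal ε ≤ ε₀ := by rw [ENNReal.ofReal_coe_nnreal]; exact hεε.le
    set V := volume.real K
    have hV : 0 ≤ V := measureReal_nonneg
    set CH' := max CH 0
    have hCH' : 0 ≤ CH' := le_max_right _ _
    set lam : ℝ := ε / (3 * (V + CH' + 1)) with hlam
    have hlam0 : 0 < lam := by positivity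
    set η : ℝ := Real.sqrt (lam * ε / (3 * (V + 1))) with hη
    have hη0 : 0 < η := Real.sqrt_pos.2 (by positivity)
    have hη2 : η ^ 2 = lam * ε / (3 * (V + 1)) := Real.sq_sqrt (by positivity)
    obtain ⟨δ, hδ, hΓ⟩ := unif_comp hK₀ cf cg (Γ := fun z => (p - 1) * ‖z.2‖ ^ p + Real.exp (s * z.1)) (by
        refine Continuous.add (continuous_const.mul ?_) (by fun_prop)
        exact (continuous_snd.norm).rpow_const fun _ => Or.inr (by linarith)) hη0
    filter_upwards [hFu δ hδ, hFu (c₀ / 2) (by linarith), hCH,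
      hres (lam * ε / 3) (by positivity)] with n hn1 hn2 hn3 hn4
    have hsub : {x ∈ K₀ | c₀ ≤ ‖∇(F n) x‖} ⊆ K := by
      rintro x ⟨hx, hx'⟩
      refine ⟨hx, ?_⟩
      have h5 := norm_sub_norm_le (∇(F n) x) (∇f x)
      linarith [(hn2 x hx).2]
    refine (lintegral_mono_set hsub).trans (le_trans ?_ hεε')
    have hm1 : Measurable fun x => ofReal (lam * ‖fderiv ℝ (∇(F n)) x‖ ^ 2) := by
      have hc : ContDiff ℝ 1 (∇(F n)) := contDiff_iff_contDiffAt.2 fun x =>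
        contDiffAt_gradient (n := 1) ((hF n).contDiffAt.of_le (by norm_cast))
      exact (((hc.continuous_fderiv one_ne_zero).norm.pow 2).const_mul lam).measurable.ennreal_ofReal
    calc _ ≤ ∫⁻ x in K, (ofReal lam⁻¹ * ofReal ((dv (fun y => A p (∇(F n) y)) x + rhs p s f x) ^ 2) +
            ofReal (lam⁻¹ * η ^ 2 + lam)) +
            ofReal (lam * ‖fderiv ℝ (∇(F n)) x‖ ^ 2) := by
          refine setLIntegral_mono' hKc.measurableSet fun x hx => ?_
          rw [← ofReal_mul (by positivity), ← ofReal_add (by positivity) (by positivity),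
            ← ofReal_add (by positivity) (by positivity)]
          refine ofReal_le_ofReal ?_
          have h6 : |rhs p s (F n) x - rhs p s f x| ≤ η :=
            hΓ x hx.1 _ _ (hn1 x hx.1).1 (hn1 x hx.1).2
          have e1 : resid p s (F n) x = (dv (fun y => A p (∇(F n) y)) x + rhs p s f x) +
            (rhs p s (F n) x - rhs p s f x) := by rw [resid]; ring
          rw [e1]
          exact abs_add_mul_le hlam0 h6 _ _
      _ = ofReal lam⁻¹ * (∫⁻ x in K, ofReal ((dv (fun y => A p (∇(F n) y)) x + rhs p s f x) ^ 2)) +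
            ofReal (lam⁻¹ * η ^ 2 + lam) * volume K + ofReal lam *
            ∫⁻ x in K, ofReal (‖fderiv ℝ (∇(F n)) x‖ ^ 2) := by
          rw [lintegral_add_right _ hm1, lintegral_add_right _ measurable_const,
            lintegral_const_mul' _ _ ofReal_ne_top, setLIntegral_const]
          simp_rw [ofReal_mul hlam0.le]
          rw [lintegral_const_mul' _ _ ofReal_ne_top]
      _ ≤ ofReal lam⁻¹ * ofReal (lam * ε / 3) + ofReal (lam⁻¹ * η ^ 2 + lam) * ofReal V +
            ofReal lam * ofReal CH' := by
          rw [ofReal_measureReal hKc.measure_lt_top.ne]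
          gcongr
          exact hn3.trans (ofReal_le_ofReal (le_max_left _ _))
      _ = ofReal (lam⁻¹ * (lam * ε / 3) + (lam⁻¹ * η ^ 2 + lam) * V + lam * CH') := by
          rw [← ofReal_mul (by positivity), ← ofReal_mul (by positivity),
            ← ofReal_mul (by positivity), ← ofReal_add (by positivity)
            (by positivity), ← ofReal_add (by positivity) (by positivity)]
      _ ≤ ofReal ε := by
          refine ofReal_le_ofReal ?_
          have i1 : lam⁻¹ * (lam * ε / 3) = ε / 3 := by field_simp
          have i2 : lam⁻¹ * η ^ 2 * V ≤ ε / 3 := by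
            have : lam⁻¹ * η ^ 2 = ε / (3 * (V + 1)) := by rw [hη2]; field_simp
            rw [this, div_mul_eq_mul_div, div_le_div_iff₀ (by positivity) (by norm_num)]
            nlinarith
          have i3 : lam * V + lam * CH' ≤ ε / 3 := by
            rw [← mul_add, hlam, div_mul_eq_mul_div, div_le_div_iff₀ (by positivity) (by norm_num)]
            nlinarith
          nlinarith
  have h1 : Tendsto (fun n => ofReal (∫ x, R (x, F n x, ∇(F n) x))) atTop
      (𝓝 (ofReal (∫ x, R (x, f x, ∇f x)))) :=
    (ENNReal.continuous_ofReal.tendsto _).comp hlim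
  have h2 := ENNReal.Tendsto.const_mul (a := ofReal C) herr (Or.inr ofReal_ne_top)
  rw [mul_zero] at h2
  have h3 := le_of_tendsto_of_tendsto h1 h2 (by
    filter_upwards [hFu δ₀ hδ₀] with n hn using hI (F n) (hF n) hn)
  exact ENNReal.ofReal_eq_zero.1 (le_antisymm h3 bot_le)

end limit

section smooth
variable {d : ℕ} {p s : ℝ}

theorem hasDerivAt_posPart_sq (t : ℝ) :
    HasDerivAt (fun t : ℝ => (max t 0) ^ 2) (2 * max t 0) t := by
  rcases lt_trichotomy t 0 with h | h | h
  · have e : (fun t : ℝ => (max t 0) ^ 2) =ᶠ[𝓝 t] fun _ => 0 := by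
      filter_upwards [Iio_mem_nhds h] with y hy
      rw [max_eq_right (le_of_lt hy)]; ring
    rw [max_eq_right h.le, mul_zero]
    exact (hasDerivAt_const t (0:ℝ)).congr_of_eventuallyEq e
  · subst h
    rw [max_self, mul_zero]
    rw [hasDerivAt_iff_isLittleO]
    refine Asymptotics.isLittleO_iff.2 fun c hc => ?_
    filter_upwards [Metric.ball_mem_nhds (0:ℝ) hc] with y hy
    rw [mem_ball_zero_iff] at hy
    simp only [max_self, sub_zero, smul_zero]
    have h1 : max y 0 ≤ |y| := max_le (le_abs_self y) (abs_nonneg y)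
    have h2 : 0 ≤ max y 0 := le_max_right _ _
    rw [norm_eq_abs] at hy ⊢
    rw [norm_eq_abs, abs_of_nonneg (by rw [zero_pow two_ne_zero, sub_zero]; positivity)]
    nlinarith [abs_nonneg y]
  · have e : (fun t : ℝ => (max t 0) ^ 2) =ᶠ[𝓝 t] fun t => t ^ 2 := by
      filter_upwards [Ioi_mem_nhds h] with y hy
      rw [max_eq_left (le_of_lt hy)]
    rw [max_eq_left h.le]
    have := hasDerivAt_pow 2 t
    simp only [Nat.cast_ofNat, Nat.add_one_sub_one, pow_one] at this
    exact this.congr_of_eventuallyEq e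

theorem contDiff_posPart_sq : ContDiff ℝ 1 (fun t : ℝ => (max t 0) ^ 2) := by
  rw [contDiff_one_iff_deriv]
  refine ⟨fun t => (hasDerivAt_posPart_sq t).differentiableAt, ?_⟩
  have : deriv (fun t : ℝ => (max t 0) ^ 2) = fun t => 2 * max t 0 :=
    funext fun t => (hasDerivAt_posPart_sq t).deriv
  rw [this]
  fun_prop

theorem contDiff_gradient {F : Eu d → ℝ} (hF : ContDiff ℝ ∞ F) : ContDiff ℝ ∞ (∇F) :=
  contDiff_iff_contDiffAt.2 fun _ => contDiffAt_gradient (n := ∞) hF.contDiffAt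

theorem hessian_symm {F : Eu d → ℝ} (hF : ContDiff ℝ ∞ F) (x y z : Eu d) :
    ⟪fderiv ℝ (∇F) x y, z⟫ = ⟪y, fderiv ℝ (∇F) x z⟫ := by
  have hd : HasFDerivAt (fderiv ℝ F) (fderiv ℝ (fderiv ℝ F) x) x :=
    ((hF.fderiv_right (m := 1) (by norm_cast)).differentiable one_ne_zero x).hasFDerivAt
  have hs := (hF.contDiffAt (x := x)).isSymmSndFDerivAt (n := ∞) (by
    simp only [minSmoothness_of_isRCLikeNormedField]; norm_cast) y z
  have hg : HasFDerivAt (∇F) (fderiv ℝ (∇F) x) x :=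
    ((contDiff_gradient hF).differentiable (by simp) x).hasFDerivAt
  have key : ∀ y z, ⟪fderiv ℝ (∇F) x y, z⟫ = fderiv ℝ (fderiv ℝ F) x y z := by
    intro y z
    have h1 := hg.inner ℝ (hasFDerivAt_const z x)
    have h2 := hd.clm_apply (hasFDerivAt_const z x)
    have e : (fun y => ⟪∇F y, z⟫) = fun y => fderiv ℝ F y z := by
      ext y; simp [gradient]
    rw [e] at h1
    have h3 := congrArg (fun L => L y) (h1.unique h2)
    simpa using h3
  rw [key, real_inner_comm, key]
  exact hs

theorem fderiv_A_gradient {F : Eu d → ℝ} (hF : ContDiff ℝ ∞ F) {x : Eu d}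
    (hx : ∇F x ≠ 0) : fderiv ℝ (fun y => A p (∇F y)) x = (DA p (∇F x)).comp (fderiv ℝ (∇F) x) :=
  ((hasFDerivAt_A hx).comp x ((contDiff_gradient hF).differentiable (by simp) x).hasFDerivAt).fderiv

theorem hasGradientAt_norm_gradient_rpow (hp : 1 < p) {F : Eu d → ℝ} (hF : ContDiff ℝ ∞ F)
    (x : Eu d) : HasGradientAt (fun y => ‖∇F y‖ ^ p) ((p * ‖∇F x‖ ^ (p - 2)) • fderiv ℝ (∇F) x (∇F x)) x := by
  have h := (hasFDerivAt_norm_rpow (∇F x) hp).comp x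
    ((contDiff_gradient hF).differentiable (by simp) x).hasFDerivAt
  rw [hasGradientAt_iff_hasFDerivAt]
  refine HasFDerivAt.congr_fderiv (f' := _) (by exact h) ?_
  ext y
  simp [hessian_symm hF x, inner_smul_left]

theorem contDiffAt_A_gradient {F : Eu d → ℝ} (hF : ContDiff ℝ ∞ F) {x : Eu d}
    (hx : ∇F x ≠ 0) : ContDiffAt ℝ 2 (fun y => A p (∇F y)) x :=
  (contDiffAt_A hx).comp x ((contDiff_gradient hF).contDiffAt.of_le (by norm_cast))

/-- Pointwise lower bound of the Bochner integrand yields an integral inequality. -/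
theorem bochner_le {Z Y : Eu d → Eu d} {φ k R E : Eu d → ℝ} (hφ : ContDiff ℝ 1 φ)
    (hc : HasCompactSupport φ) (hZ : ∀ x ∈ tsupport φ, ContDiffAt ℝ 2 Z x)
    (hk : ∀ x ∈ tsupport φ, ContDiffAt ℝ 1 k x) (hY : ∀ x ∈ tsupport φ, ContDiffAt ℝ 1 Y x)
    (hR : Integrable R) {K : Set (Eu d)} (hK : MeasurableSet K) {C : ℝ} (hC : 0 ≤ C)
    (hφK : ∀ x ∉ K, x ∉ tsupport φ)
    (hRK : ∀ x ∉ K, R x ≤ 0)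
    (hb : ∀ x ∈ K, R x ≤ ⟪fderiv ℝ Z x (Z x) - (dv Z x + k x) • Z x + Y x, ∇φ x⟫ +
      (trC d ((fderiv ℝ Z x).comp (fderiv ℝ Z x)) - dv Z x ^ 2 - k x * dv Z x
        - ⟪Z x, ∇k x⟫ + dv Y x) * φ x + C * E x) :
    ofReal (∫ x, R x) ≤ ofReal C * ∫⁻ x in K, ofReal (E x) := by
  have hfd : ∀ x ∈ tsupport φ, ContDiffAt ℝ 1 (fderiv ℝ Z) x := fun x hx =>
    (hZ x hx).fderiv_right (m := 1) (by norm_num)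
  have hfc : ∀ x ∈ tsupport φ, ContinuousAt (fderiv ℝ Z) x := fun x hx => (hfd x hx).continuousAt
  have hZc : ∀ x ∈ tsupport φ, ContinuousAt Z x := fun x hx => (hZ x hx).continuousAt
  have hdc : ∀ x ∈ tsupport φ, ContinuousAt (dv Z) x := fun x hx =>
    continuousAt_dv ((hZ x hx).of_le (by norm_num))
  have hkc : ∀ x ∈ tsupport φ, ContinuousAt k x := fun x hx => (hk x hx).continuousAt
  set q₁ : Eu d → ℝ := fun x =>
    ⟪fderiv ℝ Z x (Z x) - (dv Z x + k x) • Z x + Y x, ∇φ x⟫ with hq₁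
  set q₂ : Eu d → ℝ := fun x => (trC d ((fderiv ℝ Z x).comp (fderiv ℝ Z x)) - dv Z x ^ 2
    - k x * dv Z x - ⟪Z x, ∇k x⟫ + dv Y x) * φ x with hq₂
  have hb1 : ∫ x, q₁ x = - ∫ x, q₂ x := bochner hφ hc hZ hk hY
  have i1 : Integrable q₁ := integrable_inner_gradient hφ hc fun x hx =>
    (((hfc x hx).clm_apply (hZc x hx)).sub (((hdc x hx).add (hkc x hx)).smul (hZc x hx))).add
      (hY x hx).continuousAt
  have i2 : Integrable q₂ := by
    refine integrable_mul_of_tsupport hc hφ.continuous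
      (fun x hx => eq_zero_of_notMem hx) fun x hx => ?_
    refine ((((ContinuousAt.sub ?_ ((hdc x hx).pow 2)).sub ((hkc x hx).mul (hdc x hx))).sub
      ((hZc x hx).inner (𝕜 := ℝ) (continuousAt_gradient (hk x hx)))).add (continuousAt_dv (hY x hx)))
    exact (trC d).continuous.continuousAt.comp ((hfc x hx).clm_comp (hfc x hx))
  have e1 : ∫ x, R x = ∫ x, (R x - (q₁ x + q₂ x)) := by
    have h3 : ∫ x, (R x - (q₁ x + q₂ x)) = (∫ x, R x) - ∫ x, (q₁ x + q₂ x) :=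
      integral_sub hR (i1.add i2)
    rw [h3, integral_add i1 i2, hb1]; ring
  rw [e1]
  refine (ofReal_integral_le_lintegral (hR.sub (i1.add i2))).trans ?_
  rw [← lintegral_const_mul' _ _ ofReal_ne_top, ← lintegral_indicator hK]
  refine lintegral_mono fun x => ?_
  change ofReal (R x - (q₁ x + q₂ x)) ≤ _
  by_cases hx : x ∈ K
  · rw [indicator_of_mem hx, ← ofReal_mul hC]
    exact ofReal_le_ofReal (by have := hb x hx; simp only [hq₁, hq₂]; linarith)
  · rw [indicator_of_notMem hx]
    have h1 := hφK x hx
    have h2 : R x - (q₁ x + q₂ x) ≤ 0 := by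
      simp only [hq₁, hq₂, gradient_of_notMem h1,
        eq_zero_of_notMem h1, inner_zero_right, mul_zero]
      linarith [hRK x hx]
    rw [ENNReal.ofReal_of_nonpos h2]

end smooth

section algebra

theorem quadratic_identity {d p s b w h a : ℝ} (hp : 1 < p) (hd : 1 < d) :
    a ^ 2 + ((p - 1) * w + h + a) ^ 2 / (d - 1) - (p + s * (p - 1) / p) * w * a - (1 - b) * s * h * w
      + (s * (p - 1) ^ 2 / p ^ 2 * w - b * h) * ((p - 1) * w + h) =
    d / (d - 1) * (a - (s * (p - 1) ^ 2 / p ^ 2 * w - b * h)) ^ 2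
      + (a - (s * (p - 1) ^ 2 / p ^ 2 * w - b * h)) *
        ((2 * (s * (p - 1) ^ 2 / p ^ 2) + 2 * (p - 1 + s * (p - 1) ^ 2 / p ^ 2) / (d - 1)
          - (p + s * (p - 1) / p)) * w + 2 * (1 - b * d) / (d - 1) * h)
      + (p - 1 + s * (p - 1) ^ 2 / p ^ 2) * ((p - 1 + s * (p - 1) ^ 2 / p ^ 2) / (d - 1)
          - s * (p - 1) / p ^ 2) * w ^ 2
      + (b * (1 + s * (p - 1) / p + s - 2 * (s * (p - 1) ^ 2 / p ^ 2)) - s + s * (p - 1) ^ 2 / p ^ 2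
          + 2 * (p - 1 + s * (p - 1) ^ 2 / p ^ 2) * (1 - b) / (d - 1)) * (h * w)
      + (1 - b) * (1 - b * d) / (d - 1) * h ^ 2 := by
  have h1 : p ≠ 0 := by linarith
  have h2 : d - 1 ≠ 0 := by linarith
  field_simp
  ring

set_option maxHeartbeats 1000000 in
theorem coercive_of_coeff {d P L Lh α κ ν β ε₀ N' w h y σ ε c NN : ℝ} (hd : 1 < d) (hP : 0 < P)
    (hβ : 0 < β) (hκ : 0 < κ) (hN' : 0 < N')
    (hLh : Lh = 2 * ε₀ / (d - 1)) (hν : 4 * ε₀ ^ 2 / (d * (d - 1)) ≤ ν)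
    (h1 : L ^ 2 ≤ 2 * α * N') (h2 : L ^ 2 * β ≤ 2 * κ * N') (hNN : N' ≤ NN)
    (hε1 : ε ≤ 1 / 2) (hε2 : ε ≤ 2 * P) (hc1 : c ≤ α / 4) (hc2 : c * β ^ 2 ≤ ν / 4)
    (hc : 0 ≤ c) (hw : 0 < w) (hh : 0 < h) (hσ : 0 ≤ σ) :
    c * (w + β * h) ^ 2 ≤ d / (d - 1) * y ^ 2 + y * (L * w + Lh * h) + α * w ^ 2 + κ * (h * w)
      + ν * h ^ 2 + 2 * P * σ + NN * (w / (w + β * h)) * (y ^ 2 + P * σ) - ε * (y ^ 2 + σ) := by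
  have hD : 0 < d - 1 := by linarith
  have hG : 0 < w + β * h := by positivity
  have e1 : NN * (w / (w + β * h)) * (y ^ 2 + P * σ) ≥ N' * (w / (w + β * h)) * y ^ 2 := by
    have i1 : N' * (w / (w + β * h)) * y ^ 2 ≤ NN * (w / (w + β * h)) * y ^ 2 := by gcongr
    have i2 : 0 ≤ NN * (w / (w + β * h)) * (P * σ) := by
      have := hN'.le.trans hNN; positivity
    linarith
  have e2 : N' * (w / (w + β * h)) * y ^ 2 + y * (L * w) + L ^ 2 / (4 * N') * (w * (w + β * h)) ≥ 0 := by
    have i1 : N' * (w / (w + β * h)) * y ^ 2 + y * (L * w) + L ^ 2 / (4 * N') * (w * (w + β * h)) =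
        w / (N' * (w + β * h)) * (N' * y + L * (w + β * h) / 2) ^ 2 := by field_simp; ring
    rw [i1]; positivity
  have e3 : L ^ 2 / (4 * N') * (w * (w + β * h)) ≤ α / 2 * w ^ 2 + κ / 2 * (h * w) := by
    have i1 : L ^ 2 / (4 * N') ≤ α / 2 := by rw [div_le_iff₀ (by positivity)]; linarith
    have i2 : L ^ 2 / (4 * N') * β ≤ κ / 2 := by
      rw [div_mul_eq_mul_div, div_le_iff₀ (by positivity)]; linarith
    have i3 := mul_le_right i1 (sq_nonneg w)
    have i4 := mul_le_right i2 (mul_pos hh hw).le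
    linarith
  have e4 : d / (2 * (d - 1)) * y ^ 2 + y * (Lh * h) + ν / 2 * h ^ 2 ≥ 0 := by
    have i0 : 0 < d := by linarith
    have i1 : d / (2 * (d - 1)) * y ^ 2 + y * (Lh * h) + 2 * ε₀ ^ 2 / (d * (d - 1)) * h ^ 2 =
        d / (2 * (d - 1)) * (y + 2 * ε₀ * h / d) ^ 2 := by rw [hLh]; field_simp; ring
    have i2 : 0 ≤ d / (2 * (d - 1)) * (y + 2 * ε₀ * h / d) ^ 2 := by positivity
    have i3 : 2 * ε₀ ^ 2 / (d * (d - 1)) ≤ ν / 2 := by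
      have : 2 * ε₀ ^ 2 / (d * (d - 1)) = (4 * ε₀ ^ 2 / (d * (d - 1))) / 2 := by ring
      rw [this]; linarith
    linarith [mul_le_right i3 (sq_nonneg h)]
  have e5 : d / (d - 1) * y ^ 2 = d / (2 * (d - 1)) * y ^ 2 + d / (2 * (d - 1)) * y ^ 2 := by
    field_simp; ring
  have e6 : ε * y ^ 2 ≤ d / (2 * (d - 1)) * y ^ 2 := by
    refine mul_le_right (hε1.trans ?_) (sq_nonneg _)
    rw [div_le_div_iff₀ (by norm_num) (by positivity)]; linarith
  have e7 : ε * σ ≤ 2 * P * σ := mul_le_right hε2 hσ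
  have e8 : c * (w + β * h) ^ 2 ≤ α / 2 * w ^ 2 + ν / 2 * h ^ 2 := by
    have i1 : (w + β * h) ^ 2 ≤ 2 * w ^ 2 + 2 * β ^ 2 * h ^ 2 := by nlinarith [sq_nonneg (w - β * h)]
    have i2 := mul_le_left i1 hc
    have i3 := mul_le_right hc1 (sq_nonneg w)
    have i4 := mul_le_right hc2 (sq_nonneg h)
    linarith
  have e9 : 0 ≤ κ / 2 * (h * w) := by positivity
  linarith

theorem sq_residual_ge {D gt e a : ℝ} (hD : 0 < D) (hgt : 0 < gt) :
    (gt + a) ^ 2 / D - 2 / D * (|e| * (gt + |a|)) ≤ (-gt + e - a) ^ 2 / D := by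
  have h2 : e * (gt + a) ≤ |e| * (gt + |a|) := by
    refine (le_abs_self _).trans ?_
    rw [abs_mul]
    refine mul_le_left ((abs_add_le _ _).trans ?_) (abs_nonneg _)
    rw [abs_of_pos hgt]
  have h1 : (gt + a) ^ 2 - 2 * (|e| * (gt + |a|)) ≤ (-gt + e - a) ^ 2 := by
    have : (-gt + e - a) ^ 2 = (gt + a) ^ 2 - 2 * (e * (gt + a)) + e ^ 2 := by ring
    rw [this]
    linarith [sq_nonneg e]
  calc _ = ((gt + a) ^ 2 - 2 * (|e| * (gt + |a|))) / D := by ring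
    _ ≤ _ := div_le_div_of_nonneg_right h1 hD.le

theorem leading_coeff_pos {d p s : ℝ} (hp : 1 < p) (hpd : p < d) (hs : 0 < s) (hs2 : s * (d - p) < p ^ 2) :
    0 < (p - 1 + s * (p - 1) ^ 2 / p ^ 2) * ((p - 1 + s * (p - 1) ^ 2 / p ^ 2) / (d - 1)
          - s * (p - 1) / p ^ 2) := by
  have hP : 0 < p - 1 := by linarith
  have hD : 0 < d - 1 := by linarith
  have hp0 : 0 < p := by linarith
  refine mul_pos (by positivity) ?_
  rw [sub_pos, div_lt_div_iff₀ (by positivity) hD]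
  have h1 : (p - 1 + s * (p - 1) ^ 2 / p ^ 2) * p ^ 2 = (p - 1) * p ^ 2 + s * (p - 1) ^ 2 := by
    field_simp
  have h2 : s * (p - 1) * (d - 1) = (p - 1) * (s * (d - p)) + s * (p - 1) ^ 2 := by ring
  rw [h1, h2]
  linarith [mul_lt_mul_of_pos_left hs2 hP]

theorem exists_mixed_coeff_pos {d p s : ℝ} (hp : 1 < p) (hpd : p < d) (hs2 : s * (d - p) < p ^ 2) :
    ∃ b ε₀ : ℝ, 0 < b ∧ 0 < ε₀ ∧ 1 - b * d = ε₀ ∧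
      4 * ε₀ ^ 2 / (d * (d - 1)) ≤ (1 - b) * (1 - b * d) / (d - 1) ∧
      0 < b * (1 + s * (p - 1) / p + s - 2 * (s * (p - 1) ^ 2 / p ^ 2)) - s + s * (p - 1) ^ 2 / p ^ 2
          + 2 * (p - 1 + s * (p - 1) ^ 2 / p ^ 2) * (1 - b) / (d - 1) := by
  have hp0 : 0 < p := by linarith
  have hd0 : 0 < d := by linarith
  have hD : 0 < d - 1 := by linarith
  obtain ⟨κ₁, hκ₁⟩ : ∃ κ₁, κ₁ = (2 * (p - 1 + s * (p - 1) ^ 2 / p ^ 2) / (d - 1) -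
    (1 + s * (p - 1) / p + s - 2 * (s * (p - 1) ^ 2 / p ^ 2))) / d := ⟨_, rfl⟩
  obtain ⟨κ₀, hκ₀⟩ : ∃ κ₀, κ₀ = (p ^ 2 - s * (d - p)) * (2 * (p - 1) + 1) / (p ^ 2 * d) := ⟨_, rfl⟩
  have hκ₀0 : 0 < κ₀ := by
    have h1 : 0 < p ^ 2 - s * (d - p) := by linarith
    have h2 : 0 < 2 * (p - 1) + 1 := by linarith
    rw [hκ₀]; positivity
  obtain ⟨ε₀, hε₀0, hε₀1, hε₀2, hε₀3⟩ : ∃ ε₀ : ℝ, 0 < ε₀ ∧ ε₀ ≤ 1 / 2 ∧ ε₀ ≤ (d - 1) / 4 ∧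
      ε₀ * (2 * (|κ₁| + 1)) ≤ κ₀ := by
    refine ⟨min (1 / 2) (min ((d - 1) / 4) (κ₀ / (2 * (|κ₁| + 1)))), by positivity,
      min_le_left _ _, (min_le_right _ _).trans (min_le_left _ _), ?_⟩
    rw [← le_div_iff₀ (by positivity)]
    exact (min_le_right _ _).trans (min_le_right _ _)
  have hbd : 1 - (1 - ε₀) / d * d = ε₀ := by field_simp; ring
  refine ⟨(1 - ε₀) / d, ε₀, div_pos (by linarith) hd0, hε₀0, hbd, ?_, ?_⟩
  · rw [hbd]
    have h1 : (1 - (1 - ε₀) / d) * ε₀ / (d - 1) = (d - 1 + ε₀) * ε₀ / (d * (d - 1)) := by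
      field_simp; ring
    rw [h1]
    refine div_le_div_of_nonneg_right ?_ (by positivity)
    nlinarith
  · have e : (1 - ε₀) / d * (1 + s * (p - 1) / p + s - 2 * (s * (p - 1) ^ 2 / p ^ 2)) - s
          + s * (p - 1) ^ 2 / p ^ 2 + 2 * (p - 1 + s * (p - 1) ^ 2 / p ^ 2) *
          (1 - (1 - ε₀) / d) / (d - 1) = κ₀ + ε₀ * κ₁ := by
      rw [hκ₀, hκ₁]
      have : d - 1 ≠ 0 := hD.ne'
      field_simp
      ring
    rw [e]
    have h1 : ε₀ * κ₁ ≥ -(ε₀ * |κ₁|) := by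
      rw [← mul_neg]; exact mul_le_left (neg_abs_le _) hε₀0.le
    have h2 : 0 ≤ ε₀ * |κ₁| := by positivity
    linarith

/-- The parameters for which the quadratic form of the differential inequality is coercive. -/
theorem exists_coercive {d p s : ℝ} (hp : 1 < p) (hpd : p < d) (hs : 0 < s) (hs2 : s * (d - p) < p ^ 2) :
    ∃ b β c ε N₀ : ℝ, 0 < b ∧ β = p ^ 2 * b / ((p - 1) * s) ∧ 0 < c ∧ 0 < ε ∧ 0 < N₀ ∧
      ∀ N, N₀ ≤ N → ∀ w h a σ e a₀ gt G : ℝ, 0 < w → 0 < h → 0 ≤ σ →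
        a₀ = s * (p - 1) ^ 2 / p ^ 2 * w - b * h → gt = (p - 1) * w + h → G = w + β * h →
        c * G ^ 2 - 2 / (d - 1) * (|e| * (gt + |a|)) ≤ a ^ 2 + 2 * (p - 1) * σ + (-gt + e - a) ^ 2 / (d - 1)
          - (p + s * (p - 1) / p) * w * a - (1 - b) * s * h * w + a₀ * gt
          + N * (p / (p - 1)) * (w / G) * ((a - a₀) ^ 2 + (p - 1) * σ)
          - ε * ((a - a₀) ^ 2 + σ) := by
  have hP0 : 0 < p - 1 := by linarith
  have hp0 : 0 < p := by linarith
  have hd : 1 < d := by linarith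
  have hD : 0 < d - 1 := by linarith
  obtain ⟨b, ε₀, hb0, hε₀, hbd, hν, hκ⟩ := exists_mixed_coeff_pos hp hpd hs2
  have hα := leading_coeff_pos hp hpd hs hs2
  have hid := fun w h a => quadratic_identity (d := d) (p := p) (s := s) (b := b) (w := w) (h := h)
    (a := a) hp hd
  rw [hbd] at hν
  simp only [hbd] at hid
  generalize (p - 1 + s * (p - 1) ^ 2 / p ^ 2) * ((p - 1 + s * (p - 1) ^ 2 / p ^ 2) / (d - 1)
    - s * (p - 1) / p ^ 2) = α at hα hid
  generalize b * (1 + s * (p - 1) / p + s - 2 * (s * (p - 1) ^ 2 / p ^ 2)) - s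
    + s * (p - 1) ^ 2 / p ^ 2 + 2 * (p - 1 + s * (p - 1) ^ 2 / p ^ 2) * (1 - b) / (d - 1) = κ
    at hκ hid
  generalize (1 - b) * ε₀ / (d - 1) = ν at hν hid
  generalize 2 * (s * (p - 1) ^ 2 / p ^ 2) + 2 * (p - 1 + s * (p - 1) ^ 2 / p ^ 2) / (d - 1)
    - (p + s * (p - 1) / p) = L at hid
  have hν0 : 0 < ν := lt_of_lt_of_le (by positivity) hν
  obtain ⟨β, hβ⟩ : ∃ β, β = p ^ 2 * b / ((p - 1) * s) := ⟨_, rfl⟩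
  have hβ0 : 0 < β := by rw [hβ]; positivity
  obtain ⟨N', hN'0, hN1, hN2⟩ : ∃ N' > 0, L ^ 2 ≤ 2 * α * N' ∧ L ^ 2 * β ≤ 2 * κ * N' := by
    refine ⟨L ^ 2 / (2 * α) + L ^ 2 * β / (2 * κ) + 1, by positivity, ?_, ?_⟩
    · have h1 : 2 * α * (L ^ 2 / (2 * α) + L ^ 2 * β / (2 * κ) + 1) =
          L ^ 2 + (2 * α * (L ^ 2 * β / (2 * κ)) + 2 * α) := by field_simp; ring
      rw [h1]
      have : 0 ≤ 2 * α * (L ^ 2 * β / (2 * κ)) + 2 * α := by positivity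
      linarith
    · have h1 : 2 * κ * (L ^ 2 / (2 * α) + L ^ 2 * β / (2 * κ) + 1) =
          L ^ 2 * β + (2 * κ * (L ^ 2 / (2 * α)) + 2 * κ) := by field_simp; ring
      rw [h1]
      have : 0 ≤ 2 * κ * (L ^ 2 / (2 * α)) + 2 * κ := by positivity
      linarith
  obtain ⟨c, hc0, hc1, hc2⟩ : ∃ c > 0, c ≤ α / 4 ∧ c * β ^ 2 ≤ ν / 4 := by
    refine ⟨min (α / 4) (ν / (4 * β ^ 2)), by positivity, min_le_left _ _, ?_⟩
    have h1 : min (α / 4) (ν / (4 * β ^ 2)) ≤ ν / (4 * β ^ 2) := min_le_right _ _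
    rw [le_div_iff₀ (by positivity)] at h1; linarith
  refine ⟨b, β, c, min (1 / 2) (2 * (p - 1)), N' * (p - 1) / p, hb0, hβ, hc0, by positivity,
    by positivity, ?_⟩
  intro N hN w h a σ e a₀ gt G hw hh hσ ha₀ hgt hG
  have hNN : N' ≤ N * (p / (p - 1)) := by
    rw [div_le_iff₀ hp0] at hN
    rw [← mul_div_assoc, le_div_iff₀ hP0]; exact hN
  have key := coercive_of_coeff (y := a - a₀) (σ := σ) (ε := min (1 / 2) (2 * (p - 1)))
    hd hP0 hβ0 hκ hN'0 rfl hν hN1 hN2 hNN (min_le_left _ _) (min_le_right _ _) hc1 hc2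
    hc0.le hw hh hσ
  have he := sq_residual_ge (e := e) (a := a) hD (show 0 < gt by rw [hgt]; positivity)
  have hid' := hid w h a
  rw [← ha₀, ← hgt] at hid'
  rw [← hG] at key
  linarith

end algebra

section pointwise
variable {d : ℕ} {p : ℝ}

/-- Pointwise algebra for `Z = A v`, `T = DA(v) H Z` and `∇w = p ‖v‖^(p-2) H v`. -/
theorem pointwise_identities (hp : 1 < p) {v : Eu d} (hv : v ≠ 0) {H : Eu d →L[ℝ] Eu d}
    (hH : ∀ x y, ⟪H x, y⟫ = ⟪x, H y⟫) {m w a σ : ℝ} {Z T gw : Eu d} (hm : m = ‖v‖ ^ (p - 2))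
    (hw : w = ‖v‖ ^ p) (hZ : Z = A p v) (hT : T = DA p v (H Z)) (hgw : gw = (p * m) • H v)
    (ha : a = (p - 1) * m * ⟪H v, v⟫ / ‖v‖ ^ 2)
    (hσ : σ = m ^ 2 * (‖H v‖ ^ 2 / ‖v‖ ^ 2 - (⟪H v, v⟫ / ‖v‖ ^ 2) ^ 2)) :
    0 < m ∧ w = m * ‖v‖ ^ 2 ∧ 0 ≤ σ ∧ ⟪Z, v⟫ = w ∧ ⟪T, v⟫ = w * a ∧
      ⟪Z, gw⟫ = p / (p - 1) * (w * a) ∧ ⟪T, gw⟫ = p / (p - 1) * w * (a ^ 2 + (p - 1) * σ) ∧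
      (∀ a₀ : ℝ, ‖T - a₀ • Z‖ ^ 2 = ‖Z‖ ^ 2 * ((a - a₀) ^ 2 + σ)) ∧ |a| ≤ (p - 1) * (m * ‖H‖) := by
  have hP : 0 < p - 1 := by linarith
  have hvn : 0 < ‖v‖ := norm_pos_iff.2 hv
  have hm0 : 0 < m := by rw [hm]; positivity
  have hwm : w = m * ‖v‖ ^ 2 := by
    rw [hw, hm, ← rpow_natCast, ← rpow_add hvn]; congr 1; push_cast; ring
  have hZm : Z = m • v := by rw [hZ, A, hm]
  obtain ⟨X, hX⟩ : ∃ X, X = ⟪H v, v⟫ := ⟨_, rfl⟩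
  obtain ⟨Q, hQ⟩ : ∃ Q, Q = ‖H v‖ ^ 2 := ⟨_, rfl⟩
  obtain ⟨r, hr⟩ : ∃ r, r = ‖v‖ ^ 2 := ⟨_, rfl⟩
  have hr0 : 0 < r := by rw [hr]; positivity
  have hX' : ⟪v, H v⟫ = X := by rw [hX, real_inner_comm]
  have hvv : ⟪v, v⟫ = r := by rw [hr, real_inner_self_eq_norm_sq]
  have hHH : ⟪H v, H v⟫ = Q := by rw [hQ, real_inner_self_eq_norm_sq]
  have hTm : T = (m ^ 2) • (H v + ((p - 2) * r⁻¹ * X) • v) := by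
    rw [hT, hZm, map_smul, map_smul, DA_apply, hX', ← hm, ← hr, smul_smul, sq]
  rw [← hX, ← hr] at ha
  rw [← hX, ← hr, ← hQ] at hσ
  have hXQ : X ^ 2 ≤ Q * r := by
    have := real_inner_mul_inner_self_le (H v) v
    rw [hHH, hvv, ← hX] at this; nlinarith
  rw [← hr] at hwm
  refine ⟨hm0, by rw [← hr]; exact hwm, ?_, ?_, ?_, ?_, ?_, ?_, ?_⟩
  · have : σ = m ^ 2 * (Q * r - X ^ 2) / r ^ 2 := by rw [hσ]; field_simp
    rw [this]
    have : 0 ≤ Q * r - X ^ 2 := by linarith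
    positivity
  · rw [hZm, real_inner_smul_left, hvv, hwm]
  · rw [hTm, real_inner_smul_left, inner_add_left, real_inner_smul_left, hvv, ← hX, ha, hwm]
    field_simp; ring
  · rw [hZm, hgw, real_inner_smul_left, real_inner_smul_right, hX', ha, hwm]
    field_simp
  · rw [hTm, hgw, real_inner_smul_left, real_inner_smul_right, inner_add_left,
      real_inner_smul_left, hHH, hX', ha, hσ, hwm]
    field_simp; ring
  · intro a₀
    have e1 : T - a₀ • Z = (m ^ 2) • H v + (m ^ 2 * ((p - 2) * r⁻¹ * X) - a₀ * m) • v := by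
      rw [hTm, hZm]; module
    rw [e1, ← real_inner_self_eq_norm_sq, ← real_inner_self_eq_norm_sq, hZm]
    simp only [inner_add_left, inner_add_right, real_inner_smul_left, real_inner_smul_right,
      hHH, hX', ← hX, hvv, ha, hσ]
    field_simp; ring
  · rw [ha, abs_div, abs_mul, abs_of_pos (mul_pos hP hm0), abs_of_pos hr0, div_le_iff₀ hr0, hX, hr]
    have h1 := abs_real_inner_le_norm (H v) v
    have h2 := H.le_opNorm v
    have h3 : |⟪H v, v⟫| ≤ ‖H‖ * ‖v‖ ^ 2 := by
      refine h1.trans ?_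
      rw [sq, ← mul_assoc]; exact mul_le_right h2 hvn.le
    calc (p - 1) * m * |⟪H v, v⟫| ≤ (p - 1) * m * (‖H‖ * ‖v‖ ^ 2) :=
          mul_le_left h3 (mul_pos hP hm0).le
      _ = _ := by ring

/-- The coercivity property of the quadratic form of `exists_coercive`. -/
def Coercive (d p s b β c ε N : ℝ) : Prop :=
  ∀ w h a σ e a₀ gt G : ℝ, 0 < w → 0 < h → 0 ≤ σ →
    a₀ = s * (p - 1) ^ 2 / p ^ 2 * w - b * h → gt = (p - 1) * w + h → G = w + β * h →
    c * G ^ 2 - 2 / (d - 1) * (|e| * (gt + |a|)) ≤ a ^ 2 + 2 * (p - 1) * σ + (-gt + e - a) ^ 2 / (d - 1)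
      - (p + s * (p - 1) / p) * w * a - (1 - b) * s * h * w + a₀ * gt
      + N * (p / (p - 1)) * (w / G) * ((a - a₀) ^ 2 + (p - 1) * σ)
      - ε * ((a - a₀) ^ 2 + σ)

set_option maxHeartbeats 1000000 in
/-- The pointwise lower bound of the Bochner integrand for the test function
`φ = Φ ξ^M χ`; here `ψ = Φ χ ξ^(M-2)`, `ψ₂ = Φ ξ^M χ'`. -/
theorem integrand_ge {s b β c ε N : ℝ} (hp : 1 < p) (hd : 2 ≤ d)
    (hs : 0 < s) (hb : 0 < b) (hβ : β = p ^ 2 * b / ((p - 1) * s)) (hε : 0 < ε) (hN : 0 ≤ N)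
    (hco : Coercive d p s b β c ε N)
    {v : Eu d} (hv : v ≠ 0) {H L : Eu d →L[ℝ] Eu d} (hH : ∀ x y, ⟪H x, y⟫ = ⟪x, H y⟫)
    (hL : L = (DA p v).comp H) {m w h e a₀ gt G φ ψ ψ₂ ξ M : ℝ} {Z gw gφ gξ : Eu d}
    (hm : m = ‖v‖ ^ (p - 2)) (hw : w = ‖v‖ ^ p) (hh : 0 < h) (hZ : Z = A p v)
    (hgw : gw = (p * m) • H v)
    (ha₀ : a₀ = s * (p - 1) ^ 2 / p ^ 2 * w - b * h) (hgt : gt = (p - 1) * w + h)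
    (hG : G = w + β * h) (he : e = trC d L + gt) (hφ : φ = ψ * ξ ^ 2) (hψ : 0 ≤ ψ) (hψ₂ : 0 ≤ ψ₂)
    (hξ : 0 ≤ ξ) (hM : 0 ≤ M)
    (hgφ : gφ = (φ * N) • (G⁻¹ • (gw + (β * (s * h)) • v) - (s * (p - 1) / p) • v)
      + (ψ * M * ξ) • gξ + ψ₂ • gw) :
    c * φ * G ^ 2 - ψ₂ * w * (p / (4 * (p - 1))) * a₀ ^ 2 - ψ * (M ^ 2 / (4 * ε)) * ‖gξ‖ ^ 2 * ‖Z‖ ^ 2 ≤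
      ⟪L Z - (trC d L + (gt + a₀)) • Z, gφ⟫ +
      (trC d (L.comp L) - trC d L ^ 2 - (gt + a₀) * trC d L
        - ⟪Z, (p - 1 + s * (p - 1) ^ 2 / p ^ 2) • gw + ((1 - b) * (s * h)) • v⟫) * φ
      + |e| * (‖Z‖ * ‖gφ‖ + φ * (|trC d L| + |a₀| + 2 / (d - 1) * (gt + (p - 1) * (m * ‖H‖)))) := by
  have hP : 0 < p - 1 := by linarith
  have hp0 : 0 < p := by linarith
  obtain ⟨a, ha⟩ : ∃ a, a = (p - 1) * m * ⟪H v, v⟫ / ‖v‖ ^ 2 := ⟨_, rfl⟩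
  obtain ⟨σ, hσ⟩ : ∃ σ, σ = m ^ 2 * (‖H v‖ ^ 2 / ‖v‖ ^ 2 - (⟪H v, v⟫ / ‖v‖ ^ 2) ^ 2) := ⟨_, rfl⟩
  obtain ⟨T, hT⟩ : ∃ T, T = L Z := ⟨_, rfl⟩
  have hT' : T = DA p v (H Z) := by rw [hT, hL]; rfl
  obtain ⟨hm0, hwm, hσ0, hZv, hTv, hZgw, hTgw, hTn, haH⟩ :=
    pointwise_identities hp hv hH hm hw hZ hT' hgw ha hσ
  have hw0 : 0 < w := by rw [hw]; have := norm_pos_iff.2 hv; positivity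
  have hβ0 : 0 < β := by rw [hβ]; positivity
  have hG0 : 0 < G := by rw [hG]; positivity
  have htr := (trC_sq_ge hp hd hv hH hL (a := a) (σ := σ) (by rw [ha, hm]) (by rw [hσ, hm])).1
  obtain ⟨D, hD⟩ : ∃ D, D = trC d L := ⟨_, rfl⟩
  obtain ⟨tr2, htr2⟩ : ∃ tr2, tr2 = trC d (L.comp L) := ⟨_, rfl⟩
  rw [← hD, ← htr2] at htr
  rw [← hD] at he
  rw [← hD, ← htr2, ← hT]
  have hφ0 : 0 ≤ φ := by rw [hφ]; positivity
  have hco' := hco w h a σ e a₀ gt G hw0 hh hσ0 ha₀ hgt hG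
  have hDa : -gt + e - a = D - a := by rw [he]; ring
  rw [hDa] at hco'
  obtain ⟨y, hy0, hy⟩ : ∃ y : ℝ, 0 ≤ y ∧ y ^ 2 = (a - a₀) ^ 2 + σ :=
    ⟨Real.sqrt ((a - a₀) ^ 2 + σ), Real.sqrt_nonneg _, Real.sq_sqrt (by positivity)⟩
  have hTy : ‖T - a₀ • Z‖ = ‖Z‖ * y := by
    have := hTn a₀
    rw [← hy, ← mul_pow] at this
    exact (sq_eq_sq₀ (norm_nonneg _) (by positivity)).1 this
  have iJ : ⟪T - a₀ • Z, G⁻¹ • (gw + (β * (s * h)) • v) - (s * (p - 1) / p) • v⟫ =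
      p / (p - 1) * (w / G) * ((a - a₀) ^ 2 + (p - 1) * σ) := by
    simp only [inner_sub_left, inner_sub_right, inner_add_right, real_inner_smul_left,
      real_inner_smul_right, hZv, hTv, hZgw, hTgw]
    have e1 : s * (p - 1) / p = G⁻¹ * (β * (s * h) + p / (p - 1) * a₀) := by
      rw [ha₀, inv_mul_eq_div, eq_div_iff hG0.ne', hG, hβ]
      field_simp
      ring
    rw [e1]
    field_simp
    ring
  have iw : ⟪T - a₀ • Z, gw⟫ = p / (p - 1) * w * (a ^ 2 + (p - 1) * σ - a₀ * a) := by
    rw [inner_sub_left, real_inner_smul_left, hZgw, hTgw]; ring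
  have iξ : -(ε * ξ ^ 2 * y ^ 2 + M ^ 2 / (4 * ε) * ‖gξ‖ ^ 2 * ‖Z‖ ^ 2) ≤ M * ξ * ⟪T - a₀ • Z, gξ⟫ := by
    have h1 := abs_real_inner_le_norm (T - a₀ • Z) gξ
    rw [hTy] at h1
    have h2 := (abs_le.1 h1).1
    have h3 := mul_le_left h2 (mul_nonneg hM hξ)
    have h4 : 0 ≤ ε * (ξ * y - M / (2 * ε) * (‖gξ‖ * ‖Z‖)) ^ 2 := by positivity
    have h5 : ε * (ξ * y - M / (2 * ε) * (‖gξ‖ * ‖Z‖)) ^ 2 = ε * ξ ^ 2 * y ^ 2 -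
        M * ξ * (‖Z‖ * y * ‖gξ‖) + M ^ 2 / (4 * ε) * ‖gξ‖ ^ 2 * ‖Z‖ ^ 2 := by
      field_simp; ring
    rw [h5] at h4
    linarith
  have hin : ⟪T - (D + (gt + a₀)) • Z, gφ⟫ = φ * N * (p / (p - 1) * (w / G) *
      ((a - a₀) ^ 2 + (p - 1) * σ)) + ψ * (M * ξ * ⟪T - a₀ • Z, gξ⟫) +
      ψ₂ * ⟪T - a₀ • Z, gw⟫ - e * ⟪Z, gφ⟫ := by
    have e1 : T - (D + (gt + a₀)) • Z = (T - a₀ • Z) - e • Z := by rw [he]; module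
    rw [e1, inner_sub_left, real_inner_smul_left]
    congr 1
    rw [hgφ, inner_add_right, inner_add_right, real_inner_smul_right, real_inner_smul_right,
      real_inner_smul_right, iJ]
    ring
  have hZk : ⟪Z, (p - 1 + s * (p - 1) ^ 2 / p ^ 2) • gw + ((1 - b) * (s * h)) • v⟫ =
      (p + s * (p - 1) / p) * w * a + (1 - b) * s * h * w := by
    rw [inner_add_right, real_inner_smul_right, real_inner_smul_right, hZgw, hZv]
    field_simp
  have iw' : -(ψ₂ * w * (p / (4 * (p - 1))) * a₀ ^ 2) ≤ ψ₂ * ⟪T - a₀ • Z, gw⟫ := by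
    rw [iw]
    have h1 : 0 ≤ ψ₂ * (p / (p - 1) * w) := by positivity
    have h2 : -(a₀ ^ 2 / 4) ≤ a ^ 2 + (p - 1) * σ - a₀ * a := by
      have h5 : (a - a₀ / 2) ^ 2 = a ^ 2 - a₀ * a + a₀ ^ 2 / 4 := by ring
      linarith [sq_nonneg (a - a₀ / 2), mul_nonneg hP.le hσ0]
    have h3 := mul_le_left h2 h1
    have h4 : ψ₂ * w * (p / (4 * (p - 1))) * a₀ ^ 2 = ψ₂ * (p / (p - 1) * w) * (a₀ ^ 2 / 4) := by
      field_simp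
    rw [h4]
    linarith
  have ie : -(|e| * (‖Z‖ * ‖gφ‖)) ≤ -(e * ⟪Z, gφ⟫) := by
    have h1 : |e * ⟪Z, gφ⟫| ≤ |e| * (‖Z‖ * ‖gφ‖) := by
      rw [abs_mul]; exact mul_le_left (abs_real_inner_le_norm _ _) (abs_nonneg _)
    linarith [le_abs_self (e * ⟪Z, gφ⟫)]
  have ie2 : -(|e| * (|D| + |a₀|)) ≤ -(e * (D + a₀)) := by
    have h1 : |e * (D + a₀)| ≤ |e| * (|D| + |a₀|) := by
      rw [abs_mul]; exact mul_le_left (abs_add_le _ _) (abs_nonneg _)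
    linarith [le_abs_self (e * (D + a₀))]
  have ie3 : 2 / ((d:ℝ) - 1) * (|e| * (gt + |a|)) ≤
      |e| * (2 / (d - 1) * (gt + (p - 1) * (m * ‖H‖))) := by
    have hd1 : (0:ℝ) < (d:ℝ) - 1 := by
      have : (2:ℝ) ≤ d := by exact_mod_cast hd
      linarith
    calc 2 / ((d:ℝ) - 1) * (|e| * (gt + |a|)) ≤
        2 / ((d:ℝ) - 1) * (|e| * (gt + (p - 1) * (m * ‖H‖))) := by gcongr
      _ = _ := by ring
  rw [hin, hZk]
  clear hin hZk iw iJ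
  generalize ⟪T - a₀ • Z, gw⟫ = q₁ at *
  generalize ⟪T - a₀ • Z, gξ⟫ = q₂ at *
  generalize ⟪Z, gφ⟫ = q₃ at *
  generalize 2 / ((d:ℝ) - 1) * (|e| * (gt + |a|)) = q₄ at *
  generalize 2 / ((d:ℝ) - 1) * (gt + (p - 1) * (m * ‖H‖)) = q₅ at *
  generalize (D - a) ^ 2 / ((d:ℝ) - 1) = q₆ at *
  have hDD : D ^ 2 + (gt + a₀) * D = -(gt * a₀) + e * (D + a₀) := by rw [he]; ring
  have k1 : c * G ^ 2 - |e| * q₅ + ε * y ^ 2 ≤ tr2 - (p + s * (p - 1) / p) * w * a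
      - (1 - b) * s * h * w + a₀ * gt + N * (p / (p - 1)) * (w / G) *
      ((a - a₀) ^ 2 + (p - 1) * σ) := by rw [hy]; linarith
  have k2 := mul_le_left k1 hφ0
  have k3 := mul_le_left iξ hψ
  have k4 := mul_le_left ie2 hφ0
  have k5 : ψ * (ε * ξ ^ 2 * y ^ 2) = φ * (ε * y ^ 2) := by rw [hφ]; ring
  have k6 : (tr2 - D ^ 2 - (gt + a₀) * D - ((p + s * (p - 1) / p) * w * a + (1 - b) * s * h * w)) * φ
      = φ * (tr2 - (p + s * (p - 1) / p) * w * a - (1 - b) * s * h * w + a₀ * gt) - φ * (e * (D + a₀)) := by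
    have : tr2 - D ^ 2 - (gt + a₀) * D = tr2 + gt * a₀ - e * (D + a₀) := by linarith
    rw [this]; ring
  rw [k6]
  linarith

end pointwise

section integralEstimate
variable {d : ℕ} {p s : ℝ} {Ω : Set (Eu d)} {f : Eu d → ℝ}

/-- The weight `((w + β e^{st}) e^{-γ t})^N`, `γ = s (p-1) / p`. -/
noncomputable def wgt (p s β N t w : ℝ) : ℝ :=
  exp (N * (log (w + β * exp (s * t)) - s * (p - 1) / p * t))

theorem wgt_pos (p s β N t w : ℝ) : 0 < wgt p s β N t w := exp_pos _

theorem continuous_wgt {X : Type*} [TopologicalSpace X] {β N : ℝ} (hβ : 0 < β) {t w : X → ℝ}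
    (ht : Continuous t) (hw : Continuous w) (hw0 : ∀ x, 0 ≤ w x) :
    Continuous fun x => wgt p s β N (t x) (w x) := by
  have h1 : Continuous fun x => log (w x + β * exp (s * t x)) :=
    Continuous.log (by fun_prop) fun x => by
      have := hw0 x; have := exp_pos (s * t x); positivity
  unfold wgt
  fun_prop

/-- The test function of the integral estimate. -/
noncomputable def tst (p s β N τ δ : ℝ) (K : ℕ) (ξ F : Eu d → ℝ) (x : Eu d) : ℝ :=
  wgt p s β N (F x) (‖∇F x‖ ^ p) * (max ((‖∇F x‖ ^ p) ^ τ - δ) 0) ^ 2 * ξ x ^ (K + 2)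

theorem hasGradientAt_tst {β N τ δ : ℝ} {K : ℕ} (hp : 1 < p) (hβ : 0 < β) {ξ F : Eu d → ℝ}
    (hF : ContDiff ℝ ∞ F) (hξ : ContDiff ℝ ∞ ξ) {x : Eu d} (hx : ∇F x ≠ 0)
    {w h G Φ y : ℝ} {gw : Eu d} (hw : w = ‖∇F x‖ ^ p) (hh : h = exp (s * F x))
    (hG : G = w + β * h) (hΦ : Φ = wgt p s β N (F x) w) (hy : y = max (w ^ τ - δ) 0)
    (hgw : gw = (p * ‖∇F x‖ ^ (p - 2)) • fderiv ℝ (∇F) x (∇F x)) :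
    HasGradientAt (tst p s β N τ δ K ξ F)
      ((Φ * y ^ 2 * ξ x ^ (K + 2) * N) • (G⁻¹ • (gw + (β * (s * h)) • ∇F x) -
        (s * (p - 1) / p) • ∇F x) + (Φ * y ^ 2 * ξ x ^ K * ((K:ℝ) + 2) * ξ x) • ∇ξ x
        + (Φ * ξ x ^ (K + 2) * (2 * y * (τ * w ^ (τ - 1)))) • gw) x := by
  have hw0 : 0 < w := by rw [hw]; have := norm_pos_iff.2 hx; positivity
  have hG0 : 0 < G := by rw [hG, hh]; positivity
  have dw : HasGradientAt (fun y => ‖∇F y‖ ^ p) gw x := by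
    rw [hgw]; exact hasGradientAt_norm_gradient_rpow hp hF x
  have dF : HasGradientAt F (∇F x) x :=
    hasGradientAt_of_contDiffAt (hF.contDiffAt.of_le (by norm_cast))
  have dξ : HasGradientAt ξ (∇ξ x) x :=
    hasGradientAt_of_contDiffAt (hξ.contDiffAt.of_le (by norm_cast))
  have dh : HasGradientAt (fun y => β * exp (s * F y)) ((β * (s * h)) • ∇F x) x := by
    refine HasGradientAt.comp_real (k := fun t => β * exp (s * t)) ?_ dF
    have := (((hasDerivAt_id (F x)).const_mul s).exp).const_mul β
    refine this.congr_deriv ?_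
    simp only [id, mul_one, hh]; ring
  have dG := HasGradientAt.add' dw dh
  have dl : HasGradientAt (fun y => log (‖∇F y‖ ^ p + β * exp (s * F y)))
      (G⁻¹ • (gw + (β * (s * h)) • ∇F x)) x := by
    refine HasGradientAt.comp_real (k := log) ?_ dG
    rw [← hw, ← hh, ← hG]
    exact Real.hasDerivAt_log hG0.ne'
  have dγ : HasGradientAt (fun y => s * (p - 1) / p * F y) ((s * (p - 1) / p) • ∇F x) x := by
    refine HasGradientAt.comp_real (k := fun t => s * (p - 1) / p * t) ?_ dF
    simpa using (hasDerivAt_id (F x)).const_mul (s * (p - 1) / p)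
  have dΦ : HasGradientAt (fun y => wgt p s β N (F y) (‖∇F y‖ ^ p))
      ((Φ * N) • (G⁻¹ • (gw + (β * (s * h)) • ∇F x) - (s * (p - 1) / p) • ∇F x)) x := by
    refine HasGradientAt.comp_real (k := fun t => exp (N * t)) ?_ (HasGradientAt.sub' dl dγ)
    have := ((hasDerivAt_id (log (‖∇F x‖ ^ p + β * exp (s * F x)) - s * (p - 1) / p * F x)).const_mul N).exp
    refine this.congr_deriv ?_
    simp only [id, mul_one, hΦ, wgt, hw]
  have dy : HasGradientAt (fun y => (max ((‖∇F y‖ ^ p) ^ τ - δ) 0) ^ 2)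
      ((2 * y * (τ * w ^ (τ - 1))) • gw) x := by
    refine HasGradientAt.comp_real (k := fun t => (max (t ^ τ - δ) 0) ^ 2) ?_ dw
    rw [← hw, hy]
    exact (hasDerivAt_posPart_sq (w ^ τ - δ)).comp w
      ((Real.hasDerivAt_rpow_const (Or.inl hw0.ne')).sub_const δ)
  have dk : HasGradientAt (fun y => ξ y ^ (K + 2)) ((((K:ℝ) + 2) * ξ x ^ (K + 1)) • ∇ξ x) x := by
    refine HasGradientAt.comp_real (k := fun t => t ^ (K + 2)) ?_ dξ
    have := hasDerivAt_pow (K + 2) (ξ x)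
    refine this.congr_deriv ?_
    push_cast; simp
  have := HasGradientAt.mul' (HasGradientAt.mul' dΦ dy) dk
  rw [← hw, ← hΦ, ← hy] at this
  have e : ∀ {g₁ g₂ : Eu d}, HasGradientAt (tst p s β N τ δ K ξ F) g₁ x → g₁ = g₂ →
    HasGradientAt (tst p s β N τ δ K ξ F) g₂ x := fun h1 h2 => h2 ▸ h1
  refine e this ?_
  module

theorem contDiff_tst {β N τ δ : ℝ} {K : ℕ} (hp : 1 < p) (hβ : 0 < β) (hτ : 0 < τ) (hδ : 0 < δ)
    {ξ F : Eu d → ℝ} (hF : ContDiff ℝ ∞ F) (hξ : ContDiff ℝ ∞ ξ) :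
    ContDiff ℝ 1 (tst p s β N τ δ K ξ F) := by
  have cw : ContDiff ℝ 1 fun x => ‖∇F x‖ ^ p :=
    (contDiff_norm_rpow hp).comp ((contDiff_gradient hF).of_le (by norm_cast))
  have cF : ContDiff ℝ 1 F := hF.of_le (by norm_cast)
  have cξ : ContDiff ℝ 1 ξ := hξ.of_le (by norm_cast)
  rw [contDiff_iff_contDiffAt]
  intro x
  by_cases hx : ∇F x = 0
  · have h1 : Tendsto (fun y => (‖∇F y‖ ^ p) ^ τ) (𝓝 x) (𝓝 ((‖∇F x‖ ^ p) ^ τ)) :=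
      (cw.continuous.rpow_const fun _ => Or.inr hτ.le).tendsto x
    rw [hx, norm_zero, zero_rpow (by linarith), zero_rpow hτ.ne'] at h1
    have h2 : tst p s β N τ δ K ξ F =ᶠ[𝓝 x] fun _ => 0 := by
      filter_upwards [h1.eventually (gt_mem_nhds hδ)] with y hy
      rw [tst, max_eq_right (by linarith)]; ring
    exact contDiffAt_const.congr_of_eventuallyEq h2
  · have hw0 : ‖∇F x‖ ^ p ≠ 0 := by have := norm_pos_iff.2 hx; positivity
    have c1 : ContDiffAt ℝ 1 (fun x => (‖∇F x‖ ^ p) ^ τ - δ) x :=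
      (cw.contDiffAt.rpow_const_of_ne hw0).sub contDiffAt_const
    have c2 := contDiff_posPart_sq.contDiffAt.comp x c1
    have c3 : ContDiffAt ℝ 1 (fun x => wgt p s β N (F x) (‖∇F x‖ ^ p)) x := by
      have c4 : ContDiffAt ℝ 1 (fun x => ‖∇F x‖ ^ p + β * exp (s * F x)) x :=
        cw.contDiffAt.add (contDiffAt_const.mul (contDiffAt_const.mul cF.contDiffAt).exp)
      have c5 := c4.log (by have := exp_pos (s * F x); positivity)
      exact (contDiffAt_const.mul (c5.sub (contDiffAt_const.mul cF.contDiffAt))).exp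
    exact (c3.mul c2).mul (cξ.contDiffAt.pow (K + 2))

end integralEstimate

section integralEstimate
variable {d : ℕ} {p s : ℝ} {Ω : Set (Eu d)} {f : Eu d → ℝ}

theorem norm_test_gradient_le {v gξ : Eu d} {H : Eu d →L[ℝ] Eu d} {n Gi k γ c₁ c₂ m : ℝ}
    (hn : 0 ≤ n) (hG : 0 ≤ Gi) (hk : 0 ≤ k) (hγ : 0 ≤ γ) (h₁ : 0 ≤ c₁) (h₂ : 0 ≤ c₂) (hm : 0 ≤ m) :
    ‖n • (Gi • (m • H v + k • v) - γ • v) + c₁ • gξ + c₂ • (m • H v)‖ ≤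
      (n * (Gi * (m * ‖v‖ + k * ‖v‖) + γ * ‖v‖) + c₁ * ‖gξ‖ + c₂ * (m * ‖v‖)) * (1 + ‖H‖) := by
  have hHv := H.le_opNorm v
  have h1 : ‖m • H v‖ ≤ m * ‖v‖ * ‖H‖ := by
    rw [norm_smul, norm_of_nonneg hm, mul_assoc, mul_comm ‖v‖]
    exact mul_le_left hHv hm
  have h2 : ‖Gi • (m • H v + k • v) - γ • v‖ ≤ Gi * (m * ‖v‖ * ‖H‖ + k * ‖v‖) + γ * ‖v‖ := by
    refine (norm_sub_le _ _).trans ?_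
    rw [norm_smul, norm_smul, norm_of_nonneg hG, norm_of_nonneg hγ]
    gcongr
    refine (norm_add_le _ _).trans ?_
    rw [norm_smul k, norm_of_nonneg hk]
    gcongr
  have h3 : ‖n • (Gi • (m • H v + k • v) - γ • v) + c₁ • gξ + c₂ • (m • H v)‖ ≤
      n * (Gi * (m * ‖v‖ * ‖H‖ + k * ‖v‖) + γ * ‖v‖) + c₁ * ‖gξ‖ + c₂ * (m * ‖v‖ * ‖H‖) := by
    refine (norm_add₃_le).trans ?_
    rw [norm_smul n, norm_smul c₁, norm_smul c₂, norm_of_nonneg hn, norm_of_nonneg h₁, norm_of_nonneg h₂]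
    gcongr
  refine h3.trans ?_
  have hH0 := norm_nonneg H
  have i1 : 0 ≤ n * (Gi * (m * ‖v‖)) := by positivity
  have i2 : 0 ≤ n * (Gi * (k * ‖v‖)) * ‖H‖ := by positivity
  have i3 : 0 ≤ n * (γ * ‖v‖) * ‖H‖ := by positivity
  have i4 : 0 ≤ c₁ * ‖gξ‖ * ‖H‖ := by positivity
  have i5 : 0 ≤ c₂ * (m * ‖v‖) := by positivity
  linarith

theorem abs_trC_le (hp : 1 < p) (hd : 2 ≤ d) {v : Eu d} (hv : v ≠ 0)
    {H L : Eu d →L[ℝ] Eu d} (hH : ∀ x y, ⟪H x, y⟫ = ⟪x, H y⟫) (hL : L = (DA p v).comp H) :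
    |trC d L| ≤ d * max 1 (p - 1) * (‖v‖ ^ (p - 2) * ‖H‖) := by
  have h1 := (trC_sq_ge hp hd hv hH hL rfl rfl).2.2
  refine abs_le_of_sq_le_sq ?_ (by positivity)
  refine h1.trans (le_of_eq ?_)
  ring

/-- The integrand of the integral estimate, as a function of `(x, f, ∇f)`. -/
noncomputable def Rst (p s b β c ε N τ δ : ℝ) (K : ℕ) (ξ : Eu d → ℝ) (z : Jet d) : ℝ :=
  wgt p s β N z.2.1 (‖z.2.2‖ ^ p) * (c * ((max ((‖z.2.2‖ ^ p) ^ τ - δ) 0) ^ 2 * ξ z.1 ^ (K + 2)) *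
        (‖z.2.2‖ ^ p + β * exp (s * z.2.1)) ^ 2
      - ξ z.1 ^ (K + 2) * (2 * max ((‖z.2.2‖ ^ p) ^ τ - δ) 0 * (τ * (‖z.2.2‖ ^ p) ^ τ)) *
        (p / (4 * (p - 1))) *
        (s * (p - 1) ^ 2 / p ^ 2 * ‖z.2.2‖ ^ p - b * exp (s * z.2.1)) ^ 2
      - (max ((‖z.2.2‖ ^ p) ^ τ - δ) 0) ^ 2 * ξ z.1 ^ K * (((K:ℝ) + 2) ^ 2 / (4 * ε)) *
        ‖∇ξ z.1‖ ^ 2 * ‖A p z.2.2‖ ^ 2)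

theorem continuous_jet {β N τ : ℝ} {ξ : Eu d → ℝ} (hp : 1 < p) (hβ : 0 < β) (hτ : 0 < τ)
    (hξ : ContDiff ℝ ∞ ξ) : (Continuous fun z : Jet d => ‖z.2.2‖ ^ p) ∧
    (Continuous fun z : Jet d => (‖z.2.2‖ ^ p) ^ τ) ∧
    (Continuous fun z : Jet d => wgt p s β N z.2.1 (‖z.2.2‖ ^ p)) ∧
    (Continuous fun z : Jet d => ∇ξ z.1) ∧ (Continuous fun z : Jet d => A p z.2.2) ∧
    Continuous fun z : Jet d => ξ z.1 := by
  have c1 : Continuous fun z : Jet d => ‖z.2.2‖ ^ p :=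
    (by fun_prop : Continuous fun z : Jet d => ‖z.2.2‖).rpow_const fun _ => Or.inr (by linarith)
  exact ⟨c1, c1.rpow_const fun _ => Or.inr hτ.le,
    continuous_wgt hβ (by fun_prop) c1 fun z => by positivity,
    (continuous_gradient (hξ.of_le (by norm_cast))).comp continuous_fst,
    (continuous_A hp).comp (by fun_prop), hξ.continuous.comp continuous_fst⟩

theorem continuous_Rst {b β c ε N τ δ : ℝ} {K : ℕ} {ξ : Eu d → ℝ} (hp : 1 < p) (hβ : 0 < β)
    (hτ : 0 < τ) (hξ : ContDiff ℝ ∞ ξ) : Continuous (Rst p s b β c ε N τ δ K ξ) := by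
  obtain ⟨c1, c2, c3, c4, c5, c6⟩ := continuous_jet (s := s) (N := N) hp hβ hτ hξ
  unfold Rst
  fun_prop

/-- Multiplier of the residual in the error term of the integral estimate. -/
noncomputable def Est (p s b β N τ δ : ℝ) (K : ℕ) (ξ : Eu d → ℝ) (z : Jet d) : ℝ :=
  ‖A p z.2.2‖ * ((wgt p s β N z.2.1 (‖z.2.2‖ ^ p) * (max ((‖z.2.2‖ ^ p) ^ τ - δ) 0) ^ 2 *
      ξ z.1 ^ (K + 2) * N) * ((‖z.2.2‖ ^ p + β * exp (s * z.2.1))⁻¹ *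
        (p * ‖z.2.2‖ ^ (p - 2) * ‖z.2.2‖ + β * (s * exp (s * z.2.1)) * ‖z.2.2‖)
        + s * (p - 1) / p * ‖z.2.2‖)
      + (wgt p s β N z.2.1 (‖z.2.2‖ ^ p) * (max ((‖z.2.2‖ ^ p) ^ τ - δ) 0) ^ 2 *
        ξ z.1 ^ K * ((K:ℝ) + 2) * ξ z.1) * ‖∇ξ z.1‖
      + (wgt p s β N z.2.1 (‖z.2.2‖ ^ p) * ξ z.1 ^ (K + 2) *
        (2 * max ((‖z.2.2‖ ^ p) ^ τ - δ) 0 * (τ * (‖z.2.2‖ ^ p) ^ (τ - 1)))) *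
        (p * ‖z.2.2‖ ^ (p - 2) * ‖z.2.2‖))
    + (wgt p s β N z.2.1 (‖z.2.2‖ ^ p) * (max ((‖z.2.2‖ ^ p) ^ τ - δ) 0) ^ 2 * ξ z.1 ^ (K + 2)) *
      (d * max 1 (p - 1) * ‖z.2.2‖ ^ (p - 2) + |s * (p - 1) ^ 2 / p ^ 2 * ‖z.2.2‖ ^ p - b * exp (s * z.2.1)|
        + 2 / (d - 1) * ((p - 1) * ‖z.2.2‖ ^ p + exp (s * z.2.1) + (p - 1) * ‖z.2.2‖ ^ (p - 2)))

theorem continuousOn_Est {b β N τ δ : ℝ} {K : ℕ} {ξ : Eu d → ℝ} (hp : 1 < p) (hβ : 0 < β)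
    (hτ : 0 < τ) (hξ : ContDiff ℝ ∞ ξ) :
    ContinuousOn (Est p s b β N τ δ K ξ) {z | z.2.2 ≠ 0} := by
  have c0 : Continuous fun z : Jet d => ‖z.2.2‖ := by fun_prop
  obtain ⟨d1, d2, d3, d4, d5, d6⟩ := continuous_jet (s := s) (N := N) hp hβ hτ hξ
  have c1 := d1.continuousOn (s := {z | z.2.2 ≠ 0})
  have c2 := d2.continuousOn (s := {z | z.2.2 ≠ 0})
  have c3 := d3.continuousOn (s := {z | z.2.2 ≠ 0})
  have c4 := d4.continuousOn (s := {z | z.2.2 ≠ 0})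
  have c5 := d5.continuousOn (s := {z | z.2.2 ≠ 0})
  have c6 := d6.continuousOn (s := {z | z.2.2 ≠ 0})
  have c7 : ContinuousOn (fun z : Jet d => ‖z.2.2‖ ^ (p - 2)) {z | z.2.2 ≠ 0} :=
    c0.continuousOn.rpow_const fun z hz => Or.inl (norm_ne_zero_iff.2 hz)
  have c8 : ContinuousOn (fun z : Jet d => (‖z.2.2‖ ^ p) ^ (τ - 1)) {z | z.2.2 ≠ 0} :=
    c1.rpow_const fun z hz => Or.inl (by have := norm_pos_iff.2 (show z.2.2 ≠ 0 from hz); positivity)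
  have c9 : ContinuousOn (fun z : Jet d =>
      (‖z.2.2‖ ^ p + β * exp (s * z.2.1))⁻¹) {z | z.2.2 ≠ 0} := by
    refine ContinuousOn.inv₀ (by fun_prop) fun z _ => ?_
    have := exp_pos (s * z.2.1); positivity
  have cn : ContinuousOn (fun z : Jet d => ‖z.2.2‖) {z | z.2.2 ≠ 0} := c0.continuousOn
  have cy : ContinuousOn (fun z : Jet d => max ((‖z.2.2‖ ^ p) ^ τ - δ) 0)
    {z | z.2.2 ≠ 0} := (c2.sub continuousOn_const).sup continuousOn_const
  have ch : ContinuousOn (fun z : Jet d => exp (s * z.2.1)) {z | z.2.2 ≠ 0} := by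
    fun_prop
  have cm := (continuousOn_const (c := p)).mul c7
  have ca : ContinuousOn (fun z : Jet d =>
      |s * (p - 1) ^ 2 / p ^ 2 * ‖z.2.2‖ ^ p - b * exp (s * z.2.1)|) {z | z.2.2 ≠ 0} :=
    ((continuousOn_const.mul c1).sub (continuousOn_const.mul ch)).abs
  have cφ := (c3.mul (cy.pow 2)).mul (c6.pow (K + 2))
  refine (c5.norm.mul (((((cφ.mul continuousOn_const).mul ((c9.mul ((cm.mul cn).add
    ((continuousOn_const.mul (continuousOn_const.mul ch)).mul cn))).add
    (continuousOn_const.mul cn)))).add (((((c3.mul (cy.pow 2)).mul (c6.pow K)).mul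
    continuousOn_const).mul c6).mul c4.norm)).add (((c3.mul (c6.pow (K + 2))).mul
    ((continuousOn_const.mul cy).mul (continuousOn_const.mul c8))).mul (cm.mul cn)))).add
    (cφ.mul (((continuousOn_const.mul c7).add ca).add (continuousOn_const.mul
    (((continuousOn_const.mul c1).add ch).add (continuousOn_const.mul c7)))))

theorem residual_term_le {Z g B φ t cm a q gt Pm H E C e : ℝ} (hZ : 0 ≤ Z) (hφ : 0 ≤ φ) (he : 0 ≤ e)
    (hH : 0 ≤ H) (hcm : 0 ≤ cm) (ha : 0 ≤ a) (hq : 0 ≤ q) (hgt : 0 ≤ gt) (hPm : 0 ≤ Pm)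
    (hg : g ≤ B * (1 + H)) (ht : t ≤ cm * H)
    (hE : E = Z * B + φ * (cm + a + q * (gt + Pm))) (hC : E ≤ C) :
    e * (Z * g + φ * (t + a + q * (gt + Pm * H))) ≤ C * (e * (1 + H)) := by
  have h1 : Z * g ≤ Z * (B * (1 + H)) := mul_le_left hg hZ
  have h2 : t + a + q * (gt + Pm * H) ≤ (cm + a + q * (gt + Pm)) * (1 + H) := by
    have i1 : 0 ≤ a * H := by positivity
    have i2 : 0 ≤ q * gt * H := by positivity
    have i3 : 0 ≤ q * Pm := by positivity
    linarith
  have h3 := mul_le_left h2 hφ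
  have h4 : Z * g + φ * (t + a + q * (gt + Pm * H)) ≤ E * (1 + H) := by rw [hE]; linarith
  have h5 : E * (1 + H) ≤ C * (1 + H) := mul_le_right hC (by linarith)
  calc _ ≤ e * (C * (1 + H)) := mul_le_left (h4.trans h5) he
    _ = _ := by ring

/-- The integral estimate with a cutoff of the critical set. -/
theorem WeakEq.integral_Rst_nonpos {b β c ε N τ δ : ℝ} {K : ℕ} {ξ : Eu d → ℝ} (hp : 1 < p)
    (hd : 2 ≤ d) (hs : 0 < s) (hb : 0 < b) (hβ : β = p ^ 2 * b / ((p - 1) * s)) (hε : 0 < ε)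
    (hN : 0 ≤ N) (hco : Coercive d p s b β c ε N) (h : WeakEq p Ω f (rhs p s f))
    (hξ : ContDiff ℝ ∞ ξ) (hξc : HasCompactSupport ξ) (hξΩ : tsupport ξ ⊆ Ω) (hξ0 : ∀ x, 0 ≤ ξ x)
    (hτ : 0 < τ) (hδ : 0 < δ) (hK : K ≠ 0) :
    ∫ x, Rst p s b β c ε N τ δ K ξ (x, f x, ∇f x) ≤ 0 := by
  have hP : 0 < p - 1 := by linarith
  have hβ0 : 0 < β := by rw [hβ]; positivity
  have hcK : IsCompact (tsupport ξ) := hξc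
  obtain ⟨M₁, hM₁⟩ := hcK.exists_bound_of_continuousOn (h.c1.continuousOn.mono hξΩ)
  obtain ⟨M₂, hM₂⟩ := hcK.exists_bound_of_continuousOn (h.continuousOn_gradient.mono hξΩ)
  obtain ⟨c₀, hc₀, hc₀'⟩ : ∃ c₀ > 0, ∀ v : Eu d, δ ≤ (‖v‖ ^ p) ^ τ → c₀ ≤ ‖v‖ := by
    refine ⟨δ ^ (1 / (p * τ)), by positivity, fun v hv => ?_⟩
    rw [← rpow_mul (norm_nonneg _)] at hv
    have := rpow_le_rpow hδ.le hv (show 0 ≤ 1 / (p * τ) by positivity)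
    rwa [← rpow_mul (norm_nonneg _), mul_one_div_cancel (by positivity), Real.rpow_one] at this
  obtain ⟨S, hS⟩ : ∃ S : Set (Jet d), S = tsupport ξ ×ˢ (closedBall 0 (M₁ + 1) ×ˢ
    (closedBall 0 (M₂ + 1) ∩ {v | c₀ ≤ ‖v‖})) := ⟨_, rfl⟩
  have hSc : IsCompact S := by
    rw [hS]
    exact hcK.prod ((isCompact_closedBall _ _).prod ((isCompact_closedBall _ _).inter_right
      (isClosed_le continuous_const continuous_norm)))
  obtain ⟨C, hC⟩ := hSc.exists_bound_of_continuousOn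
    ((continuousOn_Est (p := p) (s := s) (b := b) (N := N) (δ := δ) (K := K) hp hβ0 hτ hξ).mono
      (fun z hz h0 => by
        rw [hS] at hz
        have := hz.2.2.2
        rw [mem_setOf_eq, h0, norm_zero] at this
        linarith))
  refine h.integral_nonpos_of_approx hp hcK hξΩ hc₀ one_pos (C := max C 0) (continuous_Rst hp hβ0 hτ hξ) ?_ ?_
  · intro x t v hx
    simp [Rst, eq_zero_of_notMem hx, hK]
  intro F hF hFf
  have hφ := contDiff_tst (s := s) (N := N) (K := K) hp hβ0 hτ hδ hF hξ
  have hts : tsupport (tst p s β N τ δ K ξ F) ⊆ tsupport ξ := by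
    refine closure_mono fun x hx => ?_
    rw [Function.mem_support] at hx ⊢
    intro h0; apply hx; rw [tst, h0]; simp
  have cgF : Continuous (∇F) := (contDiff_gradient hF).continuous
  have hts2 : ∀ x ∈ tsupport (tst p s β N τ δ K ξ F), c₀ ≤ ‖∇F x‖ := by
    intro x hx
    have hcl : IsClosed {x : Eu d | c₀ ≤ ‖∇F x‖} :=
      isClosed_le continuous_const cgF.norm
    refine closure_minimal (fun y hy => ?_) hcl hx
    refine hc₀' _ ?_
    by_contra hlt
    rw [Function.mem_support, tst, max_eq_right (by linarith)] at hy
    simp at hy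
  have hne : ∀ x, c₀ ≤ ‖∇F x‖ → ∇F x ≠ 0 := fun x hx h0 => by
    rw [h0, norm_zero] at hx; linarith
  have cRF : Continuous fun x => Rst p s b β c ε N τ δ K ξ (x, F x, ∇F x) :=
    (continuous_Rst hp hβ0 hτ hξ).comp (continuous_id.prodMk (hF.continuous.prodMk cgF))
  refine bochner_le (Z := fun y => A p (∇F y)) (Y := fun _ => 0)
    (k := fun x => (p - 1 + s * (p - 1) ^ 2 / p ^ 2) * ‖∇F x‖ ^ p +
      (1 - b) * Real.exp (s * F x)) hφ (hcK.of_isClosed_subset (isClosed_tsupport _) hts)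
    (fun x hx => contDiffAt_A_gradient hF (hne x (hts2 x hx))) ?_ (fun x _ => contDiffAt_const)
    ?_ ?_ (le_max_right _ _) ?_ ?_ ?_
  · intro x _
    have cw : ContDiff ℝ 1 fun x => ‖∇F x‖ ^ p :=
      (contDiff_norm_rpow hp).comp ((contDiff_gradient hF).of_le (by norm_cast))
    have cF : ContDiff ℝ 1 F := hF.of_le (by norm_cast)
    exact ((contDiff_const.mul cw).add (contDiff_const.mul (contDiff_const.mul cF).exp)).contDiffAt
  · refine cRF.integrable_of_hasCompactSupport (hcK.of_isClosed_subset (isClosed_tsupport _)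
      (closure_minimal (fun x hx => ?_) (isClosed_tsupport _)))
    by_contra hc
    refine hx ?_
    simp [Rst, eq_zero_of_notMem hc, hK]
  · exact ((isClosed_tsupport _).inter (isClosed_le continuous_const cgF.norm)).measurableSet
  · exact fun x hx hx' => hx ⟨hts hx', hts2 x hx'⟩
  · intro x hx
    by_cases hxξ : x ∈ tsupport ξ
    · have h1 : ¬ c₀ ≤ ‖∇F x‖ := fun h1 => hx ⟨hxξ, h1⟩
      have h2 : max ((‖∇F x‖ ^ p) ^ τ - δ) 0 = 0 := by
        refine max_eq_right ?_
        by_contra h3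
        exact h1 (hc₀' _ (by linarith))
      simp [Rst, h2]
    · simp [Rst, eq_zero_of_notMem hxξ, hK]
  · rintro x ⟨hxξ, hxc⟩
    have hv := hne x hxc
    obtain ⟨v, hvd⟩ : ∃ v, v = ∇F x := ⟨_, rfl⟩
    obtain ⟨H, hHd⟩ : ∃ H, H = fderiv ℝ (∇F) x := ⟨_, rfl⟩
    have hsym : ∀ y z, ⟪H y, z⟫ = ⟪y, H z⟫ := by rw [hHd]; exact hessian_symm hF x
    obtain ⟨L, hL⟩ : ∃ L, L = (DA p v).comp H := ⟨_, rfl⟩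
    have hfZ : fderiv ℝ (fun y => A p (∇F y)) x = L := by
      rw [fderiv_A_gradient hF hv, hL, hvd, hHd]
    have hdvZ : dv (fun y => A p (∇F y)) x = trC d L := by rw [dv_eq_trC, hfZ]
    have hgφ := (hasGradientAt_tst (p := p) (s := s) (β := β) (N := N) (τ := τ) (δ := δ) (K := K)
      hp hβ0 hF hξ hv rfl rfl rfl rfl rfl rfl).gradient
    have hgk : ∇(fun x => (p - 1 + s * (p - 1) ^ 2 / p ^ 2) * ‖∇F x‖ ^ p +
        (1 - b) * Real.exp (s * F x)) x = (p - 1 + s * (p - 1) ^ 2 / p ^ 2) •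
        ((p * ‖v‖ ^ (p - 2)) • H v) + ((1 - b) * (s * Real.exp (s * F x))) • v := by
      refine HasGradientAt.gradient (HasGradientAt.add' ?_ ?_)
      · refine HasGradientAt.comp_real (k := fun t => (p - 1 + s * (p - 1) ^ 2 / p ^ 2) * t) ?_ ?_
        · simpa using (hasDerivAt_id (‖∇F x‖ ^ p)).const_mul (p - 1 + s * (p - 1) ^ 2 / p ^ 2)
        · rw [hvd, hHd]; exact hasGradientAt_norm_gradient_rpow hp hF x
      · refine HasGradientAt.comp_real (k := fun t => (1 - b) * Real.exp (s * t)) ?_ ?_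
        · have := (((hasDerivAt_id (F x)).const_mul s).exp).const_mul (1 - b)
          refine this.congr_deriv ?_
          simp only [id, mul_one]; ring
        · rw [hvd]; exact hasGradientAt_of_contDiffAt (hF.contDiffAt.of_le (by norm_cast))
    have hdv0 : dv (fun _ : Eu d => (0 : Eu d)) x = 0 := by simp [dv]
    have hdvr : resid p s F x = trC d L + ((p - 1) * ‖v‖ ^ p + Real.exp (s * F x)) := by
      rw [resid, hdvZ, rhs, hvd]
    rw [hgk, hfZ, hdvZ, hgφ, hdv0, ← hvd, ← hHd, tst, ← hvd]
    rw [← hvd] at hxc hv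
    have hmem : (x, F x, v) ∈ S := by
      rw [hS]
      refine ⟨hxξ, ?_, ?_, hxc⟩
      · rw [mem_closedBall_zero_iff]
        have h1 := (hFf x hxξ).1
        have h2 := hM₁ x hxξ
        have h3 := norm_sub_norm_le (F x) (f x)
        rw [norm_eq_abs (F x - f x)] at h3
        linarith
      · rw [mem_closedBall_zero_iff]
        have h1 := (hFf x hxξ).2
        have h2 := hM₂ x hxξ
        have h3 := norm_sub_norm_le (∇F x) (∇f x)
        rw [hvd]; linarith
    have hCx : Est p s b β N τ δ K ξ (x, F x, v) ≤ max C 0 :=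
      (le_abs_self _).trans ((hC _ hmem).trans (le_max_left _ _))
    have hvn : 0 < ‖v‖ := norm_pos_iff.2 hv
    have hΦ0 := (wgt_pos p s β N (F x) (‖v‖ ^ p)).le
    have hh0 := exp_pos (s * F x)
    have hy0 : 0 ≤ max ((‖v‖ ^ p) ^ τ - δ) 0 := le_max_right _ _
    have hξx := hξ0 x
    have main := integrand_ge hp hd hs hb hβ hε hN hco hv hsym hL (M := (K:ℝ) + 2) (gξ := ∇ξ x)
      (ψ := wgt p s β N (F x) (‖v‖ ^ p) * max ((‖v‖ ^ p) ^ τ - δ) 0 ^ 2 * ξ x ^ K)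
      (ψ₂ := wgt p s β N (F x) (‖v‖ ^ p) * ξ x ^ (K + 2) *
        (2 * max ((‖v‖ ^ p) ^ τ - δ) 0 * (τ * (‖v‖ ^ p) ^ (τ - 1)))) (ξ := ξ x)
      (φ := wgt p s β N (F x) (‖v‖ ^ p) * max ((‖v‖ ^ p) ^ τ - δ) 0 ^ 2 * ξ x ^ (K + 2))
      rfl rfl hh0 rfl rfl rfl rfl rfl hdvr (by ring) (by positivity) (by positivity) hξx
      (by positivity) rfl
    have hgb := norm_test_gradient_le (v := v) (gξ := ∇ξ x) (H := H)
      (n := wgt p s β N (F x) (‖v‖ ^ p) * max ((‖v‖ ^ p) ^ τ - δ) 0 ^ 2 * ξ x ^ (K + 2) * N)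
      (Gi := (‖v‖ ^ p + β * Real.exp (s * F x))⁻¹) (k := β * (s * Real.exp (s * F x)))
      (γ := s * (p - 1) / p)
      (c₁ := wgt p s β N (F x) (‖v‖ ^ p) * max ((‖v‖ ^ p) ^ τ - δ) 0 ^ 2 * ξ x ^ K * ((K:ℝ) + 2) * ξ x)
      (c₂ := wgt p s β N (F x) (‖v‖ ^ p) * ξ x ^ (K + 2) *
        (2 * max ((‖v‖ ^ p) ^ τ - δ) 0 * (τ * (‖v‖ ^ p) ^ (τ - 1)))) (m := p * ‖v‖ ^ (p - 2))
      (by positivity) (by positivity) (by positivity) (by positivity) (by positivity)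
      (by positivity) (by positivity)
    have htrL := abs_trC_le hp hd hv hsym hL
    have hd1 : (0:ℝ) < (d:ℝ) - 1 := by
      have : (2:ℝ) ≤ d := by exact_mod_cast hd
      linarith
    have herr := residual_term_le (norm_nonneg (A p v)) (φ := wgt p s β N (F x) (‖v‖ ^ p) *
      max ((‖v‖ ^ p) ^ τ - δ) 0 ^ 2 * ξ x ^ (K + 2)) (q := 2 / ((d:ℝ) - 1))
      (gt := (p - 1) * ‖v‖ ^ p + Real.exp (s * F x)) (Pm := (p - 1) * ‖v‖ ^ (p - 2))
      (a := |s * (p - 1) ^ 2 / p ^ 2 * ‖v‖ ^ p - b * Real.exp (s * F x)|)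
      (cm := d * max 1 (p - 1) * ‖v‖ ^ (p - 2)) (by positivity) (abs_nonneg (resid p s F x))
      (norm_nonneg H) (by positivity) (abs_nonneg _) (by positivity) (by positivity) (by positivity)
      hgb (htrL.trans (le_of_eq (by ring))) rfl hCx
    have e1 : (‖v‖ ^ p) ^ τ = (‖v‖ ^ p) ^ (τ - 1) * ‖v‖ ^ p := by
      rw [← rpow_add_one (by positivity)]; congr 1; ring
    rw [add_zero, add_zero]
    have hk : (p - 1 + s * (p - 1) ^ 2 / p ^ 2) * ‖v‖ ^ p + (1 - b) * Real.exp (s * F x) =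
      (p - 1) * ‖v‖ ^ p + Real.exp (s * F x) +
        (s * (p - 1) ^ 2 / p ^ 2 * ‖v‖ ^ p - b * Real.exp (s * F x)) := by ring
    rw [hk]
    rw [mul_assoc (p - 1) (‖v‖ ^ (p - 2)) ‖H‖] at herr
    generalize ⟪L (A p v) - _, _⟫ = q₁ at main ⊢
    generalize trC d (L.comp L) - _ - _ - _ = q₂ at main ⊢
    refine le_trans (le_of_eq ?_) (main.trans (add_le_add le_rfl herr))
    simp only [Rst]
    generalize max ((‖v‖ ^ p) ^ τ - δ) 0 = y
    rw [e1]
    ring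

end integralEstimate

section integralEstimate
variable {d : ℕ} {p s : ℝ} {Ω : Set (Eu d)} {f : Eu d → ℝ}

theorem WeakEq.integrable_comp {g : Eu d → ℝ} (h : WeakEq p Ω f g) {K₀ : Set (Eu d)}
    (hK₀ : IsCompact K₀) (hK₀Ω : K₀ ⊆ Ω) {Γ : Jet d → ℝ} (hΓ : Continuous Γ)
    (h0 : ∀ x t v, x ∉ K₀ → Γ (x, t, v) = 0) : Integrable fun x => Γ (x, f x, ∇f x) := by
  have h1 : IntegrableOn (fun x => Γ (x, f x, ∇f x)) K₀ := by
    refine ContinuousOn.integrableOn_compact hK₀ ?_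
    exact hΓ.comp_continuousOn (continuousOn_id.prodMk ((h.c1.continuousOn.mono hK₀Ω).prodMk
      (h.continuousOn_gradient.mono hK₀Ω)))
  refine (integrableOn_iff_integrable_of_support_subset fun x hx => ?_).1 h1
  by_contra hc
  exact hx (h0 _ _ _ hc)

theorem cutoff_removal {Φ u y δ c ξ X G a k τ : ℝ} (hΦ : 0 ≤ Φ) (hu : 0 ≤ u) (hδ : 0 < δ)
    (hc : 0 ≤ c) (hy : y = max (u - δ) 0) (hξ : 0 ≤ ξ) (hX : 0 ≤ X) (hG : 0 ≤ G) (hk : 0 ≤ k)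
    (ha : 0 ≤ a) (hτ : 0 < τ) (h : 2 * τ * k * a ≤ c / 2 * G) :
    Φ * u ^ 2 * (c / 2 * ξ * G - X) ≤ Φ * (c * (y ^ 2 * ξ) * G - ξ * (2 * y * (τ * u)) * k * a
      - y ^ 2 * X) + 2 * δ * (Φ * (c * u * ξ * G)) := by
  have hy0 : 0 ≤ y := by rw [hy]; exact le_max_right _ _
  have hyu : y ≤ u := by rw [hy]; exact max_le (by linarith) hu
  have hy1 : u - δ ≤ y := by rw [hy]; exact le_max_left _ _
  have h1 : y ^ 2 ≤ u ^ 2 := pow_le_pow_left₀ hy0 hyu 2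
  have h2 : u ^ 2 - 2 * δ * u ≤ y ^ 2 := by
    rcases le_total δ u with h | h
    · have := pow_le_pow_left₀ (by linarith) hy1 2
      nlinarith
    · nlinarith
  have i1 : c * ξ * G * (u ^ 2 - 2 * δ * u) ≤ c * ξ * G * y ^ 2 :=
    mul_le_left h2 (by positivity)
  have i2 : ξ * (2 * y * (τ * u)) * k * a ≤ ξ * u ^ 2 * (c / 2 * G) := by
    calc ξ * (2 * y * (τ * u)) * k * a = ξ * (y * u) * (2 * τ * k * a) := by ring
      _ ≤ ξ * (u * u) * (2 * τ * k * a) := by gcongr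
      _ ≤ ξ * (u * u) * (c / 2 * G) := by gcongr
      _ = _ := by ring
  have i3 : y ^ 2 * X ≤ u ^ 2 * X := mul_le_right h1 hX
  have i4 : u ^ 2 * (c / 2 * ξ * G - X) ≤ (c * (y ^ 2 * ξ) * G - ξ * (2 * y * (τ * u)) * k * a
      - y ^ 2 * X) + 2 * δ * (c * u * ξ * G) := by linarith
  have := mul_le_left i4 hΦ
  linarith

/-- Integral estimate, with the weight `w^(2τ)` in place of a cutoff of the critical set. -/
theorem WeakEq.integral_estimate {b β c ε N τ : ℝ} {K : ℕ} {ξ : Eu d → ℝ} (hp : 1 < p)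
    (hd : 2 ≤ d) (hs : 0 < s) (hb : 0 < b) (hβ : β = p ^ 2 * b / ((p - 1) * s)) (hε : 0 < ε)
    (hN : 0 ≤ N) (hc : 0 ≤ c) (hco : Coercive d p s b β c ε N) (h : WeakEq p Ω f (rhs p s f))
    (hξ : ContDiff ℝ ∞ ξ) (hξc : HasCompactSupport ξ) (hξΩ : tsupport ξ ⊆ Ω) (hξ0 : ∀ x, 0 ≤ ξ x)
    (hτ : 0 < τ) (hK : K ≠ 0)
    (hτc : ∀ w h : ℝ, 0 ≤ w → 0 ≤ h → 2 * τ * (p / (4 * (p - 1))) *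
      (s * (p - 1) ^ 2 / p ^ 2 * w - b * h) ^ 2 ≤ c / 2 * (w + β * h) ^ 2) :
    ∃ F : Eu d → ℝ, (F = fun x => wgt p s β N (f x) (‖∇f x‖ ^ p) * ((‖∇f x‖ ^ p) ^ τ) ^ 2 *
      (c / 2 * ξ x ^ (K + 2) * (‖∇f x‖ ^ p + β * Real.exp (s * f x)) ^ 2 -
        ξ x ^ K * (((K:ℝ) + 2) ^ 2 / (4 * ε)) * ‖∇ξ x‖ ^ 2 * ‖A p (∇f x)‖ ^ 2)) ∧
      Integrable F ∧ ∫ x, F x ≤ 0 := by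
  have hP : 0 < p - 1 := by linarith
  have hβ0 : 0 < β := by rw [hβ]; positivity
  obtain ⟨c1, c2, c3, c4, c5, c6⟩ := continuous_jet (s := s) (N := N) hp hβ0 hτ hξ
  have i0 := h.integrable_comp hξc hξΩ (Γ := fun z =>
    wgt p s β N z.2.1 (‖z.2.2‖ ^ p) * ((‖z.2.2‖ ^ p) ^ τ) ^ 2 *
      (c / 2 * ξ z.1 ^ (K + 2) * (‖z.2.2‖ ^ p + β * Real.exp (s * z.2.1)) ^ 2 -
        ξ z.1 ^ K * (((K:ℝ) + 2) ^ 2 / (4 * ε)) * ‖∇ξ z.1‖ ^ 2 * ‖A p z.2.2‖ ^ 2))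
    (by fun_prop) (fun x t v hx => by simp [eq_zero_of_notMem hx, hK])
  have i1 := h.integrable_comp hξc hξΩ (Γ := fun z =>
    wgt p s β N z.2.1 (‖z.2.2‖ ^ p) * (c * (‖z.2.2‖ ^ p) ^ τ * ξ z.1 ^ (K + 2) *
      (‖z.2.2‖ ^ p + β * Real.exp (s * z.2.1)) ^ 2))
    (by fun_prop) (fun x t v hx => by simp [eq_zero_of_notMem hx])
  refine ⟨_, rfl, i0, ?_⟩
  have key : ∀ δ > 0, (∫ x, wgt p s β N (f x) (‖∇f x‖ ^ p) * ((‖∇f x‖ ^ p) ^ τ) ^ 2 *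
      (c / 2 * ξ x ^ (K + 2) * (‖∇f x‖ ^ p + β * Real.exp (s * f x)) ^ 2 -
        ξ x ^ K * (((K:ℝ) + 2) ^ 2 / (4 * ε)) * ‖∇ξ x‖ ^ 2 * ‖A p (∇f x)‖ ^ 2))
      ≤ 2 * δ * ∫ x, wgt p s β N (f x) (‖∇f x‖ ^ p) * (c * (‖∇f x‖ ^ p) ^ τ *
        ξ x ^ (K + 2) * (‖∇f x‖ ^ p + β * Real.exp (s * f x)) ^ 2) := by
    intro δ hδ
    have hR := h.integral_Rst_nonpos (c := c) (K := K) hp hd hs hb hβ hε hN hco hξ hξc hξΩ hξ0 hτ hδ hK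
    have iR := h.integrable_comp hξc hξΩ
      (continuous_Rst (s := s) (b := b) (c := c) (ε := ε) (N := N) (δ := δ) (K := K) hp hβ0 hτ hξ)
      (fun x t v hx => by simp [Rst, eq_zero_of_notMem hx, hK])
    rw [← integral_const_mul]
    have i2 := i1.const_mul (2 * δ)
    have h3 := integral_mono i0 (iR.add i2) fun x => ?_
    · refine h3.trans ?_
      have h4 : ∫ x, (Rst p s b β c ε N τ δ K ξ (x, f x, ∇f x) +
        2 * δ * (wgt p s β N (f x) (‖∇f x‖ ^ p) * (c * (‖∇f x‖ ^ p) ^ τ *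
        ξ x ^ (K + 2) * (‖∇f x‖ ^ p + β * Real.exp (s * f x)) ^ 2))) = _ :=
        integral_add iR i2
      refine le_trans (le_of_eq h4) ?_
      linarith
    · simp only [Rst, Pi.add_apply]
      generalize hvx : ∇f x = v
      have hw0 : 0 ≤ ‖v‖ ^ p := by positivity
      have hc' := hτc (‖v‖ ^ p) (Real.exp (s * f x)) hw0 (exp_pos _).le
      have hΦ := (wgt_pos p s β N (f x) (‖v‖ ^ p)).le
      have hu0 : 0 ≤ (‖v‖ ^ p) ^ τ := by positivity
      have hξx := hξ0 x
      refine (cutoff_removal hΦ hu0 hδ hc rfl (pow_nonneg hξx (K + 2))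
        (X := ξ x ^ K * (((K:ℝ) + 2) ^ 2 / (4 * ε)) * ‖∇ξ x‖ ^ 2 * ‖A p v‖ ^ 2)
        (by positivity) (sq_nonneg _) (by positivity) (sq_nonneg _) hτ hc').trans (le_of_eq ?_)
      ring
  generalize hI : (∫ x, wgt p s β N (f x) (‖∇f x‖ ^ p) * (c * (‖∇f x‖ ^ p) ^ τ *
        ξ x ^ (K + 2) * (‖∇f x‖ ^ p + β * Real.exp (s * f x)) ^ 2)) = I at key
  refine le_of_forall_pos_le_add fun η hη => ?_
  refine (key (η / (2 * (|I| + 1))) (by positivity)).trans ?_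
  rw [zero_add, mul_div_assoc', div_mul_eq_mul_div, div_le_iff₀ (by positivity)]
  nlinarith [le_abs_self I]

end integralEstimate

section comparison
variable {d : ℕ} {p : ℝ} {Ω : Set (Eu d)} {u g : Eu d → ℝ}

theorem A_smul {c : ℝ} (hc : 0 < c) (z : Eu d) : A p (c • z) = c ^ (p - 1) • A p z := by
  rw [A, A, norm_smul, norm_of_nonneg hc.le, mul_rpow hc.le (norm_nonneg _), smul_smul, smul_smul]
  congr 1
  rw [show p - 1 = p - 2 + 1 by ring, rpow_add_one hc.ne']
  ring

theorem hasGradientAt_norm_sub_rpow (z : Eu d) {x : Eu d} (hx : x ≠ z) (a : ℝ) :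
    HasGradientAt (fun x => ‖x - z‖ ^ a) ((a * ‖x - z‖ ^ (a - 2)) • (x - z)) x := by
  have hn : ‖x - z‖ ≠ 0 := norm_ne_zero_iff.2 (sub_ne_zero.2 hx)
  have h1 : HasFDerivAt (fun x : Eu d => ‖x - z‖) (‖x - z‖⁻¹ • innerSL ℝ (x - z)) x := by
    have := (hasFDerivAt_norm (sub_ne_zero.2 hx)).comp x ((hasFDerivAt_id x).sub_const z)
    rw [ContinuousLinearMap.comp_id] at this
    exact this
  have h2 := h1.rpow_const (p := a) (Or.inl hn)
  rw [hasGradientAt_iff_hasFDerivAt]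
  refine h2.congr_fderiv ?_
  ext y
  have e : ‖x - z‖ ^ (a - 1) = ‖x - z‖ ^ (a - 2) * ‖x - z‖ := by
    rw [← rpow_add_one hn]; congr 1; ring
  simp only [ContinuousLinearMap.smul_apply, innerSL_apply_apply, smul_eq_mul, map_smul,
    InnerProductSpace.toDual_apply_apply, e]
  field_simp

theorem contDiffAt_norm_sub_rpow (z : Eu d) {x : Eu d} (hx : x ≠ z) (a : ℝ) :
    ContDiffAt ℝ 1 (fun x => ‖x - z‖ ^ a) x :=
  ((contDiffAt_id.sub contDiffAt_const).norm ℝ (sub_ne_zero.2 hx)).rpow_const_of_ne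
    (norm_ne_zero_iff.2 (sub_ne_zero.2 hx))

theorem dv_radial (z : Eu d) {x : Eu d} (hx : x ≠ z) (C : ℝ) :
    dv (fun x => (C * ‖x - z‖ ^ (-(d:ℝ))) • (x - z)) x = 0 := by
  have hn : ‖x - z‖ ≠ 0 := norm_ne_zero_iff.2 (sub_ne_zero.2 hx)
  have h1 := ((hasGradientAt_norm_sub_rpow z hx (-(d:ℝ))).hasFDerivAt).const_mul C
  have h2 := h1.smul ((hasFDerivAt_id x).sub_const z)
  have h3 : fderiv ℝ (fun x => (C * ‖x - z‖ ^ (-(d:ℝ))) • (x - z)) x = _ := h2.fderiv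
  rw [dv_eq_trC, h3, map_add, map_smul, trC_smulRight]
  have h4 : trC d (ContinuousLinearMap.id ℝ (Eu d)) = d := by
    rw [trC_apply]; simp
  rw [h4]
  simp only [ContinuousLinearMap.smul_apply, InnerProductSpace.toDual_apply_apply, smul_eq_mul,
    real_inner_smul_left, real_inner_self_eq_norm_sq, id]
  have e : ‖x - z‖ ^ (-(d:ℝ)) = ‖x - z‖ ^ (-(d:ℝ) - 2) * ‖x - z‖ ^ 2 := by
    rw [← rpow_natCast, ← rpow_add (lt_of_le_of_ne (norm_nonneg _) hn.symm)]
    congr 1; push_cast; ring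
  rw [e]; ring

theorem A_gradient_radial (hp : 1 < p) (hpd : p < d) {z x : Eu d} (hx : x ≠ z) {α κ : ℝ}
    (hα : 0 < α) (hκ : κ = ((d:ℝ) - p) / (p - 1)) :
    A p ((α * (-κ * ‖x - z‖ ^ (-κ - 2))) • (x - z)) =
      (-((α * κ) ^ (p - 1)) * ‖x - z‖ ^ (-(d:ℝ))) • (x - z) := by
  have hP : 0 < p - 1 := by linarith
  have hκ0 : 0 < κ := by rw [hκ]; exact div_pos (by linarith) hP
  have hn : 0 < ‖x - z‖ := norm_pos_iff.2 (sub_ne_zero.2 hx)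
  have e1 : (α * (-κ * ‖x - z‖ ^ (-κ - 2))) • (x - z) = (α * κ * ‖x - z‖ ^ (-κ - 2)) • (-(x - z)) := by module
  rw [e1, A_smul (by positivity), A, norm_neg, smul_smul, smul_neg, ← neg_smul]
  congr 1
  rw [mul_rpow (by positivity) (by positivity), ← rpow_mul hn.le, mul_assoc, ← rpow_add hn, neg_mul]
  congr 3
  have : κ * (p - 1) = d - p := by rw [hκ]; field_simp
  linarith

/-- Comparison of a nonnegative supersolution with the fundamental solution. -/
theorem WeakEq.barrier (hp : 1 < p) (hpd : p < d) (h : WeakEq p Ω u g) {z : Eu d} {ρ R m κ : ℝ}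
    (hκ : κ = ((d:ℝ) - p) / (p - 1))
    (hρ : 0 < ρ) (hρR : ρ < R) (hΩ : closedBall z R ⊆ Ω) (hg : ∀ x ∈ closedBall z R, 0 ≤ g x)
    (hu : ∀ x ∈ closedBall z R, 0 ≤ u x) (hm : 0 < m) (hmu : ∀ x ∈ closedBall z ρ, m ≤ u x)
    {x : Eu d} (hx1 : ρ ≤ ‖x - z‖) (hx2 : ‖x - z‖ ≤ R) :
    m * (‖x - z‖ ^ (-κ) - R ^ (-κ)) / (ρ ^ (-κ) - R ^ (-κ)) ≤ u x := by
  have hP : 0 < p - 1 := by linarith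
  have hκ0 : 0 < κ := by rw [hκ]; exact div_pos (by linarith) hP
  have hR : 0 < R := hρ.trans hρR
  have hden : 0 < ρ ^ (-κ) - R ^ (-κ) :=
    sub_pos.2 (Real.rpow_lt_rpow_of_neg hρ hρR (by linarith))
  obtain ⟨α, hα⟩ : ∃ α, α = m / (ρ ^ (-κ) - R ^ (-κ)) := ⟨_, rfl⟩
  have hα0 : 0 < α := by rw [hα]; positivity
  obtain ⟨v, hv⟩ : ∃ v : Eu d → ℝ, v = fun x => α * (‖x - z‖ ^ (-κ) - R ^ (-κ)) := ⟨_, rfl⟩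
  suffices hs : ∀ ε > 0, v x - u x ≤ ε by
    have := le_of_forall_pos_le_add (a := v x - u x) (b := 0) fun ε hε => by
      rw [zero_add]; exact hs ε hε
    have e : m * (‖x - z‖ ^ (-κ) - R ^ (-κ)) / (ρ ^ (-κ) - R ^ (-κ)) = v x := by
      rw [hv, hα]; ring
    rw [e]; linarith
  intro ε hε
  have hvρ : ∀ y, ‖y - z‖ = ρ → v y = m := fun y hy => by
    rw [hv]; simp only [hy, hα]; field_simp
  have hvR : ∀ y, ‖y - z‖ = R → v y = 0 := fun y hy => by rw [hv]; simp [hy]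
  have hvc : ∀ y, y ≠ z → ContDiffAt ℝ 1 v y := fun y hy => by
    rw [hv]; exact contDiffAt_const.mul ((contDiffAt_norm_sub_rpow z hy _).sub contDiffAt_const)
  have hvg : ∀ y, y ≠ z → HasGradientAt v ((α * (-κ * ‖y - z‖ ^ (-κ - 2))) • (y - z)) y := by
    intro y hy
    rw [hv, mul_smul]
    refine HasGradientAt.comp_real (k := fun t => α * (t - R ^ (-κ))) ?_
      (hasGradientAt_norm_sub_rpow z hy (-κ))
    simpa using ((hasDerivAt_id (‖y - z‖ ^ (-κ))).sub_const (R ^ (-κ))).const_mul α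
  have hne : ∀ y, ρ ≤ ‖y - z‖ → y ≠ z := fun y hy h0 => by
    rw [h0, sub_self, norm_zero] at hy; linarith
  have huc : ∀ y, ‖y - z‖ ≤ R → ContDiffAt ℝ 1 u y := fun y hy =>
    h.contDiffAt (hΩ (by rw [mem_closedBall, dist_eq_norm]; exact hy))
  obtain ⟨S, hS⟩ : ∃ S : Set (Eu d), S = {y | ρ < ‖y - z‖ ∧ ‖y - z‖ < R} := ⟨_, rfl⟩
  have hSo : IsOpen S := by
    rw [hS]
    have hcn : Continuous fun y : Eu d => ‖y - z‖ := by fun_prop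
    exact (isOpen_lt continuous_const hcn).inter (isOpen_lt hcn continuous_const)
  obtain ⟨ψ, hψ⟩ : ∃ ψ : Eu d → ℝ, ψ = fun y => (max (v y - u y - ε) 0) ^ 2 := ⟨_, rfl⟩
  obtain ⟨φ, hφ⟩ : ∃ φ : Eu d → ℝ, φ = S.indicator ψ := ⟨_, rfl⟩
  have hφ0 : ∀ y ∉ S, φ =ᶠ[𝓝 y] fun _ => 0 := by
    intro y hy
    have aux : ∀ y, ρ ≤ ‖y - z‖ → ‖y - z‖ ≤ R → v y - u y - ε < 0 → φ =ᶠ[𝓝 y] fun _ => 0 := by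
      intro y h1 h2 h3
      have hc : ContinuousAt (fun y => v y - u y - ε) y :=
        ((hvc y (hne y h1)).continuousAt.sub (huc y h2).continuousAt).sub continuousAt_const
      filter_upwards [hc.eventually (gt_mem_nhds h3)] with y' hy'
      rw [hφ]
      by_cases hm : y' ∈ S
      · rw [indicator_of_mem hm, hψ]; simp only [max_eq_right hy'.le]; ring
      · rw [indicator_of_notMem hm]
    rw [hS, mem_setOf_eq, not_and_or, not_lt, not_lt] at hy
    have hcn : Continuous fun y : Eu d => ‖y - z‖ := by fun_prop
    rcases hy with hy | hy
    · rcases hy.lt_or_eq with hy | hy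
      · filter_upwards [hcn.continuousAt.eventually (gt_mem_nhds hy)] with y' hy'
        rw [hφ, indicator_of_notMem]
        rw [hS]; exact fun hc => absurd hc.1 (not_lt.2 hy'.le)
      · refine aux y hy.ge (hy.le.trans hρR.le) ?_
        have := hmu y (by rw [mem_closedBall, dist_eq_norm]; exact hy.le)
        rw [hvρ y hy]; linarith
    · rcases hy.lt_or_eq with hy | hy
      · filter_upwards [hcn.continuousAt.eventually (lt_mem_nhds hy)] with y' hy'
        rw [hφ, indicator_of_notMem]
        rw [hS]; exact fun hc => absurd hc.2 (not_lt.2 hy'.le)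
      · refine aux y (hρR.le.trans hy.le) hy.ge ?_
        have := hu y (by rw [mem_closedBall, dist_eq_norm]; exact hy.ge)
        rw [hvR y hy.symm]; linarith
  have hSne : ∀ y ∈ S, y ≠ z ∧ ‖y - z‖ ≤ R := fun y hy => by
    rw [hS] at hy; exact ⟨hne y hy.1.le, hy.2.le⟩
  have hφS : ∀ y ∈ S, φ =ᶠ[𝓝 y] ψ := fun y hy => by
    filter_upwards [hSo.mem_nhds hy] with y' hy'
    rw [hφ, indicator_of_mem hy']
  have hφ1 : ContDiff ℝ 1 φ := by
    rw [contDiff_iff_contDiffAt]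
    intro y
    by_cases hy : y ∈ S
    · refine ContDiffAt.congr_of_eventuallyEq ?_ (hφS y hy)
      rw [hψ]
      exact contDiff_posPart_sq.contDiffAt.comp y
        (((hvc y (hSne y hy).1).sub (huc y (hSne y hy).2)).sub contDiffAt_const)
    · exact contDiffAt_const.congr_of_eventuallyEq (hφ0 y hy)
  have hts : tsupport φ ⊆ S := by
    intro y hy
    by_contra hc
    exact (notMem_tsupport_iff_eventuallyEq.2 (hφ0 y hc)) hy
  have hSR : S ⊆ closedBall z R := fun y hy => by
    rw [mem_closedBall, dist_eq_norm]; exact (hSne y hy).2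
  have hφc : HasCompactSupport φ :=
    (isCompact_closedBall z R).of_isClosed_subset (isClosed_tsupport _) (hts.trans hSR)
  have hgφ : ∀ y ∈ S, ∇φ y = (2 * max (v y - u y - ε) 0) •
      (((α * (-κ * ‖y - z‖ ^ (-κ - 2))) • (y - z)) - ∇u y) := by
    intro y hy
    rw [(hφS y hy).gradient_eq, hψ]
    refine HasGradientAt.gradient (HasGradientAt.comp_real (k := fun t => (max (t - ε) 0) ^ 2) ?_
      (HasGradientAt.sub' (hvg y (hSne y hy).1) (hasGradientAt_of_contDiffAt (huc y (hSne y hy).2))))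
    have := (hasDerivAt_posPart_sq (v y - u y - ε)).comp (v y - u y) ((hasDerivAt_id (v y - u y)).sub_const ε)
    rw [mul_one] at this
    exact this
  obtain ⟨X, hX⟩ : ∃ X : Eu d → Eu d,
    X = fun y => (-((α * κ) ^ (p - 1)) * ‖y - z‖ ^ (-(d:ℝ))) • (y - z) := ⟨_, rfl⟩
  have hXc : ∀ y ∈ tsupport φ, ContDiffAt ℝ 1 X y := fun y hy => by
    rw [hX]
    exact (contDiffAt_const.mul (contDiffAt_norm_sub_rpow z (hSne y (hts hy)).1 _)).smul
      (contDiffAt_id.sub contDiffAt_const)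
  have I1 : ∫ y, ⟪X y, ∇φ y⟫ = 0 := by
    rw [integral_inner_gradient hφ1 hφc hXc, neg_eq_zero]
    refine integral_eq_zero_of_ae (.of_forall fun y => ?_)
    by_cases hy : y ∈ tsupport φ
    · simp only [hX, dv_radial z (hSne y (hts hy)).1, zero_mul, Pi.zero_apply]
    · simp [eq_zero_of_notMem hy]
  have hφn : ∀ y, 0 ≤ φ y := fun y => by
    rw [hφ]; exact indicator_nonneg (fun y _ => by rw [hψ]; positivity) y
  have I2 : 0 ≤ ∫ y, ⟪A p (∇u y), ∇φ y⟫ := by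
    rw [h.weak φ hφ1 hφc ((hts.trans hSR).trans hΩ)]
    refine integral_nonneg fun y => ?_
    by_cases hy : y ∈ tsupport φ
    · exact mul_nonneg (hg y (hSR (hts hy))) (hφn y)
    · simp [eq_zero_of_notMem hy]
  have i1 : Integrable fun y => ⟪X y, ∇φ y⟫ :=
    integrable_inner_gradient hφ1 hφc fun y hy => (hXc y hy).continuousAt
  have i2 : Integrable fun y => ⟪A p (∇u y), ∇φ y⟫ :=
    integrable_inner_gradient hφ1 hφc fun y hy =>
      (continuous_A hp).continuousAt.comp (continuousAt_gradient (huc y (hSne y (hts hy)).2))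
  have hpt : ∀ y, 0 ≤ ⟪X y, ∇φ y⟫ - ⟪A p (∇u y), ∇φ y⟫ ∧
      (⟪X y, ∇φ y⟫ - ⟪A p (∇u y), ∇φ y⟫ = 0 → ∇φ y = 0) := by
    intro y
    by_cases hy : y ∈ S
    · have hXA : X y = A p ((α * (-κ * ‖y - z‖ ^ (-κ - 2))) • (y - z)) := by
        rw [hX, A_gradient_radial hp hpd (hSne y hy).1 hα0 hκ]
      rw [← inner_sub_left, hgφ y hy, hXA, real_inner_smul_right]
      generalize (α * (-κ * ‖y - z‖ ^ (-κ - 2))) • (y - z) = a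
      have hmax : 0 ≤ 2 * max (v y - u y - ε) 0 := by positivity
      by_cases hab : a = ∇u y
      · rw [hab]; simp
      · have := A_strict_mono hp hab
        refine ⟨by positivity, fun h0 => ?_⟩
        rcases mul_eq_zero.1 h0 with h0 | h0
        · rw [h0, zero_smul]
        · linarith
    · have : ∇φ y = 0 := by rw [(hφ0 y hy).gradient_eq]; simp [gradient]
      rw [this]; simp
  have hI0 : ∫ y, (⟪X y, ∇φ y⟫ - ⟪A p (∇u y), ∇φ y⟫) = 0 := by
    refine le_antisymm ?_ (integral_nonneg fun y => (hpt y).1)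
    rw [integral_sub i1 i2, I1]; linarith
  rw [integral_eq_zero_iff_of_nonneg (fun y => (hpt y).1) (i1.sub i2)] at hI0
  have hgz : ∇φ = fun _ => 0 := by
    refine (Continuous.ae_eq_iff_eq volume (continuous_gradient hφ1) continuous_const).1 ?_
    filter_upwards [hI0] with y hy using (hpt y).2 hy
  have hfz : ∀ y, fderiv ℝ φ y = 0 := fun y => by
    rw [← norm_eq_zero, ← norm_gradient_eq, hgz, norm_zero]
  have hzS : z ∉ S := by rw [hS]; simp; intro; linarith
  have hφz : ∀ y, φ y = 0 := fun y => by
    rw [is_const_of_fderiv_eq_zero (𝕜 := ℝ) (hφ1.differentiable one_ne_zero) hfz y z, hφ,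
      indicator_of_notMem hzS]
  by_cases hxS : x ∈ S
  · have := hφz x
    rw [hφ, indicator_of_mem hxS, hψ] at this
    have h3 := pow_eq_zero_iff (two_ne_zero) |>.1 this
    have h4 := le_max_left (v x - u x - ε) 0
    rw [h3] at h4; linarith
  · have h3 : ‖x - z‖ = ρ ∨ ‖x - z‖ = R := by
      rw [hS, mem_setOf_eq, not_and_or, not_lt, not_lt] at hxS
      rcases hxS with h3 | h3
      · exact Or.inl (le_antisymm h3 hx1)
      · exact Or.inr (le_antisymm hx2 h3)
    rcases h3 with h3 | h3
    · rw [hvρ x h3]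
      have := hmu x (by rw [mem_closedBall, dist_eq_norm]; exact h3.le)
      linarith
    · rw [hvR x h3]
      have := hu x (by rw [mem_closedBall, dist_eq_norm]; exact h3.le)
      linarith

end comparison

section transform
variable {d : ℕ} {p s : ℝ} {Ω : Set (Eu d)} {f g : Eu d → ℝ}

theorem WeakEq.congr_rhs (h : WeakEq p Ω f g) {g' : Eu d → ℝ} (hg : ∀ x ∈ Ω, g x = g' x) :
    WeakEq p Ω f g' where
  isOpen := h.isOpen
  c1 := h.c1
  cont := h.cont.congr fun x hx => (hg x hx).symm
  weak φ h1 h2 h3 := by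
    rw [h.weak φ h1 h2 h3]
    refine integral_congr_ae (.of_forall fun x => ?_)
    by_cases hx : x ∈ tsupport φ
    · simp only [hg x (h3 hx)]
    · simp only [eq_zero_of_notMem hx, mul_zero]

/-- Change of unknown: if `A(∇f₂) = om A(∇f)`, then `f₂` solves an equation of the same kind. -/
theorem WeakEq.mul_factor (hp : 1 < p) (h : WeakEq p Ω f g) {f₂ om : Eu d → ℝ}
    (hf₂ : ContDiffOn ℝ 1 f₂ Ω) (hom : ContDiffOn ℝ 1 om Ω)
    (hA : ∀ x ∈ Ω, A p (∇f₂ x) = om x • A p (∇f x)) :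
    WeakEq p Ω f₂ (fun x => om x * g x - ⟪A p (∇f x), ∇om x⟫) := by
  have homa : ∀ x ∈ Ω, ContDiffAt ℝ 1 om x := fun x hx => (hom x hx).contDiffAt (h.isOpen.mem_nhds hx)
  have cA : ∀ x ∈ Ω, ContinuousAt (fun x => A p (∇f x)) x := fun x hx =>
    (continuous_A hp).continuousAt.comp (continuousAt_gradient (h.contDiffAt hx))
  refine ⟨h.isOpen, hf₂, ?_, ?_⟩
  · refine (hom.continuousOn.mul h.cont).sub fun x hx => ContinuousAt.continuousWithinAt ?_
    exact (cA x hx).inner (𝕜 := ℝ) (continuousAt_gradient (homa x hx))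
  intro φ hφ hc hs
  have hψ : ContDiff ℝ 1 fun x => φ x * om x := contDiff_mul_of_tsupport hφ fun x hx => homa x (hs hx)
  have hψs : tsupport (fun x => φ x * om x) ⊆ tsupport φ := tsupport_mul_subset
  have hψc : HasCompactSupport fun x => φ x * om x :=
    hc.of_isClosed_subset (isClosed_tsupport _) hψs
  have hw := h.weak _ hψ hψc (hψs.trans hs)
  have i1 : Integrable fun x => ⟪A p (∇f x), ∇(fun x => φ x * om x) x⟫ :=
    integrable_inner_gradient hψ hψc fun x hx => cA x (hs (hψs hx))
  have i2 : Integrable fun x => ⟪A p (∇f x), ∇om x⟫ * φ x :=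
    integrable_mul_of_tsupport hc hφ.continuous (fun x hx => eq_zero_of_notMem hx)
      fun x hx => (cA x (hs hx)).inner (𝕜 := ℝ) (continuousAt_gradient (homa x (hs hx)))
  have i3 : Integrable fun x => (om x * g x) * φ x :=
    integrable_mul_of_tsupport hc hφ.continuous (fun x hx => eq_zero_of_notMem hx)
      fun x hx => (homa x (hs hx)).continuousAt.mul (h.cont.continuousAt (h.isOpen.mem_nhds (hs hx)))
  have e1 : ∀ x, ⟪A p (∇f₂ x), ∇φ x⟫ = ⟪A p (∇f x), ∇(fun x => φ x * om x) x⟫ -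
        ⟪A p (∇f x), ∇om x⟫ * φ x := by
    intro x
    by_cases hx : x ∈ tsupport φ
    · have h1 := (HasGradientAt.mul' (hasGradientAt_of_contDiffAt (hφ.contDiffAt (x := x)))
        (hasGradientAt_of_contDiffAt (homa x (hs hx)))).gradient
      rw [h1, hA x (hs hx), real_inner_smul_left, inner_add_right, real_inner_smul_right,
        real_inner_smul_right]
      ring
    · have h1 : x ∉ tsupport fun x => φ x * om x := fun h => hx (hψs h)
      rw [gradient_of_notMem hx, gradient_of_notMem h1,
        eq_zero_of_notMem hx]
      simp
  simp_rw [e1]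
  rw [integral_sub i1 i2, hw]
  have e2 : ∀ x, (om x * g x - ⟪A p (∇f x), ∇om x⟫) * φ x =
      (om x * g x) * φ x - ⟪A p (∇f x), ∇om x⟫ * φ x := fun x => by ring
  simp_rw [e2]
  rw [integral_sub i3 i2]
  congr 2
  funext x; ring

theorem WeakEq.exp (hp : 1 < p) (h : WeakEq p Ω f (rhs p s f)) :
    WeakEq p Ω (fun x => Real.exp (f x)) fun x => Real.exp ((s + p - 1) * f x) := by
  have hg : ∀ x ∈ Ω, ∀ c : ℝ, HasGradientAt (fun x => Real.exp (c * f x))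
      ((Real.exp (c * f x) * c) • ∇f x) x := by
    intro x hx c
    refine HasGradientAt.comp_real (k := fun t => Real.exp (c * t)) ?_
      (hasGradientAt_of_contDiffAt (h.contDiffAt hx))
    simpa using ((hasDerivAt_id (f x)).const_mul c).exp
  have h1 := h.mul_factor hp (f₂ := fun x => Real.exp (f x)) (om := fun x => Real.exp ((p - 1) * f x))
    h.c1.exp (contDiffOn_const.mul h.c1).exp (fun x hx => by
      have := (hg x hx 1).gradient
      simp only [one_mul, mul_one] at this
      rw [this, A_smul (exp_pos _), ← exp_mul, mul_comm])
  refine h1.congr_rhs fun x hx => ?_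
  rw [(hg x hx (p - 1)).gradient, real_inner_smul_right, inner_A_self hp, rhs,
    show (s + p - 1) * f x = (p - 1) * f x + s * f x by ring, exp_add]
  ring

theorem WeakEq.log {q : ℝ} (hp : 1 < p) {u : Eu d → ℝ} (hu : ∀ x ∈ Ω, 0 < u x)
    (h : WeakEq p Ω u fun x => u x ^ q) :
    WeakEq p Ω (fun x => Real.log (u x)) (rhs p (q + 1 - p) fun x => Real.log (u x)) := by
  have hg1 : ∀ x ∈ Ω, HasGradientAt (fun x => Real.log (u x)) ((u x)⁻¹ • ∇u x) x :=
    fun x hx => HasGradientAt.comp_real (Real.hasDerivAt_log (hu x hx).ne')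
      (hasGradientAt_of_contDiffAt (h.contDiffAt hx))
  have hg2 : ∀ x ∈ Ω, HasGradientAt (fun x => u x ^ (-(p - 1)))
      ((-(p - 1) * u x ^ (-(p - 1) - 1)) • ∇u x) x :=
    fun x hx => HasGradientAt.comp_real (k := fun t => t ^ (-(p - 1)))
      (Real.hasDerivAt_rpow_const (Or.inl (hu x hx).ne'))
      (hasGradientAt_of_contDiffAt (h.contDiffAt hx))
  have h1 := h.mul_factor hp (f₂ := fun x => Real.log (u x)) (om := fun x => u x ^ (-(p - 1)))
    (h.c1.log fun x hx => (hu x hx).ne')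
    (fun x hx => ((h.contDiffAt hx).rpow_const_of_ne (hu x hx).ne').contDiffWithinAt)
    (fun x hx => by
      rw [(hg1 x hx).gradient, A_smul (inv_pos.2 (hu x hx)), Real.inv_rpow (hu x hx).le,
        rpow_neg (hu x hx).le])
  refine h1.congr_rhs fun x hx => ?_
  have hux := hu x hx
  rw [(hg2 x hx).gradient, real_inner_smul_right, inner_A_self hp, rhs, (hg1 x hx).gradient,
    norm_smul, norm_of_nonneg (inv_pos.2 hux).le, mul_rpow (inv_pos.2 hux).le (norm_nonneg _),
    Real.inv_rpow hux.le, ← rpow_neg hux.le, ← rpow_add hux, mul_comm (q + 1 - p),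
    exp_mul, exp_log hux, show -(p - 1) - 1 = -p by ring,
    show -(p - 1) + q = q + 1 - p by ring]
  ring

theorem gradient_comp_scale (f : Eu d → ℝ) (x₀ : Eu d) (l c : ℝ) {z : Eu d}
    (hf : DifferentiableAt ℝ f (x₀ + l • z)) :
    HasGradientAt (fun z => f (x₀ + l • z) - c) (l • ∇f (x₀ + l • z)) z := by
  have h1 : HasFDerivAt (fun z : Eu d => x₀ + l • z) (l • ContinuousLinearMap.id ℝ (Eu d)) z :=
    ((hasFDerivAt_id z).const_smul l).const_add x₀
  have h2 := (hf.hasGradientAt.hasFDerivAt.comp z h1).sub_const c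
  rw [hasGradientAt_iff_hasFDerivAt]
  refine HasFDerivAt.congr_fderiv (by exact h2) ?_
  ext y
  simp

/-- Scaling invariance of the equation. -/
theorem WeakEq.rescale (hp : 1 < p) (hs : 0 < s) (h : WeakEq p Ω f (rhs p s f)) (x₀ : Eu d) {l : ℝ}
    (hl : 0 < l) : WeakEq p ((fun z => x₀ + l • z) ⁻¹' Ω) (fun z => f (x₀ + l • z) - (-(p / s) * Real.log l))
      (rhs p s fun z => f (x₀ + l • z) - (-(p / s) * Real.log l)) := by
  have hcl : ContDiff ℝ 1 fun z : Eu d => x₀ + l • z := by fun_prop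
  have hdf : ∀ z ∈ (fun z => x₀ + l • z) ⁻¹' Ω, DifferentiableAt ℝ f (x₀ + l • z) := fun z hz =>
    (h.contDiffAt hz).differentiableAt one_ne_zero
  have hgr : ∀ z ∈ (fun z => x₀ + l • z) ⁻¹' Ω, ∇(fun z => f (x₀ + l • z) - (-(p / s) * Real.log l)) z =
        l • ∇f (x₀ + l • z) := fun z hz =>
    (gradient_comp_scale f x₀ l _ (hdf z hz)).gradient
  have hrhs : ∀ z ∈ (fun z => x₀ + l • z) ⁻¹' Ω, l ^ p * rhs p s f (x₀ + l • z) =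
      rhs p s (fun z => f (x₀ + l • z) - (-(p / s) * Real.log l)) z := by
    intro z hz
    have e : s * (f (x₀ + l • z) - (-(p / s) * Real.log l)) = s * f (x₀ + l • z) + Real.log l * p := by
      field_simp; ring
    rw [rhs, rhs, hgr z hz, norm_smul, norm_of_nonneg hl.le,
      mul_rpow hl.le (norm_nonneg _), e, exp_add, exp_mul (Real.log l) p, exp_log hl]
    ring
  have hopen : IsOpen ((fun z => x₀ + l • z) ⁻¹' Ω) := h.isOpen.preimage hcl.continuous
  have hw : WeakEq p ((fun z => x₀ + l • z) ⁻¹' Ω) (fun z => f (x₀ + l • z) - (-(p / s) * Real.log l))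
      (fun z => l ^ p * rhs p s f (x₀ + l • z)) := by
    refine ⟨hopen, ?_, ?_, ?_⟩
    · exact (h.c1.comp hcl.contDiffOn fun z hz => hz).sub contDiffOn_const
    · exact continuousOn_const.mul (h.cont.comp hcl.continuous.continuousOn fun z hz => hz)
    intro φ hφ hc hsup
    have hinv : ∀ x : Eu d, x₀ + l • (l⁻¹ • (x - x₀)) = x := fun x => by
      rw [smul_smul, mul_inv_cancel₀ hl.ne', one_smul]; abel
    have hinv' : ∀ z : Eu d, l⁻¹ • ((x₀ + l • z) - x₀) = z := fun z => by
      rw [add_sub_cancel_left, smul_smul, inv_mul_cancel₀ hl.ne', one_smul]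
    obtain ⟨ψ, hψ⟩ : ∃ ψ : Eu d → ℝ, ψ = fun x => φ (l⁻¹ • (x - x₀)) := ⟨_, rfl⟩
    have hψ1 : ContDiff ℝ 1 ψ := by
      rw [hψ]; exact hφ.comp (by fun_prop)
    let e : Eu d ≃ₜ Eu d :=
      { toFun := fun x => l⁻¹ • (x - x₀), invFun := fun z => x₀ + l • z, left_inv := hinv, right_inv := hinv',
        continuous_toFun := by fun_prop, continuous_invFun := by fun_prop }
    have hψc : HasCompactSupport ψ := by
      rw [hψ]; exact hc.comp_homeomorph e
    have hψs : tsupport ψ ⊆ Ω := by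
      have h1 : tsupport ψ = e ⁻¹' tsupport φ := by
        rw [hψ]; exact tsupport_comp_eq_preimage φ e
      rw [h1]
      intro x hx
      have := hsup hx
      rw [mem_preimage] at this
      have h2 : x₀ + l • (l⁻¹ • (x - x₀)) ∈ Ω := this
      rwa [hinv] at h2
    have hwk := h.weak ψ hψ1 hψc hψs
    have hgψ : ∀ z, ∇φ z = l • ∇ψ (x₀ + l • z) := by
      intro z
      have h1 := (gradient_comp_scale ψ x₀ l 0 (z := z) (hψ1.differentiable one_ne_zero _)).gradient
      rw [← h1]
      congr 1
      funext y
      rw [hψ]; simp only [hinv', sub_zero]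
    have cov : ∀ k : Eu d → ℝ, ∫ z, k (x₀ + l • z) = |(l ^ Module.finrank ℝ (Eu d))⁻¹| * ∫ x, k x := by
      intro k
      rw [Measure.integral_comp_smul (μ := volume) (fun y => k (x₀ + y)) l, smul_eq_mul,
        integral_add_left_eq_self (fun y => k y) x₀]
    have e1 : ∀ z, ⟪A p (∇(fun z => f (x₀ + l • z) - (-(p / s) * Real.log l)) z),
        ∇φ z⟫ = l ^ p * (fun x => ⟪A p (∇f x), ∇ψ x⟫) (x₀ + l • z) := by
      intro z
      by_cases hz : z ∈ tsupport φ
      · rw [hgr z (hsup hz), A_smul hl, hgψ z, real_inner_smul_left, real_inner_smul_right,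
          show p = p - 1 + 1 by ring, rpow_add_one hl.ne']
        simp only [sub_add_cancel]
        ring
      · have h1 := gradient_of_notMem hz
        have h2 := hgψ z
        rw [h1] at h2
        have h3 : ∇ψ (x₀ + l • z) = 0 := by
          rcases smul_eq_zero.1 h2.symm with h | h
          · exact absurd h hl.ne'
          · exact h
        simp only [h1, h3, inner_zero_right, mul_zero]
    have e2 : ∀ z, l ^ p * rhs p s f (x₀ + l • z) * φ z =
        l ^ p * (fun x => rhs p s f x * ψ x) (x₀ + l • z) := by
      intro z; rw [hψ]; simp only [hinv']; ring
    have c1 := cov fun x => ⟪A p (∇f x), ∇ψ x⟫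
    have c2 := cov fun x => rhs p s f x * ψ x
    rw [integral_congr_ae (.of_forall e1), integral_congr_ae (.of_forall e2),
      integral_const_mul, integral_const_mul, c1, c2, hwk]
  exact hw.congr_rhs hrhs

end transform

section decay
variable {d : ℕ} {p s : ℝ} {Ω : Set (Eu d)} {f : Eu d → ℝ}

theorem exists_bump (d : ℕ) : ∃ L > 0, ∀ (y : Eu d) (k : ℝ), 0 < k → ∃ ξ : Eu d → ℝ,
    ContDiff ℝ ∞ ξ ∧ HasCompactSupport ξ ∧ tsupport ξ ⊆ closedBall y (k / 2) ∧
    (∀ x, ξ x ∈ Icc (0:ℝ) 1) ∧ (∀ x ∈ closedBall y (k / 4), ξ x = 1) ∧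
    ∀ x, ‖∇ξ x‖ ≤ L / k := by
  let φ : ContDiffBump (0 : Eu d) := ⟨1 / 4, 1 / 2, by norm_num, by norm_num⟩
  have hφ : ContDiff ℝ ∞ (φ : Eu d → ℝ) := φ.contDiff
  have hg : Continuous (∇(φ : Eu d → ℝ)) := continuous_gradient (hφ.of_le (by simp))
  have hgc : HasCompactSupport (∇(φ : Eu d → ℝ)) := by
    refine φ.hasCompactSupport.mono' fun x hx => ?_
    by_contra h
    exact hx (gradient_of_notMem h)
  obtain ⟨L, hL⟩ := hgc.exists_bound_of_continuous hg
  refine ⟨max L 1, by positivity, fun y k hk => ?_⟩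
  have hkn : k⁻¹ ≠ 0 := inv_ne_zero hk.ne'
  have hnorm : ∀ x, dist x y = k * ‖k⁻¹ • (x - y)‖ := fun x => by
    rw [norm_smul, norm_of_nonneg (inv_pos.2 hk).le, ← mul_assoc, mul_inv_cancel₀ hk.ne', one_mul,
      dist_eq_norm]
  let e : Eu d ≃ₜ Eu d :=
      { toFun := fun x => k⁻¹ • (x - y), invFun := fun z => y + k • z,
        left_inv := fun x => by simp [smul_smul, mul_inv_cancel₀ hk.ne'],
        right_inv := fun z => by simp [smul_smul, inv_mul_cancel₀ hk.ne'],
        continuous_toFun := by fun_prop, continuous_invFun := by fun_prop }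
  refine ⟨fun x => φ (k⁻¹ • (x - y)), hφ.comp (by fun_prop), φ.hasCompactSupport.comp_homeomorph e,
    ?_, fun x => ⟨φ.nonneg, φ.le_one⟩, fun x hx => ?_, fun x => ?_⟩
  · have h1 : tsupport (fun x => φ (k⁻¹ • (x - y))) = e ⁻¹' tsupport φ :=
      tsupport_comp_eq_preimage φ e
    rw [h1, φ.tsupport_eq]
    intro x hx
    have h2 : ‖k⁻¹ • (x - y)‖ ≤ 1 / 2 := mem_closedBall_zero_iff.1 hx
    rw [mem_closedBall, hnorm]
    linarith [mul_le_left h2 hk.le]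
  · apply φ.one_of_mem_closedBall
    rw [mem_closedBall, hnorm] at hx
    rw [mem_closedBall_zero_iff]
    have : k * ‖k⁻¹ • (x - y)‖ ≤ k * (1 / 4) := by linarith
    exact le_of_mul_le_mul_left this hk
  · have h1 := (gradient_comp_scale (φ : Eu d → ℝ) (-(k⁻¹ • y)) k⁻¹ 0 (z := x)
      (hφ.differentiable (by simp) _)).gradient
    have h2 : (fun x => φ (k⁻¹ • (x - y))) = fun z => φ (-(k⁻¹ • y) + k⁻¹ • z) - 0 := by
      funext z; rw [sub_zero, smul_sub, neg_add_eq_sub]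
    rw [h2, h1, norm_smul, norm_of_nonneg (inv_pos.2 hk).le, div_eq_inv_mul]
    exact mul_le_left ((hL _).trans (le_max_left _ _)) (inv_pos.2 hk).le

theorem WeakEq.abs_sub_le {g : Eu d → ℝ} (h : WeakEq p Ω f g) {y : Eu d} {k C : ℝ}
    (hΩ : closedBall y k ⊆ Ω) (hv : ∀ x ∈ closedBall y k, ‖∇f x‖ ≤ C) {x : Eu d}
    (hx : x ∈ closedBall y k) : |f x - f y| ≤ C * ‖x - y‖ := by
  have hk : 0 ≤ k := dist_nonneg.trans hx
  have := (convex_closedBall y k).norm_image_sub_le_of_norm_fderiv_le (𝕜 := ℝ) (f := f) (C := C)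
    (fun z hz => (h.contDiffAt (hΩ hz)).differentiableAt one_ne_zero)
    (fun z hz => by rw [← norm_gradient_eq]; exact hv z hz) (mem_closedBall_self hk) hx
  rwa [norm_eq_abs] at this

theorem norm_le_of_rpow_le (hp : 1 < p) {v : Eu d} {h : ℝ} (hh : 0 ≤ h) (hv : ‖v‖ ^ p + h ≤ 2 ^ p) :
    ‖v‖ ≤ 2 := by
  have : ‖v‖ ^ p ≤ 2 ^ p := by linarith
  exact (Real.rpow_le_rpow_iff (norm_nonneg _) (by norm_num) (by linarith)).1 this

/-- Lower bound for `exp f` on a large ball, from comparison with the fundamental solution. -/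
theorem WeakEq.exp_lower_bound (hp : 1 < p) (hpd : p < d) {κ : ℝ} (hκ : κ = ((d:ℝ) - p) / (p - 1)) :
    ∃ c > 0, ∀ {Ω : Set (Eu d)} {f : Eu d → ℝ}, WeakEq p Ω f (rhs p s f) →
      ∀ (y : Eu d) (k : ℝ), 4 ≤ k → closedBall y k ⊆ Ω →
      (∀ x ∈ closedBall y k, ‖∇f x‖ ≤ 2) → ∀ x ∈ closedBall y (k / 2),
      Real.exp (f y) * (c * k ^ (-κ)) ≤ Real.exp (f x) := by
  have hκ0 : 0 < κ := by rw [hκ]; exact div_pos (by linarith) (by linarith)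
  have h2κ : 1 < (2:ℝ) ^ κ := Real.one_lt_rpow (by norm_num) hκ0
  obtain ⟨c₁, hc₁⟩ : ∃ c₁, c₁ = min 1 ((2:ℝ) ^ κ - 1) := ⟨_, rfl⟩
  have hc₁0 : 0 < c₁ := by rw [hc₁]; exact lt_min one_pos (by linarith)
  refine ⟨Real.exp (-2) * c₁, by positivity, fun {Ω f} h y k hk hΩ hv x hx => ?_⟩
  have hk0 : 0 < k := by linarith
  have hlow : ∀ z ∈ closedBall y 1, Real.exp (f y) * Real.exp (-2) ≤ Real.exp (f z) := by
    intro z hz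
    rw [← exp_add]
    apply Real.exp_le_exp.2
    have h1 := h.abs_sub_le hΩ hv (x := z) (closedBall_subset_closedBall (by linarith) hz)
    have h2 : ‖z - y‖ ≤ 1 := by rw [← dist_eq_norm]; exact hz
    have h3 := (abs_le.1 h1).1
    linarith
  have hm : 0 < Real.exp (f y) * Real.exp (-2) := by positivity
  have hkκ : 0 < k ^ (-κ) := rpow_pos_of_pos hk0 _
  have hkκ1 : k ^ (-κ) < 1 := Real.rpow_lt_one_of_one_lt_of_neg (by linarith) (by linarith)
  rcases le_total (‖x - y‖) 1 with h1 | h1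
  · refine le_trans ?_ (hlow x (by rw [mem_closedBall, dist_eq_norm]; exact h1))
    have : c₁ * k ^ (-κ) ≤ 1 * 1 := mul_le_mul (hc₁ ▸ min_le_left _ _) hkκ1.le hkκ.le zero_le_one
    have h4 := mul_le_left this hm.le
    linarith
  · have h2 : ‖x - y‖ ≤ k / 2 := by rw [← dist_eq_norm]; exact hx
    have hb := (h.exp hp).barrier hp hpd hκ one_pos (by linarith) hΩ
      (fun z _ => (exp_pos _).le) (fun z _ => (exp_pos _).le) hm hlow h1 (by linarith)
    refine le_trans ?_ hb
    rw [one_rpow, le_div_iff₀ (by linarith)]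
    have h3 : (k / 2) ^ (-κ) ≤ ‖x - y‖ ^ (-κ) :=
      rpow_le_rpow_of_nonpos (by linarith) h2 (by linarith)
    have h4 : (k / 2) ^ (-κ) = 2 ^ κ * k ^ (-κ) := by
      rw [div_rpow hk0.le (by norm_num), rpow_neg (by norm_num : (0:ℝ) ≤ 2), div_inv_eq_mul, mul_comm]
    have h5 : c₁ * k ^ (-κ) ≤ (2 ^ κ - 1) * k ^ (-κ) :=
      mul_le_right (hc₁ ▸ min_le_right _ _) hkκ.le
    have h6 : c₁ * k ^ (-κ) * (1 - k ^ (-κ)) ≤ c₁ * k ^ (-κ) * 1 :=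
      mul_le_left (by linarith) (by positivity)
    have h7 : c₁ * k ^ (-κ) * (1 - k ^ (-κ)) ≤ ‖x - y‖ ^ (-κ) - k ^ (-κ) := by linarith
    have h8 := mul_le_left h7 hm.le
    linarith

/-- Young's inequality by a dichotomy. -/
theorem young_dichotomy {c E ξ G L p N : ℝ} {K : ℕ} (hp : 1 < p) (hN : 0 ≤ N) (hc : 0 < c) (hE : 0 ≤ E)
    (hξ : 0 ≤ ξ) (hξ1 : ξ ≤ 1) (hG : 0 < G) (hL : 0 ≤ L) (hK : p * (N + 2) ≤ K) :
    E * L ^ 2 * (ξ ^ K * G ^ (N + 2 - 2 / p)) ≤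
      c * (ξ ^ (K + 2) * G ^ (N + 2)) + E * (E / c) ^ ((p * (N + 2) - 2) / 2) * L ^ (p * (N + 2)) := by
  have hp0 : 0 < p := by linarith
  have hm : 0 ≤ p * (N + 2) - 2 := by
    have := mul_le_right hp.le (by linarith : 0 ≤ N + 2)
    linarith
  have hGm : 0 < G ^ (N + 2 - 2 / p) := rpow_pos_of_pos hG _
  have hsplit : G ^ (N + 2) = G ^ (N + 2 - 2 / p) * G ^ (2 / p) := by
    rw [← rpow_add hG]; ring_nf
  rcases le_total (E * L ^ 2) (c * (ξ ^ 2 * G ^ (2 / p))) with h | h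
  · have h1 := mul_le_right h (by positivity : 0 ≤ ξ ^ K * G ^ (N + 2 - 2 / p))
    have h2 : 0 ≤ E * (E / c) ^ ((p * (N + 2) - 2) / 2) * L ^ (p * (N + 2)) := by positivity
    rw [hsplit, pow_add]
    linarith
  · have h1 : ξ ^ 2 * G ^ (2 / p) ≤ E / c * L ^ 2 := by
      rw [div_mul_eq_mul_div, le_div_iff₀ hc]; linarith
    have h2 := rpow_le_rpow (by positivity) h1 (by linarith : 0 ≤ (p * (N + 2) - 2) / 2)
    rw [mul_rpow (by positivity) (by positivity), mul_rpow (by positivity) (by positivity),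
      ← rpow_mul hG.le, ← rpow_natCast ξ, ← rpow_mul hξ, ← rpow_natCast L,
      ← rpow_mul hL] at h2
    have e1 : 2 / p * ((p * (N + 2) - 2) / 2) = N + 2 - 2 / p := by field_simp
    have e2 : ((2:ℕ):ℝ) * ((p * (N + 2) - 2) / 2) = p * (N + 2) - 2 := by push_cast; ring
    rw [e1, e2] at h2
    have h3 : ξ ^ K ≤ ξ ^ (p * (N + 2) - 2) := by
      rw [← rpow_natCast]
      exact Real.rpow_le_rpow_of_exponent_ge_of_imp hξ hξ1 (by linarith) (fun _ h0 => by
        have h5 := mul_le_right hp.le (by linarith : 0 ≤ N + 2)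
        linarith)
    have h4 := (mul_le_right h3 hGm.le).trans h2
    have h5 : L ^ (p * (N + 2)) = L ^ 2 * L ^ (p * (N + 2) - 2) := by
      have h6 := Real.rpow_add_of_nonneg hL (by norm_num : (0:ℝ) ≤ 2) hm
      rw [Real.rpow_two, add_sub_cancel] at h6
      exact h6
    rw [h5]
    have h6 := mul_le_left h4 (by positivity : 0 ≤ E * L ^ 2)
    have h7 : 0 ≤ c * (ξ ^ (K + 2) * G ^ (N + 2)) := by positivity
    linarith

theorem wgt_mul_rpow {β N t w r : ℝ} (hG : 0 < w + β * exp (s * t)) :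
    wgt p s β N t w * (w + β * exp (s * t)) ^ r =
      exp (-(s * (p - 1) / p * N) * t) * (w + β * exp (s * t)) ^ (N + r) := by
  rw [wgt, Real.rpow_def_of_pos hG, Real.rpow_def_of_pos hG, ← exp_add, ← exp_add]
  congr 1; ring

theorem rpow_le_add_mul_rpow {r Q lam t : ℝ} (hr : 0 < r) (hQ : r ≤ Q) (hl : 0 < lam) (ht : 0 ≤ t) :
    t ^ r ≤ lam + (lam ^ (1 / r)) ^ (r - Q) * t ^ Q := by
  rcases le_total (t ^ r) lam with h | h
  · have : 0 ≤ (lam ^ (1 / r)) ^ (r - Q) * t ^ Q := by positivity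
    linarith
  · have h0 : 0 < lam ^ (1 / r) := rpow_pos_of_pos hl _
    have h1 : lam ^ (1 / r) ≤ t := by
      rw [one_div]
      exact (Real.rpow_inv_le_iff_of_pos hl.le ht hr).2 h
    have ht0 : 0 < t := h0.trans_le h1
    have h2 : t ^ (r - Q) ≤ (lam ^ (1 / r)) ^ (r - Q) :=
      rpow_le_rpow_of_nonpos h0 h1 (by linarith)
    have h3 : t ^ r = t ^ (r - Q) * t ^ Q := by rw [← rpow_add ht0]; ring_nf
    rw [h3]
    have := mul_le_right h2 (rpow_nonneg ht Q)
    linarith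

end decay

section decay
variable {d : ℕ} {p s : ℝ} {Ω : Set (Eu d)} {f : Eu d → ℝ}

theorem sq_norm_A_le (hp : 1 < p) (v : Eu d) {G : ℝ} (hG : ‖v‖ ^ p ≤ G) :
    ‖A p v‖ ^ 2 ≤ G ^ (2 - 2 / p) := by
  have hp0 : 0 < p := by linarith
  have h1 : ‖A p v‖ ^ 2 = (‖v‖ ^ p) ^ (2 - 2 / p) := by
    rw [norm_A hp, ← rpow_natCast, ← rpow_mul (norm_nonneg _), ← rpow_mul (norm_nonneg _)]
    congr 1; field_simp; push_cast; ring
  rw [h1]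
  refine rpow_le_rpow (by positivity) hG ?_
  rw [sub_nonneg, div_le_iff₀ hp0]; linarith

theorem weighted_integrand_ge {β N τ c E ξ X L t : ℝ} {K : ℕ} (hp : 1 < p) (hβ : 0 < β) (hN : 0 ≤ N)
    (hc : 0 < c) (hE : 0 ≤ E) (hξ : 0 ≤ ξ) (hξ1 : ξ ≤ 1) (hX : 0 ≤ X) (hXL : X ≤ L)
    (hK : p * (N + 2) ≤ K) (v : Eu d) :
    exp (-(s * (p - 1) / p * N) * t) * ((‖v‖ ^ p) ^ τ) ^ 2 *
      (c / 4 * (ξ ^ (K + 2) * (‖v‖ ^ p + β * exp (s * t)) ^ (N + 2)) -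
        E * (E / (c / 4)) ^ ((p * (N + 2) - 2) / 2) * L ^ (p * (N + 2))) ≤
    wgt p s β N t (‖v‖ ^ p) * ((‖v‖ ^ p) ^ τ) ^ 2 *
      (c / 2 * ξ ^ (K + 2) * (‖v‖ ^ p + β * exp (s * t)) ^ 2 - ξ ^ K * E * X ^ 2 * ‖A p v‖ ^ 2) := by
  have hβe : 0 < β * exp (s * t) := by positivity
  have hw : 0 ≤ ‖v‖ ^ p := by positivity
  have hG : 0 < ‖v‖ ^ p + β * exp (s * t) := by linarith
  have h1 := wgt_mul_rpow (p := p) (N := N) (r := 2) hG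
  have h2 := wgt_mul_rpow (p := p) (N := N) (r := 2 - 2 / p) hG
  have h3 := sq_norm_A_le hp v (G := ‖v‖ ^ p + β * exp (s * t)) (by linarith)
  have hy := young_dichotomy (c := c / 4) hp hN (by linarith) hE hξ hξ1 hG (hX.trans hXL) hK
  rw [Real.rpow_two] at h1
  have hW : 0 ≤ ((‖v‖ ^ p) ^ τ) ^ 2 := sq_nonneg _
  have hΦ := (wgt_pos p s β N t (‖v‖ ^ p)).le
  have he := (exp_pos (-(s * (p - 1) / p * N) * t)).le
  rw [show N + (2 - 2 / p) = N + 2 - 2 / p by ring] at h2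
  generalize (‖v‖ ^ p + β * exp (s * t)) = G at *
  generalize E * (E / (c / 4)) ^ ((p * (N + 2) - 2) / 2) * L ^ (p * (N + 2)) = Y at *
  generalize ((‖v‖ ^ p) ^ τ) ^ 2 = W at *
  generalize wgt p s β N t (‖v‖ ^ p) = Φ at *
  generalize exp (-(s * (p - 1) / p * N) * t) = e at *
  have h4 : ξ ^ K * E * X ^ 2 * ‖A p v‖ ^ 2 ≤ E * L ^ 2 * ξ ^ K * G ^ (2 - 2 / p) := by
    have h5 : X ^ 2 * ‖A p v‖ ^ 2 ≤ L ^ 2 * G ^ (2 - 2 / p) :=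
      mul_le_mul (pow_le_pow_left₀ hX hXL 2) h3 (sq_nonneg _) (sq_nonneg _)
    have := mul_le_left h5 (by positivity : 0 ≤ ξ ^ K * E)
    linarith
  have h6 := mul_le_left h4 (mul_nonneg hΦ hW)
  have h7 := mul_le_left hy (mul_nonneg he hW)
  have h8 : Φ * W * (c / 2 * ξ ^ (K + 2) * G ^ 2) = e * W * (c / 2 * (ξ ^ (K + 2) * G ^ (N + 2))) := by
    rw [show Φ * W * (c / 2 * ξ ^ (K + 2) * G ^ 2) = (Φ * G ^ 2) * W * (c / 2 * ξ ^ (K + 2)) by ring, h1]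
    ring
  have h9 : Φ * W * (E * L ^ 2 * ξ ^ K * G ^ (2 - 2 / p)) =
      e * W * (E * L ^ 2 * (ξ ^ K * G ^ (N + 2 - 2 / p))) := by
    rw [show Φ * W * (E * L ^ 2 * ξ ^ K * G ^ (2 - 2 / p)) =
      (Φ * G ^ (2 - 2 / p)) * W * (E * L ^ 2 * ξ ^ K) by ring, h2]
    ring
  linarith

theorem exists_small_exponent {b β c : ℝ} (hp : 1 < p) (hs : 0 < s) (hb : 0 < b) (hβ : 0 < β)
    (hc : 0 < c) : ∃ τ > 0, ∀ w h : ℝ, 0 ≤ w → 0 ≤ h → 2 * τ * (p / (4 * (p - 1))) *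
      (s * (p - 1) ^ 2 / p ^ 2 * w - b * h) ^ 2 ≤ c / 2 * (w + β * h) ^ 2 := by
  have hP : 0 < p - 1 := by linarith
  have hp0 : 0 < p := by linarith
  obtain ⟨g, hg⟩ : ∃ g, g = s * (p - 1) ^ 2 / p ^ 2 := ⟨_, rfl⟩
  have hg0 : 0 < g := by rw [hg]; positivity
  obtain ⟨M, hM⟩ : ∃ M, M = g + b / β := ⟨_, rfl⟩
  have hM0 : 0 < M := by rw [hM]; positivity
  refine ⟨c / 2 / (2 * (p / (4 * (p - 1))) * M ^ 2), by positivity, fun w h hw hh => ?_⟩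
  rw [← hg]
  have hgw : 0 ≤ g * w := by positivity
  have hbh : 0 ≤ b * h := by positivity
  have e1 : M * (w + β * h) = g * w + b / β * w + g * β * h + b * h := by
    rw [hM]; field_simp; ring
  have e2 : 0 ≤ b / β * w := by positivity
  have e3 : 0 ≤ g * β * h := by positivity
  have h1 : (g * w - b * h) ^ 2 ≤ (M * (w + β * h)) ^ 2 := sq_le_sq' (by linarith) (by linarith)
  have e4 : 2 * (c / 2 / (2 * (p / (4 * (p - 1))) * M ^ 2)) * (p / (4 * (p - 1))) = c / 2 / M ^ 2 := by
    field_simp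
  rw [e4]
  refine (mul_le_left h1 (by positivity)).trans (le_of_eq ?_)
  field_simp

/-- The constants produced by `exists_coercive`. -/
structure Consts (d : ℕ) (p s b β c ε N₀ : ℝ) : Prop where
  hp : 1 < p
  hpd : p < d
  hs : 0 < s
  hs2 : s * (d - p) < p ^ 2
  hb : 0 < b
  hβ : β = p ^ 2 * b / ((p - 1) * s)
  hc : 0 < c
  hε : 0 < ε
  hN₀ : 0 < N₀
  coercive : ∀ N, N₀ ≤ N → Coercive d p s b β c ε N

variable {b β c ε N₀ : ℝ}

theorem Consts.two_le (hC : Consts d p s b β c ε N₀) : 2 ≤ d := by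
  have h1 : (1:ℝ) < d := hC.hp.trans hC.hpd
  exact_mod_cast h1

theorem Consts.β_pos (hC : Consts d p s b β c ε N₀) : 0 < β := by
  rw [hC.hβ]
  have := hC.hp
  have := hC.hs
  have := hC.hb
  have : 0 < p - 1 := by linarith
  positivity

theorem Consts.integral_decay (hC : Consts d p s b β c ε N₀) :
    ∃ Q C α : ℝ, (p - 1) / p ≤ Q ∧ 0 ≤ C ∧ 0 < α ∧ ∀ {Ω : Set (Eu d)} {f : Eu d → ℝ},
      WeakEq p Ω f (rhs p s f) → ∀ (y : Eu d) (k : ℝ), 4 ≤ k → closedBall y k ⊆ Ω →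
      (∀ x ∈ closedBall y k, ‖∇f x‖ ^ p + β * exp (s * f x) ≤ 2 ^ p) →
      ∫ x in closedBall y 1, (‖∇f x‖ ^ p) ^ Q ≤ C * k ^ (-α) := by
  have hp := hC.hp
  have hpd := hC.hpd
  have hβ0 := hC.β_pos
  have hp0 : 0 < p := by linarith
  have hP : 0 < p - 1 := by linarith
  have hs := hC.hs
  have hc := hC.hc
  obtain ⟨κ, hκ⟩ : ∃ κ, κ = ((d:ℝ) - p) / (p - 1) := ⟨_, rfl⟩
  obtain ⟨γ, hγ⟩ : ∃ γ, γ = s * (p - 1) / p := ⟨_, rfl⟩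
  have hγ0 : 0 < γ := by rw [hγ]; positivity
  have hκγ : κ * γ < p := by
    have : κ * γ = s * (d - p) / p := by rw [hκ, hγ]; field_simp
    rw [this, div_lt_iff₀ hp0]; linarith [hC.hs2]
  obtain ⟨N, hN⟩ : ∃ N, N = N₀ + d / (p - κ * γ) := ⟨_, rfl⟩
  have hdp : 0 ≤ d / (p - κ * γ) := div_nonneg (Nat.cast_nonneg d) (by linarith)
  have hN1 : N₀ ≤ N := by linarith
  have hN0 : 0 ≤ N := by linarith [hC.hN₀]
  have hNd : d ≤ N * (p - κ * γ) := by
    have h1 : d / (p - κ * γ) ≤ N := by linarith [hC.hN₀]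
    rwa [div_le_iff₀ (by linarith)] at h1
  obtain ⟨τ, hτ, hτc⟩ := exists_small_exponent hp hs hC.hb hβ0 hc
  obtain ⟨K, hK⟩ : ∃ K : ℕ, K = ⌈p * (N + 2)⌉₊ + 1 := ⟨_, rfl⟩
  have hK1 : p * (N + 2) ≤ K := by rw [hK]; push_cast; linarith [Nat.le_ceil (p * (N + 2))]
  have hK0 : K ≠ 0 := by omega
  obtain ⟨L, hL, hbump⟩ := exists_bump d
  obtain ⟨c₁, hc₁, hlow⟩ := WeakEq.exp_lower_bound (s := s) hp hpd hκ
  obtain ⟨E, hE⟩ : ∃ E : ℝ, E = ((K:ℝ) + 2) ^ 2 / (4 * ε) := ⟨_, rfl⟩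
  have hE0 : 0 ≤ E := by rw [hE]; have := hC.hε; positivity
  obtain ⟨D, hD⟩ : ∃ D : ℝ, D = E * (E / (c / 4)) ^ ((p * (N + 2) - 2) / 2) := ⟨_, rfl⟩
  have hD0 : 0 ≤ D := by rw [hD]; positivity
  obtain ⟨V, hV⟩ : ∃ V : ℝ, V = volume.real (ball (0 : Eu d) 1) := ⟨_, rfl⟩
  have hV0 : 0 ≤ V := by rw [hV]; exact measureReal_nonneg
  obtain ⟨W₀, hW₀⟩ : ∃ W₀ : ℝ, W₀ = (((2:ℝ) ^ p) ^ τ) ^ 2 := ⟨_, rfl⟩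
  have hW₀0 : 0 ≤ W₀ := by rw [hW₀]; positivity
  refine ⟨N + 2 + 2 * τ, exp (γ * N * 2) * (4 / c) * c₁ ^ (-(γ * N)) * W₀ * D * L ^ (p * (N + 2)) *
    ((1 / 2) ^ d * V), p * (N + 2) - κ * γ * N - d, ?_, by positivity, by nlinarith, ?_⟩
  · have : (p - 1) / p ≤ 1 := by rw [div_le_one hp0]; linarith
    linarith
  intro Ω f h y k hk hΩ hG
  have hk0 : 0 < k := by linarith
  obtain ⟨ξ, hξ, hξc, hξs, hξ1, hξ2, hξg⟩ := hbump y k hk0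
  have hk2 : closedBall y (k / 2) ⊆ closedBall y k := closedBall_subset_closedBall (by linarith)
  have hv : ∀ x ∈ closedBall y k, ‖∇f x‖ ≤ 2 := fun x hx =>
    norm_le_of_rpow_le hp (by positivity : 0 ≤ β * exp (s * f x)) (hG x hx)
  have hξΩ : tsupport ξ ⊆ Ω := hξs.trans (hk2.trans hΩ)
  obtain ⟨F, hF, i0, hI⟩ := h.integral_estimate hp hC.two_le hs hC.hb hC.hβ hC.hε hN0 hc.le (hC.coercive N hN1) hξ hξc
    hξΩ (fun x => (hξ1 x).1) hτ hK0 hτc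
  rw [← hE] at hF
  rw [hF] at i0 hI
  obtain ⟨a, ha⟩ : ∃ a, a = exp (-(γ * N) * (f y + 2)) * (c / 4) := ⟨_, rfl⟩
  obtain ⟨B, hB⟩ : ∃ B, B = (exp (f y) * (c₁ * k ^ (-κ))) ^ (-(γ * N)) * W₀ *
    (D * (L / k) ^ (p * (N + 2))) := ⟨_, rfl⟩
  have hLk : 0 ≤ L / k := by positivity
  have hB0 : 0 ≤ B := by rw [hB]; positivity
  have ha0 : 0 < a := by rw [ha]; positivity
  have hc1 : closedBall y 1 ⊆ closedBall y (k / 4) := closedBall_subset_closedBall (by linarith)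
  have hc2 : closedBall y (k / 4) ⊆ closedBall y (k / 2) := closedBall_subset_closedBall (by linarith)
  have hpt : ∀ x, (closedBall y 1).indicator (fun x => a * (‖∇f x‖ ^ p) ^ (N + 2 + 2 * τ)) x -
      (closedBall y (k / 2)).indicator (fun _ => B) x ≤
      wgt p s β N (f x) (‖∇f x‖ ^ p) * ((‖∇f x‖ ^ p) ^ τ) ^ 2 *
      (c / 2 * ξ x ^ (K + 2) * (‖∇f x‖ ^ p + β * exp (s * f x)) ^ 2 -
        ξ x ^ K * E * ‖∇ξ x‖ ^ 2 * ‖A p (∇f x)‖ ^ 2) := by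
    intro x
    by_cases hx : x ∈ closedBall y (k / 2)
    · refine le_trans ?_ (weighted_integrand_ge hp hβ0 hN0 hc hE0 (hξ1 x).1 (hξ1 x).2 (norm_nonneg _)
        (hξg x) hK1 (∇f x))
      rw [indicator_of_mem hx, ← hD, ← hγ, hB]
      have hWx : ((‖∇f x‖ ^ p) ^ τ) ^ 2 ≤ W₀ := by
        rw [hW₀]
        have h1 := hG x (hk2 hx)
        have h2 : 0 < β * exp (s * f x) := by positivity
        exact pow_le_pow_left₀ (by positivity) (rpow_le_rpow (by positivity) (by linarith) hτ.le) 2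
      have hex : exp (-(γ * N) * f x) ≤ (exp (f y) * (c₁ * k ^ (-κ))) ^ (-(γ * N)) := by
        have h1 := hlow h y k hk hΩ hv x hx
        rw [mul_comm, exp_mul]
        exact rpow_le_rpow_of_nonpos (by positivity) h1 (neg_nonpos.2 (mul_nonneg hγ0.le hN0))
      have hW0 : 0 ≤ ((‖∇f x‖ ^ p) ^ τ) ^ 2 := sq_nonneg _
      have hT : exp (-(γ * N) * f x) * ((‖∇f x‖ ^ p) ^ τ) ^ 2 *
          (D * (L / k) ^ (p * (N + 2))) ≤ (exp (f y) * (c₁ * k ^ (-κ))) ^ (-(γ * N)) * W₀ *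
          (D * (L / k) ^ (p * (N + 2))) :=
        mul_le_right (mul_le_mul hex hWx hW0 (by positivity)) (by positivity)
      rw [mul_sub]
      refine sub_le_sub ?_ hT
      by_cases hx1 : x ∈ closedBall y 1
      · rw [indicator_of_mem hx1, hξ2 x (hc1 hx1), one_pow, one_mul, ha]
        have h1 : f x ≤ f y + 2 := by
          have h2 := (abs_le.1 (h.abs_sub_le hΩ hv (hk2 hx))).2
          have h3 : ‖x - y‖ ≤ 1 := by rw [← dist_eq_norm]; exact hx1
          linarith
        have h2 : exp (-(γ * N) * (f y + 2)) ≤ exp (-(γ * N) * f x) := by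
          apply Real.exp_le_exp.2
          have := mul_le_left h1 (mul_nonneg hγ0.le hN0)
          linarith
        have h3 : (‖∇f x‖ ^ p) ^ (N + 2 + 2 * τ) ≤ ((‖∇f x‖ ^ p) ^ τ) ^ 2 *
            (‖∇f x‖ ^ p + β * exp (s * f x)) ^ (N + 2) := by
          have h4 : 0 ≤ ‖∇f x‖ ^ p := by positivity
          have h5 : 0 < β * exp (s * f x) := by positivity
          rw [Real.rpow_add_of_nonneg h4 (by linarith) (by linarith), mul_comm 2 τ,
            rpow_mul h4, Real.rpow_two, mul_comm]
          exact mul_le_left (rpow_le_rpow h4 (by linarith) (by linarith)) hW0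
        have h6 := mul_le_mul h2 h3 (by positivity) (exp_pos _).le
        have h7 := mul_le_left h6 (by linarith : 0 ≤ c / 4)
        linarith
      · rw [indicator_of_notMem hx1]
        have h1 := (hξ1 x).1
        positivity
    · have hx1 : x ∉ closedBall y 1 := fun h' => hx (hc2 (hc1 h'))
      rw [indicator_of_notMem hx, indicator_of_notMem hx1,
        eq_zero_of_notMem fun h' => hx (hξs h')]
      simp [hK0]
  have iw : IntegrableOn (fun x => (‖∇f x‖ ^ p) ^ (N + 2 + 2 * τ)) (closedBall y 1) := by
    refine ContinuousOn.integrableOn_compact (isCompact_closedBall _ _) ?_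
    have h1 : ContinuousOn (∇f) (closedBall y 1) :=
      h.continuousOn_gradient.mono ((hc1.trans hc2).trans (hk2.trans hΩ))
    exact ((h1.norm.rpow_const fun _ _ => Or.inr hp0.le).rpow_const fun _ _ => Or.inr (by linarith))
  have iB : IntegrableOn (fun _ : Eu d => B) (closedBall y (k / 2)) :=
    integrableOn_const (by rw [Ne, ← Ne, ← lt_top_iff_ne_top]; exact measure_closedBall_lt_top)
  have iw' : IntegrableOn (fun x => a * (‖∇f x‖ ^ p) ^ (N + 2 + 2 * τ)) (closedBall y 1) :=
    iw.const_mul a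
  have i1 := iw'.integrable_indicator measurableSet_closedBall
  have i2 := iB.integrable_indicator measurableSet_closedBall
  have h1 := (integral_mono (i1.sub i2) i0 hpt).trans hI
  rw [integral_sub' i1 i2, integral_indicator measurableSet_closedBall,
    integral_indicator measurableSet_closedBall, integral_const_mul, setIntegral_const, smul_eq_mul,
    Measure.addHaar_real_closedBall _ _ (by linarith), ← hV, finrank_euclideanSpace_fin] at h1
  have h2 : (∫ x in closedBall y 1, (‖∇f x‖ ^ p) ^ (N + 2 + 2 * τ)) ≤ a⁻¹ * ((k / 2) ^ d * V * B) := by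
    rw [← div_eq_inv_mul, le_div_iff₀ ha0]; linarith
  refine h2.trans (le_of_eq ?_)
  have hca : a⁻¹ = exp (γ * N * 2) * (4 / c) * exp (f y) ^ (γ * N) := by
    rw [ha, mul_inv, ← exp_neg, ← exp_mul, inv_div,
      show -(-(γ * N) * (f y + 2)) = γ * N * 2 + f y * (γ * N) by ring, exp_add]
    ring
  have hy0 : exp (f y) ^ (γ * N) * exp (f y) ^ (-(γ * N)) = 1 := by
    rw [← rpow_add (exp_pos _)]; simp
  have hkk : k ^ (-(p * (N + 2) - κ * γ * N - d)) =
      (k ^ (-κ)) ^ (-(γ * N)) * (k ^ d * (k ^ (p * (N + 2)))⁻¹) := by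
    rw [← rpow_mul hk0.le, ← rpow_natCast, ← rpow_neg hk0.le, ← rpow_add hk0, ← rpow_add hk0]
    congr 1; ring
  rw [hca, hB, hkk, mul_rpow (by positivity) (by positivity),
    mul_rpow (by positivity) (by positivity), div_rpow hL.le hk0.le, div_pow, div_pow, one_pow]
  generalize exp (f y) ^ (γ * N) = e₁ at *
  generalize exp (f y) ^ (-(γ * N)) = e₂ at *
  rw [div_eq_mul_inv (L ^ (p * (N + 2))), div_eq_mul_inv (k ^ d), one_div]
  linear_combination (exp (γ * N * 2) * (4 / c)) * (k ^ d * ((2:ℝ) ^ d)⁻¹ * V) *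
    (c₁ ^ (-(γ * N)) * (k ^ (-κ)) ^ (-(γ * N))) * W₀ * D * L ^ (p * (N + 2)) *
    (k ^ (p * (N + 2)))⁻¹ * hy0

end decay

section decay
variable {d : ℕ} {p s b β c ε N₀ : ℝ}

/-- On a large ball where `G` is bounded, `exp (s f)` is small at the center. -/
theorem Consts.exp_small (hC : Consts d p s b β c ε N₀) {θ : ℝ} (hθ : 0 < θ) :
    ∃ k₀ : ℝ, 4 ≤ k₀ ∧ ∀ {Ω : Set (Eu d)} {f : Eu d → ℝ},
      WeakEq p Ω f (rhs p s f) → ∀ (y : Eu d) (k : ℝ), k₀ ≤ k → closedBall y k ⊆ Ω →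
      (∀ x ∈ closedBall y k, ‖∇f x‖ ^ p + β * exp (s * f x) ≤ 2 ^ p) →
      exp (s * f y) ≤ θ := by
  have hp := hC.hp
  have hβ0 := hC.β_pos
  have hp0 : 0 < p := by linarith
  have hP : 0 < p - 1 := by linarith
  have hs := hC.hs
  obtain ⟨Q, C, α, hQ, hC0, hα, hdec⟩ := hC.integral_decay
  obtain ⟨L, hL, hbump⟩ := exists_bump d
  obtain ⟨V, hV⟩ : ∃ V : ℝ, V = volume.real (ball (0 : Eu d) 1) := ⟨_, rfl⟩
  have hV0 : 0 < V := by
    rw [hV]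
    exact ENNReal.toReal_pos (measure_ball_pos _ _ one_pos).ne' measure_ball_lt_top.ne
  obtain ⟨M, hM⟩ : ∃ M : ℝ, M = exp (2 * s) * 2 ^ d * V⁻¹ * (L / 2) := ⟨_, rfl⟩
  have hM0 : 0 < M := by rw [hM]; positivity
  obtain ⟨lam, hlam⟩ : ∃ lam : ℝ, lam = θ / (2 * M * V) := ⟨_, rfl⟩
  have hlam0 : 0 < lam := by rw [hlam]; positivity
  obtain ⟨r, hr⟩ : ∃ r, r = (p - 1) / p := ⟨_, rfl⟩
  have hr0 : 0 < r := by rw [hr]; positivity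
  obtain ⟨D, hD⟩ : ∃ D, D = (lam ^ (1 / r)) ^ (r - Q) := ⟨_, rfl⟩
  have hD0 : 0 ≤ D := by rw [hD]; positivity
  have hlim : Tendsto (fun k : ℝ => M * (D * (C * k ^ (-α)))) atTop (𝓝 (M * (D * (C * 0)))) :=
    (((tendsto_rpow_neg_atTop hα).const_mul C).const_mul D).const_mul M
  rw [mul_zero, mul_zero, mul_zero] at hlim
  obtain ⟨k₁, hk₁⟩ := eventually_atTop.1 (hlim.eventually (gt_mem_nhds (half_pos hθ)))
  refine ⟨max 4 k₁, le_max_left _ _, fun {Ω f} h y k hk hΩ hG => ?_⟩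
  have hk4 : 4 ≤ k := (le_max_left _ _).trans hk
  have hkD := hk₁ k ((le_max_right _ _).trans hk)
  have hd := hdec h y k hk4 hΩ hG
  have hc1 : closedBall y 1 ⊆ closedBall y k := closedBall_subset_closedBall (by linarith)
  have hch : closedBall y (1 / 2) ⊆ closedBall y 1 := closedBall_subset_closedBall (by norm_num)
  have hv : ∀ x ∈ closedBall y k, ‖∇f x‖ ≤ 2 := fun x hx =>
    norm_le_of_rpow_le hp (by positivity : 0 ≤ β * exp (s * f x)) (hG x hx)
  obtain ⟨ψ, hψ, hψc, hψs, hψ1, hψ2, hψg⟩ := hbump y 2 two_pos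
  rw [show (2:ℝ) / 2 = 1 by norm_num] at hψs
  rw [show (2:ℝ) / 4 = 1 / 2 by norm_num] at hψ2
  have hψC1 : ContDiff ℝ 1 ψ := hψ.of_le (by simp)
  have hsΩ : tsupport ψ ⊆ Ω := hψs.trans (hc1.trans hΩ)
  have hw := h.weak ψ hψC1 hψc hsΩ
  have i1 : Integrable fun x => ⟪A p (∇f x), ∇ψ x⟫ :=
    integrable_inner_gradient hψC1 hψc fun x hx =>
      (continuous_A hp).continuousAt.comp (continuousAt_gradient (h.contDiffAt (hsΩ hx)))
  have i2 : Integrable fun x => rhs p s f x * ψ x :=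
    integrable_mul_of_tsupport hψc hψ.continuous (fun x hx => eq_zero_of_notMem hx)
      fun x hx => h.cont.continuousAt (h.isOpen.mem_nhds (hsΩ hx))
  have iw : IntegrableOn (fun x => (‖∇f x‖ ^ p) ^ Q) (closedBall y 1) := by
    refine ContinuousOn.integrableOn_compact (isCompact_closedBall _ _) ?_
    have h1 : ContinuousOn (∇f) (closedBall y 1) :=
      h.continuousOn_gradient.mono (hc1.trans hΩ)
    exact ((h1.norm.rpow_const fun _ _ => Or.inr hp0.le).rpow_const fun _ _ => Or.inr (by linarith))
  have icst : ∀ (a r : ℝ), IntegrableOn (fun _ : Eu d => a) (closedBall y r) := fun a r =>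
    integrableOn_const measure_closedBall_lt_top.ne
  have i3 : IntegrableOn (fun x => L / 2 * (lam + D * (‖∇f x‖ ^ p) ^ Q)) (closedBall y 1) :=
    (((icst lam 1).add (iw.const_mul D)).const_mul (L / 2))
  have up : ∫ x, ⟪A p (∇f x), ∇ψ x⟫ ≤ L / 2 * (lam * V + D * (C * k ^ (-α))) := by
    have h1 := integral_mono i1 (i3.integrable_indicator measurableSet_closedBall) fun x => ?_
    · refine h1.trans ?_
      rw [integral_indicator measurableSet_closedBall, integral_const_mul,
        integral_add (icst lam 1) (iw.const_mul D), integral_const_mul, setIntegral_const, smul_eq_mul,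
        Measure.addHaar_real_closedBall _ _ zero_le_one, ← hV, one_pow, one_mul, mul_comm V]
      have h2 := mul_le_left hd hD0
      exact mul_le_left (by linarith) (by positivity)
    · by_cases hx : x ∈ closedBall y 1
      · rw [indicator_of_mem hx]
        have h3 := rpow_le_add_mul_rpow hr0 (hr ▸ hQ) hlam0 (by positivity : 0 ≤ ‖∇f x‖ ^ p)
        have h4 : ‖A p (∇f x)‖ = (‖∇f x‖ ^ p) ^ r := by
          rw [norm_A hp, ← rpow_mul (norm_nonneg _), hr, mul_div_cancel₀ _ hp0.ne']
        rw [← h4, ← hD] at h3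
        refine (real_inner_le_norm _ _).trans ?_
        rw [mul_comm]
        exact mul_le_mul (hψg x) h3 (norm_nonneg _) (by positivity)
      · rw [indicator_of_notMem hx, gradient_of_notMem fun h' => hx (hψs h'),
          inner_zero_right]
  have low : exp (s * f y) * exp (-(2 * s)) * ((1 / 2) ^ d * V) ≤ ∫ x, rhs p s f x * ψ x := by
    have h1 := integral_mono ((icst (exp (s * f y) * exp (-(2 * s))) (1 / 2)).integrable_indicator
      measurableSet_closedBall) i2 fun x => ?_
    · refine le_trans (le_of_eq ?_) h1
      rw [integral_indicator measurableSet_closedBall, setIntegral_const, smul_eq_mul,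
        Measure.addHaar_real_closedBall _ _ (by norm_num), ← hV, finrank_euclideanSpace_fin]
      ring
    · have hr0 : 0 ≤ rhs p s f x := by rw [rhs]; positivity
      by_cases hx : x ∈ closedBall y (1 / 2)
      · simp only [indicator_of_mem hx, hψ2 x hx, mul_one]
        rw [← exp_add, rhs]
        have h2 := (abs_le.1 (h.abs_sub_le hΩ hv (hc1 (hch hx)))).1
        have h3 : ‖x - y‖ ≤ 1 := by rw [← dist_eq_norm]; exact hch hx
        have h4 : exp (s * f y + -(2 * s)) ≤ exp (s * f x) := by
          apply Real.exp_le_exp.2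
          have := mul_le_left (by linarith : f y - 2 ≤ f x) hs.le
          linarith
        have h5 : 0 ≤ (p - 1) * ‖∇f x‖ ^ p := by positivity
        linarith
      · simp only [indicator_of_notMem hx]
        exact mul_nonneg hr0 (hψ1 x).1
  have h1 := low.trans (hw.symm.le.trans up)
  have h2 : exp (s * f y) ≤ M * (lam * V + D * (C * k ^ (-α))) := by
    have h3 := mul_le_left h1 (by positivity : 0 ≤ exp (2 * s) * 2 ^ d * V⁻¹)
    have e1 : exp (2 * s) * 2 ^ d * V⁻¹ * (exp (s * f y) * exp (-(2 * s)) *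
        ((1 / 2) ^ d * V)) = exp (s * f y) := by
      rw [exp_neg, one_div, inv_pow]; field_simp
    rw [e1] at h3
    rw [hM]; linarith
  have h3 : M * (lam * V) = θ / 2 := by rw [hlam]; field_simp
  linarith

end decay

section gradient_max
variable {d : ℕ} {p s : ℝ}

theorem gradient_max_scalar {A0 c₀ c₂ m₀ D w₁ CB r H a ψ J μ K₁ e Q X : ℝ} (hA0 : 0 < A0) (hc₀ : 0 < c₀)
    (hc₂ : 0 < c₂) (hm₀ : 0 < m₀) (hD : 0 ≤ D) (hw₁ : 0 ≤ w₁) (hCB : 0 ≤ CB) (hr : 0 < r)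
    (hr1 : (2 * D * w₁ + CB + CB ^ 2 / (2 * c₀ * m₀ ^ 2) + A0) * r ≤ A0 / 8) (hH : 0 ≤ H)
    (ha : m₀ * H ≤ a) (hψ : 0 ≤ ψ) (hψμ : ψ ≤ 2 * μ) (hμ : 2 * μ * (D ^ 2 / (4 * c₂)) ≤ A0 / 8)
    (hQ : Q ≤ A0 / 8)
    (hX : c₂ * ψ * J ^ 2 + ψ ^ 2 * (c₀ / 2 * a ^ 2 + A0 - D * (J + 2 * w₁ * r) - Q - CB * r * (r + H))
      - K₁ * e ≤ X) :
    A0 / 4 * ψ ^ 2 ≤ X + K₁ * e := by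
  have hr8 : r ≤ 1 := by
    have h1 : 0 ≤ (2 * D * w₁ + CB + CB ^ 2 / (2 * c₀ * m₀ ^ 2)) * r := by positivity
    have h2 : A0 * r ≤ A0 * 1 := by linarith
    exact le_of_mul_le_mul_left h2 hA0
  have h1 : CB * r * r ≤ CB * r := by
    have := mul_le_left hr8 (by positivity : 0 ≤ CB * r)
    linarith
  have h2 : CB * r * H ≤ c₀ / 2 * a ^ 2 + CB ^ 2 / (2 * c₀ * m₀ ^ 2) * r := by
    have h3 : (m₀ * H) ^ 2 ≤ a ^ 2 := pow_le_pow_left₀ (by positivity) ha 2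
    have h4 : CB * r * H ≤ c₀ / 2 * (m₀ * H) ^ 2 + CB ^ 2 / (2 * c₀ * m₀ ^ 2) * r ^ 2 := by
      have h5 : 0 ≤ (c₀ * m₀ ^ 2 * H - CB * r) ^ 2 / (2 * c₀ * m₀ ^ 2) := by positivity
      have h6 : (c₀ * m₀ ^ 2 * H - CB * r) ^ 2 / (2 * c₀ * m₀ ^ 2) =
        c₀ / 2 * (m₀ * H) ^ 2 + CB ^ 2 / (2 * c₀ * m₀ ^ 2) * r ^ 2 - CB * r * H := by field_simp; ring
      linarith
    have h5 : r ^ 2 ≤ r := by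
      have := mul_le_left hr8 hr.le
      rw [sq]; linarith
    have h6 := mul_le_left h5 (by positivity : 0 ≤ CB ^ 2 / (2 * c₀ * m₀ ^ 2))
    have h7 := mul_le_left h3 (by positivity : 0 ≤ c₀ / 2)
    linarith
  have h3 : ψ ^ 2 * (D * J) ≤ c₂ * ψ * J ^ 2 + ψ ^ 2 * (A0 / 8) := by
    have h4 : ψ * (D * J) ≤ c₂ * J ^ 2 + ψ * (ψ * (D ^ 2 / (4 * c₂))) := by
      have h5 : 0 ≤ (2 * c₂ * J - ψ * D) ^ 2 / (4 * c₂) := by positivity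
      have h6 : (2 * c₂ * J - ψ * D) ^ 2 / (4 * c₂) =
        c₂ * J ^ 2 + ψ * (ψ * (D ^ 2 / (4 * c₂))) - ψ * (D * J) := by field_simp; ring
      linarith
    have h5 : ψ * (D ^ 2 / (4 * c₂)) ≤ A0 / 8 :=
      (mul_le_right hψμ (by positivity)).trans hμ
    have h6 := mul_le_left h4 hψ
    have h7 := mul_le_left h5 (sq_nonneg ψ)
    linarith
  have h0 : 0 ≤ A0 * r := by positivity
  have h4 : A0 / 4 ≤ (c₀ / 2 * a ^ 2 + A0 - 2 * D * w₁ * r - Q - CB * r * (r + H)) - A0 / 8 := by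
    linarith
  have h5 := mul_le_left h4 (sq_nonneg ψ)
  linarith

theorem exists_rpow_bounds (a : ℝ) : ∃ m₀ m₁ : ℝ, 0 < m₀ ∧ ∀ t ∈ Icc (1 / 4 : ℝ) 3, m₀ ≤ t ^ a ∧ t ^ a ≤ m₁ := by
  have hc : ContinuousOn (fun t : ℝ => t ^ a) (Icc (1 / 4 : ℝ) 3) := fun t ht =>
    (Real.continuousAt_rpow_const t a (Or.inl (by linarith [ht.1]))).continuousWithinAt
  have hne : (Icc (1 / 4 : ℝ) 3).Nonempty := nonempty_Icc.2 (by norm_num)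
  obtain ⟨t₀, ht₀, h₀⟩ := isCompact_Icc.exists_isMinOn hne hc
  obtain ⟨t₁, ht₁, h₁⟩ := isCompact_Icc.exists_isMaxOn hne hc
  exact ⟨t₀ ^ a, t₁ ^ a, rpow_pos_of_pos (by linarith [ht₀.1]) _, fun t ht => ⟨h₀ ht, h₁ ht⟩⟩

theorem gradient_max_pointwise (hp : 1 < p) (hd : 2 ≤ d) (hs : 0 < s) {ξ₀ CB : ℝ} (hξ₀ : 0 < ξ₀)
    (hCB : 0 ≤ CB) : ∃ c₃ C₄ θ₀ μ₀ r₀ : ℝ, 0 < c₃ ∧ 0 ≤ C₄ ∧ 0 < θ₀ ∧ 0 < μ₀ ∧ 0 < r₀ ∧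
      ∀ {v Z gw gξ gJ Y gφ : Eu d} {H L : Eu d →L[ℝ] Eu d} {m w h gt e ξ ψ Dy r : ℝ},
      1 / 4 ≤ ‖v‖ → ‖v‖ ≤ 3 → (∀ x y, ⟪H x, y⟫ = ⟪x, H y⟫) → L = (DA p v).comp H →
      m = ‖v‖ ^ (p - 2) → w = ‖v‖ ^ p → Z = A p v → gw = (p * m) • H v → 0 < h → h ≤ 2 * θ₀ →
      ξ₀ ≤ ξ → ξ ≤ 1 → 0 < r → r ≤ r₀ → ‖gξ‖ ≤ 2 * r → gJ = ξ • gw + w • gξ →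
      Y = (w / (p * ξ)) • DA p v gξ → |Dy| ≤ CB * r * (r + ‖H‖) → gt = (p - 1) * w + h →
      e = trC d L + gt → 0 ≤ ψ → ψ ≤ 2 * μ₀ → gφ = (2 * ψ) • gJ →
      c₃ * ψ ^ 2 ≤ ⟪L Z - e • Z + Y, gφ⟫ + (trC d (L.comp L) - trC d L ^ 2 - gt * trC d L
        - ⟪Z, (p - 1) • gw + (s * h) • v⟫ + Dy) * ψ ^ 2 + C₄ * (|e| * (1 + ‖H‖)) := by
  have hp0 : 0 < p := by linarith
  have hP : 0 < p - 1 := by linarith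
  have hd0 : (0:ℝ) < d := by exact_mod_cast (by omega : 0 < d)
  obtain ⟨m₀, m₁, hm₀, hmb⟩ := exists_rpow_bounds (p - 2)
  obtain ⟨w₀, w₁, hw₀, hwb⟩ := exists_rpow_bounds p
  obtain ⟨_, Z₁, _, hZb⟩ := exists_rpow_bounds (p - 1)
  have h13 : (1:ℝ) ∈ Icc (1 / 4 : ℝ) 3 := ⟨by norm_num, by norm_num⟩
  have hm₁ : 0 < m₁ := by have := (hmb 1 h13).2; rw [one_rpow] at this; linarith
  have hw₁ : 0 < w₁ := by have := (hwb 1 h13).2; rw [one_rpow] at this; linarith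
  have hZ₁ : 0 < Z₁ := by have := (hZb 1 h13).2; rw [one_rpow] at this; linarith
  obtain ⟨c₀, hc₀⟩ : ∃ c₀ : ℝ, c₀ = min 1 ((p - 1) ^ 2) := ⟨_, rfl⟩
  have hc₀0 : 0 < c₀ := by rw [hc₀]; exact lt_min one_pos (by positivity)
  obtain ⟨c₁, hc₁⟩ : ∃ c₁ : ℝ, c₁ = d * (max 1 (p - 1)) ^ 2 * d := ⟨_, rfl⟩
  have hmx : 0 < max 1 (p - 1) := lt_max_of_lt_left one_pos
  have hc₁0 : 0 < c₁ := by rw [hc₁]; positivity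
  obtain ⟨c₂, hc₂⟩ : ∃ c₂ : ℝ, c₂ = 2 / p * (m₀ * min 1 (p - 1)) := ⟨_, rfl⟩
  have hmn : 0 < min 1 (p - 1) := lt_min one_pos hP
  have hc₂0 : 0 < c₂ := by rw [hc₂]; positivity
  obtain ⟨g₀, hg₀⟩ : ∃ g₀ : ℝ, g₀ = (p - 1) * w₀ := ⟨_, rfl⟩
  have hg₀0 : 0 < g₀ := by rw [hg₀]; positivity
  obtain ⟨g₁, hg₁⟩ : ∃ g₁ : ℝ, g₁ = (p - 1) * w₁ + 2 := ⟨_, rfl⟩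
  have hg₁0 : 0 < g₁ := by rw [hg₁]; positivity
  obtain ⟨A0, hA0⟩ : ∃ A0 : ℝ, A0 = c₀ / (2 * c₁) * g₀ ^ 2 := ⟨_, rfl⟩
  have hA00 : 0 < A0 := by rw [hA0]; positivity
  obtain ⟨D, hD⟩ : ∃ D : ℝ, D = (p - 1) * (Z₁ / ξ₀) := ⟨_, rfl⟩
  have hD0 : 0 < D := by rw [hD]; positivity
  obtain ⟨μ, hμ⟩ : ∃ μ : ℝ, μ = min (1 / 2) (A0 / 8 / (2 * (D ^ 2 / (4 * c₂)))) := ⟨_, rfl⟩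
  have hμ0 : 0 < μ := by rw [hμ]; exact lt_min (by norm_num) (by positivity)
  obtain ⟨S, hS⟩ : ∃ S : ℝ, S = 2 * D * w₁ + CB + CB ^ 2 / (2 * c₀ * m₀ ^ 2) + A0 := ⟨_, rfl⟩
  have hS0 : 0 < S := by rw [hS]; positivity
  have hSA : A0 ≤ S := by
    rw [hS]
    have : 0 ≤ 2 * D * w₁ + CB + CB ^ 2 / (2 * c₀ * m₀ ^ 2) := by positivity
    linarith
  obtain ⟨cm, hcm⟩ : ∃ cm : ℝ, cm = d * max 1 (p - 1) := ⟨_, rfl⟩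
  have hcm0 : 0 < cm := by rw [hcm]; positivity
  refine ⟨A0 / 4, 2 * Z₁ * (p * m₁ * 3 + 2 * w₁) + cm * m₁ + c₀ / c₁ * g₁,
    min 1 (A0 / 8 / (2 * s * w₁)), μ, A0 / 8 / S, by positivity, by positivity,
    lt_min one_pos (by positivity), hμ0, by positivity, ?_⟩
  intro v Z gw gξ gJ Y gφ H L m w h gt e ξ ψ Dy r hv1 hv3 hH hL hm hw hZ hgw hh hhθ hξ hξ1 hr hrr hgξ
    hgJ hY hDy hgt he hψ hψμ hgφ
  have hvI : ‖v‖ ∈ Icc (1 / 4 : ℝ) 3 := ⟨hv1, hv3⟩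
  have hv : v ≠ 0 := by
    intro h0; rw [h0, norm_zero] at hv1; linarith
  have hmI := hmb _ hvI
  rw [← hm] at hmI
  have hwI := hwb _ hvI
  rw [← hw] at hwI
  have hZn : ‖Z‖ ≤ Z₁ := by rw [hZ, norm_A hp]; exact (hZb _ hvI).2
  have hξ0 : 0 < ξ := by linarith
  obtain ⟨-, htr2, htr⟩ := trC_sq_ge hp hd hv hH hL rfl rfl
  have hatr := abs_trC_le hp hd hv hH hL
  rw [← hm, ← hc₀] at htr2
  rw [← hm, ← hcm] at hatr
  have htr' : trC d L ^ 2 ≤ c₁ * (m * ‖H‖) ^ 2 := by rw [hc₁, hm]; linarith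
  have hid := pointwise_identities hp hv hH hm hw hZ rfl hgw rfl rfl
  have hZv : ⟪Z, v⟫ = w := hid.2.2.2.1
  have hm0 : 0 < m := hid.1
  have hLZ : L Z = (1 / p) • DA p v gw := by
    rw [hL, hZ, hgw, A, ← hm, ContinuousLinearMap.comp_apply, map_smul, map_smul, map_smul, smul_smul]
    congr 1; field_simp
  have hLY : L Z + Y = (1 / (p * ξ)) • DA p v gJ := by
    rw [hLZ, hY, hgJ, map_add, map_smul, map_smul, smul_add, smul_smul, smul_smul]
    congr 2
    · field_simp
    · ring
  have hH0 := norm_nonneg H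
  have hHv : ‖H v‖ ≤ 3 * ‖H‖ := (H.le_opNorm v).trans (by
    have := mul_le_left hv3 hH0; linarith)
  have hrS : S * r ≤ A0 / 8 := by
    rw [mul_comm]; exact (le_div_iff₀ hS0).1 hrr
  have hr1 : r ≤ 1 := by
    have h1 : S * r ≤ S * 1 := by linarith
    exact le_of_mul_le_mul_left h1 hS0
  have hgwn : ‖gw‖ ≤ p * m₁ * (3 * ‖H‖) := by
    rw [hgw, norm_smul, norm_of_nonneg (by positivity)]
    exact mul_le_mul (mul_le_left hmI.2 hp0.le) hHv (norm_nonneg _) (by positivity)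
  have hw0 : 0 < w := lt_of_lt_of_le hw₀ hwI.1
  have hwg : ‖w • gξ‖ ≤ 2 * w₁ * r := by
    rw [norm_smul, norm_of_nonneg hw0.le]
    have := mul_le_mul hwI.2 hgξ (norm_nonneg _) hw₁.le
    linarith
  have hJn : ‖gJ‖ ≤ (p * m₁ * 3 + 2 * w₁) * (1 + ‖H‖) := by
    rw [hgJ]
    refine (norm_add_le _ _).trans ?_
    have h1 : ‖ξ • gw‖ ≤ ‖gw‖ := by
      rw [norm_smul, norm_of_nonneg hξ0.le]
      have := mul_le_right hξ1 (norm_nonneg gw)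
      linarith
    have h2 : 2 * w₁ * r ≤ 2 * w₁ * 1 := mul_le_left hr1 (by positivity)
    have h3 : 0 ≤ w₁ * ‖H‖ := by positivity
    have h4 : 0 ≤ p * m₁ * 3 := by positivity
    linarith
  have hgw2 : ‖gw‖ ≤ (‖gJ‖ + 2 * w₁ * r) / ξ₀ := by
    rw [le_div_iff₀ hξ₀]
    have h1 : ξ • gw = gJ - w • gξ := by rw [hgJ]; abel
    have h2 : ξ * ‖gw‖ = ‖gJ - w • gξ‖ := by rw [← h1, norm_smul, norm_of_nonneg hξ0.le]
    have h3 := norm_sub_le gJ (w • gξ)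
    have h4 := mul_le_right hξ (norm_nonneg gw)
    linarith
  have hZgw : (p - 1) * ⟪Z, gw⟫ ≤ D * (‖gJ‖ + 2 * w₁ * r) := by
    have h1 : ⟪Z, gw⟫ ≤ Z₁ * ((‖gJ‖ + 2 * w₁ * r) / ξ₀) :=
      (real_inner_le_norm _ _).trans (mul_le_mul hZn hgw2 (norm_nonneg _) hZ₁.le)
    refine (mul_le_left h1 hP.le).trans (le_of_eq ?_)
    rw [hD]; ring
  have hmain : c₂ * ψ * ‖gJ‖ ^ 2 ≤ ⟪L Z + Y, gφ⟫ := by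
    rw [hLY, hgφ, real_inner_smul_left, real_inner_smul_right]
    have h1 := inner_DA_ge (p := p) hv gJ
    rw [← hm] at h1
    have h2 : m₀ * min 1 (p - 1) * ‖gJ‖ ^ 2 ≤ ⟪DA p v gJ, gJ⟫ :=
      le_trans (mul_le_right (mul_le_right hmI.1 hmn.le) (sq_nonneg _)) h1
    have h3 : 1 / p ≤ 1 / (p * ξ) := by
      apply one_div_le_one_div_of_le (by positivity)
      have := mul_le_left hξ1 hp0.le
      linarith
    have h4 := mul_le_mul h3 (mul_le_left h2 (by positivity : 0 ≤ 2 * ψ))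
      (by positivity) (by positivity)
    refine le_trans (le_of_eq ?_) h4
    rw [hc₂]; ring
  have hψ1 : ψ ≤ 1 := by
    have : μ ≤ 1 / 2 := hμ ▸ min_le_left _ _
    linarith
  have hψ2 : ψ ^ 2 ≤ 1 := pow_le_one₀ hψ hψ1
  have he1 : e * ⟪Z, gφ⟫ ≤ 2 * Z₁ * (p * m₁ * 3 + 2 * w₁) * (|e| * (1 + ‖H‖)) := by
    have h1 : |⟪Z, gφ⟫| ≤ Z₁ * (2 * ((p * m₁ * 3 + 2 * w₁) * (1 + ‖H‖))) := by
      refine (abs_real_inner_le_norm _ _).trans (mul_le_mul hZn ?_ (norm_nonneg _) hZ₁.le)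
      rw [hgφ, norm_smul, norm_of_nonneg (by positivity)]
      have h2 := mul_le_right hψ1 (norm_nonneg gJ)
      linarith
    refine (le_abs_self _).trans ?_
    rw [abs_mul]
    have := mul_le_left h1 (abs_nonneg e)
    linarith
  have he2 : e * trC d L * ψ ^ 2 ≤ cm * m₁ * (|e| * (1 + ‖H‖)) := by
    have h1 : |trC d L| ≤ cm * (m₁ * (1 + ‖H‖)) := by
      refine hatr.trans (mul_le_left ?_ hcm0.le)
      exact mul_le_mul hmI.2 (by linarith) hH0 hm₁.le
    have h2 : e * trC d L ≤ |e| * (cm * (m₁ * (1 + ‖H‖))) := by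
      refine (le_abs_self _).trans ?_
      rw [abs_mul]
      exact mul_le_left h1 (abs_nonneg e)
    have h3 : 0 ≤ |e| * (cm * (m₁ * (1 + ‖H‖))) := by positivity
    have h4 := mul_le_right h2 (sq_nonneg ψ)
    have h5 := mul_le_left hψ2 h3
    linarith
  have hg1 : gt ≤ g₁ := by
    have h1 : h ≤ 2 := hhθ.trans (by
      have : min 1 (A0 / 8 / (2 * s * w₁)) ≤ 1 := min_le_left _ _
      linarith)
    have h2 := mul_le_left hwI.2 hP.le
    rw [hgt, hg₁]; linarith
  have hg0 : g₀ ≤ gt := by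
    have h2 := mul_le_left hwI.1 hP.le
    rw [hgt, hg₀]; linarith
  have hT2 : c₀ / 2 * (m * ‖H‖) ^ 2 + A0 - c₀ / c₁ * g₁ * |e| ≤ trC d (L.comp L) := by
    have h1 : trC d L = e - gt := by rw [he]; ring
    have h2 : g₀ ^ 2 - 2 * g₁ * |e| ≤ trC d L ^ 2 := by
      rw [h1]
      have h3 : g₀ ^ 2 ≤ gt ^ 2 := pow_le_pow_left₀ hg₀0.le hg0 2
      have h4 : e * gt ≤ |e| * g₁ :=
        (mul_le_right (le_abs_self e) (hg₀0.le.trans hg0)).trans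
          (mul_le_left hg1 (abs_nonneg e))
      have h5 : (e - gt) ^ 2 = e ^ 2 - 2 * (e * gt) + gt ^ 2 := by ring
      rw [h5]
      have := sq_nonneg e
      linarith
    have h3 := mul_le_left (h2.trans htr') (by positivity : 0 ≤ c₀ / (2 * c₁))
    have h4 : c₀ / (2 * c₁) * (c₁ * (m * ‖H‖) ^ 2) = c₀ / 2 * (m * ‖H‖) ^ 2 := by field_simp
    have h5 : c₀ / (2 * c₁) * (g₀ ^ 2 - 2 * g₁ * |e|) = A0 - c₀ / c₁ * g₁ * |e| := by
      rw [hA0]; field_simp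
    linarith
  have he3 : c₀ / c₁ * g₁ * |e| * ψ ^ 2 ≤ c₀ / c₁ * g₁ * (|e| * (1 + ‖H‖)) := by
    have h1 : |e| * ψ ^ 2 ≤ |e| * (1 + ‖H‖) :=
      mul_le_left (by linarith) (abs_nonneg e)
    have := mul_le_left h1 (by positivity : 0 ≤ c₀ / c₁ * g₁)
    linarith
  have hQ : s * h * w ≤ A0 / 8 := by
    have h1 : h ≤ 2 * (A0 / 8 / (2 * s * w₁)) := hhθ.trans (by
      have : min 1 (A0 / 8 / (2 * s * w₁)) ≤ A0 / 8 / (2 * s * w₁) := min_le_right _ _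
      linarith)
    have h2 := mul_le_mul (mul_le_left h1 hs.le) hwI.2 hw0.le (by positivity)
    refine h2.trans (le_of_eq ?_)
    field_simp
  have hμ' : 2 * μ * (D ^ 2 / (4 * c₂)) ≤ A0 / 8 := by
    have h1 : μ ≤ A0 / 8 / (2 * (D ^ 2 / (4 * c₂))) := hμ ▸ min_le_right _ _
    rw [le_div_iff₀ (by positivity)] at h1
    linarith
  refine gradient_max_scalar (Q := s * h * w) (a := m * ‖H‖) (J := ‖gJ‖) hA00 hc₀0 hc₂0 hm₀ hD0.le
    hw₁.le hCB hr (hS ▸ hrS) hH0 (mul_le_right hmI.1 hH0) hψ hψμ hμ' hQ ?_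
  rw [show L Z - e • Z + Y = (L Z + Y) - e • Z by abel, inner_sub_left, real_inner_smul_left,
    inner_add_right, real_inner_smul_right, real_inner_smul_right, hZv]
  have hDy' := (abs_le.1 hDy).1
  have hsum : c₀ / 2 * (m * ‖H‖) ^ 2 + A0 - c₀ / c₁ * g₁ * |e| - D * (‖gJ‖ + 2 * w₁ * r) - s * h * w
      - CB * r * (r + ‖H‖) ≤ trC d (L.comp L) - ((p - 1) * ⟪Z, gw⟫ + s * h * w) + Dy := by linarith
  have hsum' := mul_le_right hsum (sq_nonneg ψ)
  have hee : -trC d L ^ 2 - gt * trC d L = -(e * trC d L) := by rw [he]; ring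
  have hee' : (trC d (L.comp L) - trC d L ^ 2 - gt * trC d L - ((p - 1) * ⟪Z, gw⟫ + s * h * w) + Dy) *
      ψ ^ 2 = (trC d (L.comp L) - ((p - 1) * ⟪Z, gw⟫ + s * h * w) + Dy) * ψ ^ 2 -
        e * trC d L * ψ ^ 2 := by linear_combination ψ ^ 2 * hee
  rw [hee']
  linarith

end gradient_max

section gradient_max
variable {d : ℕ} {p s : ℝ}

/-- The vector field `(‖v‖^p / (p ξ)) DA(v) ∇ξ` for `ξ = 1 - ‖z‖²`. -/
noncomputable def bvec (p : ℝ) (a : Eu d × Eu d) : Eu d :=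
  (-2 * ‖a.2‖ ^ p / (p * (1 - ‖a.1‖ ^ 2))) • DA p a.2 a.1

theorem contDiffAt_bvec (hp : 1 < p) {a : Eu d × Eu d} (h1 : ‖a.1‖ ^ 2 < 1) (h2 : a.2 ≠ 0) :
    ContDiffAt ℝ 1 (bvec p) a := by
  have hn : ContDiffAt ℝ 1 (fun a : Eu d × Eu d => ‖a.2‖) a := contDiffAt_snd.norm ℝ h2
  have hr : ∀ q : ℝ, ContDiffAt ℝ 1 (fun a : Eu d × Eu d => ‖a.2‖ ^ q) a := fun q =>
    hn.rpow_const_of_ne (norm_ne_zero_iff.2 h2)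
  have hn1 : ContDiffAt ℝ 1 (fun a : Eu d × Eu d => ‖a.1‖ ^ 2) a := contDiffAt_fst.norm_sq ℝ
  have hn2 : ContDiffAt ℝ 1 (fun a : Eu d × Eu d => ‖a.2‖ ^ 2) a := contDiffAt_snd.norm_sq ℝ
  unfold bvec
  simp only [DA_apply]
  have hne : p * (1 - ‖a.1‖ ^ 2) ≠ 0 := (mul_pos (by linarith) (by linarith)).ne'
  refine ((contDiffAt_const.mul (hr p)).div (contDiffAt_const.mul (contDiffAt_const.sub hn1)) hne).smul
    ((hr _).smul (contDiffAt_fst.add (((contDiffAt_const.mul (hn2.inv ?_)).mul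
      (contDiffAt_snd.inner ℝ contDiffAt_fst)).smul contDiffAt_snd)))
  exact pow_ne_zero _ (norm_ne_zero_iff.2 h2)

theorem exists_bound_dv_bvec (hp : 1 < p) {ξ₀ : ℝ} (hξ₀ : 0 < ξ₀) : ∃ C, 0 ≤ C ∧
    ∀ {V : Eu d → Eu d} {x y : Eu d} {r : ℝ}, 0 < r → DifferentiableAt ℝ V x →
      ‖r • (x - y)‖ ^ 2 ≤ 1 - ξ₀ → 1 / 4 ≤ ‖V x‖ → ‖V x‖ ≤ 3 →
      |dv (fun x => r • bvec p (r • (x - y), V x)) x| ≤ C * r * (r + ‖fderiv ℝ V x‖) := by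
  obtain ⟨S, hS⟩ : ∃ S : Set (Eu d × Eu d), S = (closedBall 0 1 ∩ {z | ‖z‖ ^ 2 ≤ 1 - ξ₀}) ×ˢ
    (closedBall 0 3 ∩ {v | 1 / 4 ≤ ‖v‖}) := ⟨_, rfl⟩
  have hSc : IsCompact S := by
    rw [hS]
    exact ((isCompact_closedBall _ _).inter_right (isClosed_le (by fun_prop) continuous_const)).prod
      ((isCompact_closedBall _ _).inter_right (isClosed_le continuous_const continuous_norm))
  have hat : ∀ a ∈ S, ContDiffAt ℝ 1 (bvec (d := d) p) a := by
    intro a ha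
    rw [hS] at ha
    have h1 : ‖a.1‖ ^ 2 ≤ 1 - ξ₀ := ha.1.2
    have h2 : 1 / 4 ≤ ‖a.2‖ := ha.2.2
    refine contDiffAt_bvec hp (by linarith) fun h0 => ?_
    rw [h0, norm_zero] at h2; linarith
  obtain ⟨C₀, hC₀⟩ := hSc.exists_bound_of_continuousOn (f := fderiv ℝ (bvec (d := d) p)) fun a ha =>
    ((hat a ha).continuousAt_fderiv one_ne_zero).continuousWithinAt
  refine ⟨‖trC d‖ * max C₀ 0, by positivity, fun {V x y r} hr hV hz h1 h2 => ?_⟩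
  have hmem : (r • (x - y), V x) ∈ S := by
    rw [hS]
    refine ⟨⟨?_, hz⟩, ?_, h1⟩
    · rw [mem_closedBall_zero_iff]
      by_contra hlt
      have : 1 < ‖r • (x - y)‖ ^ 2 := one_lt_pow₀ (not_le.1 hlt) two_ne_zero
      linarith
    · rw [mem_closedBall_zero_iff]; exact h2
  have hin : HasFDerivAt (fun x => (r • (x - y), V x))
      ((r • ContinuousLinearMap.id ℝ (Eu d)).prod (fderiv ℝ V x)) x :=
    (((hasFDerivAt_id x).sub_const y).const_smul r).prodMk hV.hasFDerivAt
  have hder := ((((hat _ hmem).differentiableAt one_ne_zero).hasFDerivAt).comp x hin).const_smul r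
  have hfd : fderiv ℝ (fun x => r • bvec p (r • (x - y), V x)) x = r •
      (fderiv ℝ (bvec p) (r • (x - y), V x)).comp
        ((r • ContinuousLinearMap.id ℝ (Eu d)).prod (fderiv ℝ V x)) := HasFDerivAt.fderiv hder
  rw [dv_eq_trC, hfd, ← norm_eq_abs]
  refine ((trC d).le_opNorm _).trans ?_
  rw [mul_assoc, mul_assoc]
  refine mul_le_left ?_ (norm_nonneg _)
  rw [norm_smul, norm_of_nonneg hr.le]
  have hn : ‖(r • ContinuousLinearMap.id ℝ (Eu d)).prod (fderiv ℝ V x)‖ ≤ r + ‖fderiv ℝ V x‖ := by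
    rw [ContinuousLinearMap.opNorm_prod, Prod.norm_def]
    have h3 : ‖r • ContinuousLinearMap.id ℝ (Eu d)‖ ≤ r := by
      rw [norm_smul, norm_of_nonneg hr.le]
      have := mul_le_left (ContinuousLinearMap.norm_id_le (𝕜 := ℝ) (E := Eu d)) hr.le
      linarith
    exact max_le (h3.trans (by linarith [norm_nonneg (fderiv ℝ V x)])) (by simp only; linarith)
  have hc := ContinuousLinearMap.opNorm_comp_le (fderiv ℝ (bvec p) (r • (x - y), V x))
    ((r • ContinuousLinearMap.id ℝ (Eu d)).prod (fderiv ℝ V x))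
  have h4 := hc.trans (mul_le_mul ((hC₀ _ hmem).trans (le_max_left _ 0)) hn (norm_nonneg _)
    (le_max_right _ _))
  have := mul_le_left h4 hr.le
  linarith

theorem hasGradientAt_paraboloid (y x : Eu d) (r : ℝ) :
    HasGradientAt (fun x => 1 - r ^ 2 * ‖x - y‖ ^ 2) (-(2 * r ^ 2) • (x - y)) x := by
  have h1 := ((((hasFDerivAt_id x).sub_const y).norm_sq).const_mul (r ^ 2)).const_sub 1
  rw [hasGradientAt_iff_hasFDerivAt]
  refine HasFDerivAt.congr_fderiv (by exact h1) ?_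
  ext z
  simp [inner_smul_left]
  ring

/-- If `exp (s f)` is small on a large ball where `‖∇f‖ ≤ 2`, then `‖∇f‖` is small at the center. -/
theorem gradient_small (hp : 1 < p) (hd : 2 ≤ d) (hs : 0 < s) : ∃ θ₀ > 0, ∃ R₀ > 0,
    ∀ {Ω : Set (Eu d)} {f : Eu d → ℝ}, WeakEq p Ω f (rhs p s f) → ∀ (y : Eu d) (R : ℝ), R₀ ≤ R →
      closedBall y R ⊆ Ω → (∀ x ∈ closedBall y R, ‖∇f x‖ ≤ 2) →
      (∀ x ∈ closedBall y R, exp (s * f x) ≤ θ₀) → ‖∇f y‖ ^ p < 1 / 2 := by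
  have hp0 : 0 < p := by linarith
  obtain ⟨ξ₀, hξ₀⟩ : ∃ ξ₀ : ℝ, ξ₀ = 1 / 4 / 3 ^ p := ⟨_, rfl⟩
  have hξ₀0 : 0 < ξ₀ := by rw [hξ₀]; positivity
  obtain ⟨CB, hCB, hdvB⟩ := exists_bound_dv_bvec (d := d) hp hξ₀0
  obtain ⟨c₃, C₄, θ₀, μ₀, r₀, hc₃, hC₄, hθ₀, hμ₀, hr₀, hpt⟩ :=
    gradient_max_pointwise hp hd hs hξ₀0 hCB
  refine ⟨θ₀, hθ₀, 1 / r₀, by positivity, fun {Ω f} h y R hR hΩ hv2 hθ => ?_⟩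
  by_contra hlt
  have hy2 : 1 / 2 ≤ ‖∇f y‖ ^ p := not_lt.1 hlt
  have hR0 : 0 < R := lt_of_lt_of_le (by positivity) hR
  obtain ⟨r, hr⟩ : ∃ r : ℝ, r = 1 / R := ⟨_, rfl⟩
  have hr0 : 0 < r := by rw [hr]; positivity
  have hrr : r ≤ r₀ := by rw [hr, one_div_le hR0 hr₀]; exact hR
  have hrR : r * R = 1 := by rw [hr]; field_simp
  have hK := isCompact_closedBall y R
  obtain ⟨ξ, hξ⟩ : ∃ ξ : Eu d → ℝ, ξ = fun x => 1 - r ^ 2 * ‖x - y‖ ^ 2 := ⟨_, rfl⟩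
  have hξg : ∀ x, HasGradientAt ξ (-(2 * r ^ 2) • (x - y)) x := fun x => by
    rw [hξ]; exact hasGradientAt_paraboloid y x r
  have hξ1 : ∀ x, ξ x ≤ 1 := fun x => by
    rw [hξ]; have : 0 ≤ r ^ 2 * ‖x - y‖ ^ 2 := by positivity
    simp only; linarith
  have hξc : ContDiff ℝ ∞ ξ := by
    rw [hξ]; exact contDiff_const.sub (contDiff_const.mul ((contDiff_id.sub contDiff_const).norm_sq ℝ))
  have hξpos : ∀ x, 0 ≤ ξ x → x ∈ closedBall y R := by
    intro x hx
    rw [hξ] at hx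
    rw [mem_closedBall, dist_eq_norm]
    have h1 : (r * ‖x - y‖) ^ 2 ≤ 1 := by rw [mul_pow]; simp only at hx; linarith
    have h2 : r * ‖x - y‖ ≤ 1 := by
      by_contra hc
      have := one_lt_pow₀ (not_le.1 hc) two_ne_zero
      linarith
    rw [← hrR] at h2
    exact le_of_mul_le_mul_left h2 hr0
  have hξnn : ∀ x ∈ closedBall y R, 0 ≤ ξ x := by
    intro x hx
    rw [mem_closedBall, dist_eq_norm] at hx
    have h1 : r * ‖x - y‖ ≤ 1 := hrR ▸ mul_le_left hx hr0.le
    have h2 : (r * ‖x - y‖) ^ 2 ≤ 1 := pow_le_one₀ (by positivity) h1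
    rw [mul_pow] at h2
    rw [hξ]; simp only; linarith
  have hJc : ContinuousOn (fun x => ‖∇f x‖ ^ p * ξ x) (closedBall y R) :=
    (((h.continuousOn_gradient.mono hΩ).norm.rpow_const fun _ _ => Or.inr hp0.le)).mul
      hξc.continuous.continuousOn
  obtain ⟨x₀, hx₀, hmax⟩ := hK.exists_isMaxOn ⟨y, mem_closedBall_self hR0.le⟩ hJc
  obtain ⟨M, hM⟩ : ∃ M, M = ‖∇f x₀‖ ^ p * ξ x₀ := ⟨_, rfl⟩
  have hmax' : ∀ x ∈ closedBall y R, ‖∇f x‖ ^ p * ξ x ≤ M := fun x hx => by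
    rw [hM]; exact hmax hx
  have hMy : 1 / 2 ≤ M := by
    have h1 := hmax' y (mem_closedBall_self hR0.le)
    have h2 : ξ y = 1 := by rw [hξ]; simp
    rw [h2, mul_one] at h1
    linarith
  obtain ⟨μ, hμ⟩ : ∃ μ : ℝ, μ = min μ₀ (1 / 4) := ⟨_, rfl⟩
  have hμ0 : 0 < μ := by rw [hμ]; exact lt_min hμ₀ (by norm_num)
  have hμ4 : μ ≤ 1 / 4 := by rw [hμ]; exact min_le_right _ _
  have hμμ₀ : μ ≤ μ₀ := by rw [hμ]; exact min_le_left _ _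
  obtain ⟨c, hc⟩ : ∃ c : ℝ, c = M - μ := ⟨_, rfl⟩
  have hc4 : 1 / 4 ≤ c := by rw [hc]; linarith
  have hfK : ContinuousOn f (closedBall y R) := h.c1.continuousOn.mono hΩ
  have hgK : ContinuousOn (∇f) (closedBall y R) := h.continuousOn_gradient.mono hΩ
  have cnp : Continuous fun v : Eu d => ‖v‖ ^ p := continuous_norm.rpow_const fun _ => Or.inr hp0.le
  obtain ⟨δ₁, hδ₁, hu₁⟩ := unif_comp hK hfK hgK (Γ := fun z => ‖z.2‖ ^ p) (cnp.comp continuous_snd) hμ0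
  obtain ⟨δ₂, hδ₂, hu₂⟩ := unif_comp hK hfK hgK (Γ := fun z => exp (s * z.1)) (by fun_prop) hθ₀
  obtain ⟨δ, hδ⟩ : ∃ δ : ℝ, δ = min 1 (min δ₁ δ₂) := ⟨_, rfl⟩
  have hδ0 : 0 < δ := by rw [hδ]; exact lt_min one_pos (lt_min hδ₁ hδ₂)
  have hδ1 : δ ≤ 1 := by rw [hδ]; exact min_le_left _ _
  have hδδ₁ : δ ≤ δ₁ := by rw [hδ]; exact (min_le_right _ _).trans (min_le_left _ _)
  have hδδ₂ : δ ≤ δ₂ := by rw [hδ]; exact (min_le_right _ _).trans (min_le_right _ _)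
  obtain ⟨Rf, hRf⟩ : ∃ Rf : Jet d → ℝ,
    Rf = fun z => c₃ * (max (‖z.2.2‖ ^ p * ξ z.1 - c) 0) ^ 2 := ⟨_, rfl⟩
  have hRc : Continuous Rf := by
    rw [hRf]
    have h1 : Continuous fun z : Jet d => ‖z.2.2‖ ^ p * ξ z.1 :=
      (cnp.comp (continuous_snd.comp continuous_snd)).mul (hξc.continuous.comp continuous_fst)
    exact continuous_const.mul (((h1.sub continuous_const).max continuous_const).pow 2)
  have hneg : ∀ (x v : Eu d), x ∉ closedBall y R → max (‖v‖ ^ p * ξ x - c) 0 = 0 := by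
    intro x v hx
    apply max_eq_right
    have h1 : ξ x ≤ 0 := by
      by_contra h2; exact hx (hξpos x (not_le.1 h2).le)
    have := mul_nonpos_of_nonneg_of_nonpos (by positivity : 0 ≤ ‖v‖ ^ p) h1
    linarith
  have hRs : ∀ x t v, x ∉ closedBall y R → Rf (x, t, v) = 0 := fun x t v hx => by
    rw [hRf]; simp only [hneg x v hx]; ring
  have hquarter : ∀ (x v : Eu d), c ≤ ‖v‖ ^ p * ξ x → 0 ≤ ξ x ∧ 1 / 4 ≤ ‖v‖ := by
    intro x v hx
    have h0 : 0 ≤ ‖v‖ ^ p := by positivity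
    have h1 : 0 ≤ ξ x := by
      by_contra h2
      have := mul_nonpos_of_nonneg_of_nonpos h0 (not_le.1 h2).le
      linarith
    refine ⟨h1, ?_⟩
    by_contra h2
    have h3 : ‖v‖ ^ p ≤ ‖v‖ ^ (1:ℝ) :=
      Real.rpow_le_rpow_of_exponent_ge_of_imp (norm_nonneg _) (by linarith) hp.le (fun _ h => by linarith)
    rw [Real.rpow_one] at h3
    have h4 := mul_le_left (hξ1 x) h0
    linarith
  have key : ∫ x, Rf (x, f x, ∇f x) ≤ 0 := by
    refine h.integral_nonpos_of_approx hp hK hΩ (c₀ := 1 / 4) (by norm_num) hδ0 (C := C₄) hRc hRs ?_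
    intro F hF hFf
    have cgF : Continuous (∇F) := (contDiff_gradient hF).continuous
    have cw : ContDiff ℝ 1 fun x => ‖∇F x‖ ^ p :=
      (contDiff_norm_rpow hp).comp ((contDiff_gradient hF).of_le (by norm_cast))
    have cF : ContDiff ℝ 1 F := hF.of_le (by norm_cast)
    have cJ : ContDiff ℝ 1 fun x => ‖∇F x‖ ^ p * ξ x := cw.mul (hξc.of_le (by norm_cast))
    obtain ⟨φ, hφ⟩ : ∃ φ : Eu d → ℝ, φ = fun x => (max (‖∇F x‖ ^ p * ξ x - c) 0) ^ 2 := ⟨_, rfl⟩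
    have cφ : ContDiff ℝ 1 φ := by
      rw [hφ]; exact contDiff_posPart_sq.comp (cJ.sub contDiff_const)
    have hts : ∀ x ∈ tsupport φ, c ≤ ‖∇F x‖ ^ p * ξ x := by
      intro x hx
      have hcl : IsClosed {x | c ≤ ‖∇F x‖ ^ p * ξ x} :=
        isClosed_le continuous_const cJ.continuous
      refine closure_minimal (fun z hz => ?_) hcl hx
      by_contra hn
      rw [Function.mem_support, hφ] at hz
      apply hz
      have : max (‖∇F z‖ ^ p * ξ z - c) 0 = 0 := max_eq_right (by
        rw [mem_setOf_eq, not_le] at hn; linarith)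
      simp only [this]; ring
    have hne : ∀ x, 1 / 4 ≤ ‖∇F x‖ → ∇F x ≠ 0 := fun x hx h0 => by
      rw [h0, norm_zero] at hx; linarith
    have htsK : tsupport φ ⊆ closedBall y R := fun x hx => hξpos x (hquarter x _ (hts x hx)).1
    have hξpos' : ∀ x, c ≤ ‖∇F x‖ ^ p * ξ x → 0 < ξ x := by
      intro x hx
      rcases (hquarter x _ hx).1.lt_or_eq with h1 | h1
      · exact h1
      · rw [← h1, mul_zero] at hx; linarith
    have hzx : ∀ x, ‖r • (x - y)‖ ^ 2 = 1 - ξ x := fun x => by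
      rw [norm_smul, norm_of_nonneg hr0.le, mul_pow, hξ]; ring
    refine bochner_le (Z := fun z => A p (∇F z))
      (Y := fun x => r • bvec p (r • (x - y), ∇F x)) (k := rhs p s F) cφ
      (hK.of_isClosed_subset (isClosed_tsupport _) htsK)
      (fun x hx => contDiffAt_A_gradient hF (hne x (hquarter x _ (hts x hx)).2)) ?_ ?_ ?_ ?_ hC₄ ?_ ?_ ?_
    · intro x _
      exact ((contDiff_const.mul cw).add (contDiff_const.mul cF).exp).contDiffAt
    · intro x hx
      have h1 := contDiffAt_bvec hp (a := (r • (x - y), ∇F x))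
        (by simp only [hzx]; linarith [hξpos' x (hts x hx)]) (hne x (hquarter x _ (hts x hx)).2)
      have h2 : ContDiffAt ℝ 1 (fun x => (r • (x - y), ∇F x)) x :=
        ((contDiffAt_id.sub contDiffAt_const).const_smul r).prodMk
          ((contDiff_gradient hF).contDiffAt.of_le (by norm_cast))
      exact (h1.comp x h2).const_smul r
    · have cRF : Continuous fun x => Rf (x, F x, ∇F x) :=
        hRc.comp (continuous_id.prodMk (hF.continuous.prodMk cgF))
      refine cRF.integrable_of_hasCompactSupport (HasCompactSupport.intro hK fun x hx => hRs x _ _ hx)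
    · exact (isClosed_closedBall.inter (isClosed_le continuous_const cgF.norm)).measurableSet
    · exact fun x hx hx' => hx ⟨htsK hx', (hquarter x _ (hts x hx')).2⟩
    · intro x hx
      have h1 : max (‖∇F x‖ ^ p * ξ x - c) 0 = 0 := by
        by_cases hxK : x ∈ closedBall y R
        · apply max_eq_right
          by_contra h2
          exact hx ⟨hxK, (hquarter x _ (by linarith)).2⟩
        · exact hneg x _ hxK
      rw [hRf]; simp only [h1]; norm_num
    · rintro x ⟨hxK, hx4⟩
      obtain ⟨v, hvd⟩ : ∃ v, v = ∇F x := ⟨_, rfl⟩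
      obtain ⟨H, hHd⟩ : ∃ H, H = fderiv ℝ (∇F) x := ⟨_, rfl⟩
      have hv := hne x hx4
      have hsym : ∀ y z, ⟪H y, z⟫ = ⟪y, H z⟫ := by rw [hHd]; exact hessian_symm hF x
      obtain ⟨L, hL⟩ : ∃ L, L = (DA p v).comp H := ⟨_, rfl⟩
      have hfZ : fderiv ℝ (fun y => A p (∇F y)) x = L := by
        rw [fderiv_A_gradient hF hv, hL, hvd, hHd]
      have hdvZ : dv (fun y => A p (∇F y)) x = trC d L := by rw [dv_eq_trC, hfZ]
      obtain ⟨gw, hgw⟩ : ∃ gw, gw = (p * ‖v‖ ^ (p - 2)) • H v := ⟨_, rfl⟩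
      have hwg : HasGradientAt (fun y => ‖∇F y‖ ^ p) gw x := by
        rw [hgw, hvd, hHd]; exact hasGradientAt_norm_gradient_rpow hp hF x
      have hgk : ∇(rhs p s F) x = (p - 1) • gw + (s * exp (s * F x)) • v := by
        refine HasGradientAt.gradient (HasGradientAt.add' ?_ ?_)
        · refine HasGradientAt.comp_real (k := fun t => (p - 1) * t) ?_ hwg
          simpa using (hasDerivAt_id (‖∇F x‖ ^ p)).const_mul (p - 1)
        · refine HasGradientAt.comp_real (k := fun t => exp (s * t)) ?_ ?_
          · have := ((hasDerivAt_id (F x)).const_mul s).exp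
            refine this.congr_deriv ?_
            simp only [id, mul_one]; ring
          · rw [hvd]; exact hasGradientAt_of_contDiffAt cF.contDiffAt
      obtain ⟨gξ, hgξ⟩ : ∃ gξ, gξ = -(2 * r ^ 2) • (x - y) := ⟨_, rfl⟩
      obtain ⟨gJ, hgJ⟩ : ∃ gJ, gJ = ξ x • gw + ‖v‖ ^ p • gξ := ⟨_, rfl⟩
      have hgφ : ∇φ x = (2 * max (‖v‖ ^ p * ξ x - c) 0) • gJ := by
        rw [hφ]
        refine HasGradientAt.gradient (HasGradientAt.comp_real (k := fun t => (max (t - c) 0) ^ 2)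
          (f := fun x => ‖∇F x‖ ^ p * ξ x) ?_ ?_)
        · have := (hasDerivAt_posPart_sq (‖∇F x‖ ^ p * ξ x - c)).comp
            (‖∇F x‖ ^ p * ξ x) ((hasDerivAt_id _).sub_const c)
          rw [hvd]
          refine HasDerivAt.congr_deriv (by exact this) (mul_one _)
        · rw [hgJ, add_comm, hvd, hgξ]; exact HasGradientAt.mul' hwg (hξg x)
      have hφx : φ x = (max (‖v‖ ^ p * ξ x - c) 0) ^ 2 := by rw [hφ, hvd]
      have hRx : Rf (x, F x, ∇F x) = c₃ * (max (‖v‖ ^ p * ξ x - c) 0) ^ 2 := by rw [hRf, hvd]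
      obtain ⟨ψ, hψ⟩ : ∃ ψ, ψ = max (‖v‖ ^ p * ξ x - c) 0 := ⟨_, rfl⟩
      rw [hgk, hfZ, hdvZ, hgφ, hφx, hRx, resid, hdvZ, ← hψ, ← hvd, ← hHd]
      have hψ0 : 0 ≤ ψ := by rw [hψ]; exact le_max_right _ _
      rcases hψ0.lt_or_eq with hψpos | hψz
      swap
      · rw [← hψz]
        have h1 : 0 ≤ C₄ * (|trC d L + rhs p s F x| * (1 + ‖H‖)) := by positivity
        simpa using h1
      have hψJ : ψ = ‖v‖ ^ p * ξ x - c := by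
        rw [hψ]; refine max_eq_left ?_
        by_contra hn
        rw [hψ, max_eq_right (not_le.1 hn).le] at hψpos
        exact lt_irrefl _ hψpos
      have hFx := hFf x hxK
      have hw1 := hu₁ x hxK (F x) (∇F x) (hFx.1.trans hδδ₁) (hFx.2.trans hδδ₁)
      have hh1 := hu₂ x hxK (F x) (∇F x) (hFx.1.trans hδδ₂) (hFx.2.trans hδδ₂)
      simp only [← hvd] at hw1 hh1
      have hξx0 := hξnn x hxK
      have hψμ : ψ ≤ 2 * μ₀ := by
        have h1 := hmax' x hxK
        have h2 := mul_le_right (abs_le.1 hw1).2 hξx0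
        have h3 := mul_le_left (hξ1 x) hμ0.le
        rw [hψJ, hc]; linarith
      have hv3 : ‖v‖ ≤ 3 := by
        have h1 := hFx.2
        have h2 := norm_sub_norm_le (∇F x) (∇f x)
        have h3 := hv2 x hxK
        rw [hvd]; linarith
      have hh2 : exp (s * F x) ≤ 2 * θ₀ := by
        have h1 := (abs_le.1 hh1).2
        have h2 := hθ x hxK
        linarith
      have hξx : ξ₀ ≤ ξ x := by
        have h1 : ‖v‖ ^ p ≤ 3 ^ p := rpow_le_rpow (norm_nonneg _) hv3 hp0.le
        have h2 := mul_le_right h1 hξx0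
        rw [hξ₀, div_le_iff₀ (by positivity)]; linarith
      have hgξn : ‖gξ‖ ≤ 2 * r := by
        rw [hgξ, norm_smul, norm_neg, norm_of_nonneg (by positivity)]
        rw [mem_closedBall, dist_eq_norm] at hxK
        have h1 := mul_le_left hxK (by positivity : 0 ≤ 2 * r ^ 2)
        have h2 : 2 * r ^ 2 * R = 2 * r * (r * R) := by ring
        rw [h2, hrR] at h1
        linarith
      have hY : r • bvec p (r • (x - y), v) = (‖v‖ ^ p / (p * ξ x)) • DA p v gξ := by
        rw [bvec, hgξ, map_smul, map_smul, smul_smul, smul_smul, smul_smul]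
        congr 1
        simp only [hzx]
        rw [sub_sub_cancel]
        ring
      have hDy := hdvB (V := ∇F) (y := y) hr0
        ((contDiff_gradient hF).differentiable (by simp) x) (by rw [hzx]; linarith)
        hx4 (by rw [← hvd]; exact hv3)
      rw [← hHd] at hDy
      have hrhs : rhs p s F x = (p - 1) * ‖v‖ ^ p + exp (s * F x) := by rw [rhs, hvd]
      exact hpt (by rw [hvd]; exact hx4) hv3 hsym hL rfl rfl rfl hgw (exp_pos _) hh2 hξx (hξ1 x)
        hr0 hrr hgξn hgJ hY hDy hrhs rfl hψ0 hψμ rfl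
  have iR := h.integrable_comp hK hΩ hRc hRs
  have hnn : ∀ x, 0 ≤ Rf (x, f x, ∇f x) := fun x => by rw [hRf]; positivity
  have hae := (integral_eq_zero_iff_of_nonneg hnn iR).1 (le_antisymm key (integral_nonneg hnn))
  have hx₀Ω : x₀ ∈ Ω := hΩ hx₀
  have hcat : ContinuousAt (fun x => Rf (x, f x, ∇f x)) x₀ :=
    hRc.continuousAt.comp (continuousAt_id.prodMk ((h.contDiffAt hx₀Ω).continuousAt.prodMk
      (continuousAt_gradient (h.contDiffAt hx₀Ω))))
  have hpos : 0 < Rf (x₀, f x₀, ∇f x₀) := by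
    rw [hRf]
    simp only [← hM]
    have h1 : max (M - c) 0 = μ := by rw [hc, sub_sub_cancel]; exact max_eq_left hμ0.le
    rw [h1]; positivity
  have hev := hcat.eventually (lt_mem_nhds hpos)
  refine (Measure.measure_pos_of_mem_nhds volume hev).ne' (measure_mono_null (fun x hx => ?_) (ae_iff.1 hae))
  exact (ne_of_gt hx)

end gradient_max

section doubling
variable {d : ℕ} {p s b β c ε N₀ : ℝ}

/-- Universal a priori estimate for the logarithm of a positive solution. -/
theorem Consts.universal_estimate (hC : Consts d p s b β c ε N₀) : ∃ C > 0,
    ∀ {Ω : Set (Eu d)} {f : Eu d → ℝ}, WeakEq p Ω f (rhs p s f) → ∀ (y : Eu d) (ρ : ℝ), 0 < ρ →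
      closedBall y ρ ⊆ Ω →
      (‖∇f y‖ ^ p + β * exp (s * f y)) ^ (1 / p) * ρ ≤ C := by
  have hp := hC.hp
  have hp0 : 0 < p := by linarith
  have hs := hC.hs
  have hβ := hC.β_pos
  obtain ⟨θ₀, hθ₀, R₀, hR₀, hgs⟩ := gradient_small (d := d) hp hC.two_le hs
  obtain ⟨θ, hθ⟩ : ∃ θ : ℝ, θ = min θ₀ (1 / (4 * β)) := ⟨_, rfl⟩
  have hθ0 : 0 < θ := by rw [hθ]; exact lt_min hθ₀ (by positivity)
  have hθβ : β * θ ≤ 1 / 4 := by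
    have h1 : θ ≤ 1 / (4 * β) := by rw [hθ]; exact min_le_right _ _
    rw [le_div_iff₀ (by positivity)] at h1
    linarith
  obtain ⟨k₀, hk₀, hes⟩ := hC.exp_small hθ0
  refine ⟨2 * (k₀ + R₀), by positivity, fun {Ω f} h y ρ hρ hΩ => ?_⟩
  by_contra hlt
  rw [not_le] at hlt
  obtain ⟨M, hM⟩ : ∃ M : Eu d → ℝ, M = fun x => (‖∇f x‖ ^ p + β * exp (s * f x)) ^ (1 / p) := ⟨_, rfl⟩
  have hG0 : ∀ x, 0 < ‖∇f x‖ ^ p + β * exp (s * f x) := fun x => by positivity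
  have hM0 : ∀ x, 0 < M x := fun x => by rw [hM]; exact rpow_pos_of_pos (hG0 x) _
  have hMp : ∀ x, M x ^ p = ‖∇f x‖ ^ p + β * exp (s * f x) := fun x => by
    rw [hM]; simp only
    rw [← rpow_mul (hG0 x).le, one_div_mul_cancel hp0.ne', Real.rpow_one]
  have hMc : ContinuousOn M (closedBall y ρ) := by
    rw [hM]
    have h1 := (h.continuousOn_gradient.mono hΩ).norm.rpow_const fun _ _ => Or.inr hp0.le
    have h2 : ContinuousOn f (closedBall y ρ) := h.c1.continuousOn.mono hΩ
    exact (h1.add (continuousOn_const.mul (continuousOn_const.mul h2).rexp)).rpow_const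
      fun _ _ => Or.inr (by positivity)
  have hΦc : ContinuousOn (fun x => M x * (ρ - ‖x - y‖)) (closedBall y ρ) :=
    hMc.mul (by fun_prop)
  obtain ⟨a, ha, hmax⟩ := (isCompact_closedBall y ρ).exists_isMaxOn ⟨y, mem_closedBall_self hρ.le⟩ hΦc
  have hmax' : ∀ x ∈ closedBall y ρ, M x * (ρ - ‖x - y‖) ≤ M a * (ρ - ‖a - y‖) := fun x hx => hmax hx
  obtain ⟨t, ht⟩ : ∃ t, t = ρ - ‖a - y‖ := ⟨_, rfl⟩
  have hMt : 2 * (k₀ + R₀) < M a * t := by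
    have h1 := hmax' y (mem_closedBall_self hρ.le)
    rw [sub_self, norm_zero, sub_zero] at h1
    rw [ht]
    refine lt_of_lt_of_le ?_ h1
    rw [hM]; exact hlt
  have hMa := hM0 a
  have ht0 : 0 < t := by
    by_contra hn
    have := mul_nonpos_of_nonneg_of_nonpos hMa.le (not_lt.1 hn)
    linarith
  have hdouble : ∀ x, ‖x - a‖ ≤ t / 2 → x ∈ closedBall y ρ ∧ M x ≤ 2 * M a := by
    intro x hx
    have h1 : ‖x - y‖ ≤ ‖x - a‖ + ‖a - y‖ := norm_sub_le_norm_sub_add_norm_sub x a y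
    have hxb : x ∈ closedBall y ρ := by rw [mem_closedBall, dist_eq_norm]; linarith
    refine ⟨hxb, ?_⟩
    have h2 := hmax' x hxb
    rw [← ht] at h2
    have h3 : M x * (t / 2) ≤ M x * (ρ - ‖x - y‖) := mul_le_left (by linarith) (hM0 x).le
    have h4 : M x * t ≤ 2 * M a * t := by linarith
    exact le_of_mul_le_mul_right h4 ht0
  obtain ⟨l, hl⟩ : ∃ l, l = (M a)⁻¹ := ⟨_, rfl⟩
  have hl0 : 0 < l := by rw [hl]; exact inv_pos.2 hMa
  have hlM : l * M a = 1 := by rw [hl]; exact inv_mul_cancel₀ hMa.ne'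
  obtain ⟨F, hF⟩ : ∃ F : Eu d → ℝ, F = fun z => f (a + l • z) - (-(p / s) * log l) := ⟨_, rfl⟩
  have hres := h.rescale hp hs a hl0
  rw [← hF] at hres
  have hball : ∀ z, ‖z‖ ≤ k₀ + R₀ → ‖(a + l • z) - a‖ ≤ t / 2 := by
    intro z hz
    rw [add_sub_cancel_left, norm_smul, norm_of_nonneg hl0.le]
    have h1 := mul_le_left hz hl0.le
    have h2 : l * (2 * (k₀ + R₀)) ≤ l * (M a * t) := mul_le_left hMt.le hl0.le
    have h3 : l * (M a * t) = t := by rw [← mul_assoc, hlM, one_mul]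
    linarith
  have hGF : ∀ z, ‖z‖ ≤ k₀ + R₀ → ‖∇F z‖ ^ p + β * exp (s * F z) = (l * M (a + l • z)) ^ p := by
    intro z hz
    have hzΩ : a + l • z ∈ Ω := hΩ (hdouble _ (hball z hz)).1
    have h1 : ∇F z = l • ∇f (a + l • z) := by
      rw [hF]
      exact (gradient_comp_scale f a l _ ((h.contDiffAt hzΩ).differentiableAt one_ne_zero)).gradient
    have h2 : exp (s * F z) = exp (s * f (a + l • z)) * l ^ p := by
      have e : s * F z = s * f (a + l • z) + log l * p := by rw [hF]; field_simp; ring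
      rw [e, exp_add, exp_mul (log l) p, exp_log hl0]
    rw [h1, h2, norm_smul, norm_of_nonneg hl0.le, mul_rpow hl0.le (norm_nonneg _),
      mul_rpow hl0.le (hM0 _).le, hMp]
    ring
  have hGF2 : ∀ z, ‖z‖ ≤ k₀ + R₀ → ‖∇F z‖ ^ p + β * exp (s * F z) ≤ 2 ^ p := by
    intro z hz
    rw [hGF z hz]
    refine rpow_le_rpow (mul_nonneg hl0.le (hM0 _).le) ?_ hp0.le
    have h1 := mul_le_left (hdouble _ (hball z hz)).2 hl0.le
    linarith
  have hsub : ∀ z, ‖z‖ ≤ k₀ + R₀ → z ∈ (fun z => a + l • z) ⁻¹' Ω := fun z hz =>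
    hΩ (hdouble _ (hball z hz)).1
  have hsmall : ∀ z, ‖z‖ ≤ R₀ → exp (s * F z) ≤ θ := by
    intro z hz
    have hin : ∀ x ∈ closedBall z k₀, ‖x‖ ≤ k₀ + R₀ := by
      intro x hx
      rw [mem_closedBall, dist_eq_norm] at hx
      have := norm_le_norm_add_norm_sub z x
      rw [norm_sub_rev] at this
      linarith
    exact hes hres z k₀ le_rfl (fun x hx => hsub x (hin x hx)) fun x hx => hGF2 x (hin x hx)
  have hin : ∀ x ∈ closedBall (0 : Eu d) R₀, ‖x‖ ≤ k₀ + R₀ := by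
    intro x hx
    rw [mem_closedBall_zero_iff] at hx
    linarith
  have hlast := hgs hres 0 R₀ le_rfl (fun x hx => hsub x (hin x hx))
    (fun x hx => norm_le_of_rpow_le hp (by positivity : 0 ≤ β * exp (s * F x)) (hGF2 x (hin x hx)))
    (fun x hx => (hsmall x (mem_closedBall_zero_iff.1 hx)).trans (by rw [hθ]; exact min_le_left _ _))
  have h0 : ‖(0 : Eu d)‖ ≤ R₀ := by rw [norm_zero]; exact hR₀.le
  have h1 := hGF 0 (by linarith)
  rw [smul_zero, add_zero, hlM, one_rpow] at h1
  have h2 := mul_le_left (hsmall 0 h0) hβ.le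
  linarith

end doubling

section truncation

/-- A convex `C¹` truncation vanishing on `(-∞, ε]`. -/
noncomputable def trn (ε t : ℝ) : ℝ := (max (t - ε) 0) ^ 2 / t

noncomputable def trn' (ε t : ℝ) : ℝ := 1 - (ε / max t ε) ^ 2

variable {ε : ℝ}

theorem trn_eq_zero {t : ℝ} (h : t ≤ ε) : trn ε t = 0 := by
  rw [trn, max_eq_right (by linarith)]; simp

theorem trn'_eq_zero {t : ℝ} (hε : 0 < ε) (h : t ≤ ε) : trn' ε t = 0 := by
  rw [trn', max_eq_right h, div_self hε.ne']; ring

theorem hasDerivAt_trn (hε : 0 < ε) (t : ℝ) : HasDerivAt (trn ε) (trn' ε t) t := by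
  rcases lt_or_ge t ε with h | h
  · rw [trn'_eq_zero hε h.le]
    refine (hasDerivAt_const t (0:ℝ)).congr_of_eventuallyEq ?_
    filter_upwards [gt_mem_nhds h] with x hx using trn_eq_zero (le_of_lt hx)
  · have ht : 0 < t := by linarith
    have h1 := (hasDerivAt_posPart_sq (t - ε)).comp t ((hasDerivAt_id t).sub_const ε)
    have h2 := h1.div (hasDerivAt_id t) ht.ne'
    refine HasDerivAt.congr_deriv (by exact h2) ?_
    simp only [Function.comp, id, mul_one]
    rw [trn', max_eq_left h, max_eq_left (by linarith)]
    field_simp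
    ring

theorem continuous_trn' (hε : 0 < ε) : Continuous (trn' ε) := by
  unfold trn'
  have : ∀ t, max t ε ≠ 0 := fun t => (hε.trans_le (le_max_right _ _)).ne'
  fun_prop (disch := exact this _)

theorem contDiff_trn (hε : 0 < ε) : ContDiff ℝ 1 (trn ε) := by
  rw [contDiff_one_iff_deriv]
  refine ⟨fun t => (hasDerivAt_trn hε t).differentiableAt, ?_⟩
  rw [show deriv (trn ε) = trn' ε from funext fun t => (hasDerivAt_trn hε t).deriv]
  exact continuous_trn' hε

theorem trn'_mem (hε : 0 < ε) (t : ℝ) : trn' ε t ∈ Icc (0:ℝ) 1 := by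
  have h0 : 0 < max t ε := hε.trans_le (le_max_right _ _)
  have h1 : (ε / max t ε) ^ 2 ≤ 1 :=
    pow_le_one₀ (by positivity) ((div_le_one h0).2 (le_max_right _ _))
  have h2 : 0 ≤ (ε / max t ε) ^ 2 := sq_nonneg _
  rw [trn']
  constructor <;> linarith

theorem trn_nonneg {t : ℝ} (ht : 0 ≤ t) : 0 ≤ trn ε t := by unfold trn; positivity

theorem trn_le_mul (hε : 0 < ε) {t : ℝ} (ht : 0 ≤ t) : trn ε t ≤ t * trn' ε t := by
  rcases le_total t ε with h | h
  · rw [trn_eq_zero h, trn'_eq_zero hε h, mul_zero]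
  · have ht0 : 0 < t := by linarith
    rw [trn, trn', max_eq_left h, max_eq_left (by linarith), div_le_iff₀ ht0]
    have : t * (1 - (ε / t) ^ 2) * t = t ^ 2 - ε ^ 2 := by field_simp
    rw [this]
    have := mul_nonneg hε.le (sub_nonneg.2 h)
    linarith

theorem trn_le (hε : 0 < ε) {t : ℝ} (ht : 0 ≤ t) : trn ε t ≤ t :=
  (trn_le_mul hε ht).trans (by
    have := mul_le_left (trn'_mem hε t).2 ht
    linarith)

theorem tendsto_trn {t : ℝ} (ht : 0 ≤ t) {e : ℕ → ℝ} (he : Tendsto e atTop (𝓝 0)) :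
    Tendsto (fun j => trn (e j) t) atTop (𝓝 t) := by
  rcases ht.eq_or_lt with h | h
  · rw [← h]; simp [trn]
  · have h1 : Tendsto (fun j => (max (t - e j) 0) ^ 2 / t) atTop (𝓝 ((max (t - 0) 0) ^ 2 / t)) :=
      (((tendsto_const_nhds.sub he).max tendsto_const_nhds).pow 2).div_const t
    have h2 : (max (t - 0) 0) ^ 2 / t = t := by
      rw [sub_zero, max_eq_left ht]; field_simp
    rwa [h2] at h1

theorem tendsto_trn' {t : ℝ} (ht : 0 < t) {e : ℕ → ℝ} (he : Tendsto e atTop (𝓝 0)) :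
    Tendsto (fun j => trn' (e j) t) atTop (𝓝 1) := by
  have h1 : Tendsto (fun j => 1 - (e j / max t (e j)) ^ 2) atTop (𝓝 (1 - (0 / max t 0) ^ 2)) :=
    tendsto_const_nhds.sub ((he.div (tendsto_const_nhds.max he) (by
      rw [max_eq_left ht.le]; exact ht.ne')).pow 2)
  simpa [trn'] using h1

end truncation

section half_space
variable {d : ℕ} {n : Fin d} {p q : ℝ} {U : Eu d → ℝ}

/-- A positive solution in the half-space `{0 < x n}` extended by zero. -/
structure HalfSol (n : Fin d) (p q : ℝ) (U : Eu d → ℝ) : Prop where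
  hp : 1 < p
  hq : 0 < q
  cont : Continuous U
  zero : ∀ x, x n ≤ 0 → U x = 0
  pos : ∀ x, 0 < x n → 0 < U x
  weak : WeakEq p {x | 0 < x n} U fun x => U x ^ q

namespace HalfSol

theorem nonneg (h : HalfSol n p q U) (x : Eu d) : 0 ≤ U x := by
  rcases le_or_gt (x n) 0 with hx | hx
  · exact (h.zero x hx).ge
  · exact (h.pos x hx).le

theorem gradient_eq_zero (h : HalfSol n p q U) {x : Eu d} (hx : x n ≤ 0) : ∇U x = 0 := by
  have h1 : IsLocalMin U x := .of_forall fun y => by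
    rw [h.zero x hx]; exact h.nonneg y
  rw [gradient, h1.fderiv_eq_zero, map_zero]

theorem mem_of_lt (h : HalfSol n p q U) {x : Eu d} {ε : ℝ} (hε : 0 < ε) (hx : ε ≤ U x) : 0 < x n := by
  by_contra hn
  rw [h.zero x (not_lt.1 hn)] at hx
  linarith

theorem continuous_of_zero (h : HalfSol n p q U) {ε : ℝ} (hε : 0 < ε) {E : Type*} [TopologicalSpace E]
    [Zero E] {F : Eu d → E} (h1 : ∀ x, 0 < x n → ContinuousAt F x) (h0 : ∀ x, U x < ε → F x = 0) :
    Continuous F := by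
  refine continuous_iff_continuousAt.2 fun x => ?_
  rcases le_or_gt (x n) 0 with hx | hx
  · refine continuousAt_const.congr (f := fun _ => (0 : E)) ?_
    have h2 : U x < ε := by rw [h.zero x hx]; exact hε
    filter_upwards [h.cont.continuousAt.eventually (gt_mem_nhds h2)] with y hy using (h0 y hy).symm
  · exact h1 x hx

theorem hasGradientAt_trn (h : HalfSol n p q U) {ε : ℝ} (hε : 0 < ε) (x : Eu d) :
    HasGradientAt (fun x => trn ε (U x)) (trn' ε (U x) • ∇U x) x := by
  rcases le_or_gt (x n) 0 with hx | hx
  · have h2 : U x < ε := by rw [h.zero x hx]; exact hε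
    rw [h.gradient_eq_zero hx, smul_zero, hasGradientAt_iff_hasFDerivAt, map_zero]
    refine (hasFDerivAt_const (0:ℝ) x).congr_of_eventuallyEq ?_
    filter_upwards [h.cont.continuousAt.eventually (gt_mem_nhds h2)] with y hy using trn_eq_zero (le_of_lt hy)
  · exact HasGradientAt.comp_real (hasDerivAt_trn hε _) (hasGradientAt_of_contDiffAt (h.weak.contDiffAt hx))

theorem contDiff_trn (h : HalfSol n p q U) {ε : ℝ} (hε : 0 < ε) :
    ContDiff ℝ 1 fun x => trn ε (U x) := by
  rw [contDiff_one_iff_fderiv]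
  refine ⟨fun x => (h.hasGradientAt_trn hε x).differentiableAt, ?_⟩
  have h1 : (fun x => fderiv ℝ (fun x => trn ε (U x)) x) =
      fun x => InnerProductSpace.toDual ℝ (Eu d) (trn' ε (U x) • ∇U x) :=
    funext fun x => (h.hasGradientAt_trn hε x).hasFDerivAt.fderiv
  rw [show fderiv ℝ (fun x => trn ε (U x)) = _ from h1]
  refine (InnerProductSpace.toDual ℝ (Eu d)).continuous.comp (h.continuous_of_zero hε (fun x hx => ?_)
    fun x hx => by rw [trn'_eq_zero hε hx.le, zero_smul])
  exact ((continuous_trn' hε).comp h.cont).continuousAt.smul (continuousAt_gradient (h.weak.contDiffAt hx))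

theorem measurable_gradient (f : Eu d → ℝ) : Measurable (∇f) :=
  (InnerProductSpace.toDual ℝ (Eu d)).symm.continuous.measurable.comp (measurable_fderiv ℝ f)

theorem tsupport_mul_trn_shift (h : HalfSol n p q U) {ε r : ℝ} (hε : 0 < ε) (hr : 0 ≤ r) (η : Eu d → ℝ) :
    tsupport (fun x => η x * trn ε (U (x - r • single n 1))) ⊆ {x | 0 < x n} := by
  have hc : IsClosed {x : Eu d | ε ≤ U (x - r • single n 1)} :=
    isClosed_le continuous_const (h.cont.comp (by fun_prop))
  refine (closure_minimal (fun x hx => ?_) hc).trans fun x hx => ?_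
  · by_contra hn
    rw [mem_setOf_eq, not_le] at hn
    exact hx (by simp only [trn_eq_zero hn.le, mul_zero])
  · have h1 := h.mem_of_lt hε hx
    simp at h1
    rw [mem_setOf_eq]; linarith

theorem caccioppoli_pointwise (hp : 1 < p) {T T' u B X ξ g a : ℝ} {m : ℕ} (hm : p ≤ m) (hT : 0 ≤ T)
    (hT1 : T ≤ u * T') (hT' : 0 ≤ T') (hT'1 : T' ≤ 1) (hu : 0 ≤ u) (hX : 0 ≤ X) (huX : u * X ≤ B)
    (hξ : 0 ≤ ξ) (hξ1 : ξ ≤ 1) (hg : 0 ≤ g) (ha : |a| ≤ g ^ (p - 1) * X) :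
    1 / 2 * (ξ ^ m * (T' * g ^ p)) ≤ ξ ^ m * (T' * g ^ p) + T * ((m * ξ ^ (m - 1)) * a) +
      (2 * m * B) ^ p := by
  have hm0 : m ≠ 0 := by rintro rfl; norm_num at hm; linarith
  have hB : 0 ≤ B := (mul_nonneg hu hX).trans huX
  have hgp : 0 ≤ g ^ (p - 1) := by positivity
  have hterm : -(T' * ((m * ξ ^ (m - 1)) * (g ^ (p - 1) * (u * X)))) ≤ T * ((m * ξ ^ (m - 1)) * a) := by
    have h1 : -(g ^ (p - 1) * X) ≤ a := (abs_le.1 ha).1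
    have h2 := mul_le_left h1 (by positivity : 0 ≤ T * (m * ξ ^ (m - 1)))
    have h3 := mul_le_right hT1 (by positivity : 0 ≤ (m * ξ ^ (m - 1)) * (g ^ (p - 1) * X))
    linarith
  have hpos : 0 ≤ ξ ^ m * (T' * g ^ p) := by positivity
  have hBp : 0 ≤ (2 * m * B) ^ p := by positivity
  suffices hs : T' * ((m * ξ ^ (m - 1)) * (g ^ (p - 1) * (u * X))) ≤
      1 / 2 * (ξ ^ m * (T' * g ^ p)) + (2 * m * B) ^ p by linarith
  have hgg : g ^ p = g ^ (p - 1) * g := by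
    rcases hg.eq_or_lt with h | h
    · rw [← h, zero_rpow (by linarith)]; ring
    · rw [← rpow_add_one h.ne']; ring_nf
  have hξξ : ξ ^ m = ξ ^ (m - 1) * ξ := by rw [← pow_succ]; congr 1; omega
  rcases le_total (2 * m * (u * X)) (ξ * g) with h | h
  · have h1 := mul_le_left h (by positivity : 0 ≤ 1 / 2 * (T' * ξ ^ (m - 1) * g ^ (p - 1)))
    rw [hξξ, hgg]
    linarith
  · have h0 : 0 ≤ 2 * m * (u * X) := by positivity
    have h1 : ξ ^ (m - 1) * g ^ (p - 1) ≤ (2 * m * B) ^ (p - 1) := by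
      have h2 : ξ ^ (m - 1) ≤ ξ ^ (p - 1) := by
        rw [← rpow_natCast, Nat.cast_sub (Nat.one_le_iff_ne_zero.2 hm0), Nat.cast_one]
        exact Real.rpow_le_rpow_of_exponent_ge_of_imp hξ hξ1 (by linarith) fun _ h3 => by linarith
      calc ξ ^ (m - 1) * g ^ (p - 1) ≤ ξ ^ (p - 1) * g ^ (p - 1) := mul_le_right h2 hgp
        _ = (ξ * g) ^ (p - 1) := (mul_rpow hξ hg).symm
        _ ≤ (2 * m * B) ^ (p - 1) := rpow_le_rpow (by positivity)
            (h.trans (mul_le_left huX (by positivity))) (by linarith)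
    have h2 : (2 * m * B) ^ p = (2 * m * B) ^ (p - 1) * (2 * m * B) := by
      rcases (by positivity : 0 ≤ 2 * m * B).eq_or_lt with h | h
      · rw [← h, zero_rpow (by linarith)]; ring
      · rw [← rpow_add_one h.ne']; ring_nf
    have h3 : T' * ((m * ξ ^ (m - 1)) * (g ^ (p - 1) * (u * X))) ≤
        1 * ((ξ ^ (m - 1) * g ^ (p - 1)) * (m * (u * X))) := by
      have := mul_le_right hT'1
        (by positivity : 0 ≤ (ξ ^ (m - 1) * g ^ (p - 1)) * (m * (u * X)))
      linarith
    have h4 : (ξ ^ (m - 1) * g ^ (p - 1)) * (m * (u * X)) ≤ (2 * m * B) ^ (p - 1) * (2 * m * B) := by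
      refine mul_le_mul h1 ?_ (by positivity) (by positivity)
      have h5 := mul_le_left huX (by positivity : 0 ≤ (m:ℝ))
      have h6 : 0 ≤ m * B := by positivity
      linarith
    rw [h2]
    linarith

end HalfSol
end half_space

namespace HalfSol
section estimates
variable {d : ℕ} {n : Fin d} {p q : ℝ} {U : Eu d → ℝ}

theorem integrableOn_closedBall (h : HalfSol n p q U) {ρ : ℝ} (hρ : 0 < ρ) :
    IntegrableOn (fun x => ‖∇U x‖ ^ p) (closedBall 0 ρ) := by
  have hp := h.hp
  have hp0 : 0 < p := by linarith
  obtain ⟨L, hL, hb⟩ := exists_bump d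
  obtain ⟨ξ, hξ, hξc, hξs, hξ1, hξ2, hξg⟩ := hb 0 (4 * ρ) (by positivity)
  rw [show 4 * ρ / 2 = 2 * ρ by ring] at hξs
  rw [show 4 * ρ / 4 = ρ by ring] at hξ2
  obtain ⟨B₀, hB₀⟩ := (isCompact_closedBall (0 : Eu d) (2 * ρ)).exists_bound_of_continuousOn
    h.cont.continuousOn
  obtain ⟨m, hm⟩ : ∃ m : ℕ, m = ⌈p⌉₊ := ⟨_, rfl⟩
  have hpm : p ≤ m := by rw [hm]; exact Nat.le_ceil p
  have hm0 : m ≠ 0 := by rintro rfl; norm_num at hpm; linarith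
  have hξC1 : ContDiff ℝ 1 ξ := hξ.of_le (by simp)
  have hgξ := continuous_gradient hξC1
  obtain ⟨B, hB⟩ : ∃ B : ℝ, B = max B₀ 0 * (L / (4 * ρ)) := ⟨_, rfl⟩
  obtain ⟨D, hD⟩ : ∃ D : ℝ, D = (2 * m * B) ^ p := ⟨_, rfl⟩
  have hB0 : 0 ≤ B := by rw [hB]; positivity
  have iD : IntegrableOn (fun _ : Eu d => D) (closedBall 0 (2 * ρ)) :=
    integrableOn_const measure_closedBall_lt_top.ne
  have iD' := iD.integrable_indicator measurableSet_closedBall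
  have hcU : Continuous fun x => U x ^ q := h.cont.rpow_const fun _ => Or.inr h.hq.le
  have iUU : Integrable fun x => U x ^ q * (ξ x ^ m * U x) := by
    refine (hcU.mul ((hξ.continuous.pow m).mul h.cont)).integrable_of_hasCompactSupport
      (HasCompactSupport.intro hξc fun x hx => ?_)
    simp [eq_zero_of_notMem hx, hm0]
  obtain ⟨C, hC⟩ : ∃ C : ℝ, C = (∫ x, U x ^ q * (ξ x ^ m * U x)) +
    ∫ x, (closedBall (0 : Eu d) (2 * ρ)).indicator (fun _ => D) x := ⟨_, rfl⟩
  have key : ∀ ε > 0, ∫⁻ x, ofReal (1 / 2 * (ξ x ^ m * (trn' ε (U x) * ‖∇U x‖ ^ p))) ≤ ofReal C := by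
    intro ε hε
    have hφ : ContDiff ℝ 1 fun x => ξ x ^ m * trn ε (U x) := (hξC1.pow m).mul (h.contDiff_trn hε)
    have hφc : HasCompactSupport fun x => ξ x ^ m * trn ε (U x) :=
      HasCompactSupport.intro hξc fun x hx => by simp [eq_zero_of_notMem hx, hm0]
    have hφs := h.tsupport_mul_trn_shift hε le_rfl fun x => ξ x ^ m
    simp only [zero_smul, sub_zero] at hφs
    have hw := h.weak.weak _ hφ hφc hφs
    have hgr : ∀ x, ⟪A p (∇U x), ∇(fun x => ξ x ^ m * trn ε (U x)) x⟫ =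
        ξ x ^ m * (trn' ε (U x) * ‖∇U x‖ ^ p) + trn ε (U x) * ((m * ξ x ^ (m - 1)) * ⟪A p (∇U x), ∇ξ x⟫) := by
      intro x
      have h1 : HasGradientAt (fun x => ξ x ^ m) ((m * ξ x ^ (m - 1)) • ∇ξ x) x :=
        HasGradientAt.comp_real (k := fun t => t ^ m) (hasDerivAt_pow m _)
          (hasGradientAt_of_contDiffAt hξC1.contDiffAt)
      rw [(HasGradientAt.mul' h1 (h.hasGradientAt_trn hε x)).gradient, inner_add_right,
        real_inner_smul_right, real_inner_smul_right, real_inner_smul_right, real_inner_smul_right,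
        inner_A_self hp]
    have i1 : Integrable fun x => ⟪A p (∇U x), ∇(fun x => ξ x ^ m * trn ε (U x)) x⟫ :=
      integrable_inner_gradient hφ hφc fun x hx =>
        (continuous_A hp).continuousAt.comp (continuousAt_gradient (h.weak.contDiffAt (hφs hx)))
    have c0 : Continuous fun x => 1 / 2 * (ξ x ^ m * (trn' ε (U x) * ‖∇U x‖ ^ p)) := by
      refine continuous_const.mul ((hξ.continuous.pow m).mul (h.continuous_of_zero hε (fun x hx => ?_)
        fun x hx => by rw [trn'_eq_zero hε hx.le, zero_mul]))
      exact ((continuous_trn' hε).comp h.cont).continuousAt.mul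
        ((continuousAt_gradient (h.weak.contDiffAt hx)).norm.rpow_const (Or.inr hp0.le))
    have i0 : Integrable fun x => 1 / 2 * (ξ x ^ m * (trn' ε (U x) * ‖∇U x‖ ^ p)) :=
      c0.integrable_of_hasCompactSupport (HasCompactSupport.intro hξc fun x hx => by
        simp [eq_zero_of_notMem hx, hm0])
    have hnn : ∀ x, 0 ≤ 1 / 2 * (ξ x ^ m * (trn' ε (U x) * ‖∇U x‖ ^ p)) := fun x => by
      have := (hξ1 x).1
      have := (trn'_mem hε (U x)).1
      positivity
    rw [← ofReal_integral_eq_lintegral_ofReal i0 (.of_forall hnn)]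
    apply ofReal_le_ofReal
    have h2 := integral_mono i0 (i1.add iD') fun x => ?_
    · rw [integral_add' i1 iD', hw] at h2
      refine h2.trans ?_
      rw [hC]
      refine add_le_add_left (integral_mono_of_nonneg (.of_forall fun x => ?_) iUU (.of_forall fun x => ?_)) _
      · have := (hξ1 x).1
        have := trn_nonneg (ε := ε) (h.nonneg x)
        have := h.nonneg x
        positivity
      · have h3 := (hξ1 x).1
        have h4 := h.nonneg x
        exact mul_le_left (mul_le_left (trn_le hε h4) (by positivity))
          (by positivity)
    · simp only [Pi.add_apply, hgr x]
      by_cases hx : x ∈ closedBall (0 : Eu d) (2 * ρ)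
      · rw [indicator_of_mem hx, hD]
        refine caccioppoli_pointwise hp hpm (trn_nonneg (h.nonneg x)) (trn_le_mul hε (h.nonneg x))
          (trn'_mem hε _).1 (trn'_mem hε _).2 (h.nonneg x) (norm_nonneg (∇ξ x)) ?_ (hξ1 x).1
          (hξ1 x).2 (norm_nonneg _) ?_
        · rw [hB]
          exact mul_le_mul (((le_abs_self _).trans (hB₀ x hx)).trans (le_max_left _ _)) (hξg x)
            (norm_nonneg _) (le_max_right _ _)
        · rw [← norm_A hp]; exact abs_real_inner_le_norm _ _
      · have hx' : x ∉ tsupport ξ := fun h' => hx (hξs h')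
        rw [indicator_of_notMem hx, eq_zero_of_notMem hx',
          gradient_of_notMem hx', inner_zero_right]
        simp [hm0]
  have hlim : Tendsto (fun j : ℕ => 1 / ((j:ℝ) + 1)) atTop (𝓝 0) := tendsto_one_div_add_atTop_nhds_zero_nat
  have hmG : Measurable fun x => ‖∇U x‖ ^ p := (measurable_gradient U).norm.pow_const p
  have hfat : ∫⁻ x, ofReal (1 / 2 * (ξ x ^ m * ‖∇U x‖ ^ p)) ≤ ofReal C := by
    have h1 : ∀ x, Tendsto (fun j : ℕ => ofReal (1 / 2 * (ξ x ^ m *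
        (trn' (1 / ((j:ℝ) + 1)) (U x) * ‖∇U x‖ ^ p)))) atTop
        (𝓝 (ofReal (1 / 2 * (ξ x ^ m * ‖∇U x‖ ^ p)))) := by
      intro x
      refine ENNReal.tendsto_ofReal (Tendsto.const_mul _ (Tendsto.const_mul _ ?_))
      rcases le_or_gt (x n) 0 with hx | hx
      · simp [h.gradient_eq_zero hx, hp0.ne']
      · simpa using (tendsto_trn' (h.pos x hx) hlim).mul_const (‖∇U x‖ ^ p)
    calc ∫⁻ x, ofReal (1 / 2 * (ξ x ^ m * ‖∇U x‖ ^ p)) = ∫⁻ x, liminf (fun j : ℕ => ofReal (1 / 2 * (ξ x ^ m *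
          (trn' (1 / ((j:ℝ) + 1)) (U x) * ‖∇U x‖ ^ p)))) atTop :=
          lintegral_congr fun x => (h1 x).liminf_eq.symm
      _ ≤ liminf (fun j : ℕ => ∫⁻ x, ofReal (1 / 2 * (ξ x ^ m *
          (trn' (1 / ((j:ℝ) + 1)) (U x) * ‖∇U x‖ ^ p)))) atTop := by
          refine lintegral_liminf_le fun j => ?_
          have h2 : Measurable fun x => trn' (1 / ((j:ℝ) + 1)) (U x) :=
            ((continuous_trn' (by positivity)).comp h.cont).measurable
          exact ((hξ.continuous.pow m).measurable.mul (h2.mul hmG)).const_mul _ |>.ennreal_ofReal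
      _ ≤ ofReal C := by
          refine liminf_le_of_frequently_le' (Eventually.frequently (.of_forall fun j => ?_))
          exact key _ (by positivity)
  have hi : Integrable fun x => 1 / 2 * (ξ x ^ m * ‖∇U x‖ ^ p) := by
    refine ⟨(((hξ.continuous.pow m).measurable.mul hmG).const_mul _).aestronglyMeasurable, ?_⟩
    rw [hasFiniteIntegral_iff_ofReal (.of_forall fun x => by
      have := (hξ1 x).1
      positivity)]
    exact hfat.trans_lt ENNReal.ofReal_lt_top
  have hi2 := (hi.const_mul 2).integrableOn (s := closedBall 0 ρ)
  refine hi2.congr_fun (fun x hx => ?_) measurableSet_closedBall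
  simp only [hξ2 x hx, one_pow]; ring

theorem locallyIntegrable (h : HalfSol n p q U) : LocallyIntegrable fun x => ‖∇U x‖ ^ p := by
  intro x
  refine ⟨closedBall 0 (‖x‖ + 1), ?_, h.integrableOn_closedBall (by positivity)⟩
  refine mem_nhds_iff.2 ⟨ball 0 (‖x‖ + 1), ball_subset_closedBall, isOpen_ball, ?_⟩
  rw [mem_ball_zero_iff]; linarith

theorem integrable_mul (h : HalfSol n p q U) {k : Eu d → ℝ} (hk : Continuous k) (hkc : HasCompactSupport k) :
    Integrable fun x => k x * ‖∇U x‖ ^ p :=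
  h.locallyIntegrable.integrable_smul_left_of_hasCompactSupport hk hkc

theorem rpow_mul_le {p a b : ℝ} (hp : 1 < p) (ha : 0 ≤ a) (hb : 0 ≤ b) :
    a ^ (p - 1) * b ≤ a ^ p + b ^ p := by
  have e : ∀ c : ℝ, 0 ≤ c → c ^ p = c ^ (p - 1) * c := fun c hc => by
    rcases hc.eq_or_lt with h | h
    · rw [← h, zero_rpow (by linarith)]; ring
    · rw [← rpow_add_one h.ne']; ring_nf
  rcases le_total a b with h | h
  · have h1 := mul_le_right (rpow_le_rpow ha h (by linarith : 0 ≤ p - 1)) hb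
    have h2 : 0 ≤ a ^ p := by positivity
    rw [← e b hb] at h1
    linarith
  · have h1 := mul_le_left h (by positivity : 0 ≤ a ^ (p - 1))
    have h2 : 0 ≤ b ^ p := by positivity
    rw [← e a ha] at h1
    linarith

theorem integrable_mul_shift (h : HalfSol n p q U) {k : Eu d → ℝ} (hk : Continuous k)
    (hkc : HasCompactSupport k) (a : Eu d) :
    Integrable fun x => k x * ‖∇U (x - a)‖ ^ p := by
  have h1 : HasCompactSupport fun x => k (x + a) := hkc.comp_homeomorph (Homeomorph.addRight a)
  have := (h.integrable_mul (hk.comp (continuous_add_right a)) h1).comp_sub_right a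
  simpa using this

/-- The equation tested with a cutoff of a vertical translate of the solution itself. -/
theorem shift_identity (h : HalfSol n p q U) {r : ℝ} (hr : 0 ≤ r) {e : Eu d}
    (he : e = r • single n 1) {η : Eu d → ℝ}
    (hη : ContDiff ℝ 1 η) (hηc : HasCompactSupport η) :
    Integrable (fun x => ⟪A p (∇U x), η x • ∇U (x - e) + U (x - e) • ∇η x⟫) ∧
    ∫ x, ⟪A p (∇U x), η x • ∇U (x - e) + U (x - e) • ∇η x⟫ = ∫ x, U x ^ q * (η x * U (x - e)) := by
  have hp := h.hp
  have hp0 : 0 < p := by linarith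
  have hgη := continuous_gradient hη
  have hcU : Continuous fun x => U x ^ q := h.cont.rpow_const fun _ => Or.inr h.hq.le
  have hcs : Continuous fun x => U (x - e) := h.cont.comp (by fun_prop)
  have hgηc : HasCompactSupport fun x => U (x - e) * ‖∇η x‖ :=
    HasCompactSupport.intro hηc fun x hx => by
      rw [gradient_of_notMem hx, norm_zero, mul_zero]
  obtain ⟨bd, hbd⟩ : ∃ bd : Eu d → ℝ, bd = fun x => |η x| * ‖∇U x‖ ^ p +
      |η x| * ‖∇U (x - e)‖ ^ p + (U (x - e) * ‖∇η x‖ * ‖∇U x‖ ^ p + U (x - e) * ‖∇η x‖) := ⟨_, rfl⟩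
  have hηa : HasCompactSupport fun x => |η x| := hηc.comp_left (g := abs) abs_zero
  have ibd : Integrable bd := by
    rw [hbd]
    exact ((h.integrable_mul hη.continuous.abs hηa).add (h.integrable_mul_shift hη.continuous.abs hηa e)).add
      ((h.integrable_mul (hcs.mul hgη.norm) hgηc).add
        ((hcs.mul hgη.norm).integrable_of_hasCompactSupport hgηc))
  have hbound : ∀ (x : Eu d) (a b : ℝ), 0 ≤ a → a ≤ 1 → 0 ≤ b → b ≤ U (x - e) →
      ‖⟪A p (∇U x), η x • (a • ∇U (x - e)) + b • ∇η x⟫‖ ≤ bd x := by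
    intro x a b ha ha1 hb hbU
    rw [hbd]
    refine (norm_inner_le_norm _ _).trans ?_
    rw [norm_A hp]
    have h0 : 0 ≤ ‖∇U x‖ ^ (p - 1) := by positivity
    have h1 : ‖η x • (a • ∇U (x - e)) + b • ∇η x‖ ≤
        |η x| * ‖∇U (x - e)‖ + U (x - e) * ‖∇η x‖ := by
      refine (norm_add_le _ _).trans (add_le_add ?_ ?_)
      · rw [norm_smul, norm_smul, norm_eq_abs, norm_of_nonneg ha]
        refine mul_le_left ?_ (abs_nonneg _)
        have := mul_le_right ha1 (norm_nonneg (∇U (x - e)))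
        linarith
      · rw [norm_smul, norm_of_nonneg hb]
        exact mul_le_right hbU (norm_nonneg _)
    have h2 := mul_le_left h1 h0
    have h3 := mul_le_left (rpow_mul_le hp (norm_nonneg (∇U x))
      (norm_nonneg (∇U (x - e)))) (abs_nonneg (η x))
    have h4 := rpow_mul_le hp (norm_nonneg (∇U x)) zero_le_one
    rw [mul_one, one_rpow] at h4
    have h5 := mul_le_left h4 (mul_nonneg (h.nonneg (x - e)) (norm_nonneg (∇η x)))
    simp only
    linarith
  have hmA : Measurable fun x => A p (∇U x) :=
    (continuous_A hp).measurable.comp (measurable_gradient U)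
  have hmg : Measurable fun x => ∇U (x - e) :=
    (measurable_gradient U).comp (measurable_sub_const e)
  have hlim : Tendsto (fun j : ℕ => 1 / ((j:ℝ) + 1)) atTop (𝓝 0) := tendsto_one_div_add_atTop_nhds_zero_nat
  have t1 : Tendsto (fun j : ℕ => ∫ x, ⟪A p (∇U x), η x • (trn' (1 / ((j:ℝ) + 1)) (U (x - e)) •
      ∇U (x - e)) + trn (1 / ((j:ℝ) + 1)) (U (x - e)) • ∇η x⟫) atTop
      (𝓝 (∫ x, ⟪A p (∇U x), η x • ∇U (x - e) + U (x - e) • ∇η x⟫)) := by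
    refine tendsto_integral_of_dominated_convergence bd (fun j => ?_) ibd (fun j => ?_) ?_
    · have h1 : Measurable fun x => trn' (1 / ((j:ℝ) + 1)) (U (x - e)) :=
        ((continuous_trn' (by positivity)).comp hcs).measurable
      have h2 : Measurable fun x => trn (1 / ((j:ℝ) + 1)) (U (x - e)) :=
        ((PLap.contDiff_trn (by positivity)).continuous.comp hcs).measurable
      exact (hmA.inner ((hη.continuous.measurable.smul (h1.smul hmg)).add
        (h2.smul hgη.measurable))).aestronglyMeasurable
    · have hj : 0 < 1 / ((j:ℝ) + 1) := by positivity
      exact .of_forall fun x => hbound x _ _ (trn'_mem hj _).1 (trn'_mem hj _).2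
        (trn_nonneg (h.nonneg _)) (trn_le hj (h.nonneg _))
    · refine .of_forall fun x => Tendsto.inner tendsto_const_nhds (Tendsto.add ?_ ?_)
      · refine Tendsto.const_smul ?_ _
        rcases le_or_gt ((x - e) n) 0 with hx | hx
        · simp [h.gradient_eq_zero hx]
        · simpa using (tendsto_trn' (h.pos _ hx) hlim).smul_const (∇U (x - e))
      · exact (tendsto_trn (h.nonneg _) hlim).smul_const _
  have icU : Integrable fun x => U x ^ q * (|η x| * U (x - e)) :=
    (hcU.mul (hη.continuous.abs.mul hcs)).integrable_of_hasCompactSupport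
      (HasCompactSupport.intro hηc fun x hx => by simp [eq_zero_of_notMem hx])
  have t2 : Tendsto (fun j : ℕ => ∫ x, U x ^ q * (η x * trn (1 / ((j:ℝ) + 1)) (U (x - e)))) atTop
      (𝓝 (∫ x, U x ^ q * (η x * U (x - e)))) := by
    refine tendsto_integral_of_dominated_convergence _ (fun j => ?_) icU (fun j => ?_) ?_
    · exact (hcU.mul (hη.continuous.mul
        ((PLap.contDiff_trn (by positivity)).continuous.comp hcs))).aestronglyMeasurable
    · have hj : 0 < 1 / ((j:ℝ) + 1) := by positivity
      refine .of_forall fun x => ?_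
      have h1 := rpow_nonneg (h.nonneg x) q
      rw [norm_mul, norm_mul, norm_of_nonneg h1, norm_eq_abs (η x), norm_of_nonneg (trn_nonneg (h.nonneg _))]
      exact mul_le_left (mul_le_left (trn_le hj (h.nonneg _)) (abs_nonneg _)) h1
    · exact .of_forall fun x =>
        ((tendsto_trn (h.nonneg _) hlim).const_mul _).const_mul _
  refine ⟨ibd.mono' ?_ (.of_forall fun x => ?_), tendsto_nhds_unique t1 ?_⟩
  · exact (hmA.inner ((hη.continuous.measurable.smul hmg).add
      (hcs.measurable.smul hgη.measurable))).aestronglyMeasurable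
  · simpa using hbound x 1 (U (x - e)) zero_le_one le_rfl (h.nonneg _) le_rfl
  · refine t2.congr fun j => ?_
    have hj : 0 < 1 / ((j:ℝ) + 1) := by positivity
    have hV := h.contDiff_trn hj
    have hφ : ContDiff ℝ 1 fun x => η x * trn (1 / ((j:ℝ) + 1)) (U (x - e)) :=
      hη.mul (hV.comp (contDiff_id.sub contDiff_const))
    have hφc : HasCompactSupport fun x => η x * trn (1 / ((j:ℝ) + 1)) (U (x - e)) :=
      HasCompactSupport.intro hηc fun x hx => by simp [eq_zero_of_notMem hx]
    have hφs := h.tsupport_mul_trn_shift hj hr η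
    rw [← he] at hφs
    rw [← h.weak.weak _ hφ hφc hφs]
    refine integral_congr_ae (.of_forall fun x => ?_)
    have h1 : HasGradientAt (fun x => trn (1 / ((j:ℝ) + 1)) (U (x - e)))
        (trn' (1 / ((j:ℝ) + 1)) (U (x - e)) • ∇U (x - e)) x := by
      have h2 := gradient_comp_scale (fun x => trn (1 / ((j:ℝ) + 1)) (U x)) (-e) 1 0 (z := x)
        (hV.differentiable one_ne_zero _)
      simp only [one_smul, sub_zero, neg_add_eq_sub] at h2
      rwa [(h.hasGradientAt_trn hj (x - e)).gradient] at h2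
    simp only
    rw [(HasGradientAt.mul' (hasGradientAt_of_contDiffAt hη.contDiffAt) h1).gradient]

end estimates
end HalfSol

namespace HalfSol
section estimates
variable {d : ℕ} {n : Fin d} {p q : ℝ} {U : Eu d → ℝ}

theorem diff_rpow_le_of_contDiff (hp : 1 < p) {V : Eu d → ℝ} (hV : ContDiff ℝ 1 V) (x : Eu d) {e : Eu d}
    (he : ‖e‖ = 1) {r : ℝ} (hr : 0 < r) :
    ofReal ((|V x - V (x - r • e)| / r) ^ p) ≤ ∫⁻ t in Icc (0:ℝ) 1, ofReal (‖∇V (x - (r * t) • e)‖ ^ p) := by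
  have hg := continuous_gradient hV
  have hpath : Continuous fun t : ℝ => x - (r * t) • e := by fun_prop
  have hc : Continuous fun t : ℝ => ‖∇V (x - (r * t) • e)‖ := (hg.comp hpath).norm
  have hcp : Continuous fun t : ℝ => ‖∇V (x - (r * t) • e)‖ ^ p :=
    hc.rpow_const fun _ => Or.inr (by linarith)
  have hder : ∀ t : ℝ, HasDerivAt (fun t : ℝ => V (x - (r * t) • e))
      (⟪∇V (x - (r * t) • e), -(r • e)⟫) t := by
    intro t
    have h1 : HasDerivAt (fun t : ℝ => x - (r * t) • e) (-(r • e)) t := by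
      have h2 := (((hasDerivAt_id t).const_mul r).smul_const e).const_sub x
      simpa using h2
    have h2 := (hasGradientAt_of_contDiffAt (hV.contDiffAt (x := x - (r * t) • e))).hasFDerivAt
    have h3 := h2.comp_hasDerivAt t h1
    refine HasDerivAt.congr_deriv (by exact h3) ?_
    simp
  have hcd : Continuous fun t : ℝ => ⟪∇V (x - (r * t) • e), -(r • e)⟫ :=
    (hg.comp hpath).inner continuous_const
  have hftc := intervalIntegral.integral_eq_sub_of_hasDerivAt (a := 0) (b := 1)
    (fun t _ => hder t) (hcd.intervalIntegrable 0 1)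
  simp only [mul_one, mul_zero, zero_smul, sub_zero] at hftc
  have hle : |V x - V (x - r • e)| / r ≤ ∫ t in Icc (0:ℝ) 1, ‖∇V (x - (r * t) • e)‖ := by
    rw [div_le_iff₀ hr, abs_sub_comm, ← hftc, ← norm_eq_abs]
    refine (intervalIntegral.norm_integral_le_integral_norm zero_le_one).trans ?_
    rw [integral_Icc_eq_integral_Ioc, ← intervalIntegral.integral_of_le zero_le_one, mul_comm,
      ← intervalIntegral.integral_const_mul]
    refine intervalIntegral.integral_mono_on zero_le_one (hcd.norm.intervalIntegrable 0 1)
      ((continuous_const.mul hc).intervalIntegrable 0 1) fun t _ => ?_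
    refine (norm_inner_le_norm _ _).trans ?_
    rw [norm_neg, norm_smul, he, mul_one, norm_of_nonneg hr.le, mul_comm]
  have hprob : IsProbabilityMeasure (volume.restrict (Icc (0:ℝ) 1)) := ⟨by simp⟩
  have i1 : Integrable (fun t => ‖∇V (x - (r * t) • e)‖) (volume.restrict (Icc (0:ℝ) 1)) :=
    hc.continuousOn.integrableOn_compact isCompact_Icc
  have i2 : Integrable (fun t => ‖∇V (x - (r * t) • e)‖ ^ p) (volume.restrict (Icc (0:ℝ) 1)) :=
    hcp.continuousOn.integrableOn_compact isCompact_Icc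
  have hJ := (convexOn_rpow hp.le).map_integral_le (μ := volume.restrict (Icc (0:ℝ) 1))
    (continuous_id.rpow_const fun _ => Or.inr (by linarith)).continuousOn isClosed_Ici
    (.of_forall fun t => norm_nonneg (∇V (x - (r * t) • e))) i1 i2
  have h1 : (|V x - V (x - r • e)| / r) ^ p ≤ ∫ t in Icc (0:ℝ) 1, ‖∇V (x - (r * t) • e)‖ ^ p :=
    (rpow_le_rpow (by positivity) hle (by linarith)).trans hJ
  refine (ofReal_le_ofReal h1).trans (le_of_eq ?_)
  exact ofReal_integral_eq_lintegral_ofReal i2 (.of_forall fun t => by positivity)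

theorem diff_rpow_le (h : HalfSol n p q U) (x : Eu d) {e : Eu d} (he : ‖e‖ = 1) {r : ℝ} (hr : 0 < r) :
    ofReal ((|U x - U (x - r • e)| / r) ^ p) ≤ ∫⁻ t in Icc (0:ℝ) 1, ofReal (‖∇U (x - (r * t) • e)‖ ^ p) := by
  have hp := h.hp
  have hlim : Tendsto (fun j : ℕ => 1 / ((j:ℝ) + 1)) atTop (𝓝 0) := tendsto_one_div_add_atTop_nhds_zero_nat
  have t1 : Tendsto (fun j : ℕ => ofReal ((|trn (1 / ((j:ℝ) + 1)) (U x) -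
      trn (1 / ((j:ℝ) + 1)) (U (x - r • e))| / r) ^ p)) atTop
      (𝓝 (ofReal ((|U x - U (x - r • e)| / r) ^ p))) := by
    refine ENNReal.tendsto_ofReal (Tendsto.rpow_const ?_ (Or.inr (by linarith)))
    exact (((tendsto_trn (h.nonneg _) hlim).sub (tendsto_trn (h.nonneg _) hlim)).abs).div_const r
  refine le_of_tendsto t1 (.of_forall fun j => ?_)
  have hj : 0 < 1 / ((j:ℝ) + 1) := by positivity
  refine (diff_rpow_le_of_contDiff hp (h.contDiff_trn hj) x he hr).trans (lintegral_mono fun t => ?_)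
  apply ofReal_le_ofReal
  rw [(h.hasGradientAt_trn hj _).gradient, norm_smul, norm_of_nonneg (trn'_mem hj _).1]
  refine rpow_le_rpow (mul_nonneg (trn'_mem hj _).1 (norm_nonneg _)) ?_ (by linarith)
  have := mul_le_right (trn'_mem hj (U (x - (r * t) • e))).2
    (norm_nonneg (∇U (x - (r * t) • e)))
  linarith

/-- Weighted bound of vertical difference quotients by the gradient. -/
theorem lintegral_diff_le (h : HalfSol n p q U) {e : Eu d} (he : ‖e‖ = 1) {r : ℝ} (hr : 0 < r)
    {k k' : Eu d → ENNReal} (hk : Measurable k)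
    (hkk : ∀ z : Eu d, 0 < z n → ∀ t ∈ Icc (0:ℝ) r, k (z + t • e) ≤ k' z) :
    ∫⁻ x, k x * ofReal ((|U x - U (x - r • e)| / r) ^ p) ≤ ∫⁻ x, k' x * ofReal (‖∇U x‖ ^ p) := by
  have hp := h.hp
  have hm : Measurable fun x => ofReal (‖∇U x‖ ^ p) :=
    ((measurable_gradient U).norm.pow_const p).ennreal_ofReal
  have hm2 : Measurable fun z : Eu d × ℝ => z.1 - (r * z.2) • e := by fun_prop
  have hprob : IsProbabilityMeasure (volume.restrict (Icc (0:ℝ) 1)) := ⟨by simp⟩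
  calc ∫⁻ x, k x * ofReal ((|U x - U (x - r • e)| / r) ^ p)
      ≤ ∫⁻ x, ∫⁻ t in Icc (0:ℝ) 1, k x * ofReal (‖∇U (x - (r * t) • e)‖ ^ p) := by
        refine lintegral_mono fun x => ?_
        have hmx : Measurable fun t : ℝ => ofReal (‖∇U (x - (r * t) • e)‖ ^ p) :=
          hm.comp (by fun_prop : Measurable fun t : ℝ => x - (r * t) • e)
        rw [lintegral_const_mul _ hmx]
        exact mul_le_mul_right (h.diff_rpow_le x he hr) _
    _ = ∫⁻ t in Icc (0:ℝ) 1, ∫⁻ x, k x * ofReal (‖∇U (x - (r * t) • e)‖ ^ p) :=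
        lintegral_lintegral_swap ((hk.comp measurable_fst).mul (hm.comp hm2)).aemeasurable
    _ ≤ ∫⁻ t in Icc (0:ℝ) 1, ∫⁻ x, k' x * ofReal (‖∇U x‖ ^ p) := by
        refine setLIntegral_mono' measurableSet_Icc fun t ht => ?_
        rw [← lintegral_add_right_eq_self (fun x => k x * ofReal (‖∇U (x - (r * t) • e)‖ ^ p)) ((r * t) • e)]
        refine lintegral_mono fun z => ?_
        simp only [add_sub_cancel_right]
        rcases le_or_gt (z n) 0 with hz | hz
        · rw [h.gradient_eq_zero hz, norm_zero, zero_rpow (by linarith)]; simp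
        · refine mul_le_mul_left (hkk z hz _ ⟨mul_nonneg hr.le ht.1, ?_⟩) _
          have := mul_le_left ht.2 hr.le
          linarith
    _ = ∫⁻ x, k' x * ofReal (‖∇U x‖ ^ p) := by simp

theorem integrable_diff (h : HalfSol n p q U) {e : Eu d} (r : ℝ) {k : Eu d → ℝ}
    (hk : Continuous k) (hkc : HasCompactSupport k) :
    Integrable fun x => k x * (|U x - U (x - r • e)| / r) ^ p := by
  have hcs : Continuous fun x => U (x - r • e) := h.cont.comp (by fun_prop)
  refine Continuous.integrable_of_hasCompactSupport (hk.mul ?_)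
    (HasCompactSupport.intro hkc fun x hx => by simp [eq_zero_of_notMem hx])
  exact ((h.cont.sub hcs).abs.div_const r).rpow_const fun _ => Or.inr (by linarith [h.hp])

theorem integral_diff_le (h : HalfSol n p q U) {e : Eu d} (he : ‖e‖ = 1) {r : ℝ} (hr : 0 < r)
    {k k' : Eu d → ℝ} (hk : Continuous k) (hkc : HasCompactSupport k) (hk0 : ∀ x, 0 ≤ k x)
    (hk' : Continuous k') (hkc' : HasCompactSupport k') (hk0' : ∀ x, 0 ≤ k' x)
    (hkk : ∀ z : Eu d, ∀ t ∈ Icc (0:ℝ) r, k (z + t • e) ≤ k' z) :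
    ∫ x, k x * (|U x - U (x - r • e)| / r) ^ p ≤ ∫ x, k' x * ‖∇U x‖ ^ p := by
  have hp := h.hp
  have i1 := h.integrable_diff (e := e) r hk hkc
  have i2 := h.integrable_mul hk' hkc'
  have n1 : ∀ x, 0 ≤ k x * (|U x - U (x - r • e)| / r) ^ p := fun x => by
    have := hk0 x; positivity
  have n2 : ∀ x, 0 ≤ k' x * ‖∇U x‖ ^ p := fun x => by
    have := hk0' x; positivity
  rw [← ENNReal.ofReal_le_ofReal_iff (integral_nonneg n2),
    ofReal_integral_eq_lintegral_ofReal i1 (.of_forall n1),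
    ofReal_integral_eq_lintegral_ofReal i2 (.of_forall n2)]
  simp only [ofReal_mul (hk0 _), ofReal_mul (hk0' _)]
  exact h.lintegral_diff_le he hr hk.measurable.ennreal_ofReal fun z _ t ht => ofReal_le_ofReal (hkk z t ht)

end estimates
end HalfSol

namespace HalfSol
section estimates
variable {d : ℕ} {n : Fin d} {p q : ℝ} {U : Eu d → ℝ}

theorem rpow_mul_sub_le {q a b δ : ℝ} (hq : 0 < q) (ha : 0 ≤ a) (hb : 0 ≤ b) (hδ : |a ^ q - b ^ q| ≤ δ) :
    a ^ q * (a - b) ≤ (a ^ (q + 1) - b ^ (q + 1)) / (q + 1) + δ * |a - b| := by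
  have hconj : (q + 1).HolderConjugate ((q + 1) / q) := by
    rw [Real.holderConjugate_iff]
    exact ⟨by linarith, by field_simp; ring⟩
  have hy := Real.young_inequality_of_nonneg ha (rpow_nonneg hb q) hconj
  rw [← rpow_mul hb, mul_div_cancel₀ _ hq.ne'] at hy
  have h1 : b ^ (q + 1) = b ^ q * b := by
    rcases hb.eq_or_lt with h | h
    · rw [← h, zero_rpow (by linarith)]; ring
    · rw [rpow_add_one h.ne']
  have h2 : b ^ (q + 1) / ((q + 1) / q) = b ^ (q + 1) - b ^ (q + 1) / (q + 1) := by field_simp; ring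
  have h3 : (a ^ q - b ^ q) * (a - b) ≤ δ * |a - b| := by
    refine (le_abs_self _).trans ?_
    rw [abs_mul]
    exact mul_le_right hδ (abs_nonneg _)
  rw [sub_div]
  linarith

theorem exists_shift_close {k : Eu d → ℝ} (hk : Continuous k) (hkc : HasCompactSupport k) {e : Eu d}
    (he : ‖e‖ = 1) {δ : ℝ} (hδ : 0 < δ) :
    ∃ r₀ > 0, ∀ t : ℝ, |t| ≤ r₀ → ∀ z, |k (z + t • e) - k z| ≤ δ := by
  obtain ⟨r, hr, hu⟩ := Metric.uniformContinuous_iff.1 (hkc.uniformContinuous_of_continuous hk) δ hδ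
  refine ⟨r / 2, by positivity, fun t ht z => ?_⟩
  refine (hu (a := z + t • e) (b := z) ?_).le
  rw [dist_eq_norm, add_sub_cancel_left, norm_smul, he, mul_one, norm_eq_abs]
  linarith

theorem abs_shift_sub_le {η k' : Eu d → ℝ} (hη : ContDiff ℝ 1 η) {e : Eu d} (he : ‖e‖ = 1) {r : ℝ}
    (hr : 0 ≤ r) {z : Eu d} (hk : ∀ t ∈ Icc (0:ℝ) r, ‖∇η (z + t • e)‖ ≤ k' z) :
    |η (z + r • e) - η z| ≤ r * k' z := by
  have hder : ∀ t ∈ Icc (0:ℝ) r, HasDerivWithinAt (fun t : ℝ => η (z + t • e))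
      (⟪∇η (z + t • e), e⟫) (Icc 0 r) t := by
    intro t _
    have h1 : HasDerivAt (fun t : ℝ => z + t • e) e t := by
      simpa using ((hasDerivAt_id t).smul_const e).const_add z
    have h2 := (hasGradientAt_of_contDiffAt (hη.contDiffAt (x := z + t • e))).hasFDerivAt
    have h3 := h2.comp_hasDerivAt t h1
    refine HasDerivAt.hasDerivWithinAt (HasDerivAt.congr_deriv (by exact h3) ?_)
    simp
  have h1 := norm_image_sub_le_of_norm_deriv_le_segment' hder (C := k' z) (fun t ht => by
    refine (norm_inner_le_norm _ _).trans ?_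
    rw [he, mul_one]
    exact hk t ⟨ht.1, ht.2.le⟩) r ⟨hr, le_rfl⟩
  simp only [zero_smul, add_zero, sub_zero, norm_eq_abs] at h1
  linarith

theorem integral_shift (k F : Eu d → ℝ) (a : Eu d) : ∫ x, k x * F (x - a) = ∫ z, k (z + a) * F z := by
  rw [← integral_add_right_eq_self (fun x => k x * F (x - a)) a]
  simp only [add_sub_cancel_right]

theorem boundary_pointwise (hp : 1 < p) (hq : 0 < q) {g g' y : Eu d} {η k u u' r δ : ℝ} (ind : Prop) [Decidable ind]
    (hind : ind → g' = 0) (hη : 0 ≤ η) (hk : ‖y‖ ≤ k) (hu : 0 ≤ u) (hu' : 0 ≤ u') (hr : 0 < r)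
    (hδ : |u ^ q - u' ^ q| ≤ δ ∨ η = 0) :
    (1 - 1 / p) * (if ind then η * ‖g‖ ^ p else 0) ≤ (⟪A p g, η • g + u • y⟫ - ⟪A p g, η • g' + u' • y⟫) -
      (u ^ q * (η * u) - u ^ q * (η * u')) + 1 / p * (η * ‖g'‖ ^ p - η * ‖g‖ ^ p) +
      r * (k * (|u - u'| / r) ^ p + k * ‖g‖ ^ p) + 1 / (q + 1) * (η * u ^ (q + 1) - η * u' ^ (q + 1)) +
      δ * r * (η + η * (|u - u'| / r) ^ p) := by
  have hp0 : 0 < p := by linarith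
  have hconv : (1 - 1 / p) * (if ind then η * ‖g‖ ^ p else 0) + 1 / p * (η * ‖g‖ ^ p - η * ‖g'‖ ^ p) ≤
      η * ⟪A p g, g - g'⟫ := by
    by_cases hi : ind
    · rw [if_pos hi, hind hi, sub_zero, inner_A_self hp, norm_zero, zero_rpow hp0.ne']
      apply le_of_eq; ring
    · rw [if_neg hi]
      have := mul_le_left (A_convex hp g g') hη
      rw [mul_zero, zero_add]
      refine le_trans (le_of_eq ?_) this
      ring
  have hD0 : 0 ≤ |u - u'| / r := by positivity
  have hDr : |u - u'| = r * (|u - u'| / r) := by field_simp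
  have h2 : -(r * (k * (|u - u'| / r) ^ p + k * ‖g‖ ^ p)) ≤ (u - u') * ⟪A p g, y⟫ := by
    have h3 : |(u - u') * ⟪A p g, y⟫| ≤ |u - u'| * (‖g‖ ^ (p - 1) * k) := by
      rw [abs_mul]
      refine mul_le_left ?_ (abs_nonneg _)
      refine (abs_real_inner_le_norm _ _).trans ?_
      rw [norm_A hp]
      exact mul_le_left hk (by positivity)
    have h4 := rpow_mul_le hp (norm_nonneg g) hD0
    have h5 := mul_le_left h4 (mul_nonneg hr.le ((norm_nonneg y).trans hk))
    have h6 := (abs_le.1 h3).1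
    have h7 : |u - u'| * (‖g‖ ^ (p - 1) * k) = r * k * (‖g‖ ^ (p - 1) * (|u - u'| / r)) := by
      field_simp
    linarith
  have h3 : η * (u ^ q * (u - u')) ≤ 1 / (q + 1) * (η * u ^ (q + 1) - η * u' ^ (q + 1)) +
      δ * r * (η + η * (|u - u'| / r) ^ p) := by
    rcases hδ with hδ | h0
    · have h4 := mul_le_left (rpow_mul_sub_le hq hu hu' hδ) hη
      have hδ0 : 0 ≤ δ := (abs_nonneg _).trans hδ
      have h5 := rpow_mul_le hp zero_le_one hD0
      rw [one_rpow, one_rpow, one_mul] at h5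
      have h6 := mul_le_left h5 (by positivity : 0 ≤ δ * r * η)
      have h7 : δ * |u - u'| * η = δ * r * η * (|u - u'| / r) := by field_simp
      have h8 : η * ((u ^ (q + 1) - u' ^ (q + 1)) / (q + 1)) =
        1 / (q + 1) * (η * u ^ (q + 1) - η * u' ^ (q + 1)) := by ring
      linarith
    · rw [h0]; simp
  have h4 : ⟪A p g, η • g + u • y⟫ - ⟪A p g, η • g' + u' • y⟫ =
      η * ⟪A p g, g - g'⟫ + (u - u') * ⟪A p g, y⟫ := by
    simp only [inner_add_right, real_inner_smul_right, inner_sub_right]; ring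
  rw [h4]
  linarith

/-- Rellich-type estimate of the gradient near the boundary. -/
theorem boundary_estimate (h : HalfSol n p q U) {η k : Eu d → ℝ} (hη : ContDiff ℝ 1 η)
    (hηc : HasCompactSupport η) (hη0 : ∀ x, 0 ≤ η x) (hk : Continuous k) (hkc : HasCompactSupport k)
    (hηk : ∀ x, ‖∇η x‖ ≤ k x) {δ : ℝ} (hδ : 0 < δ) :
    ∃ r₀ > 0, ∀ r, 0 < r → r ≤ r₀ → (1 - 1 / p) * ∫ x in {x | x n ≤ r}, η x * ‖∇U x‖ ^ p ≤
      r * (3 * ((∫ x, k x * ‖∇U x‖ ^ p) + ∫ x, k x * U x ^ (q + 1)) + δ) := by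
  have hp := h.hp
  have hp0 : 0 < p := by linarith
  have hq := h.hq
  have hk0 : ∀ x, 0 ≤ k x := fun x => (norm_nonneg _).trans (hηk x)
  obtain ⟨e, he⟩ : ∃ e : Eu d, e = single n 1 := ⟨_, rfl⟩
  have he1 : ‖e‖ = 1 := by rw [he]; simp
  obtain ⟨ρ₁, hρ₁⟩ := hηc.isBounded.subset_closedBall (0 : Eu d)
  obtain ⟨ρ₂, hρ₂⟩ := hkc.isBounded.subset_closedBall (0 : Eu d)
  obtain ⟨ρ, hρ⟩ : ∃ ρ : ℝ, ρ = max (max ρ₁ ρ₂) 0 := ⟨_, rfl⟩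
  have hρ0 : 0 ≤ ρ := by rw [hρ]; exact le_max_right _ _
  have hsη : ∀ x, ρ < ‖x‖ → η x = 0 := fun x hx => eq_zero_of_notMem fun h' => by
    have h1 := mem_closedBall_zero_iff.1 (hρ₁ h')
    have h2 : ρ₁ ≤ ρ := by rw [hρ]; exact (le_max_left _ _).trans (le_max_left _ _)
    linarith
  have hsk : ∀ x, ρ < ‖x‖ → k x = 0 := fun x hx => eq_zero_of_notMem fun h' => by
    have h1 := mem_closedBall_zero_iff.1 (hρ₂ h')
    have h2 : ρ₂ ≤ ρ := by rw [hρ]; exact (le_max_right _ _).trans (le_max_left _ _)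
    linarith
  obtain ⟨L, -, hb⟩ := exists_bump d
  obtain ⟨χ, hχ, hχc, -, hχ1, hχ2, -⟩ := hb 0 (4 * (ρ + 1)) (by linarith)
  rw [show 4 * (ρ + 1) / 4 = ρ + 1 by ring] at hχ2
  have hχ2' : ∀ x, ‖x‖ ≤ ρ + 1 → χ x = 1 := fun x hx => hχ2 x (mem_closedBall_zero_iff.2 hx)
  have cU : ∀ a : ℝ, 0 < a → Continuous fun x => U x ^ a := fun a ha =>
    h.cont.rpow_const fun _ => Or.inr ha.le
  have iU : ∀ {k : Eu d → ℝ}, Continuous k → HasCompactSupport k →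
      Integrable fun x => k x * U x ^ (q + 1) := fun {k} hk hkc =>
    (hk.mul (cU (q + 1) (by linarith))).integrable_of_hasCompactSupport
      (HasCompactSupport.intro hkc fun x hx => by simp [eq_zero_of_notMem hx])
  obtain ⟨X, hX⟩ : ∃ X : ℝ, X = 3 * (∫ x, χ x * ‖∇U x‖ ^ p) + (∫ x, χ x * U x ^ (q + 1)) +
    (∫ x, η x) + ∫ x, η x * ‖∇U x‖ ^ p := ⟨_, rfl⟩
  have hX1 : 0 ≤ ∫ x, χ x * ‖∇U x‖ ^ p := integral_nonneg fun x => by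
    have := (hχ1 x).1
    positivity
  have hX0 : 0 ≤ X := by
    have h2 : 0 ≤ ∫ x, χ x * U x ^ (q + 1) := integral_nonneg fun x =>
      mul_nonneg (hχ1 x).1 (rpow_nonneg (h.nonneg x) _)
    have h3 : 0 ≤ ∫ x, η x := integral_nonneg hη0
    have h4 : 0 ≤ ∫ x, η x * ‖∇U x‖ ^ p := integral_nonneg fun x => by
      have := hη0 x
      positivity
    rw [hX]; linarith
  obtain ⟨δ₁, hδ₁⟩ : ∃ δ₁ : ℝ, δ₁ = min 1 (δ / (X + 1)) := ⟨_, rfl⟩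
  have hδ₁0 : 0 < δ₁ := by rw [hδ₁]; exact lt_min one_pos (by positivity)
  have hδ₁1 : δ₁ ≤ 1 := by rw [hδ₁]; exact min_le_left _ _
  have hδ₁X : δ₁ * X ≤ δ := by
    have h1 : δ₁ ≤ δ / (X + 1) := by rw [hδ₁]; exact min_le_right _ _
    rw [le_div_iff₀ (by linarith)] at h1
    linarith
  obtain ⟨r₁, hr₁, hcl₁⟩ := exists_shift_close hk hkc he1 hδ₁0
  obtain ⟨r₂, hr₂, hcl₂⟩ := exists_shift_close hη.continuous hηc he1 hδ₁0
  obtain ⟨r₃, hr₃, hcl₃⟩ := exists_shift_close (k := fun x => χ x * U x ^ q)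
    (hχ.continuous.mul (cU q hq)) (HasCompactSupport.intro hχc fun x hx => by
      simp [eq_zero_of_notMem hx]) he1 hδ₁0
  refine ⟨min 1 (min r₁ (min r₂ r₃)), lt_min one_pos (lt_min hr₁ (lt_min hr₂ hr₃)), fun r hr hrm => ?_⟩
  have hr1 : r ≤ 1 := hrm.trans (min_le_left _ _)
  have hrr₁ : r ≤ r₁ := hrm.trans ((min_le_right _ _).trans (min_le_left _ _))
  have hrr₂ : r ≤ r₂ := hrm.trans ((min_le_right _ _).trans ((min_le_right _ _).trans (min_le_left _ _)))
  have hrr₃ : r ≤ r₃ := hrm.trans ((min_le_right _ _).trans ((min_le_right _ _).trans (min_le_right _ _)))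
  have hshift : ∀ {j : Eu d → ℝ} {r' : ℝ}, r ≤ r' → (∀ x, 0 ≤ j x) → (∀ x, ρ < ‖x‖ → j x = 0) →
      (∀ t : ℝ, |t| ≤ r' → ∀ z, |j (z + t • e) - j z| ≤ δ₁) → ∀ z : Eu d, ∀ t ∈ Icc (0:ℝ) r,
      j (z + t • e) ≤ j z + δ₁ * χ z := by
    intro j r' hr' hj0 hj hjc z t ht
    by_cases hz : ‖z‖ ≤ ρ + 1
    · rw [hχ2' z hz, mul_one]
      have := (abs_le.1 (hjc t (by rw [abs_of_nonneg ht.1]; linarith [ht.2]) z)).2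
      linarith
    · have h1 : ρ < ‖z + t • e‖ := by
        have h2 := norm_sub_le (z + t • e) (t • e)
        rw [add_sub_cancel_right, norm_smul, he1, mul_one, norm_of_nonneg ht.1] at h2
        linarith [ht.2, not_le.1 hz]
      rw [hj _ h1]
      exact add_nonneg (hj0 z) (mul_nonneg hδ₁0.le (hχ1 z).1)
  have hkk := hshift hrr₁ hk0 hsk hcl₁
  have hηη := hshift hrr₂ hη0 hsη hcl₂
  have cχ := hχ.continuous
  have cη := hη.continuous
  have ck' : Continuous fun x => k x + δ₁ * χ x := hk.add (continuous_const.mul cχ)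
  have sk' : HasCompactSupport fun x => k x + δ₁ * χ x := hkc.add (hχc.mul_left)
  have cη' : Continuous fun x => η x + δ₁ * χ x := cη.add (continuous_const.mul cχ)
  have sη' : HasCompactSupport fun x => η x + δ₁ * χ x := hηc.add (hχc.mul_left)
  have n1 : ∀ x, 0 ≤ δ₁ * χ x := fun x => mul_nonneg hδ₁0.le (hχ1 x).1
  have iG := fun {k : Eu d → ℝ} => h.integrable_mul (k := k)
  have split : ∀ {j : Eu d → ℝ} {F : Eu d → ℝ}, Integrable (fun x => j x * F x) →
      Integrable (fun x => χ x * F x) →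
      ∫ x, (j x + δ₁ * χ x) * F x = (∫ x, j x * F x) + δ₁ * ∫ x, χ x * F x := by
    intro j F h1 h2
    rw [← integral_const_mul, ← integral_add h1 (h2.const_mul δ₁)]
    congr 1; funext x; ring
  have d1 : ∫ x, k x * (|U x - U (x - r • e)| / r) ^ p ≤
      (∫ x, k x * ‖∇U x‖ ^ p) + δ₁ * ∫ x, χ x * ‖∇U x‖ ^ p := by
    rw [← split (iG hk hkc) (iG cχ hχc)]
    exact h.integral_diff_le he1 hr hk hkc hk0 ck' sk' (fun x => add_nonneg (hk0 x) (n1 x)) hkk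
  have d2 : ∫ x, η x * (|U x - U (x - r • e)| / r) ^ p ≤
      (∫ x, η x * ‖∇U x‖ ^ p) + δ₁ * ∫ x, χ x * ‖∇U x‖ ^ p := by
    rw [← split (iG cη hηc) (iG cχ hχc)]
    exact h.integral_diff_le he1 hr cη hηc hη0 cη' sη' (fun x => add_nonneg (hη0 x) (n1 x)) hηη
  have hmv : ∀ z, |η (z + r • e) - η z| ≤ r * (k z + δ₁ * χ z) := fun z =>
    abs_shift_sub_le hη he1 hr.le (k' := fun z => k z + δ₁ * χ z) fun t ht => (hηk _).trans (hkk z t ht)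
  have cηs : Continuous fun x => η (x + r • e) := cη.comp (by fun_prop)
  have sηs : HasCompactSupport fun x => η (x + r • e) := hηc.comp_homeomorph (Homeomorph.addRight (r • e))
  have d3 : (∫ x, η x * ‖∇U (x - r • e)‖ ^ p) - ∫ x, η x * ‖∇U x‖ ^ p ≤
      r * ((∫ x, k x * ‖∇U x‖ ^ p) + δ₁ * ∫ x, χ x * ‖∇U x‖ ^ p) := by
    rw [integral_shift η (fun x => ‖∇U x‖ ^ p), ← split (iG hk hkc) (iG cχ hχc),
      ← integral_const_mul, ← integral_sub (iG cηs sηs) (iG cη hηc)]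
    refine integral_mono ((iG cηs sηs).sub (iG cη hηc)) ((iG ck' sk').const_mul r) fun x => ?_
    have h1 := mul_le_right (abs_le.1 (hmv x)).2 (by positivity : 0 ≤ ‖∇U x‖ ^ p)
    simp only
    linarith
  have d4 : (∫ x, η x * U x ^ (q + 1)) - ∫ x, η x * U (x - r • e) ^ (q + 1) ≤
      r * ((∫ x, k x * U x ^ (q + 1)) + δ₁ * ∫ x, χ x * U x ^ (q + 1)) := by
    rw [integral_shift η (fun x => U x ^ (q + 1)), ← split (iU hk hkc) (iU cχ hχc),
      ← integral_const_mul, ← integral_sub (iU cη hηc) (iU cηs sηs)]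
    refine integral_mono ((iU cη hηc).sub (iU cηs sηs)) ((iU ck' sk').const_mul r) fun x => ?_
    have h1 := mul_le_right (abs_le.1 (hmv x)).1 (rpow_nonneg (h.nonneg x) (q + 1))
    simp only
    linarith
  obtain ⟨j0, id0⟩ := h.shift_identity le_rfl rfl hη hηc
  obtain ⟨jr, idr⟩ := h.shift_identity hr.le rfl hη hηc
  simp only [zero_smul, sub_zero] at j0 id0
  rw [← he] at jr idr
  have cs : Continuous fun x => U (x - r • e) := h.cont.comp (by fun_prop)
  have iR0 : Integrable fun x => U x ^ q * (η x * U x) :=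
    ((cU q hq).mul (cη.mul h.cont)).integrable_of_hasCompactSupport
      (HasCompactSupport.intro hηc fun x hx => by simp [eq_zero_of_notMem hx])
  have iRr : Integrable fun x => U x ^ q * (η x * U (x - r • e)) :=
    ((cU q hq).mul (cη.mul cs)).integrable_of_hasCompactSupport
      (HasCompactSupport.intro hηc fun x hx => by simp [eq_zero_of_notMem hx])
  have iQr : Integrable fun x => η x * U (x - r • e) ^ (q + 1) :=
    (cη.mul (cs.rpow_const fun _ => Or.inr (by linarith))).integrable_of_hasCompactSupport
      (HasCompactSupport.intro hηc fun x hx => by simp [eq_zero_of_notMem hx])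
  have iη : Integrable η := cη.integrable_of_hasCompactSupport hηc
  have iDk := h.integrable_diff (e := e) r hk hkc
  have iDη := h.integrable_diff (e := e) r cη hηc
  have iGr := h.integrable_mul_shift cη hηc (r • e)
  have hms : MeasurableSet {x : Eu d | x n ≤ r} := (isClosed_le (by fun_prop) continuous_const).measurableSet
  have hpt : ∀ x, (1 - 1 / p) * {x : Eu d | x n ≤ r}.indicator (fun x => η x * ‖∇U x‖ ^ p) x ≤
      (⟪A p (∇U x), η x • ∇U x + U x • ∇η x⟫ - ⟪A p (∇U x), η x • ∇U (x - r • e) + U (x - r • e) • ∇η x⟫) -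
      (U x ^ q * (η x * U x) - U x ^ q * (η x * U (x - r • e))) +
      1 / p * (η x * ‖∇U (x - r • e)‖ ^ p - η x * ‖∇U x‖ ^ p) +
      r * (k x * (|U x - U (x - r • e)| / r) ^ p + k x * ‖∇U x‖ ^ p) +
      1 / (q + 1) * (η x * U x ^ (q + 1) - η x * U (x - r • e) ^ (q + 1)) +
      δ₁ * r * (η x + η x * (|U x - U (x - r • e)| / r) ^ p) := by
    intro x
    classical
    rw [indicator_apply]
    refine boundary_pointwise hp hq (x ∈ {x : Eu d | x n ≤ r}) (fun hx => ?_) (hη0 x) (hηk x) (h.nonneg x)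
      (h.nonneg _) hr ?_
    · apply h.gradient_eq_zero
      rw [mem_setOf_eq] at hx
      rw [he]; simpa using hx
    · by_cases hx : ‖x‖ ≤ ρ
      · left
        have h1 := hcl₃ (-r) (by rw [abs_neg, abs_of_pos hr]; exact hrr₃) x
        have h2 : ‖x + -r • e‖ ≤ ρ + 1 := by
          refine (norm_add_le _ _).trans ?_
          rw [norm_smul, he1, norm_neg, norm_of_nonneg hr.le]; linarith
        simp only [hχ2' x (by linarith), hχ2' _ h2, one_mul] at h1
        rwa [abs_sub_comm, neg_smul, ← sub_eq_add_neg] at h1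
      · exact Or.inr (hsη x (not_le.1 hx))
  have iInd := ((iG cη hηc).indicator hms).const_mul (1 - 1 / p)
  have s1 := j0.sub jr
  have s2 := iR0.sub iRr
  have s3 := (iGr.sub (iG cη hηc)).const_mul (1 / p)
  have s4 := (iDk.add (iG hk hkc)).const_mul r
  have s5 := ((iU cη hηc).sub iQr).const_mul (1 / (q + 1))
  have s6 := (iη.add iDη).const_mul (δ₁ * r)
  have hIntg := integral_mono iInd (((((s1.sub s2).add s3).add s4).add s5).add s6) hpt
  rw [integral_add' ((((s1.sub s2).add s3).add s4).add s5) s6,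
    integral_add' (((s1.sub s2).add s3).add s4) s5, integral_add' ((s1.sub s2).add s3) s4,
    integral_add' (s1.sub s2) s3, integral_sub' s1 s2, integral_sub' j0 jr, integral_sub' iR0 iRr,
    integral_const_mul, integral_const_mul, integral_const_mul, integral_const_mul, integral_const_mul,
    integral_indicator hms] at hIntg
  simp only [Pi.sub_apply, Pi.add_apply] at hIntg
  rw [integral_sub iGr (iG cη hηc), integral_add iDk (iG hk hkc), integral_sub (iU cη hηc) iQr,
    integral_add iη iDη, id0, idr] at hIntg
  refine hIntg.trans ?_
  have hIk : 0 ≤ ∫ x, k x * ‖∇U x‖ ^ p := integral_nonneg fun x => by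
    have := hk0 x
    positivity
  have hJk : 0 ≤ ∫ x, k x * U x ^ (q + 1) := integral_nonneg fun x =>
    mul_nonneg (hk0 x) (rpow_nonneg (h.nonneg x) _)
  have hXU : 0 ≤ ∫ x, χ x * U x ^ (q + 1) := integral_nonneg fun x =>
    mul_nonneg (hχ1 x).1 (rpow_nonneg (h.nonneg x) _)
  generalize (∫ x, k x * ‖∇U x‖ ^ p) = Ik at *
  generalize (∫ x, k x * U x ^ (q + 1)) = Jk at *
  generalize (∫ x, χ x * ‖∇U x‖ ^ p) = X₁ at *
  generalize (∫ x, χ x * U x ^ (q + 1)) = X₂ at *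
  generalize (∫ x, η x) = Y at *
  generalize (∫ x, η x * ‖∇U x‖ ^ p) = Iη at *
  have w1 : ∀ {c z w : ℝ}, 0 ≤ c → c ≤ 1 → z ≤ w → 0 ≤ w → c * z ≤ w := fun hc hc1 hzw hw =>
    (mul_le_left hzw hc).trans (by
      have := mul_le_right hc1 hw
      linarith)
  have hp1 : 1 / p ≤ 1 := by rw [div_le_one hp0]; exact hp.le
  have hq1 : 1 / (q + 1) ≤ 1 := by rw [div_le_one (by linarith)]; linarith
  have f3 := w1 (by positivity) hp1 d3 (by positivity)
  have f5 := w1 (by positivity) hq1 d4 (by positivity)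
  have f4 := mul_le_left d1 hr.le
  have f6 := mul_le_left d2 (by positivity : 0 ≤ δ₁ * r)
  have f7 : δ₁ * r * (δ₁ * X₁) ≤ δ₁ * r * X₁ :=
    mul_le_left (by
      have := mul_le_right hδ₁1 hX1
      linarith) (by positivity)
  have f8 := mul_le_left hδ₁X hr.le
  rw [hX] at f8
  have f9 := mul_nonneg hr.le hJk
  linarith

end estimates
end HalfSol

namespace HalfSol
section bounds
variable {d : ℕ} {n : Fin d} {p q s b β c ε N₀ : ℝ} {U : Eu d → ℝ}

theorem abs_apply_sub_le (x y : Eu d) (n : Fin d) : |y n - x n| ≤ ‖y - x‖ := by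
  have := PiLp.norm_apply_le (y - x) n
  rwa [PiLp.sub_apply, norm_eq_abs] at this

theorem log_gradient_bounds (h : HalfSol n p q U) (hC : Consts d p s b β c ε N₀) (hs : s = q + 1 - p) :
    ∃ C > 0, ∀ x : Eu d, 0 < x n → ‖∇U x‖ ≤ C * (U x / x n) ∧
      ‖∇(fun x => log (U x)) x‖ ≤ C / x n ∧ U x ^ s ≤ C * x n ^ (-p) := by
  have hp := h.hp
  have hp0 : 0 < p := by linarith
  have hβ := hC.β_pos
  obtain ⟨C, hC0, hest⟩ := hC.universal_estimate
  have hlog := h.weak.log hp h.pos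
  rw [← hs] at hlog
  refine ⟨2 * C + (2 * C) ^ p / β, by positivity, fun x hx => ?_⟩
  have hball : closedBall x (x n / 2) ⊆ {x | 0 < x n} := by
    intro y hy
    rw [mem_closedBall, dist_eq_norm] at hy
    have := (abs_le.1 ((abs_apply_sub_le x y n).trans hy)).1
    rw [mem_setOf_eq]; linarith
  have h1 := hest hlog x (x n / 2) (by linarith) hball
  obtain ⟨g, hg⟩ : ∃ g, g = ‖∇(fun x => log (U x)) x‖ := ⟨_, rfl⟩
  have hexp : exp (s * log (U x)) = U x ^ s := by
    rw [mul_comm, exp_mul, exp_log (h.pos x hx)]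
  rw [← hg, hexp] at h1
  have hg0 : 0 ≤ g := hg ▸ norm_nonneg _
  have hUs : 0 < U x ^ s := rpow_pos_of_pos (h.pos x hx) _
  have hM : (g ^ p + β * U x ^ s) ^ (1 / p) ≤ 2 * C / x n := by
    rw [le_div_iff₀ hx]; linarith
  have hMp : g ^ p + β * U x ^ s ≤ (2 * C / x n) ^ p := by
    have h2 := rpow_le_rpow (by positivity) hM hp0.le
    rwa [← rpow_mul (by positivity), one_div_mul_cancel hp0.ne', Real.rpow_one] at h2
  have hg1 : g ≤ 2 * C / x n := by
    have h2 : g ^ p ≤ (2 * C / x n) ^ p := by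
      have : 0 ≤ β * U x ^ s := by positivity
      linarith
    exact (Real.rpow_le_rpow_iff hg0 (by positivity) hp0).1 h2
  have hg2 : g ≤ (2 * C + (2 * C) ^ p / β) / x n := hg1.trans (by
    apply div_le_div_of_nonneg_right _ hx.le
    have : 0 ≤ (2 * C) ^ p / β := by positivity
    linarith)
  refine ⟨?_, hg ▸ hg2, ?_⟩
  · have h2 : HasGradientAt (fun x => log (U x)) ((U x)⁻¹ • ∇U x) x :=
      HasGradientAt.comp_real (Real.hasDerivAt_log (h.pos x hx).ne')
        (hasGradientAt_of_contDiffAt (h.weak.contDiffAt hx))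
    have h3 : ‖∇U x‖ = U x * g := by
      rw [hg, h2.gradient, norm_smul, norm_of_nonneg (inv_nonneg.2 (h.nonneg x)), ← mul_assoc,
        mul_inv_cancel₀ (h.pos x hx).ne', one_mul]
    rw [h3]
    refine (mul_le_left hg2 (h.nonneg x)).trans (le_of_eq ?_)
    ring
  · have h2 : U x ^ s ≤ (2 * C / x n) ^ p / β := by
      rw [le_div_iff₀ hβ]
      have : 0 ≤ g ^ p := by positivity
      linarith
    refine h2.trans ?_
    rw [div_rpow (by positivity) hx.le, rpow_neg hx.le, ← div_eq_mul_inv, div_right_comm]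
    apply div_le_div_of_nonneg_right _ (by positivity)
    linarith

theorem inv_rpow_sub_ge {a b κ : ℝ} (ha : 0 < a) (hab : a ≤ b) (hκ : 0 ≤ κ) :
    κ * (b ^ (-κ) * ((b - a) / b)) ≤ a ^ (-κ) - b ^ (-κ) := by
  have hb : 0 < b := by linarith
  have hab0 : 0 < a / b := by positivity
  have h1 : 1 - κ * (a / b - 1) ≤ (a / b) ^ (-κ) := by
    rw [Real.rpow_def_of_pos hab0]
    have h2 := Real.add_one_le_exp (log (a / b) * -κ)
    have h3 := mul_le_right (Real.log_le_sub_one_of_pos hab0) hκ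
    linarith
  have h2 : a ^ (-κ) = (a / b) ^ (-κ) * b ^ (-κ) := by
    rw [← mul_rpow hab0.le hb.le, div_mul_cancel₀ _ hb.ne']
  have h3 := mul_le_right h1 (rpow_nonneg hb.le (-κ))
  have h4 : κ * (b ^ (-κ) * ((b - a) / b)) = -(κ * (a / b - 1)) * b ^ (-κ) := by field_simp; ring
  rw [h2, h4]; linarith

/-- The quotient `U / x_n` is decreasing in `x_n` up to a constant. -/
theorem quotient_quasi_mono (h : HalfSol n p q U) (hpd : p < d) {C : ℝ} (hC : 0 < C)
    (hlog : ∀ x : Eu d, 0 < x n → ‖∇(fun x => log (U x)) x‖ ≤ C / x n) : ∃ C₁ > 0,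
    ∀ (x : Eu d) (r : ℝ), 0 < r → r ≤ x n → U x / x n ≤ C₁ * (U (x - (x n - r) • single n 1) / r) := by
  have hp := h.hp
  obtain ⟨κ, hκ⟩ : ∃ κ, κ = ((d:ℝ) - p) / (p - 1) := ⟨_, rfl⟩
  have hκ0 : 0 < κ := by rw [hκ]; exact div_pos (by linarith) (by linarith)
  obtain ⟨c₁, hc₁⟩ : ∃ c₁ : ℝ, c₁ = min 1 (κ / 2 * 2 ^ (-κ)) := ⟨_, rfl⟩
  have hc₁0 : 0 < c₁ := by rw [hc₁]; exact lt_min one_pos (by positivity)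
  refine ⟨exp C / c₁, by positivity, fun x r hr hrx => ?_⟩
  obtain ⟨t, ht⟩ : ∃ t, t = x n := ⟨_, rfl⟩
  rw [← ht] at hrx ⊢
  have ht0 : 0 < t := by linarith
  obtain ⟨y, hy⟩ : ∃ y, y = x - (t - r) • single n (1:ℝ) := ⟨_, rfl⟩
  have hyx : ‖y - x‖ = t - r := by
    rw [hy, sub_sub_cancel_left, norm_neg, norm_smul, norm_of_nonneg (by linarith)]; simp
  have hball : ∀ ρ, ρ < t → closedBall x ρ ⊆ {x | 0 < x n} := by
    intro ρ hρ z hz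
    rw [mem_closedBall, dist_eq_norm] at hz
    have := (abs_le.1 ((abs_apply_sub_le x z n).trans hz)).1
    rw [mem_setOf_eq]; linarith
  have hm : ∀ z ∈ closedBall x (t / 2), exp (-C) * U x ≤ U z := by
    intro z hz
    have hgr : ∀ z ∈ closedBall x (t / 2), ‖∇(fun x => log (U x)) z‖ ≤ 2 * C / t := by
      intro z hz
      refine (hlog z (hball _ (by linarith) hz)).trans ?_
      rw [mem_closedBall, dist_eq_norm] at hz
      have h1 := (abs_le.1 ((abs_apply_sub_le x z n).trans hz)).1
      rw [div_le_div_iff₀ (by linarith) ht0]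
      have := mul_le_left (by linarith : t / 2 ≤ z n) (by linarith : 0 ≤ 2 * C)
      linarith
    have h1 := (abs_le.1 ((h.weak.log hp h.pos).abs_sub_le (hball _ (by linarith)) hgr hz)).1
    rw [mem_closedBall, dist_eq_norm] at hz
    have h2 : 2 * C / t * ‖z - x‖ ≤ C := by
      refine (mul_le_left hz (by positivity)).trans (le_of_eq ?_)
      field_simp
    have hzp : 0 < U z := h.pos z (hball (t / 2) (by linarith) (by rwa [mem_closedBall, dist_eq_norm]))
    rw [← exp_log hzp, ← exp_log (h.pos x (by linarith)), ← exp_add]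
    apply Real.exp_le_exp.2
    linarith
  have hmp : 0 < exp (-C) * U x := mul_pos (exp_pos _) (h.pos x (by linarith))
  suffices hs : exp (-C) * U x * c₁ * (r / t) ≤ U y by
    rw [← hy]
    have h1 : exp C / c₁ * (exp (-C) * U x * c₁ * (r / t)) = U x * (r / t) := by
      rw [exp_neg]; field_simp
    have h2 := mul_le_left hs (by positivity : 0 ≤ exp C / c₁)
    rw [h1] at h2
    rw [← mul_div_assoc, le_div_iff₀ hr]
    refine le_trans (le_of_eq ?_) h2
    ring
  rcases le_total (t / 2) r with hc | hc
  · refine le_trans ?_ (hm y (by rw [mem_closedBall, dist_eq_norm, hyx]; linarith))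
    have h1 : c₁ * (r / t) ≤ 1 * 1 := mul_le_mul (hc₁ ▸ min_le_left _ _)
      ((div_le_one ht0).2 hrx) (by positivity) zero_le_one
    have := mul_le_left h1 hmp.le
    linarith
  · have hb := h.weak.barrier hp hpd hκ (z := x) (ρ := t / 2) (R := t - r / 2) (by linarith) (by linarith)
      (hball _ (by linarith)) (fun z _ => rpow_nonneg (h.nonneg z) q) (fun z _ => h.nonneg z) hmp hm
      (x := y) (by rw [hyx]; linarith) (by rw [hyx]; linarith)
    refine le_trans ?_ hb
    rw [hyx]
    have h1 := inv_rpow_sub_ge (a := t - r) (b := t - r / 2) (by linarith) (by linarith) hκ0.le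
    have h2 : t ^ (-κ) ≤ (t - r / 2) ^ (-κ) :=
      rpow_le_rpow_of_nonpos (by linarith) (by linarith) (by linarith)
    have h3 : r / t / 2 ≤ (t - r / 2 - (t - r)) / (t - r / 2) := by
      rw [div_div, div_le_div_iff₀ (by positivity) (by linarith)]
      have := mul_nonneg hr.le hr.le
      linarith
    have hR : 0 < (t - r / 2) ^ (-κ) := rpow_pos_of_pos (by linarith) _
    have hden : (t / 2) ^ (-κ) - (t - r / 2) ^ (-κ) ≤ (t / 2) ^ (-κ) := by linarith
    have hden0 : 0 < (t / 2) ^ (-κ) - (t - r / 2) ^ (-κ) := by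
      have := Real.rpow_lt_rpow_of_neg (by linarith : 0 < t / 2) (by linarith : t / 2 < t - r / 2)
        (by linarith : -κ < 0)
      linarith
    rw [le_div_iff₀ hden0]
    have htk : (t / 2) ^ (-κ) = t ^ (-κ) * 2 ^ κ := by
      rw [div_rpow ht0.le (by norm_num), rpow_neg (by norm_num : (0:ℝ) ≤ 2), div_inv_eq_mul]
    have h4 : c₁ * (r / t) * (t / 2) ^ (-κ) ≤ κ * (t ^ (-κ) * (r / t / 2)) := by
      have h5 : c₁ ≤ κ / 2 * 2 ^ (-κ) := hc₁ ▸ min_le_right _ _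
      have h6 := mul_le_right h5 (by positivity : 0 ≤ r / t * (t / 2) ^ (-κ))
      have h7 : (2:ℝ) ^ (-κ) * 2 ^ κ = 1 := by
        rw [← rpow_add (by norm_num)]; simp
      rw [htk] at h6 ⊢
      have h8 : κ / 2 * 2 ^ (-κ) * (r / t * (t ^ (-κ) * 2 ^ κ)) =
        κ * (t ^ (-κ) * (r / t / 2)) * (2 ^ (-κ) * 2 ^ κ) := by ring
      rw [h8, h7] at h6
      linarith
    have h5 : κ * (t ^ (-κ) * (r / t / 2)) ≤ (t - r) ^ (-κ) - (t - r / 2) ^ (-κ) :=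
      (mul_le_left (mul_le_mul h2 h3 (by positivity) hR.le) hκ0.le).trans h1
    have h6 := mul_le_left hden (by positivity : 0 ≤ c₁ * (r / t))
    have h7 := mul_le_left (h6.trans (h4.trans h5)) hmp.le
    linarith

/-- All pointwise bounds, in terms of `(U / x_n)^p`. -/
theorem pointwise_bounds (h : HalfSol n p q U) (hC : Consts d p s b β c ε N₀) (hs : s = q + 1 - p) :
    ∃ C > 0, ∀ x : Eu d, 0 < x n → ‖∇U x‖ ^ p + U x ^ (q + 1) ≤ C * (U x / x n) ^ p ∧
      (U x / x n) ^ p ≤ C * x n ^ (-(p + p ^ 2 / s)) ∧ ∀ r, 0 < r → r ≤ x n →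
        (U x / x n) ^ p ≤ C * (U (x - (x n - r) • single n 1) / r) ^ p := by
  have hp0 : 0 < p := by linarith [h.hp]
  have hs0 := hC.hs
  obtain ⟨C, hC0, h1⟩ := h.log_gradient_bounds hC hs
  obtain ⟨C₁, hC₁, h2⟩ := h.quotient_quasi_mono hC.hpd hC0 fun x hx => (h1 x hx).2.1
  refine ⟨C ^ p + C + C ^ (p / s) + C₁ ^ p, by positivity, fun x hx => ⟨?_, ?_, fun r hr hrx => ?_⟩⟩
  · obtain ⟨ha, -, hb⟩ := h1 x hx
    have hU := h.pos x hx
    have e1 : ‖∇U x‖ ^ p ≤ C ^ p * (U x / x n) ^ p := by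
      rw [← mul_rpow hC0.le (by positivity)]
      exact rpow_le_rpow (norm_nonneg _) ha hp0.le
    have e2 : U x ^ (q + 1) ≤ C * (U x / x n) ^ p := by
      have e3 : U x ^ (q + 1) = U x ^ s * U x ^ p := by rw [← rpow_add hU, hs]; ring_nf
      rw [e3, div_rpow hU.le hx.le]
      refine (mul_le_right hb (rpow_nonneg hU.le p)).trans (le_of_eq ?_)
      rw [rpow_neg hx.le]; ring
    have e4 : 0 ≤ (C ^ (p / s) + C₁ ^ p) * (U x / x n) ^ p := by positivity
    linarith
  · have hU := h.pos x hx
    have e1 : (U x) ^ p ≤ C ^ (p / s) * x n ^ (-(p ^ 2 / s)) := by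
      have e2 := rpow_le_rpow (by positivity) (h1 x hx).2.2 (by positivity : 0 ≤ p / s)
      rw [← rpow_mul hU.le, mul_div_cancel₀ _ hs0.ne', mul_rpow hC0.le (by positivity),
        ← rpow_mul hx.le] at e2
      rwa [show -p * (p / s) = -(p ^ 2 / s) by ring] at e2
    have e2 : (U x / x n) ^ p ≤ C ^ (p / s) * x n ^ (-(p + p ^ 2 / s)) := by
      rw [div_rpow hU.le hx.le, neg_add, rpow_add hx, div_eq_mul_inv, ← rpow_neg hx.le]
      refine (mul_le_right e1 (by positivity)).trans (le_of_eq ?_)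
      ring
    have e3 : 0 ≤ (C ^ p + C + C₁ ^ p) * x n ^ (-(p + p ^ 2 / s)) := by positivity
    linarith
  · have hy := h.nonneg (x - (x n - r) • single n 1)
    have e1 := rpow_le_rpow (div_nonneg (h.nonneg x) hx.le) (h2 x r hr hrx) hp0.le
    rw [mul_rpow hC₁.le (by positivity)] at e1
    have e2 : 0 ≤ (C ^ p + C + C ^ (p / s)) * (U (x - (x n - r) • single n 1) / r) ^ p := by positivity
    linarith

end bounds
end HalfSol

namespace HalfSol
section slabs
variable {d : ℕ} {n : Fin d} {p q : ℝ} {U : Eu d → ℝ}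

/-- The slab `a < x_n ≤ b`. -/
def slab (n : Fin d) (a b : ℝ) : Set (Eu d) := {x | a < x n ∧ x n ≤ b}

theorem measurable_apply (n : Fin d) : Measurable fun x : Eu d => x n :=
  (by fun_prop : Continuous fun x : Eu d => x n).measurable

theorem measurableSet_slab (n : Fin d) (a b : ℝ) : MeasurableSet (slab n a b) :=
  (measurableSet_lt measurable_const (measurable_apply n)).inter
    (measurableSet_le (measurable_apply n) measurable_const)

/-- The density `η (U / x_n)^p`. -/
noncomputable def dens (n : Fin d) (p : ℝ) (U η : Eu d → ℝ) (x : Eu d) : ENNReal :=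
  ofReal (η x * (U x / x n) ^ p)

theorem lintegral_thin_slab_le (h : HalfSol n p q U) {η : Eu d → ℝ} (hη : Continuous η)
    (hηc : HasCompactSupport η) (hη0 : ∀ x, 0 ≤ η x)
    (hmono : ∀ z : Eu d, 0 < z n → ∀ t : ℝ, 0 ≤ t → η (z + t • single n 1) ≤ η z)
    {r : ℝ} (hr : 0 < r) :
    ∫⁻ x in slab n r (2 * r), dens n p U η x ≤
      ofReal (2 ^ p * ∫ x in {x | x n ≤ 2 * r}, η x * ‖∇U x‖ ^ p) := by
  have hp0 : 0 < p := by linarith [h.hp]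
  have hS := measurableSet_slab n r (2 * r)
  have hT : MeasurableSet {x : Eu d | x n ≤ 2 * r} := measurableSet_le (measurable_apply n) measurable_const
  have hηm : Measurable fun x => ofReal (η x) := hη.measurable.ennreal_ofReal
  have key := h.lintegral_diff_le (e := single n 1) (by simp) (by linarith : 0 < 2 * r)
    (k := (slab n r (2 * r)).indicator fun x => ofReal (η x))
    (k' := {x : Eu d | x n ≤ 2 * r}.indicator fun x => ofReal (η x)) (hηm.indicator hS) ?_
  · rw [ofReal_mul (by positivity)]
    have h1 : ∫⁻ x, {x : Eu d | x n ≤ 2 * r}.indicator (fun x => ofReal (η x)) x * ofReal (‖∇U x‖ ^ p) =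
        ofReal (∫ x in {x | x n ≤ 2 * r}, η x * ‖∇U x‖ ^ p) := by
      rw [ofReal_integral_eq_lintegral_ofReal (h.integrable_mul hη hηc).integrableOn
        (ae_of_all _ fun x => mul_nonneg (hη0 x) (by positivity)), ← lintegral_indicator hT]
      refine lintegral_congr fun x => ?_
      by_cases hx : x ∈ {x : Eu d | x n ≤ 2 * r}
      · rw [indicator_of_mem hx, indicator_of_mem hx, ofReal_mul (hη0 x)]
      · rw [indicator_of_notMem hx, indicator_of_notMem hx, zero_mul]
    rw [h1] at key
    refine le_trans ?_ (mul_le_mul_right key _)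
    rw [← lintegral_indicator hS, ← lintegral_const_mul' _ _ ofReal_ne_top]
    refine lintegral_mono fun x => ?_
    by_cases hx : x ∈ slab n r (2 * r)
    · rw [indicator_of_mem hx, indicator_of_mem hx, dens, ← ofReal_mul (hη0 x), ← ofReal_mul (by positivity)]
      refine ofReal_le_ofReal ?_
      have h2 : U (x - (2 * r) • single n 1) = 0 := h.zero _ (by simp; linarith [hx.2])
      rw [h2, sub_zero, abs_of_nonneg (h.nonneg x), mul_left_comm,
        ← mul_rpow (by norm_num) (div_nonneg (h.nonneg x) (by linarith))]
      refine mul_le_left (rpow_le_rpow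
        (div_nonneg (h.nonneg x) (by linarith [hx.1])) ?_ hp0.le) (hη0 x)
      rw [mul_div_mul_left _ _ (by norm_num : (2:ℝ) ≠ 0) |>.symm.trans (mul_div_assoc _ _ _) |>.symm]
      exact div_le_div_of_nonneg_left (h.nonneg x) hr hx.1.le
    · rw [indicator_of_notMem hx]; exact zero_le
  · intro z hz t ht
    by_cases hx : z + t • single n 1 ∈ slab n r (2 * r)
    · have h1 := hx.2
      simp only [PiLp.add_apply, PiLp.smul_apply, EuclideanSpace.single_apply, if_true, smul_eq_mul, mul_one] at h1
      have h2 : z ∈ {x : Eu d | x n ≤ 2 * r} := by rw [mem_setOf_eq]; linarith [ht.1]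
      rw [indicator_of_mem hx, indicator_of_mem h2]
      exact ofReal_le_ofReal (hmono z hz t ht.1)
    · rw [indicator_of_notMem hx]; exact zero_le

theorem lintegral_slab_translate_le (h : HalfSol n p q U) {η : Eu d → ℝ} (hη0 : ∀ x, 0 ≤ η x)
    (hmono : ∀ z : Eu d, 0 < z n → ∀ t : ℝ, 0 ≤ t → η (z + t • single n 1) ≤ η z)
    {C : ℝ} (hC : 0 ≤ C) (hqm : ∀ x : Eu d, 0 < x n → ∀ r, 0 < r → r ≤ x n →
        (U x / x n) ^ p ≤ C * (U (x - (x n - r) • single n 1) / r) ^ p)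
    {a r : ℝ} (hr : 0 < r) (ha : r ≤ a) :
    ∫⁻ x in slab n a (a + r), dens n p U η x ≤ ofReal C * ∫⁻ x in slab n r (2 * r), dens n p U η x := by
  rw [← lintegral_indicator (measurableSet_slab _ _ _), ← lintegral_indicator (measurableSet_slab _ _ _),
    ← lintegral_sub_right_eq_self ((slab n r (2 * r)).indicator _) ((a - r) • single n 1),
    ← lintegral_const_mul' _ _ ofReal_ne_top]
  refine lintegral_mono fun x => ?_
  by_cases hx : x ∈ slab n a (a + r)
  · obtain ⟨y, hy⟩ : ∃ y, y = x - (a - r) • single n (1:ℝ) := ⟨_, rfl⟩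
    have hyn : y n = x n - (a - r) := by rw [hy]; simp
    have hx1 := hx.1
    have hx2 := hx.2
    have hys : y ∈ slab n r (2 * r) := ⟨by linarith, by linarith⟩
    have h1 := hmono y (by linarith) (a - r) (by linarith)
    have h2 := hqm x (by linarith) (y n) (by linarith) (by linarith)
    rw [show x n - y n = a - r by linarith, ← hy] at h2
    rw [hy, sub_add_cancel, ← hy] at h1
    rw [← hy, indicator_of_mem hx, indicator_of_mem hys, dens, dens, ← ofReal_mul hC]
    refine ofReal_le_ofReal ?_
    have h3 := rpow_nonneg (div_nonneg (h.nonneg x) (by linarith : 0 ≤ x n)) p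
    exact (mul_le_mul h1 h2 h3 (hη0 y)).trans (le_of_eq (by ring))
  · rw [indicator_of_notMem hx]; exact zero_le

/-- On dyadic slabs of width `t` the integral of `η (U / x_n)^p` is at most a multiple of `t` times a
boundary term. -/
theorem lintegral_slab_le (h : HalfSol n p q U) {η k : Eu d → ℝ} (hη : ContDiff ℝ 1 η)
    (hηc : HasCompactSupport η) (hη0 : ∀ x, 0 ≤ η x) (hk : Continuous k) (hkc : HasCompactSupport k)
    (hηk : ∀ x, ‖∇η x‖ ≤ k x)
    (hmono : ∀ z : Eu d, 0 < z n → ∀ t : ℝ, 0 ≤ t → η (z + t • single n 1) ≤ η z)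
    {C : ℝ} (hC : 0 < C) (hqm : ∀ x : Eu d, 0 < x n → ∀ r, 0 < r → r ≤ x n →
        (U x / x n) ^ p ≤ C * (U (x - (x n - r) • single n 1) / r) ^ p)
    {δ : ℝ} (hδ : 0 < δ) {t : ℝ} (ht : 0 < t) :
    ∫⁻ x in slab n t (4 * t), dens n p U η x ≤ ofReal (6 * C * 2 ^ p * (p / (p - 1)) *
      (t * (3 * ((∫ x, k x * ‖∇U x‖ ^ p) + ∫ x, k x * U x ^ (q + 1)) + δ))) := by
  have hp := h.hp
  obtain ⟨r₀, hr₀, hb⟩ := h.boundary_estimate hη hηc hη0 hk hkc hηk hδ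
  obtain ⟨B, hB⟩ : ∃ B, B = 3 * ((∫ x, k x * ‖∇U x‖ ^ p) + ∫ x, k x * U x ^ (q + 1)) + δ := ⟨_, rfl⟩
  rw [← hB] at hb ⊢
  obtain ⟨N, hN⟩ := exists_nat_gt (2 * t / r₀)
  have hN0 : (0:ℝ) < N := lt_trans (by positivity) hN
  obtain ⟨r, hr⟩ : ∃ r, r = t / N := ⟨_, rfl⟩
  have htr : N * r = t := by rw [hr]; field_simp
  have hr0 : 0 < r := by rw [hr]; positivity
  have hN1 : (1:ℝ) ≤ N := by
    have : 0 < N := by exact_mod_cast hN0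
    exact_mod_cast this
  have hrt : r ≤ t := by rw [← htr]; exact le_mul_of_one_le_left hr0.le hN1
  have hr2 : 2 * r ≤ r₀ := by
    rw [div_lt_iff₀ hr₀] at hN
    rw [hr, ← mul_div_assoc, div_le_iff₀ hN0]; linarith
  have hsum : ∀ j : ℕ, ∫⁻ x in slab n t (t + j * r), dens n p U η x ≤
      j * (ofReal C * ∫⁻ x in slab n r (2 * r), dens n p U η x) := by
    intro j
    induction j with
    | zero =>
      have : slab n t (t + (0:ℕ) * r) = ∅ := by
        ext x
        simp [slab]
      rw [this]; simp
    | succ j ih =>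
      have hsub : slab n t (t + (j + 1 : ℕ) * r) ⊆
          slab n t (t + j * r) ∪ slab n (t + j * r) (t + j * r + r) := by
        intro x hx
        rcases le_or_gt (x n) (t + j * r) with hc | hc
        · exact Or.inl ⟨hx.1, hc⟩
        · refine Or.inr ⟨hc, hx.2.trans (le_of_eq ?_)⟩
          push_cast; ring
      refine (lintegral_mono_set hsub).trans ((lintegral_union_le _ _ _).trans ?_)
      push_cast
      rw [add_mul, one_mul]
      exact add_le_add ih (h.lintegral_slab_translate_le hη0 hmono hC.le hqm hr0
        (hrt.trans (le_add_of_nonneg_right (by positivity))))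
  have h4 := hsum (3 * N)
  rw [show t + ((3 * N : ℕ) : ℝ) * r = 4 * t by push_cast; rw [mul_assoc, htr]; ring] at h4
  refine h4.trans ?_
  have h5 : ∫⁻ x in slab n r (2 * r), dens n p U η x ≤ ofReal (2 ^ p * (p / (p - 1) * (2 * r * B))) := by
    refine (h.lintegral_thin_slab_le hη.continuous hηc hη0 hmono hr0).trans (ofReal_le_ofReal ?_)
    refine mul_le_left ?_ (by positivity)
    have h6 := mul_le_left (hb (2 * r) (by linarith) hr2)
      (div_nonneg (by linarith : 0 ≤ p) (by linarith : 0 ≤ p - 1))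
    rwa [← mul_assoc, show p / (p - 1) * (1 - 1 / p) = 1 by
      have : p - 1 ≠ 0 := by linarith
      field_simp, one_mul] at h6
  refine (mul_le_mul_right (mul_le_mul_right h5 _) _).trans (le_of_eq ?_)
  rw [← ofReal_mul hC.le, ← ENNReal.ofReal_natCast, ← ofReal_mul (by positivity)]
  congr 1
  push_cast
  rw [← htr]; ring

end slabs
end HalfSol

namespace HalfSol
section conclusion
variable {d : ℕ} {n : Fin d} {p q s b β c ε N₀ : ℝ} {U : Eu d → ℝ}

theorem exists_cutoff (n : Fin d) {R : ℝ} (hR : 0 < R) (σ : ℕ) : ∃ ζ : Eu d → ℝ, Continuous ζ ∧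
    (∀ x, 0 ≤ ζ x) ∧ (∀ x, R < ‖x‖ → ζ x = 0) ∧ (∀ x, ‖x‖ ≤ R / 2 → 1 / 2 ≤ ζ x) ∧
    (∀ z : Eu d, 0 < z n → ∀ t : ℝ, 0 ≤ t → ζ (z + t • single n 1) ≤ ζ z) ∧
    ContDiff ℝ 1 (fun x => ζ x ^ (2 * σ + 2)) ∧
    ∀ x, ‖∇(fun x => ζ x ^ (2 * σ + 2)) x‖ ≤ 4 * (σ + 1) / R * ζ x ^ (2 * σ + 1) := by
  obtain ⟨P, hP⟩ : ∃ P : Eu d → ℝ, P = fun x => 1 - R⁻¹ ^ 2 * ‖x - 0‖ ^ 2 := ⟨_, rfl⟩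
  have hPc : ContDiff ℝ 1 P := by
    rw [hP]; exact contDiff_const.sub (contDiff_const.mul ((contDiff_id.sub contDiff_const).norm_sq ℝ))
  have hPx : ∀ x, P x = 1 - (‖x‖ / R) ^ 2 := fun x => by
    rw [hP]; simp only [sub_zero]; rw [div_pow, inv_pow]; ring
  have hz : ∀ x, R ≤ ‖x‖ → max (P x) 0 = 0 := fun x hx => by
    have h1 : 1 ≤ ‖x‖ / R := (one_le_div hR).2 hx
    refine max_eq_right ?_
    rw [hPx]; have := one_le_pow₀ h1 (n := 2); linarith
  have hpow : (fun x => max (P x) 0 ^ (2 * σ + 2)) = fun x => (max (P x) 0 ^ 2) ^ (σ + 1) :=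
    funext fun x => by rw [← pow_mul]; ring_nf
  refine ⟨fun x => max (P x) 0, hPc.continuous.max continuous_const, fun x => le_max_right _ _,
    fun x hx => hz x hx.le, fun x hx => le_max_of_le_left ?_, fun z hz t ht => ?_, ?_, fun x => ?_⟩
  · have h1 : ‖x‖ / R ≤ 1 / 2 := by rw [div_le_iff₀ hR]; linarith
    have h2 := pow_le_pow_left₀ (by positivity) h1 2
    rw [hPx]; linarith
  · refine max_le_max ?_ le_rfl
    have h1 : ‖z‖ ^ 2 ≤ ‖z + t • single n (1:ℝ)‖ ^ 2 := by
      rw [norm_add_sq_real, inner_smul_right, EuclideanSpace.inner_single_right]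
      simp only [map_one, one_mul, conj_trivial]
      have := mul_nonneg ht hz.le
      have := sq_nonneg ‖t • single n (1:ℝ)‖
      linarith
    rw [hPx, hPx, div_pow, div_pow]
    have := div_le_div_of_nonneg_right h1 (sq_nonneg R)
    linarith
  · rw [hpow]; exact (contDiff_posPart_sq.comp hPc).pow _
  · have h1 : HasGradientAt (fun x => max (P x) 0 ^ (2 * σ + 2))
        ((((σ + 1 : ℕ) : ℝ) * (max (P x) 0 ^ 2) ^ σ * (2 * max (P x) 0)) • (-(2 * R⁻¹ ^ 2) • (x - 0))) x := by
      rw [hpow]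
      refine HasGradientAt.comp_real (k := fun t => (max t 0 ^ 2) ^ (σ + 1)) ?_ ?_
      · exact (hasDerivAt_posPart_sq (P x)).pow (σ + 1)
      · rw [hP]; exact hasGradientAt_paraboloid 0 x _
    rw [h1.gradient]
    rcases le_or_gt R ‖x‖ with hx | hx
    · rw [hz x hx, mul_zero, mul_zero, zero_smul, norm_zero]; positivity
    have hm : 0 ≤ max (P x) 0 := le_max_right _ _
    rw [norm_smul, norm_smul, sub_zero, norm_of_nonneg (by positivity), norm_neg,
      norm_of_nonneg (by positivity), ← pow_mul]
    have h2 : R⁻¹ ^ 2 * ‖x‖ ≤ 1 / R := by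
      have := mul_le_left hx.le (by positivity : 0 ≤ R⁻¹ ^ 2)
      refine this.trans (le_of_eq ?_); field_simp
    have h3 := mul_le_left h2 (by positivity : 0 ≤ 4 * ((σ:ℝ) + 1) * max (P x) 0 ^ (2 * σ + 1))
    refine le_trans (le_of_eq ?_) (h3.trans (le_of_eq ?_))
    · push_cast; ring
    · ring

theorem mul_pow_le_add {B δ ζ : ℝ} (hB : 0 ≤ B) (hδ : 0 < δ) (hζ : 0 ≤ ζ) (j : ℕ) :
    B * ζ ^ j ≤ δ * ζ ^ (j + 1) + B * (B / δ) ^ j := by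
  rcases le_or_gt ζ (B / δ) with hc | hc
  · have := mul_le_left (pow_le_pow_left₀ hζ hc j) hB
    have : 0 ≤ δ * ζ ^ (j + 1) := by positivity
    linarith
  · rw [div_lt_iff₀ hδ] at hc
    have h1 := mul_le_right hc.le (pow_nonneg hζ j)
    have : 0 ≤ B * (B / δ) ^ j := by positivity
    rw [pow_succ]; linarith

theorem lintegral_le_tsum_slab {F : Eu d → ENNReal} {R : ℝ} (hR : 0 < R)
    (h0 : ∀ x : Eu d, x n ≤ 0 → F x = 0) (h1 : ∀ x, R < ‖x‖ → F x = 0) :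
    ∫⁻ x, F x ≤ ∑' j : ℕ, ∫⁻ x in slab n (R * (1 / 4) ^ j / 4) (4 * (R * (1 / 4) ^ j / 4)), F x := by
  have hm : MeasurableSet (⋃ j : ℕ, slab n (R * (1 / 4) ^ j / 4) (4 * (R * (1 / 4) ^ j / 4))) :=
    MeasurableSet.iUnion fun j => measurableSet_slab _ _ _
  refine le_trans (le_of_eq ?_) (lintegral_iUnion_le _ _)
  rw [← lintegral_indicator hm]
  refine lintegral_congr fun x => ?_
  by_cases hx : x ∈ ⋃ j : ℕ, slab n (R * (1 / 4) ^ j / 4) (4 * (R * (1 / 4) ^ j / 4))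
  · rw [indicator_of_mem hx]
  rw [indicator_of_notMem hx]
  rcases le_or_gt (x n) 0 with hn | hn
  · exact h0 x hn
  refine h1 x ?_
  by_contra hc
  refine hx (mem_iUnion.2 ?_)
  have h2 : x n ≤ R := (le_abs_self _).trans ((by simpa using abs_apply_sub_le 0 x n : |x n| ≤ ‖x‖).trans
    (not_lt.1 hc))
  obtain ⟨j, hj1, hj2⟩ := exists_nat_pow_near_of_lt_one (div_pos hn hR) ((div_le_one hR).2 h2)
    (by norm_num : (0:ℝ) < 1 / 4) (by norm_num)
  rw [lt_div_iff₀ hR, pow_succ] at hj1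
  rw [div_le_iff₀ hR] at hj2
  exact ⟨j, by linarith, by linarith⟩

/-- The energy in a half ball of radius `R` decays like a negative power of `R`. -/
theorem exists_decay (h : HalfSol n p q U) (hC : Consts d p s b β c ε N₀) (hs : s = q + 1 - p) :
    ∃ (K : ℝ) (m : ℕ), ∀ R, 0 < R → ∃ η : Eu d → ℝ, (∀ x, 0 ≤ η x) ∧ (∀ x, ‖x‖ ≤ R / 2 → (1 / 2) ^ m ≤ η x) ∧
      ∫⁻ x in slab n 1 (4 * 1), dens n p U η x ≤ ofReal (K * R ^ ((d:ℝ) - 1 - (p + p ^ 2 / s))) := by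
  obtain ⟨C, hC0, hpt⟩ := h.pointwise_bounds hC hs
  obtain ⟨S, hS⟩ : ∃ S, S = p + p ^ 2 / s := ⟨_, rfl⟩
  rw [← hS] at hpt ⊢
  obtain ⟨σ, hσ⟩ := exists_nat_ge S
  have hp := h.hp
  have hP : 0 < p / (p - 1) := div_pos (by linarith) (by linarith)
  obtain ⟨C₂, hC₂⟩ : ∃ C₂, C₂ = 6 * C * 2 ^ p * (p / (p - 1)) := ⟨_, rfl⟩
  have hC₂0 : 0 < C₂ := by rw [hC₂]; positivity
  obtain ⟨V, hV⟩ : ∃ V, V = (volume (ball (0 : Eu d) 1)).toReal := ⟨_, rfl⟩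
  have hV0 : 0 ≤ V := by rw [hV]; positivity
  obtain ⟨κ, hκ⟩ : ∃ κ : ℝ, κ = 4 * (σ + 1) := ⟨_, rfl⟩
  have hκ0 : 0 < κ := by rw [hκ]; positivity
  obtain ⟨lam, hlam⟩ : ∃ lam, lam = 1 / (3 * (C * C₂)) := ⟨_, rfl⟩
  have hlam0 : 0 < lam := by rw [hlam]; positivity
  obtain ⟨C₄, hC₄⟩ : ∃ C₄, C₄ = C * (κ * (κ / lam) ^ (2 * σ + 1) * (C * 4 ^ σ)) * V := ⟨_, rfl⟩
  have hC₄0 : 0 ≤ C₄ := by rw [hC₄]; positivity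
  refine ⟨C₂ * (3 * (1 / 3 + 4 * C₄) + 1), 2 * σ + 2, fun R hR => ?_⟩
  obtain ⟨ζ, hζc, hζ0, hζR, hζ2, hζm, hηc, hηk⟩ := exists_cutoff n hR σ
  obtain ⟨E, hE⟩ : ∃ E, E = R ^ ((d:ℝ) - 1 - S) := ⟨_, rfl⟩
  have hE0 : 0 < E := by rw [hE]; positivity
  have hcs : ∀ j, j ≠ 0 → HasCompactSupport fun x => ζ x ^ j := fun j hj =>
    HasCompactSupport.intro (isCompact_closedBall (0 : Eu d) R) fun x hx => by
      rw [mem_closedBall, dist_zero_right, not_le] at hx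
      rw [hζR x hx, zero_pow hj]
  obtain ⟨k, hk⟩ : ∃ k : Eu d → ℝ, k = fun x => κ / R * ζ x ^ (2 * σ + 1) := ⟨_, rfl⟩
  have hkc : Continuous k := by rw [hk]; exact continuous_const.mul (hζc.pow _)
  have hks : HasCompactSupport k := by rw [hk]; exact (hcs _ (by omega)).mul_left
  have hk0 : ∀ x, 0 ≤ k x := fun x => by rw [hk]; have := hζ0 x; positivity
  have hη0 : ∀ x, 0 ≤ ζ x ^ (2 * σ + 2) := fun x => pow_nonneg (hζ0 x) _
  obtain ⟨I, hI⟩ : ∃ I, I = (∫ x, k x * ‖∇U x‖ ^ p) + ∫ x, k x * U x ^ (q + 1) := ⟨_, rfl⟩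
  have hUq : Continuous fun x => U x ^ (q + 1) := h.cont.rpow_const fun x => Or.inr (by linarith [h.hq])
  have hi1 := h.integrable_mul hkc hks
  have hi2 : Integrable fun x => k x * U x ^ (q + 1) := (hkc.mul hUq).integrable_of_hasCompactSupport hks.mul_right
  have hF0 : ∀ x, 0 ≤ k x * ‖∇U x‖ ^ p + k x * U x ^ (q + 1) := fun x => by
    have := hk0 x; have := h.nonneg x; positivity
  have hI0 : 0 ≤ I := by
    rw [hI, ← integral_add hi1 hi2]; exact integral_nonneg hF0
  have hslab : ∀ t, 0 < t → ∫⁻ x in slab n t (4 * t), dens n p U (fun x => ζ x ^ (2 * σ + 2)) x ≤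
      ofReal (C₂ * (t * (3 * I + E))) := by
    intro t ht
    rw [hC₂, hI]
    refine h.lintegral_slab_le hηc (hcs _ (by omega)) hη0 hkc hks (fun x => ?_) (fun z hz t ht => ?_) hC0
      (fun x hx => (hpt x hx).2.2) hE0 ht
    · rw [hk, hκ]; exact hηk x
    · exact pow_le_pow_left₀ (hζ0 _) (hζm z hz t ht) _
  refine ⟨fun x => ζ x ^ (2 * σ + 2), hη0, fun x hx => pow_le_pow_left₀ (by norm_num) (hζ2 x hx) _,
    (hslab 1 one_pos).trans (ofReal_le_ofReal ?_)⟩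
  rw [one_mul, ← hE, mul_assoc]
  refine mul_le_left ?_ hC₂0.le
  suffices hmain : I ≤ 2 * (C * lam / 4 * C₂ * (3 * I + E) + C₄ * E) by
    have e1 : C * lam / 4 * C₂ = 1 / 12 := by rw [hlam]; field_simp; norm_num
    rw [e1] at hmain
    linarith
  have hrhs : 0 ≤ C * lam / 4 * C₂ * (3 * I + E) + C₄ * E := by positivity
  have hIl : ofReal I = ∫⁻ x, ofReal (k x * ‖∇U x‖ ^ p + k x * U x ^ (q + 1)) := by
    rw [hI, ← integral_add hi1 hi2]
    exact ofReal_integral_eq_lintegral_ofReal (hi1.add hi2) (ae_of_all _ hF0)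
  rw [← ENNReal.ofReal_le_ofReal_iff (by positivity), hIl]
  refine (lintegral_le_tsum_slab (n := n) hR (fun x hx => ?_) (fun x hx => ?_)).trans ?_
  · simp only [h.gradient_eq_zero hx, h.zero x hx, norm_zero]
    rw [zero_rpow (by linarith), zero_rpow (by linarith [h.hq])]; simp
  · rw [hk]; simp [hζR x hx]
  have hj : ∀ j : ℕ, ∫⁻ x in slab n (R * (1 / 4) ^ j / 4) (4 * (R * (1 / 4) ^ j / 4)),
      ofReal (k x * ‖∇U x‖ ^ p + k x * U x ^ (q + 1)) ≤
      ofReal ((C * lam / 4 * C₂ * (3 * I + E) + C₄ * E) * (1 / 2) ^ j) := by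
    intro j
    obtain ⟨t, ht⟩ : ∃ t, t = R * (1 / 4) ^ j / 4 := ⟨_, rfl⟩
    have ht0 : 0 < t := by rw [ht]; positivity
    obtain ⟨D, hD⟩ : ∃ D, D = κ / R * (κ / (lam * 2 ^ j)) ^ (2 * σ + 1) * (C * t ^ (-S)) := ⟨_, rfl⟩
    have hD0 : 0 ≤ D := by rw [hD]; positivity
    have hδ0 : 0 < lam * 2 ^ j / R := by positivity
    rw [← ht]
    have hpt' : ∀ x ∈ slab n t (4 * t), ofReal (k x * ‖∇U x‖ ^ p + k x * U x ^ (q + 1)) ≤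
        ofReal (C * (lam * 2 ^ j / R)) * dens n p U (fun x => ζ x ^ (2 * σ + 2)) x +
        ofReal (C * D) * (closedBall (0 : Eu d) R).indicator 1 x := by
      intro x hx
      by_cases hxR : x ∈ closedBall (0 : Eu d) R
      · have hxn : 0 < x n := ht0.trans hx.1
        obtain ⟨g1, g2, -⟩ := hpt x hxn
        have hW0 := rpow_nonneg (div_nonneg (h.nonneg x) hxn.le) p
        rw [indicator_of_mem hxR, Pi.one_apply, mul_one, dens, ← ofReal_mul (by positivity),
          ← ofReal_add (mul_nonneg (by positivity) (mul_nonneg (hη0 x) hW0)) (by positivity)]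
        refine ofReal_le_ofReal ?_
        have g3 : (U x / x n) ^ p ≤ C * t ^ (-S) := g2.trans (mul_le_left
          (rpow_le_rpow_of_nonpos ht0 hx.1.le
            (by rw [hS]; have := hC.hs; have : 0 < p := by linarith
                have : 0 < p + p ^ 2 / s := by positivity
                linarith)) hC0.le)
        have g4 := mul_pow_le_add (by positivity : 0 ≤ κ / R) hδ0 (hζ0 x) (2 * σ + 1)
        rw [show κ / R / (lam * 2 ^ j / R) = κ / (lam * 2 ^ j) by field_simp] at g4
        have g5 := mul_le_right g4 hW0
        have g6 := mul_le_left g3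
          (by positivity : 0 ≤ κ / R * (κ / (lam * 2 ^ j)) ^ (2 * σ + 1))
        rw [← hD] at g6
        have g7 := mul_le_left g1 (hk0 x)
        have g8 : k x * (U x / x n) ^ p ≤ lam * 2 ^ j / R * (ζ x ^ (2 * σ + 2) * (U x / x n) ^ p) + D := by
          rw [hk]; linarith
        have g9 := mul_le_left g8 hC0.le
        linarith
      · rw [mem_closedBall, dist_zero_right, not_le] at hxR
        rw [hk]; simp [hζR x hxR]
    refine (setLIntegral_mono' (measurableSet_slab n t (4 * t)) hpt').trans ?_
    rw [lintegral_add_right _ ((measurable_one.indicator measurableSet_closedBall).const_mul _),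
      lintegral_const_mul' _ _ ofReal_ne_top, lintegral_const_mul' _ _ ofReal_ne_top]
    have hvol : ∫⁻ x in slab n t (4 * t), (closedBall (0 : Eu d) R).indicator 1 x ≤ ofReal (R ^ d * V) := by
      refine (setLIntegral_le_lintegral _ _).trans ?_
      rw [lintegral_indicator_one measurableSet_closedBall, Measure.addHaar_closedBall _ _ hR.le,
        finrank_euclideanSpace_fin, ofReal_mul (by positivity), hV,
        ENNReal.ofReal_toReal measure_ball_lt_top.ne]
    refine (add_le_add (mul_le_mul_right (hslab t ht0) _) (mul_le_mul_right hvol _)).trans ?_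
    rw [← ofReal_mul (by positivity), ← ofReal_mul (by positivity),
      ← ofReal_add (by positivity) (by positivity)]
    refine ofReal_le_ofReal ?_
    rw [add_mul]
    have hhalf : (2:ℝ) ^ j * (1 / 4) ^ j = (1 / 2) ^ j := by rw [← mul_pow]; norm_num
    refine add_le_add (le_of_eq ?_) ?_
    · rw [ht, ← hhalf]; field_simp
    · have hts : t ^ (-S) ≤ R ^ (-S) * (4 ^ σ * (4 ^ σ) ^ j) := by
        have e1 : t = R * (4 ^ (j + 1))⁻¹ := by rw [ht, one_div, inv_pow, pow_succ]; field_simp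
        rw [e1, mul_rpow hR.le (by positivity)]
        refine mul_le_left ?_ (by positivity)
        rw [rpow_neg (by positivity), Real.inv_rpow (by positivity), inv_inv]
        refine (Real.rpow_le_rpow_of_exponent_le (one_le_pow₀ (by norm_num)) hσ).trans (le_of_eq ?_)
        rw [rpow_natCast, ← pow_mul, ← pow_mul, ← pow_add]; ring_nf
      have hER : R ^ d * (R⁻¹ * R ^ (-S)) = E := by
        rw [hE, ← Real.rpow_neg_one, ← rpow_natCast, ← rpow_add hR, ← rpow_add hR]
        ring_nf
      have h2j : (κ / (lam * 2 ^ j)) ^ (2 * σ + 1) * (4 ^ σ) ^ j = (κ / lam) ^ (2 * σ + 1) * (1 / 2) ^ j := by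
        rw [show (4:ℝ) = 2 ^ 2 by norm_num, ← div_div, div_pow (κ / lam), one_div, inv_pow]
        have : ((2:ℝ) ^ j) ^ (2 * σ + 1) = ((2 ^ 2) ^ σ) ^ j * 2 ^ j := by
          rw [← pow_mul, ← pow_mul, ← pow_mul, ← pow_add]; ring_nf
        rw [this]; field_simp
      calc C * D * (R ^ d * V) = C * (κ / R * (κ / (lam * 2 ^ j)) ^ (2 * σ + 1) * C) * (R ^ d * V) * t ^ (-S) := by
            rw [hD]; ring
        _ ≤ C * (κ / R * (κ / (lam * 2 ^ j)) ^ (2 * σ + 1) * C) * (R ^ d * V) *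
            (R ^ (-S) * (4 ^ σ * (4 ^ σ) ^ j)) := mul_le_left hts (by positivity)
        _ = C * (κ * C * 4 ^ σ) * V * (R ^ d * (R⁻¹ * R ^ (-S))) *
            ((κ / (lam * 2 ^ j)) ^ (2 * σ + 1) * (4 ^ σ) ^ j) := by ring
        _ = C₄ * E * (1 / 2) ^ j := by rw [hER, h2j, hC₄]; ring
  refine (ENNReal.tsum_le_tsum hj).trans (le_of_eq ?_)
  rw [← ENNReal.ofReal_tsum_of_nonneg (fun j => by positivity)
    ((summable_geometric_two).mul_left _), tsum_mul_left, tsum_geometric_two, mul_comm]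

theorem false_of_consts (h : HalfSol n p q U) (hC : Consts d p s b β c ε N₀) (hs : s = q + 1 - p) : False := by
  obtain ⟨K, m, hK⟩ := h.exists_decay hC hs
  have hp := h.hp
  have hexp : 0 < p + p ^ 2 / s + 1 - d := by
    have h1 : (d:ℝ) - p < p ^ 2 / s := by rw [lt_div_iff₀ hC.hs]; linarith [hC.hs2]
    linarith
  obtain ⟨T, hT⟩ : ∃ T : Set (Eu d), T = slab n 1 (4 * 1) ∩ closedBall 0 4 := ⟨_, rfl⟩
  have hTm : MeasurableSet T := hT ▸ (measurableSet_slab _ _ _).inter measurableSet_closedBall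
  have hle : ∀ R : ℝ, 8 ≤ R → ofReal ((1 / 2) ^ m) * ∫⁻ x in T, ofReal ((U x / x n) ^ p) ≤
      ofReal (K * R ^ ((d:ℝ) - 1 - (p + p ^ 2 / s))) := by
    intro R hR
    obtain ⟨η, hη0, hη1, hη2⟩ := hK R (by linarith)
    refine le_trans ?_ hη2
    rw [← lintegral_const_mul' _ _ ofReal_ne_top]
    refine le_trans (setLIntegral_mono' hTm fun x hx => ?_)
      (lintegral_mono_set (hT ▸ inter_subset_left : T ⊆ slab n 1 (4 * 1)))
    rw [hT] at hx
    rw [← ofReal_mul (by positivity), dens]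
    refine ofReal_le_ofReal (mul_le_right (hη1 x ?_)
      (rpow_nonneg (div_nonneg (h.nonneg x) (by linarith [hx.1.1])) p))
    have := hx.2
    rw [mem_closedBall, dist_zero_right] at this
    linarith
  have hlim : Tendsto (fun R : ℝ => ofReal (K * R ^ ((d:ℝ) - 1 - (p + p ^ 2 / s)))) atTop (𝓝 0) := by
    have h1 := (tendsto_rpow_neg_atTop hexp).const_mul K
    rw [mul_zero, show -(p + p ^ 2 / s + 1 - d) = (d:ℝ) - 1 - (p + p ^ 2 / s) by ring] at h1
    simpa using ENNReal.tendsto_ofReal h1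
  have hz := le_of_tendsto_of_tendsto tendsto_const_nhds hlim
    ((eventually_ge_atTop 8).mono fun R hR => hle R hR)
  rw [nonpos_iff_eq_zero, mul_eq_zero, ENNReal.ofReal_eq_zero] at hz
  rcases hz with hz | hz
  · have : (0:ℝ) < (1 / 2) ^ m := by positivity
    linarith
  have hWm : Measurable fun x => ofReal ((U x / x n) ^ p) :=
    ((h.cont.measurable.div (measurable_apply n)).pow_const p).ennreal_ofReal
  rw [setLIntegral_eq_zero_iff hTm hWm] at hz
  have hT0 : volume T = 0 := by
    refine measure_mono_null (fun x hx => ?_) (ae_iff.1 hz)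
    rw [mem_setOf_eq, Classical.not_imp]
    refine ⟨hx, ?_⟩
    have hxn : 0 < x n := by rw [hT] at hx; linarith [hx.1.1]
    exact (ENNReal.ofReal_pos.2 (rpow_pos_of_pos (div_pos (h.pos x hxn) hxn) p)).ne'
  have hsub : ball ((2:ℝ) • single n 1) 1 ⊆ T := by
    intro x hx
    rw [mem_ball, dist_eq_norm] at hx
    have h1 := abs_lt.1 ((abs_apply_sub_le _ x n).trans_lt hx)
    simp only [PiLp.smul_apply, EuclideanSpace.single_apply, if_true, smul_eq_mul, mul_one] at h1
    have h2 : ‖x‖ ≤ ‖x - (2:ℝ) • single n 1‖ + 2 := by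
      have := norm_add_le (x - (2:ℝ) • single n (1:ℝ)) ((2:ℝ) • single n 1)
      rw [sub_add_cancel] at this
      simpa [norm_smul] using this
    rw [hT]
    refine ⟨⟨by linarith [h1.1], by linarith [h1.2]⟩, ?_⟩
    rw [mem_closedBall, dist_zero_right]; linarith
  exact (measure_ball_pos volume _ one_pos).ne' (measure_mono_null hsub hT0)

end conclusion
end HalfSol

/-- The extension by zero of a positive solution in a half-space with zero boundary values. -/
theorem HalfSol.of_extension {d : ℕ} {n : Fin d} {p q : ℝ} (hp : 1 < p) (hq : 0 < q) {u : Eu d → ℝ}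
    (hc : ContinuousOn u {x | 0 ≤ x n}) (h1 : ContDiffOn ℝ 1 u {x | 0 < x n})
    (hpos : ∀ x : Eu d, 0 < x n → 0 < u x) (h0 : ∀ x : Eu d, x n = 0 → u x = 0)
    (hw : ∀ φ : Eu d → ℝ, ContDiff ℝ ∞ φ → HasCompactSupport φ → tsupport φ ⊆ {x | 0 < x n} →
      ∫ x, ‖∇u x‖ ^ (p - 2) * ⟪∇u x, ∇φ x⟫ = ∫ x, u x ^ q * φ x) :
    HalfSol n p q fun x => if 0 ≤ x n then u x else 0 := by
  have hcn : Continuous fun x : Eu d => x n := by fun_prop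
  have hO : IsOpen {x : Eu d | 0 < x n} := isOpen_lt continuous_const hcn
  have hEq : ∀ x ∈ {x : Eu d | 0 < x n}, (fun x => if 0 ≤ x n then u x else 0) =ᶠ[𝓝 x] u := fun x hx => by
    filter_upwards [hO.mem_nhds hx] with y hy
    rw [if_pos (le_of_lt hy)]
  have hgr : ∀ x ∈ {x : Eu d | 0 < x n}, ∇(fun x => if 0 ≤ x n then u x else 0) x = ∇u x :=
    fun x hx => by unfold gradient; rw [(hEq x hx).fderiv_eq]
  have hcu : ContinuousOn (fun x => u x ^ q) {x | 0 < x n} :=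
    h1.continuousOn.rpow_const fun x hx => Or.inr hq.le
  have hcg : ContinuousOn (fun x => A p (∇u x)) {x | 0 < x n} := by
    refine (continuous_A hp).comp_continuousOn ?_
    exact (InnerProductSpace.toDual ℝ (Eu d)).symm.continuous.comp_continuousOn
      (h1.continuousOn_fderiv_of_isOpen hO le_rfl)
  refine ⟨hp, hq, ?_, fun x hx => ?_, fun x hx => ?_, hO, ?_, ?_, fun φ hφ hφc hφs => ?_⟩
  · refine continuous_if_le continuous_const hcn hc continuousOn_const fun x hx => h0 x hx.symm
  · split_ifs with hc
    · exact h0 x (le_antisymm hx hc)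
    · rfl
  · rw [if_pos hx.le]; exact hpos x hx
  · exact h1.congr fun x hx => if_pos (le_of_lt hx)
  · exact hcu.congr fun x hx => by rw [if_pos (le_of_lt hx)]
  · have h2 := weak_test_C1 hO hcg hcu (fun φ hφ hφc hφs => by
      simp only [inner_A]; exact hw φ hφ hφc hφs) hφ hφc hφs
    have hz : ∀ x, x ∉ {x : Eu d | 0 < x n} → φ x = 0 ∧ ∇φ x = 0 := fun x hx => by
      have hx' : x ∉ tsupport φ := fun hc => hx (hφs hc)
      refine ⟨eq_zero_of_notMem hx', ?_⟩
      unfold gradient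
      rw [(notMem_tsupport_iff_eventuallyEq.1 hx').fderiv_eq]
      simp
    refine ((integral_congr_ae (ae_of_all _ fun x => ?_)).trans h2).trans
      (integral_congr_ae (ae_of_all _ fun x => ?_))
    · by_cases hx : x ∈ {x : Eu d | 0 < x n}
      · simp only [hgr x hx]
      · simp only [(hz x hx).2, inner_zero_right]
    · by_cases hx : x ∈ {x : Eu d | 0 < x n}
      · simp only [if_pos (show (0:ℝ) ≤ x n from le_of_lt hx)]
      · simp only [(hz x hx).1, mul_zero]

end PLap

theorem stmt14 (d : ℕ) (hd : 0 < d) (p q : ℝ) (hp : 1 < p) (hpd : p < (d : ℝ))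
    (hq1 : p - 1 < q) (hq2 : q < p * d / ((d : ℝ) - p) - 1) :
    ¬ ∃ u : EuclideanSpace ℝ (Fin d) → ℝ,
        ContinuousOn u {x : EuclideanSpace ℝ (Fin d) | 0 ≤ x ⟨d - 1, by omega⟩} ∧
        ContDiffOn ℝ 1 u {x : EuclideanSpace ℝ (Fin d) | 0 < x ⟨d - 1, by omega⟩} ∧
        (∀ x : EuclideanSpace ℝ (Fin d), 0 < x ⟨d - 1, by omega⟩ → 0 < u x) ∧
        (∀ x : EuclideanSpace ℝ (Fin d), x ⟨d - 1, by omega⟩ = 0 → u x = 0) ∧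
        ∀ φ : EuclideanSpace ℝ (Fin d) → ℝ, ContDiff ℝ (⊤ : ℕ∞) φ → HasCompactSupport φ →
          tsupport φ ⊆ {x : EuclideanSpace ℝ (Fin d) | 0 < x ⟨d - 1, by omega⟩} →
          ∫ x, ‖gradient u x‖ ^ (p - 2) * ⟪gradient u x, gradient φ x⟫
            = ∫ x, u x ^ q * φ x := by
  rintro ⟨u, hc, h1, hpos, h0, hw⟩
  have hs : 0 < q + 1 - p := by linarith
  have hs2 : (q + 1 - p) * (d - p) < p ^ 2 := by
    have hdp : 0 < (d : ℝ) - p := by linarith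
    have h2 := mul_lt_mul_of_pos_right (by linarith : q + 1 < p * d / ((d : ℝ) - p)) hdp
    rw [div_mul_cancel₀ _ hdp.ne'] at h2
    linarith
  obtain ⟨b, β, c, ε, N₀, hb, hβ, hc', hε, hN₀, hco⟩ := PLap.exists_coercive hp hpd hs hs2
  exact (PLap.HalfSol.of_extension hp (by linarith) hc h1 hpos h0 hw).false_of_consts
    ⟨hp, hpd, hs, hs2, hb, hβ, hc', hε, hN₀, hco⟩ rfl
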